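/- There is a universal constant c > 0 such that for every GCMP instance I with k robots and every schedule opt(I) for I of minimum total traveled length, every vertex of G is visited (entered) at most c·k⁵ many times over the course of the schedule. -/

import Mathlib

open SimpleGraph

/-- A GCMP instance on a graph `G` with `k` robots: `isM i` holds iff robot `i` belongs
to the set `M` of robots with destinations (otherwise it is a free robot of `F`);
`start` gives the starting vertices (pairwise distinct), and `dest` gives the
destination vertices of the robots in `M` (pairwise distinct on `M`). -/
structure Inst (V : Type) (G : SimpleGraph V) (k : ℕ) where
  isM : Fin k → Prop
  start : Fin k → V
  dest : Fin k → V
  start_inj : Function.Injective start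
  dest_injOn : Set.InjOn dest {i | isM i}

/-- A schedule for a GCMP instance: positions `pos j i` of robot `i` at time `j ∈ [0,T]`,
each robot follows a route (stay or move along an edge), starting at its starting vertex,
robots of `M` ending at their destinations, and the routes are pairwise non-conflicting
(no two robots on the same vertex at the same time, and no edge swap). -/
structure Sched {V : Type} {G : SimpleGraph V} {k : ℕ} (I : Inst V G k) where
  T : ℕ
  pos : ℕ → Fin k → V
  init : ∀ i, pos 0 i = I.start i
  final : ∀ i, I.isM i → pos T i = I.dest i
  step : ∀ j, j < T → ∀ i, pos (j + 1) i = pos j i ∨ G.Adj (pos j i) (pos (j + 1) i)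
  noVertexConflict : ∀ j, j ≤ T → Function.Injective fun i => pos j i
  noSwap : ∀ j, j < T → ∀ i i', i ≠ i' →
      ¬(pos (j + 1) i = pos j i' ∧ pos (j + 1) i' = pos j i)

/-- The (traveled) length of the route of robot `i` in schedule `S`:
the number of time steps at which robot `i` moves. -/
noncomputable def routeLength {V : Type} {G : SimpleGraph V} {k : ℕ} {I : Inst V G k}
    (S : Sched I) (i : Fin k) : ℕ :=
  {j : ℕ | j < S.T ∧ S.pos j i ≠ S.pos (j + 1) i}.ncard

/-- The total traveled length (energy) of a schedule. -/
noncomputable def totalLength {V : Type} {G : SimpleGraph V} {k : ℕ} {I : Inst V G k}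
    (S : Sched I) : ℕ :=
  ∑ i : Fin k, routeLength S i

/-- A schedule is optimal if it has minimum total traveled length. -/
def Optimal {V : Type} {G : SimpleGraph V} {k : ℕ} {I : Inst V G k}
    (S : Sched I) : Prop :=
  ∀ S' : Sched I, totalLength S ≤ totalLength S'

namespace GCMP

set_option linter.unusedSectionVars false

variable {V ι : Type*}

/-- One legal parallel step from the configuration `x` to the configuration `y`. -/
structure Step (G : SimpleGraph V) (x y : ι → V) : Prop where
  inj : Function.Injective x
  inj' : Function.Injective y
  adj : ∀ i, y i = x i ∨ G.Adj (x i) (y i)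
  noswap : ∀ i j, i ≠ j → ¬ (y i = x j ∧ y j = x i)

/-- The number of robots that change their position. -/
def stepCost [Fintype ι] [DecidableEq V] (x y : ι → V) : ℕ :=
  (Finset.univ.filter fun i => x i ≠ y i).card

/-- `Reach G x y c`: the configuration `y` can be reached from `x` by legal steps
of total length at most `c`. -/
inductive Reach [Fintype ι] [DecidableEq V] (G : SimpleGraph V) :
    (ι → V) → (ι → V) → ℕ → Prop
  | refl (x : ι → V) (hx : Function.Injective x) (c : ℕ) : Reach G x x c
  | tail (x y z : ι → V) (c d : ℕ) : Reach G x y c → Step G y z → c + stepCost y z ≤ d →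
      Reach G x z d

theorem Step.symm {G : SimpleGraph V} {x y : ι → V} (h : Step G x y) : Step G y x where
  inj := h.inj'
  inj' := h.inj
  adj i := by
    rcases h.adj i with h | h
    · exact Or.inl h.symm
    · exact Or.inr h.symm
  noswap i j hij := by
    rintro ⟨h1, h2⟩
    exact h.noswap i j hij ⟨h2.symm, h1.symm⟩

theorem Step.mono {G H : SimpleGraph V} (hGH : G ≤ H) {x y : ι → V} (h : Step G x y) :
    Step H x y where
  inj := h.inj
  inj' := h.inj'
  adj i := (h.adj i).imp id fun h => hGH h
  noswap := h.noswap

theorem Step.relabel {κ : Type*} {G : SimpleGraph V} {x y : ι → V} (h : Step G x y) {τ : κ → ι}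
    (hτ : Function.Injective τ) : Step G (x ∘ τ) (y ∘ τ) where
  inj := h.inj.comp hτ
  inj' := h.inj'.comp hτ
  adj i := h.adj (τ i)
  noswap i j hij := h.noswap (τ i) (τ j) (hτ.ne hij)

section

variable [Fintype ι] [DecidableEq V]

theorem stepCost_comm (x y : ι → V) : stepCost x y = stepCost y x := by
  simp [stepCost, ne_comm]

theorem stepCost_le (x y : ι → V) : stepCost x y ≤ Fintype.card ι :=
  (Finset.card_filter_le _ _).trans (by simp)

theorem stepCost_relabel (x y : ι → V) (τ : Equiv.Perm ι) :
    stepCost (x ∘ τ) (y ∘ τ) = stepCost x y := by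
  unfold stepCost
  apply Finset.card_bij (fun i _ => τ i)
  · intro a ha
    simpa using ha
  · intro a _ b _ h
    exact τ.injective h
  · intro b hb
    exact ⟨τ.symm b, by simpa using hb, by simp⟩

namespace Reach

variable {G H : SimpleGraph V} {x y z : ι → V} {c d : ℕ}

theorem inj (h : Reach G x y c) : Function.Injective x := by
  induction h with
  | refl hx c => exact hx
  | tail y z c d _ _ _ ih => exact ih

theorem inj' (h : Reach G x y c) : Function.Injective y := by
  cases h with
  | refl hx c => exact hx
  | tail y z c d _ h _ => exact h.inj'

theorem mono (h : Reach G x y c) (hcd : c ≤ d) : Reach G x y d := by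
  cases h with
  | refl hx c => exact refl _ hx _
  | tail y z c d h1 h2 h3 => exact tail _ _ _ _ _ h1 h2 (h3.trans hcd)

theorem mono_graph (hGH : G ≤ H) (h : Reach G x y c) : Reach H x y c := by
  induction h with
  | refl hx c => exact refl _ hx _
  | tail y z c d _ h2 h3 ih => exact tail _ _ _ _ _ ih (h2.mono hGH) h3

theorem single (h : Step G x y) : Reach G x y (stepCost x y) :=
  tail _ _ _ 0 _ (refl _ h.inj _) h (by simp)

theorem trans (h1 : Reach G x y c) (h2 : Reach G y z d) : Reach G x z (c + d) := by
  induction h2 with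
  | refl hx d => exact h1.mono (Nat.le_add_right _ _)
  | tail y z a b _ hs hab ih => exact tail _ _ _ _ _ ih hs (by omega)

theorem symm (h : Reach G x y c) : Reach G y x c := by
  induction h with
  | refl hx c => exact refl _ hx _
  | tail y z a b _ hs hab ih =>
    refine ((single hs.symm).trans ih).mono ?_
    rw [stepCost_comm]; omega

theorem relabel (h : Reach G x y c) (τ : Equiv.Perm ι) : Reach G (x ∘ τ) (y ∘ τ) c := by
  induction h with
  | refl hx c => exact refl _ (hx.comp τ.injective) _
  | tail y z a b _ hs hab ih =>
    refine tail _ _ _ _ _ ih (hs.relabel τ.injective) ?_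
    rwa [stepCost_relabel]

/-- Conjugating a relabelling motion by a motion. -/
theorem conj (h : Reach G x y c) {τ : Equiv.Perm ι} (hy : Reach G y (y ∘ τ) d) :
    Reach G x (x ∘ τ) (2 * c + d) :=
  ((h.trans hy).trans (h.symm.relabel τ)).mono (by omega)

end Reach

end

section Slide

variable [Fintype ι] [DecidableEq V] [DecidableEq ι] {G : SimpleGraph V} {x y z : ι → V}

theorem update_injective (hx : Function.Injective x) {r : ι} {b : V} (hb : ∀ i, i ≠ r → x i ≠ b) :
    Function.Injective (Function.update x r b) := by
  intro i j hij
  by_cases hi : i = r <;> by_cases hj : j = r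
  · rw [hi, hj]
  · subst hi
    simp [Function.update_of_ne hj] at hij
    exact absurd hij.symm (hb j hj)
  · subst hj
    simp [Function.update_of_ne hi] at hij
    exact absurd hij (hb i hi)
  · rw [Function.update_of_ne hi, Function.update_of_ne hj] at hij
    exact hx hij

theorem step_slide (hx : Function.Injective x) {r : ι} {b : V} (hb : ∀ i, x i ≠ b)
    (h : G.Adj (x r) b) : Step G x (Function.update x r b) where
  inj := hx
  inj' := update_injective hx fun i _ => hb i
  adj i := by
    by_cases hi : i = r
    · subst hi; right; simpa using h
    · left; simp [hi]
  noswap i j hij := by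
    rintro ⟨h1, h2⟩
    by_cases hi : i = r
    · subst hi
      simp at h1
      exact hb j h1.symm
    · by_cases hj : j = r
      · subst hj
        simp at h2
        exact hb i h2.symm
      · simp [hi] at h1
        exact hij (hx h1)

theorem stepCost_update_le (r : ι) (b : V) : stepCost x (Function.update x r b) ≤ 1 := by
  unfold stepCost
  refine (Finset.card_le_card (t := {r}) ?_).trans (by simp)
  intro i hi
  by_contra h
  simp at h
  simp [h] at hi

theorem reach_slide (hx : Function.Injective x) {r : ι} {b : V} (hb : ∀ i, x i ≠ b)
    (h : G.Adj (x r) b) : Reach G x (Function.update x r b) 1 :=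
  (Reach.single (step_slide hx hb h)).mono (stepCost_update_le r b)

/-- `Slides G x y m`: the configuration `y` arises from `x` by `m` moves of single robots into
free vertices. -/
inductive Slides (G : SimpleGraph V) (x : ι → V) : (ι → V) → ℕ → Prop
  | refl : Slides G x x 0
  | tail (y : ι → V) (m : ℕ) (r : ι) (b : V) : Slides G x y m → (∀ i, y i ≠ b) → G.Adj (y r) b →
      Slides G x (Function.update y r b) (m + 1)

theorem Slides.reach {m : ℕ} (h : Slides G x y m) (hx : Function.Injective x) : Reach G x y m := by
  induction h with
  | refl => exact Reach.refl _ hx _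
  | tail y m r b _ hb ha ih => exact ih.trans (reach_slide ih.inj' hb ha)

theorem Slides.trans {m l : ℕ} (h : Slides G x y m) (h' : Slides G y z l) :
    Slides G x z (m + l) := by
  induction h' with
  | refl => exact h
  | tail y l r b _ hb ha ih => exact Slides.tail _ _ _ _ ih hb ha

theorem Slides.single {r : ι} {b : V} (hb : ∀ i, x i ≠ b) (h : G.Adj (x r) b) :
    Slides G x (Function.update x r b) 1 :=
  Slides.tail _ _ _ _ Slides.refl hb h

/-- A robot travels along a path whose vertices are not occupied by other robots. -/
theorem slides_along {u v : V} (w : G.Walk u v) (hw : w.IsPath) {x : ι → V} {r : ι} (hr : x r = u)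
    (hfree : ∀ a ∈ w.support, ∀ i, i ≠ r → x i ≠ a) :
    Slides G x (Function.update x r v) w.length := by
  induction w generalizing x with
  | nil =>
    subst hr
    simp only [Function.update_eq_self]
    exact Slides.refl
  | @cons u u1 v h w ih =>
    rw [Walk.cons_isPath_iff] at hw
    have h1 : ∀ i, x i ≠ u1 := by
      intro i
      by_cases hi : i = r
      · subst hi; rw [hr]; exact h.ne
      · exact hfree u1 (by simp) i hi
    have hs : Slides G x (Function.update x r u1) 1 := Slides.single h1 (by rwa [hr])
    have := ih hw.1 (x := Function.update x r u1) (by simp) (by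
      intro a ha i hi
      rw [Function.update_of_ne hi]
      exact hfree a (by simp [ha]) i hi)
    rw [Function.update_idem] at this
    have h2 := hs.trans this
    rwa [add_comm] at h2

/-- `u` and `v` are joined by a walk inside `A`. -/
def Joined (G : SimpleGraph V) (A : Set V) (u v : V) : Prop :=
  ∃ w : G.Walk u v, ∀ a ∈ w.support, a ∈ A

theorem Joined.exists_path {A : Set V} {u v : V} (h : Joined G A u v) :
    ∃ w : G.Walk u v, w.IsPath ∧ ∀ a ∈ w.support, a ∈ A := by
  classical
  obtain ⟨w, hw⟩ := h
  exact ⟨w.bypass, w.bypass_isPath, fun a ha => hw a (w.support_bypass_subset_support ha)⟩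

theorem Joined.symm {A : Set V} {u v : V} (h : Joined G A u v) : Joined G A v u := by
  obtain ⟨w, hw⟩ := h
  exact ⟨w.reverse, fun a ha => hw a (by simpa using ha)⟩

theorem Joined.trans {A : Set V} {u v w : V} (h : Joined G A u v) (h' : Joined G A v w) :
    Joined G A u w := by
  obtain ⟨p, hp⟩ := h
  obtain ⟨q, hq⟩ := h'
  refine ⟨p.append q, fun a ha => ?_⟩
  rw [Walk.mem_support_append_iff] at ha
  exact ha.elim (hp a) (hq a)

theorem Joined.refl {A : Set V} {u : V} (h : u ∈ A) : Joined G A u u :=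
  ⟨Walk.nil, by simpa using h⟩

theorem Joined.of_adj {A : Set V} {u v : V} (hu : u ∈ A) (hv : v ∈ A) (h : G.Adj u v) :
    Joined G A u v :=
  ⟨h.toWalk, by
    intro a ha
    simp at ha
    rcases ha with rfl | rfl <;> assumption⟩

theorem Joined.mono {A B : Set V} (hAB : A ⊆ B) {u v : V} (h : Joined G A u v) :
    Joined G B u v := by
  obtain ⟨w, hw⟩ := h
  exact ⟨w, fun a ha => hAB (hw a ha)⟩

theorem Joined.left_mem {A : Set V} {u v : V} (h : Joined G A u v) : u ∈ A := by
  obtain ⟨w, hw⟩ := h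
  exact hw u (by simp)

theorem Joined.right_mem {A : Set V} {u v : V} (h : Joined G A u v) : v ∈ A :=
  h.symm.left_mem

theorem exists_exit {Z : Set V} {u v : V} (w : G.Walk u v) (hu : u ∉ Z) (hv : v ∈ Z) :
    ∃ p z, Joined G Zᶜ u p ∧ G.Adj p z ∧ z ∈ Z := by
  induction w with
  | nil => exact absurd hv hu
  | @cons u u1 v h w ih =>
    by_cases h1 : u1 ∈ Z
    · exact ⟨u, u1, Joined.refl hu, h, h1⟩
    · obtain ⟨p, z, hp, hpz, hz⟩ := ih h1 hv
      exact ⟨p, z, (Joined.of_adj hu h1 h).trans hp, hpz, hz⟩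

theorem reach_joined [Fintype V] {A : Set V} {v : V} (hx : Function.Injective x) {r : ι}
    (h : Joined G A (x r) v) (hA : ∀ a ∈ A, ∀ i, i ≠ r → x i ≠ a) :
    Reach G x (Function.update x r v) (Fintype.card V) := by
  obtain ⟨w, hw, hwA⟩ := h.exists_path
  exact ((slides_along w hw rfl fun a ha => hA a (hwA a ha)).reach hx).mono hw.length_lt.le

/-- Moving a hole along a path to an occupied vertex. -/
theorem exists_slides_hole {g h : V} (w : G.Walk g h) (hw : w.IsPath) {x : ι → V}
    (hx : Function.Injective x) (hg : ∀ i, x i ≠ g) (hh : ∃ i, x i = h) :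
    ∃ (y : ι → V) (m : ℕ), m ≤ w.length ∧ Slides G x y m ∧ (∀ i, x i ∉ w.support → y i = x i) ∧
      (∀ i, y i ≠ x i → y i ∈ w.support) ∧ Set.range y = insert g (Set.range x \ {h}) := by
  induction w generalizing x with
  | nil => obtain ⟨i, hi⟩ := hh; exact absurd hi (hg i)
  | @cons g g1 h hadj w ih =>
    rw [Walk.cons_isPath_iff] at hw
    have hgh : g ≠ h := fun e => hw.2 (by rw [e]; simp)
    by_cases hocc : ∃ i, x i = g1
    · obtain ⟨i, hi⟩ := hocc
      have hs : Slides G x (Function.update x i g) 1 :=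
        Slides.single hg (by rw [hi]; exact hadj.symm)
      have hr : Set.range (Function.update x i g) = insert g (Set.range x \ {g1}) := by
        ext a
        simp only [Set.mem_insert_iff, Set.mem_range, Set.mem_sdiff, Set.mem_singleton_iff]
        constructor
        · rintro ⟨j, rfl⟩
          by_cases hji : j = i
          · subst hji; simp
          · right
            rw [Function.update_of_ne hji]
            exact ⟨⟨j, rfl⟩, by rw [← hi]; exact hx.ne hji⟩
        · rintro (rfl | ⟨⟨j, rfl⟩, hj⟩)
          · exact ⟨i, by simp⟩
          · refine ⟨j, Function.update_of_ne ?_ _ _⟩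
            rintro rfl; exact hj hi
      have hg1 : ∀ j, Function.update x i g j ≠ g1 := by
        intro j hj
        have : g1 ∈ Set.range (Function.update x i g) := ⟨j, hj⟩
        rw [hr] at this
        simp [hadj.ne'] at this
      by_cases hhg : h = g1
      · refine ⟨Function.update x i g, 1, by simp, hs, ?_, ?_, by rw [hr, hhg]⟩
        · intro j hj
          refine Function.update_of_ne ?_ _ _
          rintro rfl; exact hj (by simp [hi])
        · intro j hj
          have : j = i := by
            by_contra hji
            exact hj (Function.update_of_ne hji _ _)
          subst this; simp
      · have hh' : ∃ j, Function.update x i g j = h := by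
          have : h ∈ Set.range (Function.update x i g) := by
            rw [hr]; right; exact ⟨hh, hhg⟩
          exact this
        obtain ⟨y, m, hm, h1, h3, h4, h5⟩ := ih hw.1 (hs.reach hx).inj' hg1 hh'
        refine ⟨y, 1 + m, by simp; omega, hs.trans h1, ?_, ?_, ?_⟩
        · intro j hj
          have hji : j ≠ i := by
            rintro rfl
            exact hj (by simp [hi])
          have := h3 j
          rw [Function.update_of_ne hji] at this
          apply this
          intro h; exact hj (by simp [h])
        · intro j hj
          by_cases hjx : y j = Function.update x i g j
          · by_cases hji : j = i
            · subst hji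
              rw [hjx]; simp
            · rw [Function.update_of_ne hji] at hjx
              exact absurd hjx hj
          · have := h4 j hjx
            simp [this]
        · rw [h5, hr]
          ext a
          have e1 : g1 ∈ Set.range x := ⟨i, hi⟩
          simp only [Set.mem_insert_iff, Set.mem_sdiff, Set.mem_singleton_iff]
          by_cases ha : a = g1
          · subst ha; simp [e1, Ne.symm hhg]
          · by_cases hag : a = g
            · subst hag; simp [hgh]
            · simp [ha, hag]
    · push Not at hocc
      obtain ⟨y, m, hm, h1, h3, h4, h5⟩ := ih hw.1 hx hocc hh
      have hy := (h1.reach hx).inj'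
      have hg1y : g1 ∈ Set.range y := by rw [h5]; simp
      obtain ⟨i, hi⟩ := hg1y
      have hgy : ∀ j, y j ≠ g := by
        intro j hj
        have : g ∈ Set.range y := ⟨j, hj⟩
        rw [h5] at this
        rcases this with h | h
        · exact hadj.ne h
        · obtain ⟨l, hl⟩ := h.1
          exact hg l hl
      have hs : Slides G y (Function.update y i g) 1 :=
        Slides.single hgy (by rw [hi]; exact hadj.symm)
      refine ⟨_, m + 1, by simp; omega, h1.trans hs, ?_, ?_, ?_⟩
      · intro j hj
        have e : y j = x j := h3 j fun h => hj (by simp [h])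
        rw [Function.update_of_ne, e]
        rintro rfl
        exact hocc j (e.symm.trans hi)
      · intro j hj
        by_cases hji : j = i
        · subst hji; simp
        · rw [Function.update_of_ne hji] at hj ⊢
          simp [h4 j hj]
      · ext a
        have e1 : g1 ∉ Set.range x := by rintro ⟨j, hj⟩; exact hocc j hj
        constructor
        · rintro ⟨j, rfl⟩
          by_cases hji : j = i
          · subst hji; simp
          · rw [Function.update_of_ne hji]
            have : y j ∈ Set.range y := ⟨j, rfl⟩
            rw [h5] at this
            rcases this with h | h
            · exact absurd (hy (h.trans hi.symm)) hji
            · exact Or.inr h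
        · rintro (rfl | h)
          · exact ⟨i, by simp⟩
          · have : a ∈ Set.range y := by rw [h5]; exact Or.inr h
            obtain ⟨j, rfl⟩ := this
            refine ⟨j, Function.update_of_ne ?_ _ _⟩
            rintro rfl
            rw [hi] at h
            exact e1 h.1

end Slide

end GCMP

namespace GCMP

set_option linter.unusedSectionVars false

variable {V ι : Type*} [Fintype ι] [DecidableEq V] [DecidableEq ι]

/-- A permutation that rotates a cycle of the graph by one position. -/
structure Rot (G : SimpleGraph V) (ρ : Equiv.Perm V) : Prop where
  isCycle : ρ.IsCycle
  adj : ∀ u, ρ u ≠ u → G.Adj u (ρ u)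
  two : ∀ u, ρ u ≠ u → ρ (ρ u) ≠ u

variable {G : SimpleGraph V} {ρ : Equiv.Perm V} {x y z : ι → V}

theorem Rot.inv (h : Rot G ρ) : Rot G ρ⁻¹ where
  isCycle := h.isCycle.inv
  adj u hu := by
    have h1 : ρ (ρ⁻¹ u) ≠ ρ⁻¹ u := by simpa using hu.symm
    simpa using (h.adj _ h1).symm
  two u hu := by
    intro h2
    have h3 : u = ρ (ρ u) := by
      rw [Equiv.Perm.inv_eq_iff_eq, Equiv.Perm.inv_eq_iff_eq] at h2
      exact h2
    exact h.two u (fun h4 => hu (by rw [Equiv.Perm.inv_eq_iff_eq]; exact h4.symm)) h3.symm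

theorem Rot.step (h : Rot G ρ) (hx : Function.Injective x) : Step G x (ρ ∘ x) where
  inj := hx
  inj' := ρ.injective.comp hx
  adj i := by
    by_cases hi : ρ (x i) = x i
    · exact Or.inl hi
    · exact Or.inr (h.adj _ hi)
  noswap i j hij := by
    rintro ⟨h1, h2⟩
    simp only [Function.comp] at h1 h2
    refine h.two (x i) ?_ (by rw [h1, h2])
    rw [h1]; exact (hx.ne hij).symm

theorem Rot.reach (h : Rot G ρ) (hx : Function.Injective x) :
    Reach G x (ρ ∘ x) (Fintype.card ι) :=
  (Reach.single (h.step hx)).mono (stepCost_le _ _)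

theorem Rot.reach_pow (h : Rot G ρ) (hx : Function.Injective x) (a : ℕ) :
    Reach G x ((ρ ^ a) ∘ x) (a * Fintype.card ι) := by
  induction a with
  | zero => exact Reach.refl _ hx _
  | succ a ih =>
    have := ih.trans (h.reach ih.inj')
    rw [pow_succ', Equiv.Perm.coe_mul, Function.comp_assoc]
    exact this.mono (by ring_nf; rfl)

theorem card_le_of_injective [Fintype V] (hx : Function.Injective x) :
    Fintype.card ι ≤ Fintype.card V := Fintype.card_le_of_injective x hx

theorem Rot.exists_reach_rotate [Fintype V] (h : Rot G ρ) (hx : Function.Injective x) {u z : V}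
    (hu : ρ u ≠ u) (hz : ρ z ≠ z) :
    ∃ a : ℕ, (ρ ^ a) u = z ∧ Reach G x ((ρ ^ a) ∘ x) (Fintype.card V ^ 2) := by
  obtain ⟨a, ha, hap⟩ := (h.isCycle.sameCycle hu hz).exists_pow_eq'
  refine ⟨a, hap, (h.reach_pow hx a).mono ?_⟩
  rw [sq]
  refine Nat.mul_le_mul ?_ (card_le_of_injective hx)
  rw [h.isCycle.orderOf] at ha
  exact ha.le.trans (Finset.card_le_univ _)

/-- Two robots that are consecutive on a cycle, the first one in front of a free vertex
off the cycle, can be swapped. -/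
theorem Rot.swap_at (h : Rot G ρ) (hx : Function.Injective x) {r s : ι} {p : V}
    (hrs : x s = ρ (x r)) (hr : ρ (x r) ≠ x r) (hp : ∀ i, x i ≠ p) (hpρ : ρ p = p)
    (hadj : G.Adj (x r) p) :
    Reach G x (x ∘ Equiv.swap r s) (2 * Fintype.card ι + 3) := by
  have hsr : s ≠ r := by rintro rfl; exact hr hrs.symm
  have R1 : Reach G x (Function.update x r p) 1 := reach_slide hx hp hadj
  have R2 : Reach G (Function.update x r p) (Function.update (Function.update x r p) s (x r)) 1 := by
    refine reach_slide R1.inj' ?_ ?_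
    · intro i
      by_cases hi : i = r
      · subst hi; simpa using (hp i).symm
      · rw [Function.update_of_ne hi]; exact hx.ne hi
    · rw [Function.update_of_ne hsr, hrs]
      exact (h.adj _ hr).symm
  have R3 := h.inv.reach R2.inj'
  set y := ⇑ρ⁻¹ ∘ Function.update (Function.update x r p) s (x r) with hy
  have yr : y r = p := by
    simp [hy, hsr.symm, Function.update_of_ne]
    rw [Equiv.symm_apply_eq]; exact hpρ.symm
  have R4 : Reach G y (Function.update y r (x r)) 1 := by
    refine reach_slide R3.inj' ?_ (by rw [yr]; exact hadj.symm)
    intro i hi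
    by_cases his : i = s
    · subst his
      simp [hy, Equiv.symm_apply_eq] at hi
      exact hr hi.symm
    · by_cases hir : i = r
      · subst hir; rw [yr] at hi; exact hp _ hi.symm
      · simp [hy, his, hir, Equiv.symm_apply_eq] at hi
        rw [← hrs] at hi; exact his (hx hi)
  have R5 := h.reach R4.inj'
  have e : ⇑ρ ∘ Function.update y r (x r) = x ∘ Equiv.swap r s := by
    funext i
    by_cases hir : i = r
    · subst hir; simp [hrs]
    · by_cases his : i = s
      · subst his; simp [hy, hsr]
      · simp [hir, hy, his, Equiv.swap_apply_of_ne_of_ne]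
  rw [e] at R5
  exact ((((R1.trans R2).trans R3).trans R4).trans R5).mono (by omega)

theorem pow_apply_eq_self_iff {u : V} (a : ℕ) :
    ρ ((ρ ^ a) u) = (ρ ^ a) u ↔ ρ u = u := by
  have : ρ ((ρ ^ a) u) = (ρ ^ a) (ρ u) := by
    rw [← Equiv.Perm.mul_apply, ← Equiv.Perm.mul_apply, ← pow_succ', ← pow_succ]
  rw [this]; simp

theorem pow_apply_comm' (ρ : Equiv.Perm V) (a : ℕ) (u : V) : ρ ((ρ ^ a) u) = (ρ ^ a) (ρ u) := by
  rw [← Equiv.Perm.mul_apply, ← Equiv.Perm.mul_apply, ← pow_succ', ← pow_succ]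

theorem pow_apply_of_fixed {u : V} (h : ρ u = u) (a : ℕ) : (ρ ^ a) u = u := by
  induction a with
  | zero => rfl
  | succ a ih => rw [pow_succ', Equiv.Perm.mul_apply, ih, h]

theorem formPerm_getElem_succ {l : List V} (hl : l.Nodup) (i : ℕ) (hi : i + 1 < l.length) :
    l.formPerm l[i] = l[i + 1] := List.formPerm_apply_lt_getElem _ hl _ hi

/-- The rotation of a closed nodup list of consecutively adjacent vertices. -/
theorem rot_formPerm {l : List V} (hl : l.Nodup) (h3 : 3 ≤ l.length)
    (hc : ∀ i (hi : i + 1 < l.length), G.Adj l[i] l[i + 1])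
    (hlast : G.Adj (l[l.length - 1]'(by omega)) (l[0]'(by omega))) : Rot G l.formPerm := by
  have key : ∀ i (hi : i < l.length), l.formPerm l[i] =
      l[(i + 1) % l.length]'(Nat.mod_lt _ (by omega)) := fun i hi =>
    List.formPerm_apply_getElem _ hl _ hi
  have hmem : ∀ u, l.formPerm u ≠ u → u ∈ l := fun u hu => List.mem_of_formPerm_apply_ne hu
  refine ⟨List.isCycle_formPerm hl (by omega), ?_, ?_⟩
  · intro u hu
    obtain ⟨i, hi, rfl⟩ := List.getElem_of_mem (hmem u hu)
    rw [key i hi]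
    by_cases hi' : i + 1 < l.length
    · simp only [Nat.mod_eq_of_lt hi']
      exact hc i hi'
    · have e : i = l.length - 1 := by omega
      subst e
      have : (l.length - 1 + 1) % l.length = 0 := by
        rw [Nat.sub_add_cancel (by omega)]; simp
      simp only [this]
      exact hlast
  · intro u hu h2
    obtain ⟨i, hi, rfl⟩ := List.getElem_of_mem (hmem u hu)
    rw [key i hi, key _ (Nat.mod_lt _ (by omega)), hl.getElem_inj_iff] at h2
    rw [Nat.mod_add_mod] at h2
    have : i + 1 + 1 < l.length ∨ i + 1 + 1 = l.length ∨ i + 1 + 1 = l.length + 1 := by omega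
    rcases this with h | h | h
    · rw [Nat.mod_eq_of_lt h] at h2; omega
    · rw [h] at h2; simp at h2; omega
    · rw [h, Nat.add_mod_left, Nat.mod_eq_of_lt (by omega)] at h2; omega

/-- The robots `i` and `j` can be swapped at cost at most `Q`. -/
def Sw (G : SimpleGraph V) (Q : ℕ) (x : ι → V) (i j : ι) : Prop :=
  Reach G x (x ∘ Equiv.swap i j) Q

theorem Sw.mono {Q Q' : ℕ} (hQ : Q ≤ Q') {i j : ι} (h : Sw G Q x i j) : Sw G Q' x i j :=
  Reach.mono h hQ

theorem Sw.symm {Q : ℕ} {i j : ι} (h : Sw G Q x i j) : Sw G Q x j i := by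
  unfold Sw at *; rwa [Equiv.swap_comm]

theorem eqvGen_mono {α : Type*} {r s : α → α → Prop} (h : ∀ a b, r a b → s a b) {a b : α}
    (hab : Relation.EqvGen r a b) : Relation.EqvGen s a b := Relation.EqvGen.mono h _ _ hab

theorem eqvGen_sw_conj {Q c : ℕ} (hR : Reach G x y c) {i j : ι}
    (h : Relation.EqvGen (Sw G Q y) i j) : Relation.EqvGen (Sw G (2 * c + Q) x) i j :=
  eqvGen_mono (fun _ _ hab => hR.conj hab) h

/-- Every step consists of slides into free vertices followed by a permutation of the robots. -/
theorem Step.exists_slides (h : Step G x y) :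
    ∃ (w : ι → V) (m : ℕ), Slides G x w m ∧ Step G w y ∧ Set.range y ⊆ Set.range w := by
  generalize hc : stepCost x y = c
  induction c using Nat.strong_induction_on generalizing x with
  | _ c ih =>
    by_cases hmv : ∃ i, ∀ j, x j ≠ y i
    · obtain ⟨i, hi⟩ := hmv
      have hadj : G.Adj (x i) (y i) := (h.adj i).resolve_left fun e => hi i e.symm
      have hs := Slides.single hi hadj
      have hst : Step G (Function.update x i (y i)) y := by
        refine ⟨(hs.reach h.inj).inj', h.inj', ?_, ?_⟩
        · intro j
          by_cases hj : j = i
          · subst hj; simp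
          · rw [Function.update_of_ne hj]; exact h.adj j
        · rintro j l hjl ⟨h1, h2⟩
          by_cases hj : j = i
          · subst hj
            simp at h2
            exact hjl (h.inj' h2).symm
          · by_cases hl : l = i
            · subst hl
              simp at h1
              exact hjl (h.inj' h1)
            · rw [Function.update_of_ne hl] at h1
              rw [Function.update_of_ne hj] at h2
              exact h.noswap j l hjl ⟨h1, h2⟩
      have hlt : stepCost (Function.update x i (y i)) y < c := by
        rw [← hc]
        apply Finset.card_lt_card
        rw [Finset.ssubset_iff_of_subset]
        · refine ⟨i, ?_, ?_⟩
          · simpa using hi i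
          · simp
        · intro j hj
          simp only [Finset.mem_filter, Finset.mem_univ, true_and] at hj ⊢
          by_cases hji : j = i
          · subst hji; simp at hj
          · rwa [Function.update_of_ne hji] at hj
      obtain ⟨w, m, h1, h2, h3⟩ := ih _ hlt hst rfl
      exact ⟨w, 1 + m, hs.trans h1, h2, h3⟩
    · push Not at hmv
      refine ⟨x, 0, Slides.refl, h, ?_⟩
      rintro _ ⟨i, rfl⟩
      exact hmv i

theorem exists_perm_of_range_subset (hy : Function.Injective y)
    (h : Set.range y ⊆ Set.range x) : ∃ π : Equiv.Perm ι, y = x ∘ π := by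
  choose f hf using fun i => h ⟨i, rfl⟩
  have hfi : Function.Injective f := by
    intro i j hij
    apply hy
    rw [← hf, ← hf, hij]
  refine ⟨Equiv.ofBijective f (Finite.injective_iff_bijective.1 hfi), ?_⟩
  funext i
  exact (hf i).symm

/-- The robots moved by a step that permutes the occupied vertices move along cycles. -/
theorem Step.exists_rot {π : Equiv.Perm ι} (h : Step G x (x ∘ π)) {i : ι} (hi : π i ≠ i) :
    ∃ ρ, Rot G ρ ∧ ρ (x i) = x (π i) := by
  set l := (π.toList i).map x with hl
  have hi' : i ∈ π.support := by simpa using hi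
  have hadj : ∀ a : ℕ, G.Adj (x ((π ^ a) i)) (x ((π ^ (a + 1)) i)) := by
    intro a
    have := h.adj ((π ^ a) i)
    simp only [Function.comp] at this
    rw [← Equiv.Perm.mul_apply, ← pow_succ'] at this
    refine this.resolve_left fun e => hi ?_
    have := h.inj e
    rw [pow_succ, Equiv.Perm.mul_apply] at this
    exact (π ^ a).injective this
  have hlen : l.length = (π.cycleOf i).support.card := by simp [hl]
  have h2 : 2 ≤ l.length := by
    rw [hlen, Equiv.Perm.two_le_card_support_cycleOf_iff]; exact hi
  have h3 : 3 ≤ l.length := by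
    rcases Nat.lt_or_ge 2 l.length with h | h'
    · exact h
    · exfalso
      have e : (π.cycleOf i).support.card = 2 := by omega
      have : (π ^ 2) i = i := by
        rw [← Equiv.Perm.cycleOf_pow_apply_self, ← e,
          ← ((Equiv.Perm.isCycle_cycleOf π hi).orderOf), pow_orderOf_eq_one]; rfl
      refine h.noswap i (π i) (Ne.symm hi) ⟨rfl, ?_⟩
      simp only [Function.comp]
      rw [sq, Equiv.Perm.mul_apply] at this
      rw [this]
  have hnd : l.Nodup := (Equiv.Perm.nodup_toList π i).map h.inj
  have hget : ∀ a (ha : a < l.length), l[a] = x ((π ^ a) i) := by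
    intro a ha; simp [hl, Equiv.Perm.getElem_toList]
  refine ⟨l.formPerm, rot_formPerm hnd h3 ?_ ?_, ?_⟩
  · intro a ha
    rw [hget, hget]; exact hadj a
  · rw [hget, hget]
    have := hadj (l.length - 1)
    rw [Nat.sub_add_cancel (by omega)] at this
    have e : (π ^ l.length) i = i := by
      rw [← Equiv.Perm.cycleOf_pow_apply_self, hlen,
          ← ((Equiv.Perm.isCycle_cycleOf π hi).orderOf), pow_orderOf_eq_one]; rfl
    rw [e] at this
    simpa using this
  · have := formPerm_getElem_succ hnd 0 (by omega)
    rw [hget, hget] at this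
    simpa using this

variable [Fintype V]

theorem Rot.swap_of_free (h : Rot G ρ) (hx : Function.Injective x) {r s : ι} {p z : V}
    (hrs : x s = ρ (x r)) (hr : ρ (x r) ≠ x r) (hp : ∀ i, x i ≠ p) (hpρ : ρ p = p)
    (hz : ρ z ≠ z) (hadj : G.Adj z p) :
    Reach G x (x ∘ Equiv.swap r s) (7 * Fintype.card V ^ 2) := by
  obtain ⟨a, ha, hR⟩ := h.exists_reach_rotate hx hr hz
  have := h.swap_at hR.inj' (r := r) (s := s) (p := p)
    (by simp only [Function.comp]; rw [hrs, pow_apply_comm'])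
    (by simp only [Function.comp]; rwa [ha]) (by
      intro i hi
      apply hp i
      apply (ρ ^ a).injective
      rw [pow_apply_of_fixed hpρ]; exact hi) hpρ (by simpa [ha] using hadj)
  refine (hR.conj this).mono ?_
  have h1 := card_le_of_injective hx
  have h2 : 1 ≤ Fintype.card V := Fintype.card_pos_iff.2 ⟨p⟩
  nlinarith

/-- Consecutive robots on a cycle can be swapped if the cycle does not exhaust the graph. -/
theorem Rot.swap_of_exists_off (hG : G.Connected) (h : Rot G ρ) (hx : Function.Injective x)
    {r s : ι} (hrs : x s = ρ (x r)) (hr : ρ (x r) ≠ x r) (hole : ∃ p, ∀ i, x i ≠ p) {q : V}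
    (hq : ρ q = q) :
    Reach G x (x ∘ Equiv.swap r s) (11 * Fintype.card V ^ 2) := by
  have hn : 1 ≤ Fintype.card V := Fintype.card_pos_iff.2 ⟨q⟩
  have hn2 : Fintype.card V ≤ Fintype.card V ^ 2 := by nlinarith
  obtain ⟨g, hg⟩ := hole
  set Z : Set V := {u | ρ u ≠ u} with hZ
  by_cases hgZ : ρ g = g
  · obtain ⟨w⟩ := hG.preconnected g (x r)
    obtain ⟨p, z, hp, hpz, hz⟩ := exists_exit (Z := Z) w (by simpa [hZ] using hgZ) hr
    by_cases hocc : ∃ i, x i = p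
    · obtain ⟨w', hw', hwZ⟩ := hp.exists_path
      obtain ⟨y, m, hm, hs, h1, h2, h3⟩ := exists_slides_hole w' hw' hx hg hocc
      have hR := hs.reach hx
      have e : ∀ i, ρ (x i) ≠ x i → y i = x i := fun i hi => h1 i fun hh => hwZ _ hh hi
      have hs' : ρ (x s) ≠ x s := by rw [hrs]; simpa using hr
      have := h.swap_of_free hR.inj' (r := r) (s := s) (p := p) (z := z)
        (by rw [e r hr, e s hs', hrs]) (by rwa [e r hr])
        (by
          intro i hi
          have : p ∈ Set.range y := ⟨i, hi⟩
          rw [h3] at this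
          rcases this with rfl | h
          · obtain ⟨j, hj⟩ := hocc; exact hg j hj
          · exact h.2 rfl)
        (by have := hp.right_mem; simpa [hZ] using this) hz hpz.symm
      refine (hR.conj this).mono ?_
      have := hw'.length_lt
      omega
    · push Not at hocc
      exact (h.swap_of_free hx hrs hr hocc (by have := hp.right_mem; simpa [hZ] using this) hz
        hpz.symm).mono (by omega)
  · obtain ⟨w⟩ := hG.preconnected q (x r)
    obtain ⟨p, z, hp, hpz, hz⟩ := exists_exit (Z := Z) w (by simpa [hZ] using hq) hr
    have hpρ : ρ p = p := by have := hp.right_mem; simpa [hZ] using this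
    by_cases hocc : ∃ i, x i = p
    · obtain ⟨l, hl⟩ := hocc
      obtain ⟨a, ha, hR⟩ := h.exists_reach_rotate hx hgZ hz
      set y := (ρ ^ a) ∘ x with hy
      have hyz : ∀ i, y i ≠ z := by
        intro i hi
        rw [← ha] at hi
        exact hg i ((ρ ^ a).injective hi)
      have hyl : y l = p := by simp [hy, hl, pow_apply_of_fixed hpρ]
      have R2 : Reach G y (Function.update y l z) 1 :=
        reach_slide hR.inj' hyz (by rw [hyl]; exact hpz)
      have hrl : r ≠ l := by rintro rfl; rw [hl] at hr; exact hr hpρ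
      have hsl : s ≠ l := by
        rintro rfl; rw [hl] at hrs
        have : ρ p = ρ (x r) := by rw [hpρ, hrs]
        rw [← ρ.injective this] at hr; exact hr hpρ
      have := h.swap_of_free R2.inj' (r := r) (s := s) (p := p) (z := z)
        (by simp [hrl, hsl, hy, hrs]; rw [pow_apply_comm'])
        (by
          rw [Function.update_of_ne hrl]
          exact (pow_apply_eq_self_iff a).not.2 hr)
        (by
          intro i hi
          by_cases hil : i = l
          · subst hil; simp at hi; rw [hi] at hpz; exact hpz.ne rfl
          · rw [Function.update_of_ne hil, ← hyl] at hi
            exact hil (hR.inj' hi)) hpρ hz hpz.symm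
      refine ((hR.trans R2).conj this).mono ?_
      omega
    · push Not at hocc
      exact (h.swap_of_free hx hrs hr hocc hpρ hz hpz.symm).mono (by omega)

/-- The graph has a vertex whose degree is not two. -/
def NotCycle (G : SimpleGraph V) : Prop := ∃ v, (G.neighborSet v).ncard ≠ 2

theorem Rot.pow_inj (h : Rot G ρ) {v : V} (hv : ρ v ≠ v) {i j : ℕ} (hi : i < orderOf ρ)
    (hj : j < orderOf ρ) (hij : (ρ ^ i) v = (ρ ^ j) v) : i = j := by
  wlog hle : i ≤ j generalizing i j
  · exact (this hj hi hij.symm (by omega)).symm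
  obtain ⟨d, rfl⟩ := Nat.exists_eq_add_of_le hle
  rw [pow_add, Equiv.Perm.mul_apply] at hij
  have h1 : (ρ ^ d) v = v := ((ρ ^ i).injective hij).symm
  have h2 : ρ ^ d = 1 := (h.isCycle.pow_eq_one_iff' hv).2 h1
  have := orderOf_dvd_of_pow_eq_one h2
  rcases Nat.eq_zero_or_pos d with h0 | h0
  · omega
  · have := Nat.le_of_dvd h0 this; omega

/-- A rotation through all vertices of a graph that is not a cycle can be shortened by a chord. -/
theorem Rot.exists_chord (h : Rot G ρ) (hall : ∀ u, ρ u ≠ u) (hG : NotCycle G) :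
    ∃ (v : V) (ρ' : Equiv.Perm V), Rot G ρ' ∧ ρ' v = ρ v ∧ ρ' (ρ⁻¹ v) = ρ⁻¹ v := by
  obtain ⟨v, hv⟩ := hG
  have hne : ρ v ≠ ρ⁻¹ v := by
    intro e
    exact h.two v (hall v) (by rw [e]; simp)
  have hsub : ({ρ v, ρ⁻¹ v} : Set V) ⊆ G.neighborSet v := by
    rintro a (rfl | rfl)
    · exact h.adj v (hall v)
    · exact h.inv.adj v (by rw [Ne, Equiv.Perm.inv_eq_iff_eq]; exact (hall v).symm)
  obtain ⟨c, hc, hcn⟩ : ∃ c ∈ G.neighborSet v, c ∉ ({ρ v, ρ⁻¹ v} : Set V) := by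
    by_contra hcon
    push Not at hcon
    have : G.neighborSet v = {ρ v, ρ⁻¹ v} := Set.Subset.antisymm hcon hsub
    rw [this, Set.ncard_pair hne] at hv
    exact hv rfl
  simp only [Set.mem_insert_iff, Set.mem_singleton_iff, not_or] at hcn
  obtain ⟨m, hm, hmc⟩ := (h.isCycle.sameCycle (hall v) (hall c)).exists_pow_eq'
  have hm0 : m ≠ 0 := by rintro rfl; simp at hmc; exact hc.ne hmc
  have hm1 : m ≠ 1 := by rintro rfl; simp at hmc; exact hcn.1 hmc.symm
  have hN : ρ⁻¹ v = (ρ ^ (orderOf ρ - 1)) v := by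
    rw [Equiv.Perm.inv_eq_iff_eq, ← Equiv.Perm.mul_apply, ← pow_succ',
      Nat.sub_add_cancel (by omega), pow_orderOf_eq_one]; rfl
  have hm2 : m ≠ orderOf ρ - 1 := by
    rintro rfl
    exact hcn.2 (by rw [hN, hmc])
  set l : List V := (List.range (m + 1)).map fun i => (ρ ^ i) v with hl
  have hlen : l.length = m + 1 := by simp [hl]
  have hnd : l.Nodup := by
    rw [hl, List.nodup_map_iff_inj_on List.nodup_range]
    intro i hi j hj hij
    simp at hi hj
    exact h.pow_inj (hall v) (by omega) (by omega) hij
  have hget : ∀ i (hi : i < l.length), l[i] = (ρ ^ i) v := by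
    intro i hi; simp [hl]
  refine ⟨v, l.formPerm, rot_formPerm hnd (by omega) ?_ ?_, ?_, ?_⟩
  · intro i hi
    rw [hget, hget, pow_succ', Equiv.Perm.mul_apply]
    exact h.adj _ (hall _)
  · rw [hget, hget, hlen]
    simp only [Nat.add_sub_cancel, pow_zero, Equiv.Perm.coe_one, id_eq, hmc]
    exact hc.symm
  · have := formPerm_getElem_succ hnd 0 (by omega)
    rw [hget, hget] at this
    simpa using this
  · apply List.formPerm_apply_of_notMem
    intro hmem
    obtain ⟨i, hi, hi'⟩ := List.getElem_of_mem hmem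
    rw [hget, hN] at hi'
    have := h.pow_inj (hall v) (by omega) (by omega) hi'
    omega

/-- Consecutive robots on a cycle can be swapped if the graph is not a cycle. -/
theorem Rot.swap_consecutive (hG : G.Connected) (hnc : NotCycle G) (h : Rot G ρ)
    (hx : Function.Injective x) {r s : ι} (hrs : x s = ρ (x r)) (hr : ρ (x r) ≠ x r)
    (hole : ∃ p, ∀ i, x i ≠ p) :
    Reach G x (x ∘ Equiv.swap r s) (13 * Fintype.card V ^ 2) := by
  by_cases hall : ∀ u, ρ u ≠ u
  · obtain ⟨v, ρ', h', hv, hv'⟩ := h.exists_chord hall hnc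
    obtain ⟨a, ha, hR⟩ := h.exists_reach_rotate hx hr (hall v)
    have := h'.swap_of_exists_off hG hR.inj' (r := r) (s := s)
      (by simp only [Function.comp]; rw [hrs, ← pow_apply_comm', ha, hv])
      (by simp only [Function.comp]; rw [ha, hv]; exact hall v) (by
        obtain ⟨p, hp⟩ := hole
        exact ⟨(ρ ^ a) p, fun i hi => hp i ((ρ ^ a).injective hi)⟩) hv'
    exact (hR.conj this).mono (by omega)
  · push Not at hall
    obtain ⟨q, hq⟩ := hall
    exact (h.swap_of_exists_off hG hx hrs hr hole hq).mono (by omega)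

/-- All robots on a cycle are equivalent under cheap swaps if the graph is not a cycle. -/
theorem Rot.eqvGen_sw (hG : G.Connected) (hnc : NotCycle G) (h : Rot G ρ)
    (hx : Function.Injective x) {r s : ι} (hr : ρ (x r) ≠ x r) (hs : ρ (x s) ≠ x s)
    (hole : ∃ p, ∀ i, x i ≠ p) :
    Relation.EqvGen (Sw G (15 * Fintype.card V ^ 2) x) r s := by
  have key : ∀ (m : ℕ) (x : ι → V) (r s : ι), Function.Injective x → ρ (x r) ≠ x r →
      (∃ p, ∀ i, x i ≠ p) → (ρ ^ m) (x r) = x s → m < orderOf ρ →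
      Relation.EqvGen (Sw G (13 * Fintype.card V ^ 2 + 2 * m) x) r s := by
    intro m
    induction m with
    | zero =>
      intro x r s hx _ _ h1 _
      simp at h1
      rw [hx h1]; exact Relation.EqvGen.refl _
    | succ m ih =>
      intro x r s hx hr hole h1 hm
      by_cases hocc : ∃ t, x t = ρ (x r)
      · obtain ⟨t, ht⟩ := hocc
        refine Relation.EqvGen.trans _ t _ ?_ ?_
        · refine Relation.EqvGen.rel _ _ ?_
          exact (h.swap_consecutive hG hnc hx ht hr hole).mono (by omega)
        · refine eqvGen_mono (fun _ _ hab => Sw.mono (by omega) hab)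
            (ih x t s hx (by rw [ht]; simpa using hr) hole ?_ (by omega))
          rw [ht, ← h1, pow_succ, Equiv.Perm.mul_apply]
      · push Not at hocc
        have R := reach_slide hx hocc (h.adj _ hr)
        rcases Nat.eq_zero_or_pos m with rfl | hm0
        · simp at h1; exact absurd h1.symm (hocc s)
        have hsr : s ≠ r := by
          rintro rfl
          have := h.pow_inj hr hm (j := 0) (by omega) (by simpa using h1)
          omega
        have := ih (Function.update x r (ρ (x r))) r s R.inj' (by simpa using hr)
          ⟨x r, fun i => by
            by_cases hi : i = r
            · subst hi; simpa using hr
            · rw [Function.update_of_ne hi]; exact hx.ne hi⟩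
          (by
            rw [Function.update_self, Function.update_of_ne hsr, ← h1, pow_succ,
              Equiv.Perm.mul_apply]) (by omega)
        exact eqvGen_mono (fun _ _ hab => Sw.mono (by omega) hab) (eqvGen_sw_conj R this)
  obtain ⟨m, hm, hmc⟩ := (h.isCycle.sameCycle hr hs).exists_pow_eq'
  refine eqvGen_mono (fun _ _ hab => Sw.mono ?_ hab) (key m x r s hx hr hole hmc hm)
  have h1 : m ≤ Fintype.card V := by
    rw [h.isCycle.orderOf] at hm
    exact hm.le.trans (Finset.card_le_univ _)
  have hn : 1 ≤ Fintype.card V := Fintype.card_pos_iff.2 ⟨x r⟩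
  nlinarith

end GCMP

namespace GCMP

set_option linter.unusedSectionVars false

variable {V ι : Type*} [Fintype ι] [DecidableEq V] [DecidableEq ι]

section Perms

variable {G : SimpleGraph V} {Q : ℕ} {x y z : ι → V}

theorem Reach.comp_perm {σ τ : Equiv.Perm ι} {c d : ℕ} (h : Reach G z (z ∘ σ) c)
    (h' : Reach G z (z ∘ τ) d) : Reach G z (z ∘ (σ * τ : Equiv.Perm ι)) (c + d) := by
  have := h'.trans (h.relabel τ)
  rw [Equiv.Perm.coe_mul, ← Function.comp_assoc]
  exact this.mono (by omega)

theorem sw_of_eqvGen (hz : Function.Injective z) {i j : ι} (h : Relation.EqvGen (Sw G Q z) i j) :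
    Sw G (2 * Fintype.card ι * Q) z i j := by
  let S : SimpleGraph ι :=
    { Adj := fun a b => a ≠ b ∧ Sw G Q z a b
      symm := ⟨fun a b h => ⟨h.1.symm, h.2.symm⟩⟩
      loopless := ⟨fun a h => h.1 rfl⟩ }
  have hreach : S.Reachable i j := by
    induction h with
    | rel a b hab =>
      by_cases e : a = b
      · subst e; rfl
      · exact SimpleGraph.Adj.reachable ⟨e, hab⟩
    | refl a => rfl
    | symm a b _ ih => exact ih.symm
    | trans a b c _ _ ih1 ih2 => exact ih1.trans ih2
  have key : ∀ (i j : ι) (w : S.Walk i j), Sw G (2 * w.length * Q) z i j := by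
    intro i j w
    induction w with
    | nil =>
      unfold Sw; simp only [Equiv.swap_self]; exact Reach.refl _ hz _
    | @cons a b c hab w ih =>
      by_cases hac : a = c
      · subst hac
        unfold Sw; simp only [Equiv.swap_self]; exact Reach.refl _ hz _
      · by_cases hbc : b = c
        · subst hbc
          exact hab.2.mono (by simp only [Walk.length_cons]; ring_nf; omega)
        have h1 := (Reach.comp_perm hab.2 ih).comp_perm hab.2
        have e : Equiv.swap a b * Equiv.swap b c * Equiv.swap a b = Equiv.swap a c := by
          rw [Equiv.swap_comm a b, Equiv.swap_comm b c]
          exact Equiv.swap_mul_swap_mul_swap (Ne.symm hbc) (Ne.symm hac)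
        rw [e] at h1
        refine Reach.mono h1 ?_
        simp only [Walk.length_cons]; ring_nf; omega
  obtain ⟨w⟩ := hreach
  refine (key i j w.bypass).mono ?_
  have := w.bypass_isPath.length_lt
  exact Nat.mul_le_mul_right _ (by omega)

/-- A permutation of the robots that preserves the classes of cheaply swappable robots. -/
theorem reach_of_classes (hz : Function.Injective z) (σ : Equiv.Perm ι)
    (hσ : ∀ i, Relation.EqvGen (Sw G Q z) i (σ i)) :
    Reach G z (z ∘ σ) (2 * Fintype.card ι ^ 2 * Q) := by
  have key : ∀ (m : ℕ) (σ : Equiv.Perm ι), σ.support.card ≤ m →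
      (∀ i, Relation.EqvGen (Sw G Q z) i (σ i)) →
      Reach G z (z ∘ σ) (m * (2 * Fintype.card ι * Q)) := by
    intro m
    induction m with
    | zero =>
      intro σ hm _
      have : σ = 1 := by
        rw [← Equiv.Perm.support_eq_empty_iff]
        exact Finset.card_eq_zero.1 (by omega)
      subst this
      exact Reach.refl _ hz _
    | succ m ih =>
      intro σ hm hσ
      by_cases h1 : σ = 1
      · subst h1; exact Reach.refl _ hz _
      · obtain ⟨i, hi⟩ : ∃ i, σ i ≠ i := by
          by_contra hcon
          push Not at hcon
          exact h1 (Equiv.ext hcon)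
        have hlt := Equiv.Perm.card_support_swap_mul hi
        have h2 := ih (Equiv.swap i (σ i) * σ) (by omega) (by
          intro j
          rw [Equiv.Perm.mul_apply]
          by_cases h3 : σ j = i
          · rw [h3, Equiv.swap_apply_left]
            refine (hσ j).trans _ _ _ ?_
            rw [h3]; exact hσ i
          · by_cases h4 : σ j = σ i
            · rw [h4, Equiv.swap_apply_right]
              rw [σ.injective h4]; exact Relation.EqvGen.refl _
            · rw [Equiv.swap_apply_of_ne_of_ne h3 h4]; exact hσ j)
        have h3 := Reach.comp_perm (sw_of_eqvGen hz (hσ i)) h2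
        rw [← mul_assoc, Equiv.swap_mul_self, one_mul] at h3
        exact h3.mono (by ring_nf; omega)
  refine (key _ σ (Finset.card_le_univ _) hσ).mono ?_
  ring_nf; rfl

/-- `y` arises from `x` by permuting robots within the classes of cheaply swappable robots. -/
def Sim (G : SimpleGraph V) (Q : ℕ) (x y : ι → V) : Prop :=
  ∃ σ : Equiv.Perm ι, y = x ∘ σ ∧ ∀ i, Relation.EqvGen (Sw G Q x) i (σ i)

theorem eqvGen_sw_relabel (σ : Equiv.Perm ι) {i j : ι} (h : Relation.EqvGen (Sw G Q x) i j) :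
    Relation.EqvGen (Sw G Q (x ∘ σ)) (σ⁻¹ i) (σ⁻¹ j) := by
  induction h with
  | rel a b hab =>
    refine Relation.EqvGen.rel _ _ ?_
    have := Reach.relabel hab σ
    unfold Sw
    convert this using 1
    funext l
    simp only [Function.comp]
    congr 1
    have h2 := Equiv.mul_swap_eq_swap_mul σ (σ⁻¹ a) (σ⁻¹ b)
    have h3 := congrArg (fun f => f l) h2
    simpa using h3
  | refl a => exact Relation.EqvGen.refl _
  | symm a b _ ih => exact ih.symm
  | trans a b c _ _ ih1 ih2 => exact ih1.trans _ _ _ ih2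

theorem Sim.refl (x : ι → V) : Sim G Q x x := ⟨1, rfl, fun _ => Relation.EqvGen.refl _⟩

theorem Sim.symm (h : Sim G Q x y) : Sim G Q y x := by
  obtain ⟨σ, rfl, hσ⟩ := h
  refine ⟨σ⁻¹, by funext i; simp, fun i => ?_⟩
  have := eqvGen_sw_relabel σ (hσ i).symm
  simpa using this

theorem Sim.trans (h : Sim G Q x y) (h' : Sim G Q y z) : Sim G Q x z := by
  obtain ⟨σ, rfl, hσ⟩ := h
  obtain ⟨τ, rfl, hτ⟩ := h'
  refine ⟨σ * τ, rfl, fun i => ?_⟩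
  have := eqvGen_sw_relabel σ⁻¹ (hτ i)
  have e : (x ∘ σ) ∘ ⇑σ⁻¹ = x := by funext; simp
  rw [e, inv_inv] at this
  exact (hσ i).trans _ _ _ this

theorem Sim.of_sw {i j : ι} (h : Sw G Q x i j) : Sim G Q x (x ∘ Equiv.swap i j) := by
  refine ⟨_, rfl, fun l => ?_⟩
  by_cases h1 : l = i
  · subst h1; rw [Equiv.swap_apply_left]; exact Relation.EqvGen.rel _ _ h
  · by_cases h2 : l = j
    · subst h2; rw [Equiv.swap_apply_right]; exact (Relation.EqvGen.rel _ _ h).symm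
    · rw [Equiv.swap_apply_of_ne_of_ne h1 h2]; exact Relation.EqvGen.refl _

end Perms

section Canonical

/-- The list orders its vertices so that each one has exactly one neighbour among its successors,
except for the last one. -/
inductive Elim (T : SimpleGraph V) : List V → Prop
  | single (v : V) : Elim T [v]
  | cons (v y : V) (l : List V) : v ∉ l → y ∈ l → T.Adj v y → (∀ u ∈ l, T.Adj v u → u = y) →
      Elim T l → Elim T (v :: l)

variable {T : SimpleGraph V} {x y z : ι → V} {l : List V}

theorem Elim.congr {T' : SimpleGraph V} (h : Elim T l)
    (hT : ∀ a ∈ l, ∀ b ∈ l, (T.Adj a b ↔ T'.Adj a b)) : Elim T' l := by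
  induction h with
  | single v => exact Elim.single v
  | cons v y l hv hy hvy hu _ ih =>
    refine Elim.cons v y l hv hy ((hT v (by simp) y (by simp [hy])).1 hvy) ?_ ?_
    · intro u hul hadj
      exact hu u hul ((hT v (by simp) u (by simp [hul])).2 hadj)
    · exact ih fun a ha b hb => hT a (by simp [ha]) b (by simp [hb])

theorem Elim.nodup (h : Elim T l) : l.Nodup := by
  induction h with
  | single v => simp
  | cons v y l hv _ _ _ _ ih => exact List.nodup_cons.2 ⟨hv, ih⟩

theorem Elim.joined (h : Elim T l) : ∀ u ∈ l, ∀ v ∈ l, Joined T {a | a ∈ l} u v := by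
  induction h with
  | single v =>
    intro a ha b hb
    simp at ha hb
    subst ha hb
    exact Joined.refl (by simp)
  | cons v y l hv hy hvy _ _ ih =>
    have hsub : {a | a ∈ l} ⊆ {a | a ∈ v :: l} := fun a ha => by
      simp only [Set.mem_ofPred_eq] at *; simp [ha]
    have hv' : ∀ a ∈ l, Joined T {a | a ∈ v :: l} v a := fun a ha =>
      (Joined.of_adj (by simp) (by simp [hy]) hvy).trans ((ih y hy a ha).mono hsub)
    intro a ha b hb
    rw [List.mem_cons] at ha hb
    rcases ha with rfl | ha
    · rcases hb with rfl | hb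
      · exact Joined.refl (by simp)
      · exact hv' b hb
    · rcases hb with rfl | hb
      · exact (hv' a ha).symm
      · exact (ih a ha b hb).mono hsub

/-- A connected graph has a spanning tree with an elimination order. -/
theorem exists_elim [Fintype V] {G : SimpleGraph V} (hG : G.Connected) :
    ∃ (T : SimpleGraph V) (l : List V), T ≤ G ∧ Elim T l ∧ ∀ v, v ∈ l := by
  have key : ∀ m, 1 ≤ m → m ≤ Fintype.card V → ∃ (T : SimpleGraph V) (l : List V), T ≤ G ∧
      Elim T l ∧ l.length = m ∧ ∀ a b, T.Adj a b → a ∈ l := by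
    intro m hm
    induction m, hm using Nat.le_induction with
    | base =>
      intro _
      obtain ⟨v⟩ := hG.nonempty
      exact ⟨⊥, [v], bot_le, Elim.single v, rfl, fun a b h => absurd h (by simp)⟩
    | succ m hm ih =>
      intro hle
      obtain ⟨T, l, hTG, hel, hlen, hin⟩ := ih (by omega)
      obtain ⟨u, hu⟩ : ∃ u, u ∉ l := by
        by_contra hcon
        push Not at hcon
        have h1 : l.toFinset = Finset.univ := by
          ext a; simp [hcon a]
        have h2 := List.toFinset_card_le l
        rw [h1, Finset.card_univ] at h2
        omega
      obtain ⟨c, hc⟩ : ∃ c, c ∈ l := List.exists_mem_of_length_pos (by omega)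
      obtain ⟨w⟩ := hG.preconnected u c
      obtain ⟨p, q, hp, hpq, hq⟩ := exists_exit (Z := {a | a ∈ l}) w hu hc
      have hpl : p ∉ l := hp.right_mem
      have hql : q ∈ l := hq
      have hadj : ∀ a b, (T ⊔ SimpleGraph.edge p q).Adj a b ↔
          T.Adj a b ∨ ((a = p ∧ b = q) ∨ (a = q ∧ b = p)) := by
        intro a b
        rw [SimpleGraph.sup_adj, SimpleGraph.edge_adj]
        have := hpq.ne
        constructor
        · rintro (h | ⟨h, _⟩)
          · exact Or.inl h
          · exact Or.inr (by tauto)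
        · rintro (h | h)
          · exact Or.inl h
          · refine Or.inr ⟨by tauto, ?_⟩
            rcases h with ⟨rfl, rfl⟩ | ⟨rfl, rfl⟩
            · exact this
            · exact this.symm
      refine ⟨T ⊔ SimpleGraph.edge p q, p :: l, ?_, ?_, by simp [hlen], ?_⟩
      · intro a b hab
        rcases (hadj a b).1 hab with h | ⟨rfl, rfl⟩ | ⟨rfl, rfl⟩
        · exact hTG h
        · exact hpq
        · exact hpq.symm
      · refine Elim.cons p q l hpl hql ((hadj p q).2 (by simp)) ?_ (hel.congr ?_)
        · intro u hu hpu
          rcases (hadj p u).1 hpu with h | h | h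
          · exact absurd (hin p u h) hpl
          · exact h.2
          · exact absurd h.1 (by rintro rfl; exact hpl hql)
        · intro a ha b hb
          rw [hadj]
          constructor
          · exact Or.inl
          · rintro (h | ⟨rfl, rfl⟩ | ⟨rfl, rfl⟩)
            · exact h
            · exact absurd ha hpl
            · exact absurd hb hpl
      · intro a b hab
        rcases (hadj a b).1 hab with h | ⟨rfl, rfl⟩ | ⟨rfl, rfl⟩
        · simp [hin a b h]
        · simp
        · simp [hql]
  have hpos : 1 ≤ Fintype.card V := by
    obtain ⟨v⟩ := hG.nonempty
    exact Fintype.card_pos_iff.2 ⟨v⟩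
  obtain ⟨T, l, h1, h2, h3, -⟩ := key _ hpos le_rfl
  refine ⟨T, l, h1, h2, fun v => ?_⟩
  have h4 : l.toFinset.card = Fintype.card V := by
    rw [List.toFinset_card_of_nodup h2.nodup, h3]
  have h5 := (Finset.card_eq_iff_eq_univ _).1 h4
  have : v ∈ l.toFinset := by rw [h5]; simp
  simpa using this

/-- The robot `r` can travel to `v` inside the list without meeting other robots. -/
def FreeTo (T : SimpleGraph V) (l : List V) (x : ι → V) (r : ι) (v : V) : Prop :=
  Joined T {u | u ∈ l ∧ ∀ i, i ≠ r → x i ≠ u} (x r) v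

/-- `z` is a canonical configuration obtained from `x` by filling the vertices of the list
in order. -/
inductive Can (T : SimpleGraph V) : List V → (ι → V) → (ι → V) → Prop
  | none (l : List V) (x : ι → V) : (∀ i, x i ∉ l) → Can T l x x
  | fill (v : V) (l : List V) (x z : ι → V) (r : ι) : FreeTo T (v :: l) x r v →
      Can T l (Function.update x r v) z → Can T (v :: l) x z

theorem FreeTo.free {v : V} {r : ι} (h : FreeTo T l x r v) : ∀ i, i ≠ r → x i ≠ v :=
  h.right_mem.2

theorem FreeTo.update_injective {v : V} {r : ι} (h : FreeTo T l x r v)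
    (hx : Function.Injective x) : Function.Injective (Function.update x r v) :=
  GCMP.update_injective hx h.free

theorem FreeTo.reach [Fintype V] {v : V} {r : ι} (h : FreeTo T l x r v)
    (hx : Function.Injective x) : Reach T x (Function.update x r v) (Fintype.card V) :=
  reach_joined hx h fun _ ha => ha.2

theorem Can.reach [Fintype V] (h : Can T l x z) (hx : Function.Injective x) :
    Reach T x z (l.length * Fintype.card V) := by
  induction h with
  | none l x _ => exact Reach.refl _ hx _
  | fill v l x z r hf _ ih =>
    refine ((hf.reach hx).trans (ih (hf.update_injective hx))).mono ?_
    simp only [List.length_cons]; ring_nf; rfl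

theorem Can.relabel (h : Can T l x z) (σ : Equiv.Perm ι) : Can T l (x ∘ σ) (z ∘ σ) := by
  induction h with
  | none l x h => exact Can.none _ _ fun i => h (σ i)
  | fill v l x z r hf _ ih =>
    refine Can.fill v l _ _ (σ⁻¹ r) ?_ ?_
    · unfold FreeTo at *
      have e : {u | u ∈ v :: l ∧ ∀ i, i ≠ σ⁻¹ r → (x ∘ σ) i ≠ u} =
          {u | u ∈ v :: l ∧ ∀ i, i ≠ r → x i ≠ u} := by
        ext u
        simp only [Set.mem_ofPred_eq, Function.comp]
        refine and_congr_right fun _ => ⟨fun h i hi => ?_, fun h i hi => ?_⟩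
        · have := h (σ⁻¹ i) (σ⁻¹.injective.ne hi)
          simpa using this
        · exact h (σ i) fun e => hi (by rw [← e]; simp)
      rw [e]
      simpa using hf
    · have e : Function.update (x ∘ σ) (σ⁻¹ r) v = Function.update x r v ∘ σ := by
        funext i
        by_cases hi : i = σ⁻¹ r
        · subst hi; simp
        · rw [Function.update_of_ne hi]
          simp only [Function.comp]
          rw [Function.update_of_ne]
          intro e; exact hi (by rw [← e]; simp)
      rw [e]; exact ih

theorem exists_can (h : Elim T l) (x : ι → V) (hx : Function.Injective x) : ∃ z, Can T l x z := by
  induction h generalizing x with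
  | single v =>
    by_cases hv : ∃ i, x i = v
    · obtain ⟨i, hi⟩ := hv
      refine ⟨x, Can.fill v [] x x i ?_ ?_⟩
      · unfold FreeTo; rw [hi]
        exact Joined.refl ⟨by simp, fun j hj => by rw [← hi]; exact hx.ne hj⟩
      · rw [← hi, Function.update_eq_self]
        exact Can.none _ _ (by simp)
    · push Not at hv
      exact ⟨x, Can.none _ _ (by simpa using hv)⟩
  | cons v y l hv hy hvy hu hel ih =>
    by_cases hocc : ∃ i, x i ∈ v :: l
    · obtain ⟨r, hr⟩ : ∃ r, FreeTo T (v :: l) x r v := by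
        by_cases hvo : ∃ i, x i = v
        · obtain ⟨i, hi⟩ := hvo
          refine ⟨i, ?_⟩
          unfold FreeTo; rw [hi]
          exact Joined.refl ⟨by simp, fun j hj => by rw [← hi]; exact hx.ne hj⟩
        · push Not at hvo
          obtain ⟨i, hi⟩ := hocc
          obtain ⟨w, hw⟩ := (Elim.cons v y l hv hy hvy hu hel).joined v (by simp) (x i) hi
          have key : ∀ (a b : V) (w : T.Walk a b), (∀ c ∈ w.support, c ∈ v :: l) → (∀ i, x i ≠ a) →
              (∃ i, x i = b) → ∃ i, Joined T {u | u ∈ v :: l ∧ ∀ j, j ≠ i → x j ≠ u} (x i) a := by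
            intro a b w
            induction w with
            | nil => intro _ h1 ⟨i, h2⟩; exact absurd h2 (h1 i)
            | @cons a a1 b hadj w ihw =>
              intro h1 h2 h3
              by_cases h4 : ∃ i, x i = a1
              · obtain ⟨j, hj⟩ := h4
                refine ⟨j, ?_⟩
                rw [hj]
                exact Joined.of_adj
                  ⟨h1 _ (by simp), fun l hl => by rw [← hj]; exact hx.ne hl⟩
                  ⟨h1 _ (by simp), fun l _ => h2 l⟩ hadj.symm
              · push Not at h4
                obtain ⟨j, hj⟩ := ihw (fun c hc => h1 c (by simp [hc])) h4 h3
                exact ⟨j, hj.trans (Joined.of_adj hj.right_mem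
                  ⟨h1 _ (by simp), fun l _ => h2 l⟩ hadj.symm)⟩
          exact key v (x i) w hw hvo ⟨i, rfl⟩
      obtain ⟨z, hz⟩ := ih (Function.update x r v) (hr.update_injective hx)
      exact ⟨z, Can.fill v l x z r hr hz⟩
    · push Not at hocc
      exact ⟨x, Can.none _ _ hocc⟩

end Canonical

end GCMP

namespace GCMP

set_option linter.unusedSectionVars false

variable {V ι : Type*} [Fintype ι] [DecidableEq V] [DecidableEq ι]
  {G T : SimpleGraph V} {x y z : ι → V} {l : List V} {Q : ℕ}

theorem Joined.exit {A : Set V} {u v : V} (h : Joined G A u v) (hu : u ≠ v) :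
    ∃ p, Joined G (A \ {v}) u p ∧ G.Adj p v := by
  obtain ⟨w, hw⟩ := h
  induction w with
  | nil => exact absurd rfl hu
  | @cons u u1 v hadj w ih =>
    have hmem : u ∈ A \ {v} := ⟨hw u (by simp), hu⟩
    by_cases h1 : u1 = v
    · subst h1; exact ⟨u, Joined.refl hmem, hadj⟩
    · obtain ⟨p, hp, hpv⟩ := ih h1 fun a ha => hw a (by simp [ha])
      exact ⟨p, (Joined.of_adj hmem hp.left_mem hadj).trans hp, hpv⟩

theorem can_nil (h : Can T [] x z) : z = x := by
  cases h; rfl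

theorem Can.filler (h : Can T l x z) {i : ι} (hi : x i ∈ l) :
    ∃ v l' r, l = v :: l' ∧ FreeTo T l x r v ∧ Can T l' (Function.update x r v) z := by
  cases h with
  | none _ _ h => exact absurd hi (h i)
  | fill v l' _ _ r hf hc => exact ⟨v, l', r, rfl, hf, hc⟩

variable [Fintype V]

theorem Elim.length_le (h : Elim T l) : l.length ≤ Fintype.card V := h.nodup.length_le_card

theorem Can.sw_conj (hTG : T ≤ G) (hl : l.length ≤ Fintype.card V) (hx : Function.Injective x)
    (h : Can T l x z) {c : ℕ} {i j : ι} (hs : Relation.EqvGen (Sw G c x) i j) :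
    Relation.EqvGen (Sw G (2 * Fintype.card V ^ 2 + c) z) i j := by
  have h1 := ((h.reach hx).symm.mono_graph hTG).mono
    (show l.length * Fintype.card V ≤ Fintype.card V ^ 2 by rw [sq]; exact Nat.mul_le_mul_right _ hl)
  exact eqvGen_sw_conj h1 hs

/-- Canonical configurations of the same configuration are similar. -/
def SameSim (T G : SimpleGraph V) (Q : ℕ) (ι : Type*) [Fintype ι] [DecidableEq ι]
    (l : List V) : Prop :=
  ∀ (x y z : ι → V), Function.Injective x → Can T l x y → Can T l x z → Sim G Q y z

/-- Canonical configurations of two configurations that differ by a slide are similar. -/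
def SlideSim (T G : SimpleGraph V) (Q : ℕ) (ι : Type*) [Fintype ι] [DecidableEq ι]
    (l : List V) : Prop :=
  ∀ (x : ι → V) (s : ι) (b : V) (z z' : ι → V), Function.Injective x → x s ∈ l → b ∈ l →
    (∀ i, x i ≠ b) → T.Adj (x s) b → Can T l x z → Can T l (Function.update x s b) z' →
    Sim G Q z z'

theorem sim_of_joined (hel : Elim T l) (h1 : SameSim T G Q ι l) (h2 : SlideSim T G Q ι l)
    (hx : Function.Injective x) {s : ι} {b : V}
    (hJ : Joined T {u | u ∈ l ∧ ∀ i, i ≠ s → x i ≠ u} (x s) b) {z z' : ι → V}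
    (hz : Can T l x z) (hz' : Can T l (Function.update x s b) z') : Sim G Q z z' := by
  obtain ⟨w, hw, hwA⟩ := hJ.exists_path
  clear hJ
  generalize hu : x s = u at w
  induction w generalizing x z with
  | nil =>
    subst hu
    rw [Function.update_eq_self] at hz'
    exact h1 x z z' hx hz hz'
  | @cons u u1 b hadj w ih =>
    rw [Walk.cons_isPath_iff] at hw
    have hfree : ∀ i, x i ≠ u1 := by
      intro i
      by_cases hi : i = s
      · subst hi; rw [hu]; exact hadj.ne
      · exact (hwA u1 (by simp)).2 i hi
    have hinj := update_injective hx (r := s) (b := u1) fun i _ => hfree i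
    obtain ⟨z1, hz1⟩ := exists_can hel (Function.update x s u1) hinj
    have hsim := h2 x s u1 z z1 hx (by rw [hu]; exact (hwA u (by simp)).1)
      (hwA u1 (by simp)).1 hfree (by rw [hu]; exact hadj) hz hz1
    refine hsim.trans (ih hinj hz1 (by rwa [Function.update_idem]) (by simp) hw.1 ?_)
    intro a ha
    refine ⟨(hwA a (by simp [ha])).1, fun i hi => ?_⟩
    rw [Function.update_of_ne hi]
    exact (hwA a (by simp [ha])).2 i hi

theorem sim_of_two_fillers (hTG : T ≤ G) (hQ : 5 * Fintype.card V ^ 2 ≤ Q) {v y : V}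
    (hv : v ∉ l) (hu : ∀ u ∈ l, T.Adj v u → u = y) (hel : Elim T l)
    (h1 : SameSim T G Q ι l) (h2 : SlideSim T G Q ι l) (hx : Function.Injective x) {r s : ι}
    (hrs : r ≠ s) (hr : FreeTo T (v :: l) x r v) (hs : FreeTo T (v :: l) x s v) {z z' : ι → V}
    (hz : Can T l (Function.update x r v) z) (hz' : Can T l (Function.update x s v) z') :
    Sim G Q z z' := by
  have aux : ∀ r s, r ≠ s → FreeTo T (v :: l) x r v → FreeTo T (v :: l) x s v →
      Joined T {u | u ∈ l ∧ ∀ i, i ≠ r → x i ≠ u} (x r) y := by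
    intro r s hrs hr hs
    obtain ⟨p, hp, hpv⟩ := Joined.exit hr (hs.free r hrs)
    have hsub : {u | u ∈ v :: l ∧ ∀ i, i ≠ r → x i ≠ u} \ {v} ⊆
        {u | u ∈ l ∧ ∀ i, i ≠ r → x i ≠ u} := by
      rintro u ⟨⟨ha, hb⟩, hc⟩
      rw [List.mem_cons] at ha
      exact ⟨ha.resolve_left hc, hb⟩
    have hp' := hp.mono hsub
    rwa [hu p hp'.right_mem.1 hpv.symm] at hp'
  have Jr := aux r s hrs hr hs
  have Js := aux s r hrs.symm hs hr
  have e : Function.update (Function.update x s v) r (x s) =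
      Function.update x r v ∘ Equiv.swap r s := by
    funext i
    by_cases hi : i = r
    · subst hi; simp [hrs.symm]
    · by_cases his : i = s
      · subst his; simp [hrs.symm]
      · simp [hi, his, Equiv.swap_apply_of_ne_of_ne]
  have J : Joined T {u | u ∈ l ∧ ∀ i, i ≠ r → Function.update x s v i ≠ u}
      (Function.update x s v r) (x s) := by
    rw [Function.update_of_ne hrs]
    refine (Jr.mono ?_).trans (Js.symm.mono ?_)
    · rintro u ⟨hul, hur⟩
      refine ⟨hul, fun i hi => ?_⟩
      by_cases his : i = s
      · subst his; rw [Function.update_self]; rintro rfl; exact hv hul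
      · rw [Function.update_of_ne his]; exact hur i hi
    · rintro u ⟨hul, hus⟩
      refine ⟨hul, fun i hi => ?_⟩
      by_cases his : i = s
      · subst his; rw [Function.update_self]; rintro rfl; exact hv hul
      · rw [Function.update_of_ne his]; exact hus i his
  have hxs := hs.update_injective hx
  have hxr := hr.update_injective hx
  have S1 : Sim G Q z' (z ∘ Equiv.swap r s) := by
    refine sim_of_joined hel h1 h2 hxs J hz' ?_
    rw [e]; exact hz.relabel _
  have R3 := reach_joined hxs J fun a ha => ha.2
  rw [e] at R3
  have hsw : Sw G (3 * Fintype.card V) (Function.update x r v) r s := by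
    have := (((hr.reach hx).symm.trans (hs.reach hx)).trans R3).mono_graph hTG
    exact this.mono (by omega)
  have hR := (hz.reach hxr).symm.mono_graph hTG
  have hN : 1 ≤ Fintype.card V := Fintype.card_pos_iff.2 ⟨v⟩
  have hlen := hel.length_le
  have hsw' : Sw G Q z r s := (hR.conj hsw).mono (by nlinarith)
  exact (Sim.of_sw hsw').trans S1.symm

theorem can_sim (hTG : T ≤ G) (hQ : 5 * Fintype.card V ^ 2 ≤ Q) (hel : Elim T l) :
    SameSim T G Q ι l ∧ SlideSim T G Q ι l := by
  induction hel with
  | single v =>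
    have aux : ∀ x z : ι → V, Can T [v] x z → z = x := by
      intro x z h
      cases h with
      | none _ _ h => rfl
      | fill _ _ _ _ r hf hc =>
        have := hf.left_mem.1
        simp at this
        rw [can_nil hc, ← this, Function.update_eq_self]
    constructor
    · intro x z z' _ h h'
      rw [aux x z h, aux x z' h']
      exact Sim.refl _
    · intro x s b z z' _ hs hb _ hadj _ _
      simp at hs hb
      rw [hs, hb] at hadj
      exact absurd rfl hadj.ne
  | cons v y l hv hy hvy hu hel ih =>
    obtain ⟨h1, h2⟩ := ih
    have same : SameSim T G Q ι (v :: l) := by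
      intro x z z' hx hz hz'
      by_cases hocc : ∃ i, x i ∈ v :: l
      · obtain ⟨i, hi⟩ := hocc
        obtain ⟨v1, l1, r, e1, hr, hc⟩ := hz.filler hi
        obtain ⟨v2, l2, s, e2, hs, hc'⟩ := hz'.filler hi
        cases e1; cases e2
        by_cases hrs : r = s
        · subst hrs
          exact h1 _ z z' (hr.update_injective hx) hc hc'
        · exact sim_of_two_fillers hTG hQ hv hu hel h1 h2 hx hrs hr hs hc hc'
      · push Not at hocc
        cases hz with
        | fill _ _ _ _ r hf _ => exact absurd hf.left_mem.1 (hocc r)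
        | none _ _ _ =>
          cases hz' with
          | fill _ _ _ _ r hf _ => exact absurd hf.left_mem.1 (hocc r)
          | none _ _ _ => exact Sim.refl _
    refine ⟨same, ?_⟩
    intro x s b z z' hx hs hb hfree hadj hz hz'
    have hx' := update_injective hx (r := s) (b := b) fun i _ => hfree i
    have hedge : Joined T {u | u ∈ v :: l ∧ ∀ i, i ≠ s → x i ≠ u} (x s) b :=
      Joined.of_adj ⟨hs, fun i hi => hx.ne hi⟩ ⟨hb, fun i _ => hfree i⟩ hadj
    have hset : {u | u ∈ v :: l ∧ ∀ i, i ≠ s → Function.update x s b i ≠ u} =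
        {u | u ∈ v :: l ∧ ∀ i, i ≠ s → x i ≠ u} := by
      ext u
      refine and_congr_right fun _ => forall_congr' fun i => ?_
      refine imp_congr_right fun hi => ?_
      rw [Function.update_of_ne hi]
    have hiff : FreeTo T (v :: l) (Function.update x s b) s v ↔ FreeTo T (v :: l) x s v := by
      unfold FreeTo
      rw [hset, Function.update_self]
      exact ⟨fun h => hedge.trans h, fun h => hedge.symm.trans h⟩
    by_cases hsf : FreeTo T (v :: l) x s v
    · have hsf' := hiff.2 hsf
      obtain ⟨z1, hz1⟩ := exists_can hel _ (hsf.update_injective hx)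
      have c1 := Can.fill v l x z1 s hsf hz1
      have c2 := Can.fill v l _ z1 s hsf' (by rwa [Function.update_idem])
      exact (same _ _ _ hx hz c1).trans (same _ _ _ hx' c2 hz')
    · have hsf' := hiff.not.2 hsf
      obtain ⟨v1, l1, r, e1, hr, hc⟩ := hz.filler hs
      cases e1
      have hrs : s ≠ r := by rintro rfl; exact hsf hr
      have hr' : FreeTo T (v :: l) (Function.update x s b) r v := by
        obtain ⟨w, hw, hwA⟩ := Joined.exists_path hr
        unfold FreeTo
        rw [Function.update_of_ne hrs.symm]
        refine ⟨w, fun a ha => ⟨(hwA a ha).1, fun i hi => ?_⟩⟩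
        by_cases his : i = s
        · subst his
          rw [Function.update_self]
          rintro rfl
          apply hsf
          refine hedge.trans ⟨w.dropUntil b ha, fun c hc => ?_⟩
          have hcw := w.support_dropUntil_subset_support ha hc
          refine ⟨(hwA c hcw).1, fun j hj => ?_⟩
          by_cases hjr : j = r
          · subst hjr
            rintro rfl
            have hbj : x j ≠ b := hfree j
            have h4 := (w.take_spec ha)
            have hnd := hw.support_nodup
            rw [← h4, Walk.support_append] at hnd
            have h5 : x j ∈ (w.takeUntil b ha).support := by simp
            rw [← Walk.cons_tail_support, List.mem_cons] at hc
            rcases hc with hc | hc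
            · exact hbj hc
            · exact (List.disjoint_of_nodup_append hnd) h5 hc
          · exact (hwA c hcw).2 j hjr
        · rw [Function.update_of_ne his]; exact (hwA a ha).2 i hi
      have e : Function.update (Function.update x s b) r v =
          Function.update (Function.update x r v) s b := Function.update_comm hrs _ _ _
      have hxr := hr.update_injective hx
      have hav : x s ≠ v := by
        intro h
        apply hsf
        unfold FreeTo; rw [h]; rw [h] at hedge; exact Joined.refl hedge.left_mem
      have hbv : b ≠ v := by
        rintro rfl
        exact hsf hedge
      obtain ⟨z2, hz2⟩ := exists_can hel _ (hr'.update_injective hx')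
      have c2 := Can.fill v l _ z2 r hr' hz2
      refine Sim.trans ?_ (same _ _ _ hx' c2 hz')
      rw [e] at hz2
      refine h2 (Function.update x r v) s b z z2 hxr ?_ ?_ ?_ ?_ hc hz2
      · rw [Function.update_of_ne hrs]
        exact (List.mem_cons.1 hs).resolve_left hav
      · exact (List.mem_cons.1 hb).resolve_left hbv
      · intro i
        by_cases hi : i = r
        · subst hi; rw [Function.update_self]; exact hbv.symm
        · rw [Function.update_of_ne hi]; exact hfree i
      · rwa [Function.update_of_ne hrs]

theorem slides_sim (hTG : T ≤ G) (hQ : 5 * Fintype.card V ^ 2 ≤ Q) (hel : Elim T l)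
    (hl : ∀ v, v ∈ l) (hx : Function.Injective x) {m : ℕ} (h : Slides T x y m) {z z' : ι → V}
    (hz : Can T l x z) (hz' : Can T l y z') : Sim G Q z z' := by
  obtain ⟨h1, h2⟩ := can_sim (ι := ι) hTG hQ hel
  induction h generalizing z' with
  | refl => exact h1 _ _ _ hx hz hz'
  | tail y m r b hs hb hadj ih =>
    have hy := (hs.reach hx).inj'
    obtain ⟨z1, hz1⟩ := exists_can hel y hy
    exact (ih hz1).trans (h2 y r b z1 z' hy (hl _) (hl _) hb hadj hz1 hz')

/-- The rotation of the cycle closed by an edge between the ends of a path. -/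
theorem exists_rot_of_path {a b : V} (w : T.Walk b a) (hw : w.IsPath) (hTG : T ≤ G)
    (hab : G.Adj a b) (hT : ¬ T.Adj b a) :
    ∃ ρ, Rot G ρ ∧ ∀ u ∈ w.support, ρ u ≠ u := by
  have h2 : 2 ≤ w.length := by
    by_contra hlt
    have : w.length = 0 ∨ w.length = 1 := by omega
    rcases this with h | h
    · exact hab.ne (Walk.eq_of_length_eq_zero h).symm
    · exact hT (Walk.adj_of_length_eq_one h)
  have hlen : w.support.length = w.length + 1 := w.length_support
  have hget : ∀ i (hi : i < w.support.length), w.support[i] = w.getVert i := by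
    intro i hi
    exact Walk.support_getElem_eq_getVert ..
  refine ⟨w.support.formPerm, rot_formPerm hw.support_nodup (by omega) ?_ ?_, ?_⟩
  · intro i hi
    rw [hget, hget]
    exact hTG (w.adj_getVert_succ (by omega))
  · rw [hget, hget]
    simpa [hlen] using hab
  · intro u hu
    rwa [← List.mem_toFinset, ← List.support_formPerm_of_nodup _ hw.support_nodup,
      Equiv.Perm.mem_support] at hu
    intro v hv
    have := congrArg List.length hv
    rw [hlen, List.length_singleton] at this
    omega

theorem can_sim_of_perm (hTG : T ≤ G) (hQ : 17 * Fintype.card V ^ 2 ≤ Q) (hel : Elim T l)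
    (hx : Function.Injective x) (π : Equiv.Perm ι)
    (hπ : ∀ i, Relation.EqvGen (Sw G (15 * Fintype.card V ^ 2) x) i (π i)) {z z' : ι → V}
    (hz : Can T l x z) (hz' : Can T l (x ∘ π) z') : Sim G Q z z' := by
  obtain ⟨h1, -⟩ := can_sim (ι := ι) hTG (show 5 * Fintype.card V ^ 2 ≤ Q by omega) hel
  refine Sim.trans ⟨π, rfl, fun i => ?_⟩ (h1 _ _ _ (hx.comp π.injective) (hz.relabel π) hz')
  exact eqvGen_mono (fun _ _ h => Sw.mono (by omega) h)
    (hz.sw_conj hTG hel.length_le hx (hπ i))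

theorem slide_sim (hG : G.Connected) (hnc : NotCycle G) (hTG : T ≤ G)
    (hQ : 17 * Fintype.card V ^ 2 ≤ Q) (hel : Elim T l) (hl : ∀ v, v ∈ l)
    (hx : Function.Injective x) {s : ι} {b : V} (hb : ∀ i, x i ≠ b) (hadj : G.Adj (x s) b)
    {z z' : ι → V} (hz : Can T l x z) (hz' : Can T l (Function.update x s b) z') :
    Sim G Q z z' := by
  have hQ5 : 5 * Fintype.card V ^ 2 ≤ Q := by omega
  by_cases hT : T.Adj b (x s)
  · exact slides_sim hTG hQ5 hel hl hx (Slides.single hb hT.symm) hz hz'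
  · obtain ⟨w, hw, -⟩ := (hel.joined b (hl b) (x s) (hl _)).exists_path
    obtain ⟨ρ, hρ, hρw⟩ := exists_rot_of_path w hw hTG hadj hT
    obtain ⟨g, m, -, hsl, hoff, hon, hrange⟩ := exists_slides_hole w hw hx hb ⟨s, rfl⟩
    have hg := (hsl.reach hx).inj'
    have hx' := update_injective hx (r := s) (b := b) fun i _ => hb i
    set x' := Function.update x s b with hx'def
    have hsub : Set.range g ⊆ Set.range x' := by
      rw [hrange]
      rintro a (rfl | ⟨⟨i, rfl⟩, hi⟩)
      · exact ⟨s, by simp [hx'def]⟩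
      · refine ⟨i, ?_⟩
        rw [hx'def, Function.update_of_ne]
        rintro rfl; exact hi rfl
    obtain ⟨π, hπ⟩ := exists_perm_of_range_subset hg hsub
    obtain ⟨zg, hzg⟩ := exists_can hel g hg
    refine (slides_sim hTG hQ5 hel hl hx hsl hz hzg).trans (Sim.symm ?_)
    rw [hπ] at hzg
    refine can_sim_of_perm hTG hQ hel hx' π (fun i => ?_) hz' hzg
    by_cases hi : π i = i
    · rw [hi]; exact Relation.EqvGen.refl _
    · have e : g i = x' (π i) := by rw [hπ]; rfl
      have hne : g i ≠ x' i := by rw [e]; exact hx'.ne hi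
      have hxi : x i ∈ w.support := by
        by_contra hcon
        have h3 := hoff i hcon
        apply hne
        rw [h3, hx'def, Function.update_of_ne]
        rintro rfl; exact hcon (by simp)
      have h4 : x' i ∈ w.support := by
        by_cases his : i = s
        · subst his; simp [hx'def]
        · rwa [hx'def, Function.update_of_ne his]
      have h5 : x' (π i) ∈ w.support := by
        rw [← e]
        by_cases h6 : g i = x i
        · rwa [h6]
        · exact hon i h6
      refine hρ.eqvGen_sw hG hnc hx' (hρw _ h4) (hρw _ h5) ⟨x s, fun j hj => ?_⟩
      by_cases hjs : j = s
      · subst hjs; rw [hx'def, Function.update_self] at hj; exact hb j hj.symm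
      · rw [hx'def, Function.update_of_ne hjs] at hj; exact hjs (hx hj)

theorem step_sim (hG : G.Connected) (hnc : NotCycle G) (hTG : T ≤ G)
    (hQ : 17 * Fintype.card V ^ 2 ≤ Q) (hel : Elim T l) (hl : ∀ v, v ∈ l)
    (hcard : Fintype.card ι < Fintype.card V) (h : Step G x y)
    {z z' : ι → V} (hz : Can T l x z) (hz' : Can T l y z') : Sim G Q z z' := by
  have hole : ∀ x : ι → V, ∃ p, ∀ i, x i ≠ p := by
    intro x
    by_contra hcon
    push Not at hcon
    have := Fintype.card_le_of_surjective x hcon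
    omega
  obtain ⟨u, m, hsl, hst, hr⟩ := h.exists_slides
  obtain ⟨zu, hzu⟩ := exists_can hel u hst.inj
  have s1 : Sim G Q z zu := by
    clear hst hr
    induction hsl generalizing zu with
    | refl => exact (can_sim (ι := ι) hTG (by omega) hel).1 _ _ _ h.inj hz hzu
    | tail u m r b hs hb hadj ih =>
      have hu := (hs.reach h.inj).inj'
      obtain ⟨z1, hz1⟩ := exists_can hel u hu
      exact (ih _ hz1).trans (slide_sim hG hnc hTG hQ hel hl hu hb hadj hz1 hzu)
  refine s1.trans ?_
  obtain ⟨π, rfl⟩ := exists_perm_of_range_subset h.inj' hr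
  refine can_sim_of_perm hTG hQ hel hst.inj π (fun i => ?_) hzu hz'
  by_cases hi : π i = i
  · rw [hi]; exact Relation.EqvGen.refl _
  · obtain ⟨ρ, hρ, hρi⟩ := hst.exists_rot hi
    refine Relation.EqvGen.rel _ _ ?_
    refine (hρ.swap_consecutive hG hnc hst.inj hρi.symm ?_ (hole u)).mono (by omega)
    rw [hρi]; exact hst.inj.ne hi

/-- In a connected graph that is not a cycle and with at least one hole, reachable configurations
are cheaply reachable. -/
theorem Reach.bound (hG : G.Connected) (hnc : NotCycle G)
    (hcard : Fintype.card ι < Fintype.card V) {c : ℕ} (h : Reach G x y c) :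
    Reach G x y (36 * Fintype.card V ^ 4) := by
  obtain ⟨T, l, hTG, hel, hl⟩ := exists_elim hG
  obtain ⟨z, hz⟩ := exists_can hel x h.inj
  obtain ⟨z', hz'⟩ := exists_can hel y h.inj'
  have hsim : Sim G (17 * Fintype.card V ^ 2) z z' := by
    induction h generalizing z' with
    | refl hx c => exact (can_sim (ι := ι) hTG (by omega) hel).1 _ _ _ hx hz hz'
    | tail y y' c d hr hs _ ih =>
      obtain ⟨z1, hz1⟩ := exists_can hel y hs.inj
      exact (ih _ hz1).trans (step_sim hG hnc hTG le_rfl hel hl hcard hs hz1 hz')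
  obtain ⟨σ, rfl, hσ⟩ := hsim
  have R1 := (hz.reach h.inj).mono_graph hTG
  have R3 := (hz'.reach h.inj').mono_graph hTG
  have R2 := reach_of_classes R1.inj' σ hσ
  refine ((R1.trans R2).trans R3.symm).mono ?_
  have h1 := hel.length_le
  have h2 : Fintype.card ι ^ 2 ≤ Fintype.card V ^ 2 := Nat.pow_le_pow_left hcard.le 2
  have h3 : Fintype.card V ≤ Fintype.card V ^ 3 := Nat.le_self_pow (by norm_num) _
  have h4 : l.length * Fintype.card V ≤ Fintype.card V ^ 4 := by
    calc l.length * Fintype.card V ≤ Fintype.card V * Fintype.card V := Nat.mul_le_mul_right _ h1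
      _ ≤ Fintype.card V * Fintype.card V ^ 3 := Nat.mul_le_mul_left _ h3
      _ = _ := by ring
  have h5 : 2 * Fintype.card ι ^ 2 * (17 * Fintype.card V ^ 2) ≤ 34 * Fintype.card V ^ 4 := by
    calc _ ≤ 2 * Fintype.card V ^ 2 * (17 * Fintype.card V ^ 2) := by gcongr
      _ = _ := by ring
  omega

end GCMP

namespace GCMP

set_option linter.unusedSectionVars false

variable {V ι : Type*}

/-- The edges of `G` with both ends in `W`. -/
def inside (G : SimpleGraph V) (W : Set V) : SimpleGraph V where
  Adj a b := G.Adj a b ∧ a ∈ W ∧ b ∈ W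
  symm := ⟨fun _ _ h => ⟨h.1.symm, h.2.2, h.2.1⟩⟩
  loopless := ⟨fun _ h => h.1.ne rfl⟩

theorem inside_le (G : SimpleGraph V) (W : Set V) : inside G W ≤ G := fun _ _ h => h.1

variable [Fintype ι] [DecidableEq V] [DecidableEq ι]

theorem Joined.inside {G : SimpleGraph V} {W : Set V} {a b : V} (h : Joined G W a b) :
    Joined (GCMP.inside G W) W a b := by
  obtain ⟨w, hw⟩ := h
  induction w with
  | nil => exact Joined.refl (hw _ (by simp))
  | @cons a a1 b hadj w ih =>
    have h1 := ih fun c hc => hw c (by simp [hc])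
    have ha := hw a (by simp)
    exact (Joined.of_adj (G := GCMP.inside G W) ha h1.left_mem ⟨hadj, ha, h1.left_mem⟩).trans h1

theorem Step.inside_eq {G : SimpleGraph V} {W : Set V} {x y : ι → V} (h : Step (inside G W) x y)
    {i : ι} (hi : x i ∉ W) : y i = x i :=
  (h.adj i).resolve_right fun h => hi h.2.1

theorem Step.inside_mem {G : SimpleGraph V} {W : Set V} {x y : ι → V} (h : Step (inside G W) x y)
    (i : ι) : y i ∈ W ↔ x i ∈ W := by
  rcases h.adj i with h | h
  · rw [h]
  · exact ⟨fun _ => h.2.1, fun _ => h.2.2⟩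

theorem Reach.inside_mem {G : SimpleGraph V} {W : Set V} {x y : ι → V} {c : ℕ}
    (h : Reach (inside G W) x y c) (i : ι) : y i ∈ W ↔ x i ∈ W := by
  induction h with
  | refl => rfl
  | tail y z c d _ hs _ ih => rw [hs.inside_mem, ih]

theorem Reach.inside_eq {G : SimpleGraph V} {W : Set V} {x y : ι → V} {c : ℕ}
    (h : Reach (inside G W) x y c) {i : ι} (hi : x i ∉ W) : y i = x i := by
  induction h with
  | refl => rfl
  | tail y z c d hr hs _ ih => rw [hs.inside_eq (by rwa [hr.inside_mem]), ih]

/-- Replace the positions of the robots in `A` by those of `f`. -/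
noncomputable def patch {A : Set ι} {W : Set V} (x : ι → V) (f : A → W) : ι → V := by
  classical exact fun i => if h : i ∈ A then f ⟨i, h⟩ else x i

theorem patch_of_mem {A : Set ι} {W : Set V} (x : ι → V) (f : A → W) {i : ι} (h : i ∈ A) :
    patch x f i = f ⟨i, h⟩ := by simp [patch, h]

theorem patch_of_notMem {A : Set ι} {W : Set V} (x : ι → V) (f : A → W) {i : ι} (h : i ∉ A) :
    patch x f i = x i := by simp [patch, h]

section Transfer

variable {G : SimpleGraph V} {W : Set V} {A : Set ι} [Fintype A]

theorem patch_injective {x : ι → V} {f : A → W} (hx : ∀ i ∉ A, ∀ j ∉ A, x i = x j → i = j)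
    (hxW : ∀ i ∉ A, x i ∉ W) (hf : Function.Injective f) : Function.Injective (patch x f) := by
  intro i j hij
  by_cases hi : i ∈ A <;> by_cases hj : j ∈ A
  · rw [patch_of_mem _ _ hi, patch_of_mem _ _ hj] at hij
    have := hf (Subtype.ext hij)
    exact congrArg Subtype.val this
  · rw [patch_of_mem _ _ hi, patch_of_notMem _ _ hj] at hij
    exact absurd (hij ▸ (f ⟨i, hi⟩).2) (hxW j hj)
  · rw [patch_of_notMem _ _ hi, patch_of_mem _ _ hj] at hij
    exact absurd (hij ▸ (f ⟨j, hj⟩).2) (hxW i hi)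
  · rw [patch_of_notMem _ _ hi, patch_of_notMem _ _ hj] at hij
    exact hx i hi j hj hij

theorem Step.patch {x : ι → V} {f g : A → W} (hx : ∀ i ∉ A, ∀ j ∉ A, x i = x j → i = j)
    (hxW : ∀ i ∉ A, x i ∉ W) (h : Step (G.induce W) f g) :
    Step (inside G W) (patch x f) (GCMP.patch x g) where
  inj := patch_injective hx hxW h.inj
  inj' := patch_injective hx hxW h.inj'
  adj i := by
    by_cases hi : i ∈ A
    · rw [patch_of_mem _ _ hi, patch_of_mem _ _ hi]
      rcases h.adj ⟨i, hi⟩ with h | h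
      · rw [h]; exact Or.inl rfl
      · exact Or.inr ⟨h, Subtype.mem _, Subtype.mem _⟩
    · rw [patch_of_notMem _ _ hi, patch_of_notMem _ _ hi]; exact Or.inl rfl
  noswap i j hij := by
    rintro ⟨h1, h2⟩
    by_cases hi : i ∈ A <;> by_cases hj : j ∈ A
    · rw [patch_of_mem _ _ hi, patch_of_mem _ _ hj] at h1
      rw [patch_of_mem _ _ hi, patch_of_mem _ _ hj] at h2
      exact h.noswap ⟨i, hi⟩ ⟨j, hj⟩ (fun e => hij (congrArg Subtype.val e))
        ⟨Subtype.ext h1, Subtype.ext h2⟩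
    · rw [patch_of_mem _ _ hi, patch_of_notMem _ _ hj] at h1
      exact hxW j hj (h1 ▸ Subtype.mem _)
    · rw [patch_of_mem _ _ hj, patch_of_notMem _ _ hi] at h1
      exact hxW i hi (h1 ▸ Subtype.mem _)
    · rw [patch_of_notMem _ _ hi, patch_of_notMem _ _ hj] at h1
      exact hij (hx i hi j hj h1)

theorem stepCost_patch (x : ι → V) (f g : A → W) :
    stepCost (patch x f) (patch x g) = stepCost f g := by
  unfold stepCost
  symm
  apply Finset.card_bij (fun (i : A) _ => (i : ι))
  · intro i hi
    simp only [Finset.mem_filter, Finset.mem_univ, true_and] at hi ⊢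
    rw [patch_of_mem _ _ i.2, patch_of_mem _ _ i.2]
    exact fun h => hi (Subtype.ext h)
  · intro i _ j _ h; exact Subtype.ext h
  · intro i hi
    simp only [Finset.mem_filter, Finset.mem_univ, true_and] at hi
    by_cases hA : i ∈ A
    · refine ⟨⟨i, hA⟩, ?_, rfl⟩
      simp only [Finset.mem_filter, Finset.mem_univ, true_and]
      rw [patch_of_mem _ _ hA, patch_of_mem _ _ hA] at hi
      exact fun h => hi (by rw [h])
    · rw [patch_of_notMem _ _ hA, patch_of_notMem _ _ hA] at hi
      exact absurd rfl hi

theorem Reach.patch {x : ι → V} {f g : A → W} {c : ℕ}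
    (hx : ∀ i ∉ A, ∀ j ∉ A, x i = x j → i = j) (hxW : ∀ i ∉ A, x i ∉ W)
    (h : Reach (G.induce W) f g c) : Reach (inside G W) (GCMP.patch x f) (GCMP.patch x g) c := by
  induction h with
  | refl hf c => exact Reach.refl _ (patch_injective hx hxW hf) _
  | tail g g' c d _ hs hcd ih =>
    exact Reach.tail _ _ _ _ _ ih (hs.patch hx hxW) (by rwa [stepCost_patch])

/-- The configuration of the robots in `A` when they are all inside `W`. -/
def confine (x : ι → V) (h : ∀ i ∈ A, x i ∈ W) : A → W := fun i => ⟨x i, h i i.2⟩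

theorem patch_confine (x : ι → V) (h : ∀ i ∈ A, x i ∈ W) {y : ι → V} (hy : ∀ i ∉ A, y i = x i) :
    patch y (confine x h) = x := by
  funext i
  by_cases hi : i ∈ A
  · rw [patch_of_mem _ _ hi]; rfl
  · rw [patch_of_notMem _ _ hi, hy i hi]

theorem Step.confine {x y : ι → V} (h : Step (inside G W) x y) (hx : ∀ i ∈ A, x i ∈ W)
    (hy : ∀ i ∈ A, y i ∈ W) : Step (G.induce W) (confine x hx) (GCMP.confine y hy) where
  inj i j hij := Subtype.ext (h.inj (congrArg Subtype.val hij))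
  inj' i j hij := Subtype.ext (h.inj' (congrArg Subtype.val hij))
  adj i := by
    rcases h.adj i with h | h
    · exact Or.inl (Subtype.ext h)
    · exact Or.inr h.1
  noswap i j hij := by
    rintro ⟨h1, h2⟩
    exact h.noswap i j (fun e => hij (Subtype.ext e))
      ⟨congrArg Subtype.val h1, congrArg Subtype.val h2⟩

theorem stepCost_confine_le (x y : ι → V) (hx : ∀ i ∈ A, x i ∈ W) (hy : ∀ i ∈ A, y i ∈ W) :
    stepCost (confine x hx) (confine y hy) ≤ stepCost x y := by
  unfold stepCost
  apply Finset.card_le_card_of_injOn (fun i : A => (i : ι))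
  · intro i hi
    simp only [Finset.coe_filter, Finset.mem_univ, true_and, Set.mem_ofPred_eq] at hi ⊢
    exact fun h => hi (Subtype.ext h)
  · intro i _ j _ h; exact Subtype.ext h

theorem Reach.confine {x y : ι → V} {c : ℕ} (h : Reach (inside G W) x y c)
    (hx : ∀ i ∈ A, x i ∈ W) (hy : ∀ i ∈ A, y i ∈ W) :
    Reach (G.induce W) (confine x hx) (GCMP.confine y hy) c := by
  induction h with
  | refl hinj c =>
    exact Reach.refl _ (fun i j hij => Subtype.ext (hinj (congrArg Subtype.val hij))) _
  | tail y z c d hr hs hcd ih =>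
    have hy' : ∀ i ∈ A, y i ∈ W := fun i hi => (hr.inside_mem i).2 (hx i hi)
    exact Reach.tail _ _ _ _ _ (ih hy') (hs.confine hy' hy)
      ((Nat.add_le_add_left (stepCost_confine_le _ _ _ _) _).trans hcd)

theorem confine_injective {x : ι → V} (hinj : Function.Injective x) (hx : ∀ i ∈ A, x i ∈ W) :
    Function.Injective (confine x hx) :=
  fun _ _ hij => Subtype.ext (hinj (congrArg Subtype.val hij))

/-- Motions inside `W` can be computed in the induced graph. -/
theorem reach_inside_of_induce {x y : ι → V} {c : ℕ} (hinj : Function.Injective x)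
    (hxA : ∀ i, x i ∈ W ↔ i ∈ A) (hyA : ∀ i ∈ A, y i ∈ W) (hoff : ∀ i ∉ A, y i = x i)
    (h : Reach (G.induce W) (confine x fun i hi => (hxA i).2 hi) (confine y hyA) c) :
    Reach (inside G W) x y c := by
  have := Reach.patch (x := x) (fun i _ j _ h => hinj h) (fun i hi => (hxA i).not.2 hi) h
  rwa [patch_confine _ _ fun i _ => rfl, patch_confine _ _ fun i hi => (hoff i hi).symm] at this

end Transfer

section OneClass

variable {G : SimpleGraph V} {x y z : ι → V}

/-- `y` can be reached from `x`. -/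
def Rch (G : SimpleGraph V) (x y : ι → V) : Prop := ∃ c, Reach G x y c

theorem Rch.trans (h : Rch G x y) (h' : Rch G y z) : Rch G x z := by
  obtain ⟨c, h⟩ := h
  obtain ⟨d, h'⟩ := h'
  exact ⟨_, h.trans h'⟩

theorem Rch.symm (h : Rch G x y) : Rch G y x := by
  obtain ⟨c, h⟩ := h
  exact ⟨_, h.symm⟩

theorem Rch.refl (h : Function.Injective x) : Rch G x x := ⟨0, Reach.refl _ h _⟩

theorem Rch.inj' (h : Rch G x y) : Function.Injective y := h.choose_spec.inj'

/-- The robots `i` and `j` can be exchanged by some motion. -/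
def Exch (G : SimpleGraph V) (x : ι → V) (i j : ι) : Prop := Rch G x (x ∘ Equiv.swap i j)

theorem Exch.of_rch (h : Rch G x y) {i j : ι} (hxy : Exch G x i j) : Exch G y i j := by
  obtain ⟨c, h⟩ := h.symm
  obtain ⟨d, h'⟩ := hxy
  exact ⟨_, h.conj h'⟩

theorem Exch.symm {i j : ι} (h : Exch G x i j) : Exch G x j i := by
  unfold Exch at *; rwa [Equiv.swap_comm]

theorem Exch.refl (hx : Function.Injective x) (i : ι) : Exch G x i i := by
  unfold Exch
  simpa using Rch.refl hx

theorem Exch.trans {i j l : ι} (h : Exch G x i j) (h' : Exch G x j l) : Exch G x i l := by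
  obtain ⟨c, h⟩ := h
  obtain ⟨d, h'⟩ := h'
  have h1 : Relation.EqvGen (Sw G (max c d) x) i j :=
    Relation.EqvGen.rel _ _ (h.mono (le_max_left _ _))
  have h2 : Relation.EqvGen (Sw G (max c d) x) j l :=
    Relation.EqvGen.rel _ _ (h'.mono (le_max_right _ _))
  exact ⟨_, sw_of_eqvGen h.inj (h1.trans _ _ _ h2)⟩

theorem rch_of_exch (hx : Function.Injective x) (h : ∀ i j, Exch G x i j) (σ : Equiv.Perm ι) :
    Rch G x (x ∘ σ) := by
  choose f hf using h
  have hb : ∀ i j, f i j ≤ ∑ i, ∑ j, f i j := fun i j =>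
    (Finset.single_le_sum (f := fun j => f i j) (fun _ _ => Nat.zero_le _) (Finset.mem_univ j)).trans
      (Finset.single_le_sum (f := fun i => ∑ j, f i j) (fun _ _ => Nat.zero_le _)
        (Finset.mem_univ i))
  exact ⟨_, reach_of_classes hx σ fun i => Relation.EqvGen.rel _ _ ((hf i (σ i)).mono (hb _ _))⟩

/-- The robots inside a connected set can gather at any given places of this set. -/
theorem exists_gather [Fintype V] {W : Set V} [DecidablePred (· ∈ W)] (hW : ∀ a ∈ W, ∀ b ∈ W, Joined G W a b)
    (hx : Function.Injective x) (S : Finset V) (hS : ↑S ⊆ W)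
    (hcard : S.card = (Finset.univ.filter fun i => x i ∈ W).card) :
    ∃ y, Reach (inside G W) x y
        ((Finset.univ.filter fun i => x i ∈ W ∧ x i ∉ S).card * Fintype.card V) ∧
      ∀ i, x i ∈ W → y i ∈ S := by
  generalize hm : (Finset.univ.filter fun i => x i ∈ W ∧ x i ∉ S).card = m
  induction m using Nat.strong_induction_on generalizing x with
  | _ m ih =>
    by_cases hall : ∀ i, x i ∈ W → x i ∈ S
    · exact ⟨x, Reach.refl _ hx _, hall⟩
    · push Not at hall
      obtain ⟨i0, hi0, hi0S⟩ := hall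
      obtain ⟨g, hgS, hg⟩ : ∃ g ∈ S, ∀ i, x i ≠ g := by
        by_contra hcon
        push Not at hcon
        have hsub : S ⊂ (Finset.univ.filter fun i => x i ∈ W).image x := by
          rw [Finset.ssubset_iff_of_subset]
          · exact ⟨x i0, by simpa using ⟨i0, hi0, rfl⟩, hi0S⟩
          · intro a ha
            obtain ⟨i, hi⟩ := hcon a ha
            rw [Finset.mem_image]
            exact ⟨i, by simpa [hi] using hS ha, hi⟩
        have h1 := Finset.card_lt_card hsub
        have h2 := Finset.card_image_le (s := Finset.univ.filter fun i => x i ∈ W) (f := x)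
        omega
      obtain ⟨w, hw, hwW⟩ := ((hW g (hS hgS) (x i0) hi0).inside).exists_path
      obtain ⟨y, n, hn, hsl, hoff, hon, hr⟩ := exists_slides_hole w hw hx hg ⟨i0, rfl⟩
      have hR := hsl.reach hx
      have hy := hR.inj'
      have hmem := hR.inside_mem
      have hcard' : S.card = (Finset.univ.filter fun i => y i ∈ W).card := by
        rw [hcard]; congr 1; ext i; simp [hmem]
      have hlt : (Finset.univ.filter fun i => y i ∈ W ∧ y i ∉ S).card < m := by
        rw [← hm]
        have e : ∀ z : ι → V, Function.Injective z →
            (Finset.univ.filter fun i => z i ∈ W ∧ z i ∉ S).card =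
            ((Finset.univ.filter fun i => z i ∈ W ∧ z i ∉ S).image z).card := fun z hz =>
          (Finset.card_image_of_injective _ hz).symm
        rw [e x hx, e y hy]
        apply Finset.card_lt_card
        rw [Finset.ssubset_iff_of_subset]
        · refine ⟨x i0, by simpa using ⟨i0, ⟨hi0, hi0S⟩, rfl⟩, ?_⟩
          intro hh
          rw [Finset.mem_image] at hh
          obtain ⟨j, -, hj⟩ := hh
          have : x i0 ∈ Set.range y := ⟨j, hj⟩
          rw [hr] at this
          rcases this with h | h
          · exact hg i0 h
          · exact h.2 rfl
        · intro a ha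
          rw [Finset.mem_image] at ha
          obtain ⟨j, hj, rfl⟩ := ha
          simp only [Finset.mem_filter, Finset.mem_univ, true_and] at hj
          have : y j ∈ Set.range y := ⟨j, rfl⟩
          rw [hr] at this
          rcases this with h | ⟨⟨l, hl⟩, -⟩
          · exact absurd (h ▸ hgS) hj.2
          · rw [Finset.mem_image]
            exact ⟨l, by simpa [hl] using hj, hl⟩
      obtain ⟨y', hy', h1⟩ := ih _ hlt hy hcard' rfl
      refine ⟨y', (hR.trans hy').mono ?_, fun i hi => h1 i ((hmem i).2 hi)⟩
      have h2 := Nat.mul_le_mul_right (Fintype.card V) (Nat.succ_le_of_lt hlt)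
      rw [Nat.succ_mul] at h2
      have h3 := hw.length_lt
      omega

/-- Some robot in a connected set has free access to a given free vertex of the set. -/
theorem exists_nearest {W : Set V} {v : V} (hx : Function.Injective x) {i : ι}
    (hJ : Joined G W (x i) v) (hv : ∀ i, x i ≠ v) :
    ∃ s, Joined G {u | u ∈ W ∧ ∀ j, j ≠ s → x j ≠ u} (x s) v := by
  obtain ⟨w, hw⟩ := hJ.symm
  have key : ∀ (a b : V) (w : G.Walk a b), (∀ c ∈ w.support, c ∈ W) → (∀ i, x i ≠ a) →
      (∃ i, x i = b) → ∃ i, Joined G {u | u ∈ W ∧ ∀ j, j ≠ i → x j ≠ u} (x i) a := by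
    intro a b w
    induction w with
    | nil => intro _ h1 ⟨i, h2⟩; exact absurd h2 (h1 i)
    | @cons a a1 b hadj w ihw =>
      intro h1 h2 h3
      by_cases h4 : ∃ i, x i = a1
      · obtain ⟨j, hj⟩ := h4
        refine ⟨j, ?_⟩
        rw [hj]
        exact Joined.of_adj
          ⟨h1 _ (by simp), fun l hl => by rw [← hj]; exact hx.ne hl⟩
          ⟨h1 _ (by simp), fun l _ => h2 l⟩ hadj.symm
      · push Not at h4
        obtain ⟨j, hj⟩ := ihw (fun c hc => h1 c (by simp [hc])) h4 h3
        exact ⟨j, hj.trans (Joined.of_adj hj.right_mem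
          ⟨h1 _ (by simp), fun l _ => h2 l⟩ hadj.symm)⟩
  exact key v (x i) w hw hv ⟨i, rfl⟩

theorem rch_joined {A : Set V} {v : V} (hx : Function.Injective x) {r : ι}
    (h : Joined G A (x r) v) (hA : ∀ a ∈ A, ∀ i, i ≠ r → x i ≠ a) :
    Rch G x (Function.update x r v) := by
  obtain ⟨w, hw, hwA⟩ := h.exists_path
  exact ⟨_, (slides_along w hw rfl fun a ha => hA a (hwA a ha)).reach hx⟩

/-- Exchanging two robots at a junction. -/
theorem exch_junction (hx : Function.Injective x) {s b : ι} {w y2 : V} {A : Set V}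
    (hsb : s ≠ b) (hJ : Joined G {u | u ∈ A ∧ ∀ j, j ≠ s → x j ≠ u} (x s) w)
    (hw : ∀ i, x i ≠ w) (h2 : ∀ i, x i ≠ y2) (a2 : G.Adj w y2) (a3 : G.Adj w (x b))
    (hb : x b ∉ A) (h2A : y2 ∉ A) : Exch G x s b := by
  have R1 := rch_joined hx hJ fun a ha => ha.2
  set x1 := Function.update x s w with hx1
  have h21 : ∀ i, x1 i ≠ y2 := by
    intro i
    by_cases hi : i = s
    · subst hi; rw [hx1, Function.update_self]; exact a2.ne
    · rw [hx1, Function.update_of_ne hi]; exact h2 i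
  have R2 : Rch G x1 (Function.update x1 s y2) :=
    ⟨1, reach_slide R1.inj' h21 (by rw [hx1, Function.update_self]; exact a2)⟩
  rw [hx1, Function.update_idem] at R2
  set x2 := Function.update x s y2 with hx2
  have hwA : w ∈ A := hJ.right_mem.1
  have hx2b : x2 b = x b := by rw [hx2, Function.update_of_ne hsb.symm]
  have J3 : Joined G (insert (x b) {u | u ∈ A ∧ ∀ j, j ≠ s → x j ≠ u}) (x2 b) (x s) := by
    rw [hx2b]
    refine (Joined.of_adj (Set.mem_insert _ _) (Set.mem_insert_of_mem _ hJ.right_mem) a3.symm).trans (hJ.symm.mono ?_)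
    exact Set.subset_insert _ _
  have R3 : Rch G x2 (Function.update x2 b (x s)) := by
    refine rch_joined R2.inj' J3 ?_
    rintro a ha i hi hia
    by_cases his : i = s
    · subst his
      rw [hx2, Function.update_self] at hia
      subst hia
      rcases ha with ha | ha
      · exact h2 b ha.symm
      · exact h2A ha.1
    · rw [hx2, Function.update_of_ne his] at hia
      rcases ha with ha | ha
      · exact hi (hx (hia.trans ha))
      · exact ha.2 i his hia
  set x3 := Function.update x2 b (x s) with hx3
  have hx3s : x3 s = y2 := by rw [hx3, Function.update_of_ne hsb, hx2, Function.update_self]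
  have hxsw : x s ≠ w := hw s
  have J4 : Joined G {y2, w, x b} (x3 s) (x b) := by
    rw [hx3s]
    exact (Joined.of_adj (by simp) (by simp) a2.symm).trans
      (Joined.of_adj (by simp) (by simp) a3)
  have R4 : Rch G x3 (Function.update x3 s (x b)) := by
    refine rch_joined R3.inj' J4 ?_
    rintro a ha i hi hia
    have hya : x3 i = if i = b then x s else x i := by
      by_cases hib : i = b
      · subst hib; simp [hx3]
      · simp [hx3, hx2, hib, hi]
    rw [hya] at hia
    simp only [Set.mem_insert_iff, Set.mem_singleton_iff] at ha
    by_cases hib : i = b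
    · subst hib
      rw [if_pos rfl] at hia
      rcases ha with rfl | rfl | rfl
      · exact h2 s hia
      · exact hw s hia
      · exact hsb (hx hia)
    · rw [if_neg hib] at hia
      rcases ha with rfl | rfl | rfl
      · exact h2 i hia
      · exact hw i hia
      · exact hib (hx hia)
  have e : Function.update x3 s (x b) = x ∘ Equiv.swap s b := by
    funext i
    by_cases his : i = s
    · subst his; simp
    · by_cases hib : i = b
      · subst hib; simp [hx3, hsb.symm]
      · simp [his, hib, hx3, hx2, Equiv.swap_apply_of_ne_of_ne]
  rw [e] at R4
  exact ((R1.trans R2).trans R3).trans R4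

/-- Data that allow arbitrary rearrangements: a long arm `A` and a branching or cyclic part `B`
that meet at `w`. -/
structure Junction (G : SimpleGraph V) (k : ℕ) (w : V) (A B : Finset V) : Prop where
  notMem_A : w ∉ A
  notMem_B : w ∉ B
  disj : Disjoint A B
  joined_A : ∀ a ∈ A, Joined G (insert w (A : Set V)) a w
  joined_B : ∀ b ∈ B, Joined G (insert w (B : Set V)) b w
  card_A : k ≤ A.card
  fork : (∃ y2 y3, y2 ≠ y3 ∧ y2 ∈ B ∧ y3 ∈ B ∧ G.Adj w y2 ∧ G.Adj w y3 ∧ k ≤ B.card) ∨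
    (∃ ρ, Rot G ρ ∧ (∀ u, ρ u ≠ u → u ∈ insert w B) ∧ ρ w ≠ w ∧ k ≤ B.card + 1)

variable {w : V} {A B : Finset V}

theorem Junction.joined (hJ : Junction G (Fintype.card ι) w A B) :
    ∀ a ∈ insert w (B : Set V), ∀ b ∈ insert w (B : Set V), Joined G (insert w (B : Set V)) a b := by
  have h1 : ∀ a ∈ insert w (B : Set V), Joined G (insert w (B : Set V)) a w := by
    rintro a (rfl | ha)
    · exact Joined.refl (Set.mem_insert _ _)
    · exact hJ.joined_B a ha
  exact fun a ha b hb => (h1 a ha).trans (h1 b hb).symm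

theorem Junction.exists_two (hJ : Junction G (Fintype.card ι) w A B) :
    ∃ y2 y3, y2 ≠ y3 ∧ y2 ∈ B ∧ y3 ∈ B ∧ G.Adj w y2 ∧ G.Adj w y3 := by
  rcases hJ.fork with ⟨y2, y3, h1, h2, h3, h4, h5, -⟩ | ⟨ρ, hρ, hB, hw, -⟩
  · exact ⟨y2, y3, h1, h2, h3, h4, h5⟩
  · have hw' : ρ⁻¹ w ≠ w := by rw [Ne, Equiv.Perm.inv_eq_iff_eq]; exact hw.symm
    refine ⟨ρ w, ρ⁻¹ w, ?_, ?_, ?_, hρ.adj w hw, hρ.inv.adj w hw'⟩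
    · intro e
      exact hρ.two w hw (by rw [e]; simp)
    · have := hB (ρ w) (by simpa using hw)
      rw [Finset.mem_insert] at this
      exact this.resolve_left hw
    · have := hB (ρ⁻¹ w) (by simpa using hw'.symm)
      rw [Finset.mem_insert] at this
      exact this.resolve_left hw'

theorem Junction.notCycle (hJ : Junction G (Fintype.card ι) w A B) (hA : A.Nonempty) :
    NotCycle G := by
  obtain ⟨y2, y3, h1, h2, h3, h4, h5⟩ := hJ.exists_two
  obtain ⟨a, ha⟩ := hA
  obtain ⟨p, hp, hpw⟩ := (hJ.joined_A a ha).exit (by rintro rfl; exact hJ.notMem_A ha)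
  have hpA : p ∈ A := by
    have := hp.right_mem
    rcases this.1 with h | h
    · exact absurd h this.2
    · exact h
  refine ⟨w, fun hcard => ?_⟩
  have hsub : ({p, y2, y3} : Set V) ⊆ G.neighborSet w := by
    rintro c (rfl | rfl | rfl)
    · exact hpw.symm
    · exact h4
    · exact h5
  have hne2 : p ≠ y2 := by rintro rfl; exact Finset.disjoint_left.1 hJ.disj hpA h2
  have hne3 : p ≠ y3 := by rintro rfl; exact Finset.disjoint_left.1 hJ.disj hpA h3
  have hfin : (G.neighborSet w).Finite := Set.finite_of_ncard_ne_zero (by omega)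
  have := Set.ncard_le_ncard hsub hfin
  rw [hcard, Set.ncard_eq_three.2 ⟨p, y2, y3, hne2, hne3, h1, rfl⟩] at this
  omega

theorem Junction.card_lt [Fintype V] (hJ : Junction G (Fintype.card ι) w A B) :
    Fintype.card ι < Fintype.card V := by
  have h4 := hJ.card_A
  have hne : A ⊂ Finset.univ :=
    Finset.ssubset_univ_iff.2 fun h => hJ.notMem_A (by rw [h]; exact Finset.mem_univ w)
  have h5 := Finset.card_lt_card hne
  rw [Finset.card_univ] at h5
  omega

/-- One more robot becomes exchangeable with the robots in `B ∪ {w}`. -/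
theorem Junction.stage [Fintype V] (hG : G.Connected) (hJ : Junction G (Fintype.card ι) w A B)
    (hx : Function.Injective x) (hAB : ∀ i, x i ∈ insert w (A ∪ B)) {i0 : ι} (hi0 : x i0 ∈ A)
    (hex : ∀ i j, x i ∉ A → x j ∉ A → Exch G x i j) :
    ∃ y, Rch G x y ∧ (∀ i, y i ∈ insert w (A ∪ B)) ∧ (∀ i j, y i ∉ A → y j ∉ A → Exch G y i j) ∧
      (Finset.univ.filter fun i => y i ∈ A).card < (Finset.univ.filter fun i => x i ∈ A).card := by
  classical
  obtain ⟨y2, y3, h23, h2, h3, a2, a3⟩ := hJ.exists_two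
  have hWA : ∀ i, x i ∈ insert w (B : Set V) ↔ x i ∉ A := by
    intro i
    have := hAB i
    simp only [Finset.mem_insert, Finset.mem_union] at this
    simp only [Set.mem_insert_iff, Finset.mem_coe]
    constructor
    · rintro (h | h)
      · rw [h]; exact hJ.notMem_A
      · exact fun h' => Finset.disjoint_left.1 hJ.disj h' h
    · tauto
  set j := (Finset.univ.filter fun i => x i ∈ insert w (B : Set V)).card with hj
  have hjk : j < Fintype.card ι := by
    rw [hj, ← Finset.card_univ]
    apply Finset.card_lt_card
    rw [Finset.ssubset_iff_of_subset (Finset.filter_subset _ _)]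
    exact ⟨i0, Finset.mem_univ _, by
      rw [Finset.mem_filter, hWA]; simpa using hi0⟩
  -- a set of places in `B` for the robots in `B ∪ {w}`
  have hplace : ∃ S : Finset V, S ⊆ B ∧ S.card = j ∧
      ((y2 ∉ S ∧ (0 < j → y3 ∈ S)) ∨
        ∃ ρ, Rot G ρ ∧ ρ w ≠ w ∧ (∀ u, ρ u ≠ u → u ∈ insert w B) ∧ (0 < j → ρ w ∈ S)) := by
    rcases hJ.fork with ⟨y2', y3', h1, h2', h3', a2', a3', hk⟩ | ⟨ρ, hρ, hB, hw, hk⟩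
    · by_cases hj0 : j = 0
      · exact ⟨∅, by simp, by simp [hj0], Or.inl ⟨by simp, fun h => by omega⟩⟩
      · have hsub : ({y3} : Finset V) ⊆ B.erase y2 := by
          simp [h3, h23.symm]
        have hc : (B.erase y2).card = B.card - 1 := Finset.card_erase_of_mem h2
        obtain ⟨S, hS1, hS2, hS3⟩ := Finset.exists_subsuperset_card_eq hsub
          (show ({y3} : Finset V).card ≤ j by simp; omega) (show j ≤ (B.erase y2).card by omega)
        refine ⟨S, hS2.trans (Finset.erase_subset _ _), hS3, Or.inl ⟨fun h => ?_, fun _ => ?_⟩⟩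
        · exact Finset.notMem_erase y2 B (hS2 h)
        · exact hS1 (by simp)
    · by_cases hj0 : j = 0
      · exact ⟨∅, by simp, by simp [hj0], Or.inl ⟨by simp, fun h => by omega⟩⟩
      · have hρw : ρ w ∈ B := by
          have := hB (ρ w) (by simpa using hw)
          rw [Finset.mem_insert] at this
          exact this.resolve_left hw
        obtain ⟨S, hS1, hS2, hS3⟩ := Finset.exists_subsuperset_card_eq
          (Finset.singleton_subset_iff.2 hρw)
          (show ({ρ w} : Finset V).card ≤ j by simp; omega) (show j ≤ B.card by omega)
        exact ⟨S, hS2, hS3, Or.inr ⟨ρ, hρ, hw, hB, fun _ => hS1 (by simp)⟩⟩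
  obtain ⟨S, hSB, hSj, hcase⟩ := hplace
  obtain ⟨u, hRu, hu⟩ := exists_gather hJ.joined hx S
    (fun a ha => Set.mem_insert_of_mem _ (hSB ha)) (hSj.trans hj)
  have hc := hRu
  have huA : ∀ i, x i ∈ A → u i = x i := fun i hi => hc.inside_eq ((hWA i).not.2 (by simpa using hi))
  have huW : ∀ i, x i ∉ A → u i ∈ S := fun i hi => hu i ((hWA i).2 hi)
  have hxu : Rch G x u := ⟨_, hc.mono_graph (inside_le _ _)⟩
  have huinj := hxu.inj'
  have huw : ∀ i, u i ≠ w := by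
    intro i hi
    by_cases hiA : x i ∈ A
    · rw [huA i hiA] at hi; rw [hi] at hiA; exact hJ.notMem_A hiA
    · have := hSB (huW i hiA); rw [hi] at this; exact hJ.notMem_B this
  have huA' : ∀ i, u i ∈ A ↔ x i ∈ A := by
    intro i
    by_cases hiA : x i ∈ A
    · rw [huA i hiA]
    · simp only [hiA, iff_false]
      exact fun h => Finset.disjoint_left.1 hJ.disj h (hSB (huW i hiA))
  have hexu : ∀ i j, u i ∉ A → u j ∉ A → Exch G u i j := fun i j hi hj =>
    (hex i j ((huA' i).not.1 hi) ((huA' j).not.1 hj)).of_rch hxu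
  -- the nearest robot in `A`
  obtain ⟨s, hs⟩ := exists_nearest huinj (i := i0) (v := w)
    (by rw [huA i0 hi0]; exact hJ.joined_A _ hi0) huw
  have hsA : u s ∈ A := by
    rcases hs.left_mem.1 with h | h
    · exact absurd h (huw s)
    · exact h
  have R := rch_joined huinj hs fun a ha => ha.2
  set y := Function.update u s w with hy
  have hys : y s = w := by rw [hy, Function.update_self]
  have hyo : ∀ i, i ≠ s → y i = u i := fun i hi => by rw [hy, Function.update_of_ne hi]
  -- the new robot is exchangeable with all old ones
  have hnew : ∀ b, u b ∉ A → Exch G y s b := by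
    intro b hb
    have hbx : x b ∉ A := (huA' b).not.1 hb
    have hj0 : 0 < j := by
      rw [hj, Finset.card_pos]
      exact ⟨b, by rw [Finset.mem_filter, hWA]; exact ⟨Finset.mem_univ _, hbx⟩⟩
    have hocc : ∀ p ∈ S, ∃ i, x i ∉ A ∧ u i = p := by
      have himg : (Finset.univ.filter fun i => x i ∈ insert w (B : Set V)).image u = S := by
        apply Finset.eq_of_subset_of_card_le
        · intro p hp
          rw [Finset.mem_image] at hp
          obtain ⟨i, hi, rfl⟩ := hp
          exact hu i (by simpa using hi)
        · rw [Finset.card_image_of_injective _ huinj, hSj]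
      intro p hp
      rw [← himg, Finset.mem_image] at hp
      obtain ⟨i, hi, rfl⟩ := hp
      exact ⟨i, (hWA i).1 (by simpa using hi), rfl⟩
    rcases hcase with ⟨hy2, hy3⟩ | ⟨ρ, hρ, hρw, hρB, hρS⟩
    · obtain ⟨b', hb', hub'⟩ := hocc y3 (hy3 hj0)
      have hsb' : s ≠ b' := by
        rintro rfl; exact hb' ((huA' s).1 hsA)
      have : Exch G u s b' := by
        refine exch_junction huinj hsb' hs huw (y2 := y2) ?_ a2 (by rwa [hub']) ?_ ?_
        · intro i hi
          by_cases hiA : x i ∈ A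
          · rw [huA i hiA] at hi; rw [hi] at hiA; exact Finset.disjoint_left.1 hJ.disj hiA h2
          · have := huW i hiA; rw [hi] at this; exact hy2 this
        · rw [hub']
          rintro (h | h)
          · exact a3.ne h.symm
          · exact Finset.disjoint_left.1 hJ.disj h h3
        · rintro (h | h)
          · exact a2.ne h.symm
          · exact Finset.disjoint_left.1 hJ.disj h h2
      exact (this.trans (hexu b' b ((huA' b').not.2 hb') hb)).of_rch R
    · obtain ⟨b', hb', hub'⟩ := hocc _ (hρS hj0)
      have hsb' : b' ≠ s := by
        rintro rfl; exact hb' ((huA' b').1 hsA)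
      have hlt := hJ.card_lt
      have hole : ∃ p, ∀ i, y i ≠ p := by
        by_contra hcon
        push Not at hcon
        have := Fintype.card_le_of_surjective y hcon
        omega
      have : Exch G y s b' := ⟨_, hρ.swap_consecutive hG (hJ.notCycle ⟨_, hi0⟩) R.inj'
        (by rw [hyo b' hsb', hub', hys]) (by rwa [hys]) hole⟩
      exact this.trans ((hexu b' b ((huA' b').not.2 hb') hb).of_rch R)
  refine ⟨y, hxu.trans R, ?_, ?_, ?_⟩
  · intro i
    by_cases hi : i = s
    · subst hi; rw [hys]; simp
    · rw [hyo i hi]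
      by_cases hiA : x i ∈ A
      · rw [huA i hiA]; exact hAB i
      · have := hSB (huW i hiA); simp [this]
  · intro a b ha hb
    by_cases has : a = s
    · subst has
      by_cases hbs : b = a
      · subst hbs; exact Exch.refl R.inj' _
      · exact hnew b (by rwa [← hyo b hbs])
    · by_cases hbs : b = s
      · subst hbs; exact (hnew a (by rwa [← hyo a has])).symm
      · exact (hexu a b (by rwa [← hyo a has]) (by rwa [← hyo b hbs])).of_rch R
  · apply Finset.card_lt_card
    rw [Finset.ssubset_iff_of_subset]
    · refine ⟨s, ?_, ?_⟩
      · simpa using (huA' s).1 hsA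
      · simp [hys, hJ.notMem_A]
    · intro i hi
      simp only [Finset.mem_filter, Finset.mem_univ, true_and] at hi ⊢
      by_cases his : i = s
      · subst his; rw [hys] at hi; exact absurd hi hJ.notMem_A
      · rw [hyo i his] at hi; exact (huA' i).1 hi

theorem Junction.exch [Fintype V] (hG : G.Connected) (hJ : Junction G (Fintype.card ι) w A B)
    (hx : Function.Injective x) (hAB : ∀ i, x i ∈ insert w (A ∪ B))
    (hex : ∀ i j, x i ∉ A → x j ∉ A → Exch G x i j) : ∀ i j, Exch G x i j := by
  generalize hm : (Finset.univ.filter fun i => x i ∈ A).card = m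
  induction m using Nat.strong_induction_on generalizing x with
  | _ m ih =>
    by_cases h0 : ∃ i, x i ∈ A
    · obtain ⟨i0, hi0⟩ := h0
      obtain ⟨y, hR, h1, h2, h3⟩ := hJ.stage hG hx hAB hi0 hex
      intro i j
      exact (ih _ (by omega) hR.inj' h1 h2 rfl i j).of_rch hR.symm
    · push Not at h0
      exact fun i j => hex i j (h0 i) (h0 j)

/-- At a junction all configurations are reachable from each other. -/
theorem Junction.rch [Fintype V] (hG : G.Connected) (hJ : Junction G (Fintype.card ι) w A B)
    (hx : Function.Injective x) (hy : Function.Injective y) : Rch G x y := by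
  classical
  obtain ⟨S, hSA, hS⟩ := Finset.exists_subset_card_eq hJ.card_A
  have hW : ∀ a ∈ (Set.univ : Set V), ∀ b ∈ (Set.univ : Set V), Joined G Set.univ a b := by
    intro a _ b _
    obtain ⟨w⟩ := hG.preconnected a b
    exact ⟨w, fun _ _ => Set.mem_univ _⟩
  have hgather : ∀ x : ι → V, Function.Injective x → ∃ x', Rch G x x' ∧ ∀ i, x' i ∈ S := by
    intro x hx
    obtain ⟨x', h1, h2⟩ := exists_gather hW hx S (Set.subset_univ _) (by simp [hS])
    exact ⟨x', ⟨_, h1.mono_graph (inside_le _ _)⟩, fun i => h2 i (Set.mem_univ _)⟩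
  obtain ⟨x', hxx', hx'⟩ := hgather x hx
  obtain ⟨y', hyy', hy'⟩ := hgather y hy
  have hrange : ∀ z : ι → V, Function.Injective z → (∀ i, z i ∈ S) → Finset.univ.image z = S := by
    intro z hz hzS
    apply Finset.eq_of_subset_of_card_le
    · intro a ha
      rw [Finset.mem_image] at ha
      obtain ⟨i, -, rfl⟩ := ha
      exact hzS i
    · rw [Finset.card_image_of_injective _ hz, hS, Finset.card_univ]
  have hsub : Set.range y' ⊆ Set.range x' := by
    rintro _ ⟨i, rfl⟩
    have := hy' i
    rw [← hrange x' hxx'.inj' hx', Finset.mem_image] at this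
    obtain ⟨j, -, hj⟩ := this
    exact ⟨j, hj⟩
  obtain ⟨σ, rfl⟩ := exists_perm_of_range_subset hyy'.inj' hsub
  have hex := hJ.exch hG hxx'.inj' (fun i => by simp [hSA (hx' i)])
    (fun i j hi _ => absurd (hSA (hx' i)) hi)
  exact (hxx'.trans (rch_of_exch hxx'.inj' hex σ)).trans hyy'.symm

/-- Quantitative version: at a junction all configurations are cheaply reachable from each
other. -/
theorem Junction.reach [Fintype V] (hG : G.Connected) (hJ : Junction G (Fintype.card ι) w A B)
    (hx : Function.Injective x) (hy : Function.Injective y) :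
    Reach G x y (36 * Fintype.card V ^ 4) := by
  by_cases hk : Nonempty ι
  · obtain ⟨c, hc⟩ := hJ.rch hG hx hy
    have hA : A.Nonempty := by
      rw [← Finset.card_pos]
      have := hJ.card_A
      have := Fintype.card_pos (α := ι)
      omega
    exact hc.bound hG (hJ.notCycle hA) hJ.card_lt
  · rw [not_nonempty_iff] at hk
    have : x = y := Subsingleton.elim _ _
    subst this
    exact Reach.refl _ hx _

end OneClass

end GCMP

namespace GCMP

set_option linter.unusedSectionVars false

variable {V ι : Type*} [Fintype ι] [DecidableEq V] [DecidableEq ι] {G : SimpleGraph V}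

/-- The motion `p` on the time interval `[0, T]` has minimum total length among all motions
between its end configurations. -/
structure Opt (G : SimpleGraph V) (p : ℕ → ι → V) (T : ℕ) : Prop where
  inj : ∀ t ≤ T, Function.Injective (p t)
  step : ∀ t < T, Step G (p t) (p (t + 1))
  min : ∀ c, Reach G (p 0) (p T) c → ∑ t ∈ Finset.range T, stepCost (p t) (p (t + 1)) ≤ c

section Static

variable {D : Set V} {x x' y y' : ι → V} {c : ℕ}

/-- A motion inside `D` does not depend on the positions of the robots outside. -/
theorem Reach.static (h : Reach (inside G D) x x' c) (hy : Function.Injective y)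
    (h1 : ∀ i, x i ∈ D → y i = x i ∧ y' i = x' i) (h2 : ∀ i, x i ∉ D → y i ∉ D ∧ y' i = y i) :
    Reach (inside G D) y y' c := by
  classical
  have hyA : ∀ i, y i ∈ D ↔ i ∈ {i | x i ∈ D} := by
    intro i
    by_cases hi : x i ∈ D
    · simp [(h1 i hi).1, hi]
    · simp [(h2 i hi).1, hi]
  have hy' : ∀ i ∈ {i | x i ∈ D}, y' i ∈ D := by
    intro i hi
    rw [(h1 i hi).2]; exact (h.inside_mem i).2 hi
  refine reach_inside_of_induce hy hyA hy' (fun i hi => (h2 i hi).2) ?_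
  have := h.confine (A := {i | x i ∈ D}) (fun i hi => hi) (fun i hi => (h.inside_mem i).2 hi)
  convert this using 1
  · funext i; exact Subtype.ext (h1 i i.2).1
  · funext i; exact Subtype.ext (h1 i i.2).2

end Static

/-- Any two placements inside `H` of the same set of at most `N` robots are reachable from each
other at cost `P`. -/
def Univ (G : SimpleGraph V) (ι : Type*) [Fintype ι] (H : Set V) (N P : ℕ) : Prop :=
  ∀ x y : ι → V, Function.Injective x → Function.Injective y → (∀ i, x i ∈ H ↔ y i ∈ H) →
    (∀ i, x i ∉ H → y i = x i) → {i | x i ∈ H}.ncard ≤ N → Reach (inside G H) x y P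

/-- Any two placements inside `D` that are reachable from each other are so at cost `P`. -/
def Cheap (G : SimpleGraph V) (ι : Type*) [Fintype ι] (D : Set V) (P : ℕ) : Prop :=
  ∀ (x y : ι → V) (c : ℕ), Reach (inside G D) x y c → Reach (inside G D) x y P

section Reroute

variable {p : ℕ → ι → V} {T : ℕ} {H D : Set V} {w : ℕ → ι → Prop} {P : ℕ}

/-- The positions in the rerouted motion just before a step at which some flag changes. -/
theorem exists_parking (hp : ∀ t ≤ T, Function.Injective (p t))
    (hcard : 3 * Fintype.card ι ≤ H.ncard ∨ ∀ t i, ¬ w t i) {t : ℕ} (ht : t < T) :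
    ∃ f : ι → V, Function.Injective f ∧ ∀ i, w t i → f i ∈ H ∧
      (∀ j, p t j ≠ f i) ∧ ∀ j, p (t + 1) j ≠ f i := by
  rcases hcard with hcard | hno
  · by_cases hfin : H.Finite
    · set S : Finset V := hfin.toFinset \ (Finset.univ.image (p t) ∪ Finset.univ.image (p (t + 1)))
        with hS
      have h1 : Fintype.card ι ≤ S.card := by
        have h2 := Finset.le_card_sdiff (Finset.univ.image (p t) ∪ Finset.univ.image (p (t + 1)))
          hfin.toFinset
        have h3 : (Finset.univ.image (p t) ∪ Finset.univ.image (p (t + 1))).card ≤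
            2 * Fintype.card ι := by
          refine (Finset.card_union_le _ _).trans ?_
          have h4 := Finset.card_image_le (s := (Finset.univ : Finset ι)) (f := p t)
          have h5 := Finset.card_image_le (s := (Finset.univ : Finset ι)) (f := p (t + 1))
          rw [Finset.card_univ] at h4 h5
          omega
        rw [Set.ncard_eq_toFinset_card H hfin] at hcard
        rw [hS]
        omega
      obtain ⟨e⟩ := Function.Embedding.nonempty_of_card_le (α := ι) (β := S) (by simpa using h1)
      refine ⟨fun i => e i, fun i j hij => e.injective (Subtype.ext hij), fun i _ => ?_⟩
      have h6 : (e i : V) ∈ hfin.toFinset \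
        (Finset.univ.image (p t) ∪ Finset.univ.image (p (t + 1))) := (e i).2
      rw [Finset.mem_sdiff, Finset.mem_union, not_or] at h6
      refine ⟨by simpa using h6.1, fun j hj => h6.2.1 ?_, fun j hj => h6.2.2 ?_⟩
      · exact Finset.mem_image.2 ⟨j, Finset.mem_univ _, hj⟩
      · exact Finset.mem_image.2 ⟨j, Finset.mem_univ _, hj⟩
    · have : H.ncard = 0 := Set.Infinite.ncard hfin
      have h0 : Fintype.card ι = 0 := by omega
      have := Fintype.card_eq_zero_iff.1 h0
      exact ⟨p t, hp t ht.le, fun i => isEmptyElim i⟩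
  · exact ⟨p t, hp t ht.le, fun i hi => absurd hi (hno t i)⟩

/-- The moves of a robot in one of the sets `H` (in its time window) and `D` are rare apart from
the times at which some robot changes its status. -/
theorem Opt.reroute (hopt : Opt G p T) (hHD : Disjoint H D)
    (hH : Univ G ι H (Fintype.card ι) P) (hD : Cheap G ι D P)
    (hcard : 3 * Fintype.card ι ≤ H.ncard ∨ ∀ t i, ¬ w t i)
    (hout : ∀ t ≤ T, ∀ i, ¬ w t i → p t i ∉ H)
    (henter : ∀ t < T, ∀ i, ¬ w t i → w (t + 1) i → p (t + 1) i ∈ H)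
    (hleave : ∀ t < T, ∀ i, w t i → ¬ w (t + 1) i → p t i ∈ H)
    (h0 : ∀ i, w 0 i → p 0 i ∈ H) (hT : ∀ i, w T i → p T i ∈ H) (Ev : Finset ℕ)
    (hEv : ∀ t < T, t ∉ Ev → ∀ i, (w t i ↔ w (t + 1) i) ∧
      ((p t i ∈ D ∧ ¬ w t i) ↔ (p (t + 1) i ∈ D ∧ ¬ w (t + 1) i))) :
    {q : ι × ℕ | q.2 < T ∧ q.2 ∉ Ev ∧ (w q.2 q.1 ∨ p q.2 q.1 ∈ D) ∧
      p q.2 q.1 ≠ p (q.2 + 1) q.1}.ncard ≤ Ev.card * (Fintype.card ι + 2 * P) + 2 * P := by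
  classical
  have hdis : ∀ a, a ∈ H → a ∈ D → False := fun a h1 h2 => Set.disjoint_left.1 hHD h1 h2
  set act : ℕ → Finset ι := fun t => Finset.univ.filter fun i =>
    (w t i ∨ p t i ∈ D) ∧ p t i ≠ p (t + 1) i with hact
  set inact : ℕ → Finset ι := fun t => Finset.univ.filter fun i =>
    ¬ (w t i ∨ p t i ∈ D) ∧ p t i ≠ p (t + 1) i with hinact
  have hsplit : ∀ t, stepCost (p t) (p (t + 1)) = (act t).card + (inact t).card := by
    intro t
    unfold stepCost
    rw [hact, hinact]
    simp only
    rw [← Finset.card_filter_add_card_filter_not (s := Finset.univ.filter fun i =>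
      p t i ≠ p (t + 1) i) (fun i => w t i ∨ p t i ∈ D), Finset.filter_filter,
      Finset.filter_filter]
    congr 2 <;> ext i <;> simp [and_comm]
  -- the rearrangement before a status change
  have rearr : ∀ t ≤ T, ∀ y : ι → V, Function.Injective y →
      (∀ i, ¬ w t i → p t i ∉ D → y i = p t i) → (∀ i, w t i → y i ∈ H) →
      (∀ i, ¬ w t i → p t i ∈ D → y i ∈ D) →
      (∃ c, Reach (inside G D) y (fun i => if p t i ∈ D ∧ ¬ w t i then p t i else y i) c) →
      ∀ z : ι → V, Function.Injective z → (∀ i, ¬ w t i → z i = p t i) → (∀ i, w t i → z i ∈ H) →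
      Reach G y z (2 * P) := by
    intro t ht y hy h1 h2 h3 ⟨c, hc⟩ z hz hz1 hz2
    have R1 := hD _ _ _ hc
    set y' := fun i => if p t i ∈ D ∧ ¬ w t i then p t i else y i with hy'
    have hyw : ∀ i, w t i → y' i = y i := fun i hi => by simp [hy', hi]
    have hynw : ∀ i, ¬ w t i → y' i = p t i := fun i hi => by
      by_cases hd : p t i ∈ D
      · simp [hy', hd, hi]
      · simp [hy', hd, h1 i hi hd]
    have R2 : Reach (inside G H) y' z P := by
      refine hH y' z R1.inj' hz ?_ ?_ ?_
      · intro i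
        by_cases hi : w t i
        · simp [hyw i hi, h2 i hi, hz2 i hi]
        · rw [hynw i hi, hz1 i hi]
      · intro i hi
        have hw : ¬ w t i := fun hw => hi (by rw [hyw i hw]; exact h2 i hw)
        rw [hynw i hw, hz1 i hw]
      · rw [← Nat.card_eq_fintype_card (α := ι)]
        exact Set.ncard_le_card _
    exact ((R1.mono_graph (inside_le _ _)).trans (R2.mono_graph (inside_le _ _))).mono (by omega)
  have main : ∀ t ≤ T, ∃ y : ι → V, Reach G (p 0) y (∑ s ∈ Finset.range t,
      if s ∈ Ev then Fintype.card ι + 2 * P else (inact s).card) ∧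
      (∀ i, ¬ w t i → p t i ∉ D → y i = p t i) ∧ (∀ i, w t i → y i ∈ H) ∧
      (∀ i, ¬ w t i → p t i ∈ D → y i ∈ D) ∧
      (∃ c, Reach (inside G D) y (fun i => if p t i ∈ D ∧ ¬ w t i then p t i else y i) c) := by
    intro t
    induction t with
    | zero =>
      intro _
      have hinj := hopt.inj 0 (Nat.zero_le _)
      refine ⟨p 0, Reach.refl _ hinj _, fun _ _ _ => rfl, h0, fun _ _ h => h, 0, ?_⟩
      have e : (fun i => if p 0 i ∈ D ∧ ¬ w 0 i then p 0 i else p 0 i) = p 0 := by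
        funext i; simp
      rw [e]
      exact Reach.refl _ hinj _
    | succ t ih =>
      intro ht
      obtain ⟨y, hR, h1, h2, h3, c, hc⟩ := ih (by omega)
      have hst := hopt.step t (by omega)
      have hpt := hopt.inj t (by omega)
      have hpt1 := hopt.inj (t + 1) ht
      rw [Finset.sum_range_succ]
      by_cases hE : t ∈ Ev
      · rw [if_pos hE]
        obtain ⟨f, hf, hfw⟩ := exists_parking (w := w) hopt.inj hcard (show t < T by omega)
        -- the staying robots are parked
        have mk : ∀ s, s = t ∨ s = t + 1 → Function.Injective
            (fun i => if w t i ∧ w (t + 1) i then f i else p s i) := by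
          intro s hs i j hij
          have hne : ∀ i j, w t i → p s j ≠ f i := by
            intro i j hi
            rcases hs with rfl | rfl
            · exact (hfw i hi).2.1 j
            · exact (hfw i hi).2.2 j
          by_cases hi : w t i ∧ w (t + 1) i <;> by_cases hj : w t j ∧ w (t + 1) j
          · simp only [hi, hj, and_self, if_true] at hij; exact hf hij
          · simp only [hi, hj, and_self, if_true, if_false] at hij
            exact absurd hij.symm (hne i j hi.1)
          · simp only [hi, hj, and_self, if_true, if_false] at hij
            exact absurd hij (hne j i hj.1)
          · simp only [hi, hj, if_false] at hij
            rcases hs with rfl | rfl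
            · exact hpt hij
            · exact hpt1 hij
        set z := fun i => if w t i ∧ w (t + 1) i then f i else p t i with hz
        set z' := fun i => if w t i ∧ w (t + 1) i then f i else p (t + 1) i with hz'
        have R2 : Reach G y z (2 * P) := by
          refine rearr t (by omega) y hR.inj' h1 h2 h3 ⟨c, hc⟩ z (mk t (Or.inl rfl)) ?_ ?_
          · intro i hi; simp [hz, hi]
          · intro i hi
            by_cases hi' : w (t + 1) i
            · simp only [hz, hi, hi', and_self, if_true]; exact (hfw i hi).1
            · simp only [hz, hi', and_false, if_false]; exact hleave t (by omega) i hi hi'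
        have S3 : Step G z z' := by
          refine ⟨mk t (Or.inl rfl), mk _ (Or.inr rfl), ?_, ?_⟩
          · intro i
            by_cases hi : w t i ∧ w (t + 1) i
            · left; simp [hz, hz', hi]
            · simp only [hz, hz', hi, if_false]; exact hst.adj i
          · rintro i j hij ⟨e1, e2⟩
            by_cases hi : w t i ∧ w (t + 1) i <;> by_cases hj : w t j ∧ w (t + 1) j
            · simp only [hz, hz', hi, hj, and_self, if_true] at e1; exact hij (hf e1)
            · simp only [hz, hz', hi, hj, and_self, if_true, if_false] at e1
              exact (hfw i hi.1).2.1 j e1.symm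
            · simp only [hz, hz', hi, hj, and_self, if_true, if_false] at e2
              exact (hfw j hj.1).2.1 i e2.symm
            · simp only [hz, hz', hi, hj, if_false] at e1 e2
              exact hst.noswap i j hij ⟨e1, e2⟩
        refine ⟨z', ((hR.trans R2).trans (Reach.single S3)).mono ?_, ?_, ?_, ?_, 0, ?_⟩
        · have := stepCost_le z z'
          omega
        · intro i hi _; simp [hz', hi]
        · intro i hi
          by_cases hi' : w t i
          · simp only [hz', hi, hi', and_self, if_true]; exact (hfw i hi').1
          · simp only [hz', hi', false_and, if_false]; exact henter t (by omega) i hi' hi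
        · intro i hi hd; simp only [hz', hi, and_false, if_false]; exact hd
        · have e : (fun i => if p (t + 1) i ∈ D ∧ ¬ w (t + 1) i then p (t + 1) i else z' i) = z' := by
            funext i
            by_cases hi : p (t + 1) i ∈ D ∧ ¬ w (t + 1) i
            · simp [hz', hi]
            · simp [hi]
          rw [e]; exact Reach.refl _ S3.inj' _
      · rw [if_neg hE]
        have hfl := hEv t (by omega) hE
        have hact_iff : ∀ i, (w t i ∨ p t i ∈ D) ↔ (w (t + 1) i ∨ p (t + 1) i ∈ D) := by
          intro i; have := hfl i; tauto
        set y' := fun i => if w t i ∨ p t i ∈ D then y i else p (t + 1) i with hy'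
        have hya : ∀ i, (w t i ∨ p t i ∈ D) → y' i = y i := fun i hi => by simp only [hy', hi, if_true]
        have hyi : ∀ i, ¬ (w t i ∨ p t i ∈ D) → y' i = p (t + 1) i := fun i hi => by
          simp only [hy', hi, if_false]
        have hin : ∀ i, (w t i ∨ p t i ∈ D) → y i ∈ H ∨ y i ∈ D := by
          intro i hi
          by_cases hw : w t i
          · exact Or.inl (h2 i hw)
          · exact Or.inr (h3 i hw (hi.resolve_left hw))
        have hnot : ∀ i, ¬ (w t i ∨ p t i ∈ D) → p t i ∉ H ∧ p t i ∉ D ∧ p (t + 1) i ∉ H ∧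
            p (t + 1) i ∉ D := by
          intro i hi
          have h4 := (hact_iff i).not.1 hi
          push Not at hi h4
          exact ⟨hout t (by omega) i hi.1, hi.2, hout _ ht i h4.1, h4.2⟩
        have hinj' : Function.Injective y' := by
          intro i j hij
          by_cases hi : w t i ∨ p t i ∈ D <;> by_cases hj : w t j ∨ p t j ∈ D
          · rw [hya i hi, hya j hj] at hij; exact hR.inj' hij
          · rw [hya i hi, hyi j hj] at hij
            rcases hin i hi with h | h <;> rw [hij] at h
            · exact absurd h (hnot j hj).2.2.1
            · exact absurd h (hnot j hj).2.2.2
          · rw [hyi i hi, hya j hj] at hij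
            rcases hin j hj with h | h <;> rw [← hij] at h
            · exact absurd h (hnot i hi).2.2.1
            · exact absurd h (hnot i hi).2.2.2
          · rw [hyi i hi, hyi j hj] at hij; exact hpt1 hij
        have hyt : ∀ i, ¬ (w t i ∨ p t i ∈ D) → y i = p t i := by
          intro i hi
          push Not at hi
          exact h1 i hi.1 hi.2
        have S : Step G y y' := by
          refine ⟨hR.inj', hinj', ?_, ?_⟩
          · intro i
            by_cases hi : w t i ∨ p t i ∈ D
            · exact Or.inl (hya i hi)
            · rw [hyi i hi, hyt i hi]; exact hst.adj i
          · rintro i j hij ⟨e1, e2⟩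
            by_cases hi : w t i ∨ p t i ∈ D
            · rw [hya i hi] at e1; exact hij (hR.inj' e1)
            · by_cases hj : w t j ∨ p t j ∈ D
              · rw [hya j hj] at e2; exact hij (hR.inj' e2).symm
              · rw [hyi i hi, hyt j hj] at e1
                rw [hyi j hj, hyt i hi] at e2
                exact hst.noswap i j hij ⟨e1, e2⟩
        have hcost : stepCost y y' ≤ (inact t).card := by
          apply Finset.card_le_card
          intro i hi
          simp only [Finset.mem_filter, Finset.mem_univ, true_and, hinact] at hi ⊢
          by_cases ha : w t i ∨ p t i ∈ D
          · exact absurd (hya i ha).symm hi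
          · rw [hyi i ha, hyt i ha] at hi
            exact ⟨ha, hi⟩
        refine ⟨y', (hR.trans (Reach.single S)).mono (by omega), ?_, ?_, ?_, ?_⟩
        · intro i hi hd
          exact hyi i fun h => ((hact_iff i).1 h).elim hi hd
        · intro i hi
          have hi' := ((hfl i).1).2 hi
          rw [hya i (Or.inl hi')]; exact h2 i hi'
        · intro i hi hd
          have hi' := ((hfl i).2).2 ⟨hd, hi⟩
          rw [hya i (Or.inr hi'.1)]; exact h3 i hi'.2 hi'.1
        · -- the robots in `D`
          have hdiff : ∀ i, y i ∈ D ↔ p t i ∈ D ∧ ¬ w t i := by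
            intro i
            constructor
            · intro hi
              by_cases hw : w t i
              · exact absurd hi (hdis _ (h2 i hw))
              · refine ⟨?_, hw⟩
                by_contra hd
                rw [h1 i hw hd] at hi; exact hd hi
            · rintro ⟨hd, hw⟩; exact h3 i hw hd
          have C1 : Reach (inside G D) y' (fun i => if p t i ∈ D ∧ ¬ w t i then p t i else y' i) c := by
            refine hc.static hinj' ?_ ?_
            · intro i hi
              have h5 := (hdiff i).1 hi
              simp only [h5, not_false_eq_true, and_self, if_true]
              exact ⟨hya i (Or.inr h5.1), trivial⟩
            · intro i hi
              have h5 := (hdiff i).not.1 hi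
              simp only [h5, if_false]
              refine ⟨?_, trivial⟩
              by_cases ha : w t i ∨ p t i ∈ D
              · rwa [hya i ha]
              · rw [hyi i ha]; exact (hnot i ha).2.2.2
          refine ⟨_, C1.trans (Reach.single ⟨C1.inj', ?_, ?_, ?_⟩)⟩
          · -- injectivity
            intro i j hij
            simp only at hij
            by_cases hi : p (t + 1) i ∈ D ∧ ¬ w (t + 1) i <;>
              by_cases hj : p (t + 1) j ∈ D ∧ ¬ w (t + 1) j
            · rw [if_pos hi, if_pos hj] at hij; exact hpt1 hij
            · rw [if_pos hi, if_neg hj] at hij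
              exfalso
              by_cases ha : w t j ∨ p t j ∈ D
              · rw [hya j ha] at hij
                exact hj (((hfl j).2).1 ((hdiff j).1 (hij ▸ hi.1)))
              · rw [hyi j ha] at hij
                exact (hnot j ha).2.2.2 (hij ▸ hi.1)
            · rw [if_neg hi, if_pos hj] at hij
              exfalso
              by_cases ha : w t i ∨ p t i ∈ D
              · rw [hya i ha] at hij
                exact hi (((hfl i).2).1 ((hdiff i).1 (hij ▸ hj.1)))
              · rw [hyi i ha] at hij
                exact (hnot i ha).2.2.2 (hij ▸ hj.1)
            · rw [if_neg hi, if_neg hj] at hij; exact hinj' hij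
          · intro i
            have h5 := (hfl i).2
            by_cases hi : p t i ∈ D ∧ ¬ w t i
            · have hi' := h5.1 hi
              rw [if_pos hi, if_pos hi']
              rcases hst.adj i with h | h
              · exact Or.inl h
              · exact Or.inr ⟨h, hi.1, hi'.1⟩
            · rw [if_neg hi, if_neg (h5.not.1 hi)]; exact Or.inl rfl
          · rintro i j hij ⟨e1, e2⟩
            simp only [← (hfl i).2, ← (hfl j).2] at e1 e2
            by_cases hi : p t i ∈ D ∧ ¬ w t i <;> by_cases hj : p t j ∈ D ∧ ¬ w t j
            · rw [if_pos hi, if_pos hj] at e1 e2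
              exact hst.noswap i j hij ⟨e1, e2⟩
            · rw [if_pos hi, if_neg hj] at e2
              rw [if_pos hi, if_neg hj] at e1
              have : p (t + 1) i ∈ D := (((hfl i).2).1 hi).1
              by_cases ha : w t j ∨ p t j ∈ D
              · rw [e1, hya j ha] at this
                exact hj ((hdiff j).1 this)
              · rw [e1, hyi j ha] at this
                exact (hnot j ha).2.2.2 this
            · rw [if_neg hi, if_pos hj] at e1 e2
              have : p (t + 1) j ∈ D := (((hfl j).2).1 hj).1
              by_cases ha : w t i ∨ p t i ∈ D
              · rw [e2, hya i ha] at this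
                exact hi ((hdiff i).1 this)
              · rw [e2, hyi i ha] at this
                exact (hnot i ha).2.2.2 this
            · rw [if_neg hi, if_neg hj] at e1
              exact hij (hinj' e1)
  obtain ⟨y, hR, h1, h2, h3, hc⟩ := main T le_rfl
  have R2 := rearr T le_rfl y hR.inj' h1 h2 h3 hc (p T) (hopt.inj T le_rfl) (fun _ _ => rfl) hT
  have hmin := hopt.min _ (hR.trans R2)
  -- compare the costs
  have hS1 : ∑ s ∈ Finset.range T, (if s ∈ Ev then Fintype.card ι + 2 * P else (inact s).card) ≤
      Ev.card * (Fintype.card ι + 2 * P) +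
        ∑ s ∈ (Finset.range T).filter (· ∉ Ev), (inact s).card := by
    rw [Finset.sum_ite, Finset.sum_const, smul_eq_mul]
    refine Nat.add_le_add_right (Nat.mul_le_mul_right _ (Finset.card_le_card ?_)) _
    intro s hs; exact (Finset.mem_filter.1 hs).2
  have hS2 : ∑ s ∈ (Finset.range T).filter (· ∉ Ev), stepCost (p s) (p (s + 1)) ≤
      ∑ s ∈ Finset.range T, stepCost (p s) (p (s + 1)) :=
    Finset.sum_le_sum_of_subset (Finset.filter_subset _ _)
  simp only [hsplit, Finset.sum_add_distrib] at hS2 hmin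
  have hS3 : {q : ι × ℕ | q.2 < T ∧ q.2 ∉ Ev ∧ (w q.2 q.1 ∨ p q.2 q.1 ∈ D) ∧
      p q.2 q.1 ≠ p (q.2 + 1) q.1}.ncard =
      ∑ s ∈ (Finset.range T).filter (· ∉ Ev), (act s).card := by
    have e : {q : ι × ℕ | q.2 < T ∧ q.2 ∉ Ev ∧ (w q.2 q.1 ∨ p q.2 q.1 ∈ D) ∧
      p q.2 q.1 ≠ p (q.2 + 1) q.1} =
        ↑(((Finset.range T).filter (· ∉ Ev)).biUnion fun s => (act s).image fun i => (i, s)) := by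
      ext ⟨i, s⟩
      simp only [hact, Set.mem_ofPred_eq, Finset.coe_biUnion, Finset.coe_filter, Finset.mem_range,
        Set.mem_iUnion, Finset.coe_image, Finset.mem_univ, true_and, Set.mem_image, Prod.mk.injEq]
      constructor
      · rintro ⟨a, b, c, d⟩
        exact ⟨s, ⟨a, b⟩, i, ⟨c, d⟩, rfl, rfl⟩
      · rintro ⟨s', ⟨a, b⟩, i', ⟨c, d⟩, rfl, rfl⟩
        exact ⟨a, b, c, d⟩
    rw [e, Set.ncard_coe_finset, Finset.card_biUnion]
    · refine Finset.sum_congr rfl fun s _ => Finset.card_image_of_injective _ fun a b h => ?_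
      exact (Prod.mk.inj h).1
    · intro s _ s' _ hss'
      rw [Function.onFun, Finset.disjoint_left]
      rintro ⟨i, a⟩ ha hb
      simp only [Finset.mem_image, Prod.mk.injEq] at ha hb
      obtain ⟨_, _, _, rfl⟩ := ha
      obtain ⟨_, _, _, rfl⟩ := hb
      exact hss' rfl
  rw [hS3]
  omega

end Reroute

section Local

variable {W : Set V}

theorem Joined.induce {S : Set V} {a b : V} (h : Joined G S a b) (hS : S ⊆ W) :
    Joined (G.induce W) (Subtype.val ⁻¹' S) ⟨a, hS h.left_mem⟩ ⟨b, hS h.right_mem⟩ := by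
  obtain ⟨w, hw⟩ := h
  induction w with
  | nil => exact Joined.refl (hw _ (by simp))
  | @cons a a1 b hadj w ih =>
    have ha := hw a (by simp)
    have ha1 := hw a1 (by simp)
    have h1 : Joined (G.induce W) (Subtype.val ⁻¹' S) ⟨a, hS ha⟩ ⟨a1, hS ha1⟩ :=
      Joined.of_adj (G := G.induce W) ha ha1 hadj
    exact h1.trans (ih fun c hc => hw c (by simp [hc]))

theorem connected_induce (hW : ∀ a ∈ W, ∀ b ∈ W, Joined G W a b) (hne : W.Nonempty) :
    (G.induce W).Connected := by
  have : Nonempty W := hne.to_subtype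
  refine ⟨fun a b => ?_⟩
  obtain ⟨w, -⟩ := (hW a a.2 b b.2).induce subset_rfl
  exact ⟨w⟩

theorem cheap_of_connected [Fintype V] (hW : ∀ a ∈ W, ∀ b ∈ W, Joined G W a b)
    (hnc : NotCycle (G.induce W)) (hcard : Fintype.card ι < W.ncard) :
    Cheap G ι W (36 * W.ncard ^ 4) := by
  classical
  intro x y c h
  have hne : W.Nonempty := Set.nonempty_of_ncard_ne_zero (by omega)
  have hx : ∀ i ∈ {i | x i ∈ W}, x i ∈ W := fun i hi => hi
  have hy : ∀ i ∈ {i | x i ∈ W}, y i ∈ W := fun i hi => (h.inside_mem i).2 hi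
  have h1 := h.confine hx hy
  have e : Fintype.card W = W.ncard := by
    rw [← Nat.card_eq_fintype_card, Nat.card_coe_set_eq]
  have h2 : Fintype.card {i | x i ∈ W} ≤ Fintype.card ι := Fintype.card_subtype_le _
  have h3 := h1.bound (connected_induce hW hne) hnc (by omega)
  rw [e] at h3
  exact reach_inside_of_induce h.inj (fun i => Iff.rfl) hy (fun i hi => h.inside_eq hi) h3

theorem Rot.induce {ρ : Equiv.Perm V} (h : Rot G ρ) (hW : ∀ u, ρ u ≠ u → u ∈ W) :
    ∃ ρ' : Equiv.Perm W, Rot (G.induce W) ρ' ∧ ∀ u, (ρ' u : V) = ρ u := by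
  have hinv : ∀ u, ρ u ∈ W ↔ u ∈ W := by
    intro u
    by_cases hu : ρ u = u
    · rw [hu]
    · exact ⟨fun _ => hW u hu, fun _ => hW _ (by simpa using hu)⟩
  refine ⟨ρ.subtypePerm hinv, ⟨?_, ?_, ?_⟩, fun u => rfl⟩
  · obtain ⟨a, ha, hcyc⟩ := h.isCycle
    refine ⟨⟨a, hW a ha⟩, fun e => ha (congrArg Subtype.val e), fun b hb => ?_⟩
    rw [Equiv.Perm.sameCycle_subtypePerm]
    exact hcyc fun e => hb (Subtype.ext e)
  · intro u hu
    exact h.adj u fun e => hu (Subtype.ext e)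
  · intro u hu e
    exact h.two u (fun e => hu (Subtype.ext e)) (congrArg Subtype.val e)

theorem Junction.mono {k k' : ℕ} {w : V} {A B : Finset V} (h : Junction G k w A B) (hk : k' ≤ k) :
    Junction G k' w A B where
  notMem_A := h.notMem_A
  notMem_B := h.notMem_B
  disj := h.disj
  joined_A := h.joined_A
  joined_B := h.joined_B
  card_A := hk.trans h.card_A
  fork := by
    rcases h.fork with ⟨y2, y3, h1, h2, h3, h4, h5, h6⟩ | ⟨ρ, h1, h2, h3, h4⟩
    · exact Or.inl ⟨y2, y3, h1, h2, h3, h4, h5, hk.trans h6⟩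
    · exact Or.inr ⟨ρ, h1, h2, h3, hk.trans h4⟩

theorem Junction.induce {k : ℕ} {w : V} {A B : Finset V} (h : Junction G k w A B) (hw : w ∈ W)
    (hA : ↑A ⊆ W) (hB : ↑B ⊆ W) [DecidablePred (· ∈ W)] :
    Junction (G.induce W) k ⟨w, hw⟩ (A.subtype (· ∈ W)) (B.subtype (· ∈ W)) where
  notMem_A := by simpa using h.notMem_A
  notMem_B := by simpa using h.notMem_B
  disj := by
    rw [Finset.disjoint_left]
    intro a ha hb
    rw [Finset.mem_subtype] at ha hb
    exact Finset.disjoint_left.1 h.disj ha hb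
  joined_A a ha := by
    rw [Finset.mem_subtype] at ha
    refine ((h.joined_A a ha).induce (Set.insert_subset hw hA)).mono ?_
    rintro u (hu | hu)
    · exact Or.inl (Subtype.ext hu)
    · exact Or.inr (by simpa using hu)
  joined_B a ha := by
    rw [Finset.mem_subtype] at ha
    refine ((h.joined_B a ha).induce (Set.insert_subset hw hB)).mono ?_
    rintro u (hu | hu)
    · exact Or.inl (Subtype.ext hu)
    · exact Or.inr (by simpa using hu)
  card_A := by
    rw [Finset.card_subtype, Finset.filter_true_of_mem fun a ha => hA ha]
    exact h.card_A
  fork := by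
    have e : (B.subtype (· ∈ W)).card = B.card := by
      rw [Finset.card_subtype, Finset.filter_true_of_mem fun a ha => hB ha]
    rcases h.fork with ⟨y2, y3, h1, h2, h3, h4, h5, h6⟩ | ⟨ρ, h1, h2, h3, h4⟩
    · refine Or.inl ⟨⟨y2, hB h2⟩, ⟨y3, hB h3⟩, fun e => h1 (congrArg Subtype.val e), ?_, ?_, h4, h5,
        by rwa [e]⟩
      · rwa [Finset.mem_subtype]
      · rwa [Finset.mem_subtype]
    · obtain ⟨ρ', hρ', hval⟩ := h1.induce (W := W) (fun u hu => by
        have := h2 u hu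
        rw [Finset.mem_insert] at this
        rcases this with rfl | h
        · exact hw
        · exact hB h)
      refine Or.inr ⟨ρ', hρ', ?_, ?_, by rwa [e]⟩
      · intro u hu
        have := h2 u fun e => hu (Subtype.ext ((hval u).trans e))
        rw [Finset.mem_insert] at this ⊢
        rcases this with h | h
        · exact Or.inl (Subtype.ext h)
        · exact Or.inr (by rwa [Finset.mem_subtype])
      · intro e
        exact h3 ((hval _).symm.trans (congrArg Subtype.val e))

theorem Junction.univ [Fintype V] {N : ℕ} {w : V} {A B : Finset V} (h : Junction G N w A B)
    (hw : w ∈ W) (hA : ↑A ⊆ W) (hB : ↑B ⊆ W) (hW : ∀ a ∈ W, ∀ b ∈ W, Joined G W a b) :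
    Univ G ι W N (36 * W.ncard ^ 4) := by
  classical
  intro x y hx hy hxy hoff hN
  have hxW : ∀ i ∈ {i | x i ∈ W}, x i ∈ W := fun i hi => hi
  have hyW : ∀ i ∈ {i | x i ∈ W}, y i ∈ W := fun i hi => (hxy i).1 hi
  have e : Fintype.card W = W.ncard := by
    rw [← Nat.card_eq_fintype_card, Nat.card_coe_set_eq]
  have e' : Fintype.card {i | x i ∈ W} = {i | x i ∈ W}.ncard := by
    rw [← Nat.card_eq_fintype_card, Nat.card_coe_set_eq]
  have hJ : Junction (G.induce W) (Fintype.card {i | x i ∈ W}) ⟨w, hw⟩ (A.subtype (· ∈ W))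
      (B.subtype (· ∈ W)) := (h.induce hw hA hB).mono (by omega)
  have h1 := hJ.reach (connected_induce hW ⟨w, hw⟩) (confine_injective hx hxW)
    (confine_injective hy hyW)
  rw [e] at h1
  exact reach_inside_of_induce hx (fun i => Iff.rfl) hyW (fun i hi => hoff i hi) h1

end Local

end GCMP

namespace GCMP

set_option linter.unusedSectionVars false

variable {V ι : Type*} [Fintype ι] [DecidableEq V] [DecidableEq ι] {G : SimpleGraph V}
  {p : ℕ → ι → V} {T : ℕ}

theorem reach_of_steps (hinj : Function.Injective (p 0)) (h : ∀ t < T, Step G (p t) (p (t + 1))) :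
    Reach G (p 0) (p T) (∑ t ∈ Finset.range T, stepCost (p t) (p (t + 1))) := by
  induction T with
  | zero => exact Reach.refl _ hinj _
  | succ T ih =>
    rw [Finset.sum_range_succ]
    exact (ih fun t ht => h t (by omega)).trans (Reach.single (h T (by omega)))

/-- In an optimal motion a robot returns to a vertex only if another one was there meanwhile. -/
theorem Opt.exists_other (hopt : Opt G p T) {i : ι} {u : V} {s t : ℕ} (hst : s + 1 ≤ t)
    (htT : t + 1 ≤ T) (hs : p s i = u) (hs1 : p (s + 1) i ≠ u) (ht : p (t + 1) i = u) :
    ∃ l, l ≠ i ∧ ∃ τ, s + 1 ≤ τ ∧ τ ≤ t ∧ p τ l = u := by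
  by_contra hcon
  push Not at hcon
  set p' : ℕ → ι → V := fun τ j => if j = i ∧ s ≤ τ ∧ τ ≤ t + 1 then u else p τ j with hp'
  have ho : ∀ τ j, j ≠ i → p' τ j = p τ j := fun τ j hj => by simp [hp', hj]
  have hin : ∀ τ, s ≤ τ → τ ≤ t + 1 → p' τ i = u := fun τ h1 h2 => by simp [hp', h1, h2]
  have hout : ∀ τ, ¬ (s ≤ τ ∧ τ ≤ t + 1) → p' τ i = p τ i := fun τ h => by
    simp only [hp', true_and, h, if_false]
  have hends : p' s = p s ∧ p' (t + 1) = p (t + 1) := by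
    constructor <;> funext j <;> by_cases hj : j = i
    · subst hj; rw [hin s le_rfl (by omega), hs]
    · exact ho _ _ hj
    · subst hj; rw [hin _ (by omega) le_rfl, ht]
    · exact ho _ _ hj
  have hfree : ∀ τ, s ≤ τ → τ ≤ t + 1 → ∀ j, j ≠ i → p τ j ≠ u := by
    intro τ h1 h2 j hj hu
    rcases Nat.lt_or_ge s τ with h3 | h3
    · rcases Nat.lt_or_ge τ (t + 1) with h4 | h4
      · exact hcon j hj τ h3 (by omega) hu
      · have e : τ = t + 1 := by omega
        subst e
        exact hj (hopt.inj _ htT (hu.trans ht.symm))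
    · have e : τ = s := by omega
      subst e
      exact hj (hopt.inj _ (by omega) (hu.trans hs.symm))
  have hinj' : ∀ τ ≤ T, Function.Injective (p' τ) := by
    intro τ hτ a b hab
    by_cases hr : s ≤ τ ∧ τ ≤ t + 1
    · by_cases ha : a = i <;> by_cases hb : b = i
      · rw [ha, hb]
      · subst ha; rw [hin τ hr.1 hr.2, ho τ b hb] at hab
        exact absurd hab.symm (hfree τ hr.1 hr.2 b hb)
      · subst hb; rw [hin τ hr.1 hr.2, ho τ a ha] at hab
        exact absurd hab (hfree τ hr.1 hr.2 a ha)
      · rw [ho τ a ha, ho τ b hb] at hab; exact hopt.inj τ hτ hab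
    · have e : ∀ a, p' τ a = p τ a := by
        intro a
        by_cases ha : a = i
        · subst ha; exact hout τ hr
        · exact ho τ a ha
      rw [e, e] at hab; exact hopt.inj τ hτ hab
  have hcase : ∀ τ, (s ≤ τ ∧ τ ≤ t) ∨ (p' τ = p τ ∧ p' (τ + 1) = p (τ + 1)) := by
    intro τ
    by_cases h : s ≤ τ ∧ τ ≤ t
    · exact Or.inl h
    · right
      have h1 : ∀ σ, ¬ (s < σ ∧ σ < t + 1) → p' σ = p σ := by
        intro σ hσ
        by_cases e1 : σ = s
        · rw [e1]; exact hends.1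
        · by_cases e2 : σ = t + 1
          · rw [e2]; exact hends.2
          · funext j
            by_cases hj : j = i
            · subst hj; exact hout σ (by omega)
            · exact ho σ j hj
      exact ⟨h1 τ (by omega), h1 (τ + 1) (by omega)⟩
  have hstep : ∀ τ < T, Step G (p' τ) (p' (τ + 1)) := by
    intro τ hτ
    rcases hcase τ with h | ⟨h1, h2⟩
    · have hst := hopt.step τ hτ
      refine ⟨hinj' τ hτ.le, hinj' _ hτ, ?_, ?_⟩
      · intro j
        by_cases hj : j = i
        · subst hj; left; rw [hin τ h.1 (by omega), hin (τ + 1) (by omega) (by omega)]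
        · rw [ho _ _ hj, ho _ _ hj]; exact hst.adj j
      · rintro a b hab ⟨e1, e2⟩
        by_cases ha : a = i
        · subst ha
          rw [hin (τ + 1) (by omega) (by omega), ho _ _ hab.symm] at e1
          exact hfree τ h.1 (by omega) b hab.symm e1.symm
        · by_cases hb : b = i
          · subst hb
            rw [hin (τ + 1) (by omega) (by omega), ho _ _ ha] at e2
            exact hfree τ h.1 (by omega) a ha e2.symm
          · rw [ho _ _ ha, ho _ _ hb] at e1 e2
            exact hst.noswap a b hab ⟨e1, e2⟩
    · rw [h1, h2]; exact hopt.step τ hτ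
  have hsub : ∀ τ, (Finset.univ.filter fun j => p' τ j ≠ p' (τ + 1) j) ⊆
      Finset.univ.filter fun j => p τ j ≠ p (τ + 1) j := by
    intro τ j hj
    simp only [Finset.mem_filter, Finset.mem_univ, true_and] at hj ⊢
    rcases hcase τ with h | ⟨h1, h2⟩
    · by_cases hji : j = i
      · subst hji
        rw [hin τ h.1 (by omega), hin (τ + 1) (by omega) (by omega)] at hj
        exact absurd rfl hj
      · rwa [ho _ _ hji, ho _ _ hji] at hj
    · rwa [h1, h2] at hj
  have hR := reach_of_steps (hinj' 0 (Nat.zero_le _)) hstep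
  have h0 : p' 0 = p 0 := by
    by_cases h : s = 0
    · subst h; exact hends.1
    · funext j
      by_cases hj : j = i
      · subst hj; exact hout 0 (by omega)
      · exact ho _ _ hj
  have hTT : p' T = p T := by
    by_cases h : T = t + 1
    · subst h; exact hends.2
    · funext j
      by_cases hj : j = i
      · subst hj; exact hout T (by omega)
      · exact ho _ _ hj
  rw [h0, hTT] at hR
  have h1 := hopt.min _ hR
  refine absurd h1 (not_le.2 ?_)
  refine Finset.sum_lt_sum (fun τ _ => Finset.card_le_card (hsub τ))
    ⟨s, Finset.mem_range.2 (by omega), Finset.card_lt_card ?_⟩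
  rw [Finset.ssubset_iff_of_subset (hsub s)]
  refine ⟨i, ?_, ?_⟩
  · simp only [Finset.mem_filter, Finset.mem_univ, true_and]
    rw [hs]; exact hs1.symm
  · simp only [Finset.mem_filter, Finset.mem_univ, true_and, not_not]
    rw [hin s le_rfl (by omega), hin (s + 1) (by omega) (by omega)]

/-- A path `q 1, …, q M` whose inner vertices have no other neighbours. -/
structure Corridor (G : SimpleGraph V) (q : ℕ → V) (M : ℕ) : Prop where
  three : 3 ≤ M
  inj : ∀ a b, 1 ≤ a → a ≤ M → 1 ≤ b → b ≤ M → q a = q b → a = b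
  adj : ∀ a, 1 ≤ a → a < M → G.Adj (q a) (q (a + 1))
  inner : ∀ a, 1 < a → a < M → ∀ u, G.Adj (q a) u → u = q (a - 1) ∨ u = q (a + 1)
  ends : ¬ G.Adj (q 1) (q M)

variable {q : ℕ → V} {M : ℕ}

theorem Corridor.reverse (h : Corridor G q M) : Corridor G (fun a => q (M + 1 - a)) M where
  three := h.three
  inj a b h1 h2 h3 h4 e := by
    have := h.inj _ _ (by omega) (by omega) (by omega) (by omega) e
    omega
  adj a h1 h2 := by
    have := h.adj (M + 1 - (a + 1)) (by omega) (by omega)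
    rw [show M + 1 - (a + 1) + 1 = M + 1 - a by omega] at this
    exact this.symm
  inner a h1 h2 u hu := by
    have := h.inner (M + 1 - a) (by omega) (by omega) u hu
    rw [show M + 1 - a - 1 = M + 1 - (a + 1) by omega,
      show M + 1 - a + 1 = M + 1 - (a - 1) by omega] at this
    exact this.symm
  ends := by
    have := h.three
    rw [show M + 1 - 1 = M by omega, show M + 1 - M = 1 by omega]
    exact fun e => h.ends e.symm

theorem Corridor.adj_index (h : Corridor G q M) {a b : ℕ} (ha : 1 ≤ a) (ha' : a ≤ M) (hb : 1 ≤ b)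
    (hb' : b ≤ M) (hab : G.Adj (q a) (q b)) : a + 1 = b ∨ b + 1 = a := by
  have h3 := h.three
  by_cases h1 : 1 < a ∧ a < M
  · rcases h.inner a h1.1 h1.2 _ hab with e | e
    · have := h.inj _ _ hb hb' (by omega) (by omega) e; omega
    · have := h.inj _ _ hb hb' (by omega) (by omega) e; omega
  · by_cases h2 : 1 < b ∧ b < M
    · rcases h.inner b h2.1 h2.2 _ hab.symm with e | e
      · have := h.inj _ _ ha ha' (by omega) (by omega) e; omega
      · have := h.inj _ _ ha ha' (by omega) (by omega) e; omega
    · exfalso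
      have e1 : a = 1 ∨ a = M := by omega
      have e2 : b = 1 ∨ b = M := by omega
      rcases e1 with rfl | rfl <;> rcases e2 with rfl | rfl
      · exact hab.ne rfl
      · exact h.ends hab
      · exact h.ends hab.symm
      · exact hab.ne rfl

theorem Corridor.step_index (h : Corridor G q M) {x y : ι → V} (hst : Step G x y) {l : ι} {a b : ℕ}
    (ha : 1 ≤ a) (ha' : a ≤ M) (hb : 1 ≤ b) (hb' : b ≤ M) (hx : x l = q a) (hy : y l = q b) :
    a = b ∨ a + 1 = b ∨ b + 1 = a := by
  rcases hst.adj l with e | e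
  · left; exact h.inj _ _ ha ha' hb hb' (by rw [← hx, ← hy, e])
  · right; rw [hx, hy] at e; exact h.adj_index ha ha' hb hb' e

theorem Corridor.step_inner (h : Corridor G q M) {x y : ι → V} (hst : Step G x y) {l : ι} {a : ℕ}
    (ha : 1 < a) (ha' : a < M) (hx : x l = q a) :
    ∃ b, (b = a ∨ b + 1 = a ∨ a + 1 = b) ∧ y l = q b := by
  rcases hst.adj l with e | e
  · exact ⟨a, Or.inl rfl, by rw [e, hx]⟩
  · rw [hx] at e
    rcases h.inner a ha ha' _ e with e | e
    · exact ⟨a - 1, by omega, e⟩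
    · exact ⟨a + 1, by omega, e⟩

/-- Robots in a corridor keep their order. -/
theorem Corridor.order (h : Corridor G q M) {x y : ι → V} (hst : Step G x y) {l i : ι}
    {a b a' b' : ℕ} (ha : 1 ≤ a) (hb : b ≤ M) (hab : a < b) (ha1 : 1 ≤ a') (ha2 : a' ≤ M)
    (hb1 : 1 ≤ b') (hb2 : b' ≤ M) (xl : x l = q a) (xi : x i = q b) (yl : y l = q a')
    (yi : y i = q b') : a' < b' := by
  have hli : l ≠ i := by
    rintro rfl
    have := h.inj a b ha (by omega) (by omega) hb (by rw [← xl, ← xi])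
    omega
  have h1 := h.step_index hst ha (by omega) ha1 ha2 xl yl
  have h2 := h.step_index hst (by omega) hb hb1 hb2 xi yi
  have h3 : a' ≠ b' := by
    rintro rfl
    exact hli (hst.inj' (by rw [yl, yi]))
  have h4 : ¬ (a' = b ∧ b' = a) := by
    rintro ⟨rfl, rfl⟩
    exact hst.noswap l i hli ⟨by rw [yl, xi], by rw [yi, xl]⟩
  omega

/-- The robot `i` traverses the `j`-th edge at time `s`, and back at time `t`, and does not leave
the corridor meanwhile. -/
structure Return (q : ℕ → V) (M : ℕ) (p : ℕ → ι → V) (i : ι) (j s t : ℕ) : Prop where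
  le : s + 1 ≤ t
  hs : p s i = q j
  hs1 : p (s + 1) i = q (j + 1)
  ht : p t i = q (j + 1)
  ht1 : p (t + 1) i = q j
  mem : ∀ τ, s + 1 ≤ τ → τ ≤ t → ∃ a, j + 1 ≤ a ∧ a ≤ M ∧ p τ i = q a

/-- A return forces a nested return of another robot one edge earlier. -/
theorem Corridor.nested (hq : Corridor G q M) (hopt : Opt G p T) {i : ι} {j s t : ℕ} (hj : 1 < j)
    (hjM : j + 1 ≤ M) (htT : t + 1 ≤ T) (h : Return q M p i j s t) :
    ∃ l s' t', s ≤ s' ∧ t' ≤ t ∧ Return q M p l (j - 1) s' t' ∧ p (s' + 1) l = q j := by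
  classical
  have hne : q j ≠ q (j + 1) := (hq.adj j (by omega) (by omega)).ne
  obtain ⟨l, hli, τ, hτ1, hτ2, hτ⟩ := hopt.exists_other (u := q j) h.le htT h.hs
    (by rw [h.hs1]; exact hne.symm) h.ht1
  have hex : ∃ τ, s + 1 ≤ τ ∧ τ ≤ t ∧ p τ l = q j := ⟨τ, hτ1, hτ2, hτ⟩
  obtain ⟨hf1, hf2, hf3⟩ := Nat.find_spec hex
  have hfmin : ∀ σ, s + 1 ≤ σ → σ < Nat.find hex → p σ l ≠ q j := by
    intro σ h1 h2 h3
    exact Nat.find_min hex h2 ⟨h1, by omega, h3⟩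
  generalize Nat.find hex = τ0 at hf1 hf2 hf3 hfmin
  -- `l` does not come from behind `i`
  have hbet : ∀ σ, s + 1 ≤ σ → σ < τ0 →
      ¬ ∃ a b, j + 1 ≤ a ∧ a < b ∧ b ≤ M ∧ p σ l = q a ∧ p σ i = q b := by
    intro σ h1
    induction σ, h1 using Nat.le_induction with
    | base =>
      rintro - ⟨a, b, h2, h3, h4, -, h6⟩
      rw [h.hs1] at h6
      have := hq.inj _ _ (by omega) (by omega) (by omega) h4 h6
      omega
    | succ σ h1 ih =>
      rintro h2 ⟨a, b, h3, h4, h5, h6, h7⟩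
      have hst := hopt.step σ (by omega)
      obtain ⟨a', ha', hla⟩ := hq.step_inner hst.symm (a := a) (by omega) (by omega) h6
      obtain ⟨b', hb1, hb2, hib⟩ := h.mem σ h1 (by omega)
      have haj : a' ≠ j := by
        rintro rfl
        exact hfmin σ h1 (by omega) hla
      refine ih (by omega) ⟨a', b', by omega, ?_, hb2, hla, hib⟩
      exact hq.order hst.symm (by omega) h5 h4 (by omega) (by omega) (by omega) hb2 h6 h7 hla hib
  obtain ⟨s', rfl⟩ : ∃ s', τ0 = s' + 1 := ⟨τ0 - 1, by omega⟩
  have hst := hopt.step s' (by omega)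
  have hs'l : p s' l = q (j - 1) := by
    obtain ⟨a', ha', hla⟩ := hq.step_inner hst.symm (a := j) hj (by omega) hf3
    have h1 : a' = j ∨ a' = j - 1 ∨ a' = j + 1 := by omega
    rcases Nat.lt_or_ge s s' with hss | hss
    · rcases h1 with rfl | rfl | rfl
      · exact absurd hla (hfmin s' hss (by omega))
      · exact hla
      · exfalso
        obtain ⟨b', hb1, hb2, hib⟩ := h.mem s' hss (by omega)
        have : b' ≠ j + 1 := by
          rintro rfl
          exact hli (hst.inj (hla.trans hib.symm))
        exact hbet s' hss (by omega) ⟨j + 1, b', le_rfl, by omega, hb2, hla, hib⟩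
    · have e : s' = s := by omega
      subst e
      rcases h1 with rfl | rfl | rfl
      · exact absurd (hst.inj (hla.trans h.hs.symm)) hli
      · exact hla
      · exact absurd ⟨by rw [hf3, h.hs], by rw [h.hs1, hla]⟩ (hst.noswap l i hli)
  -- `l` stays between until it turns back
  have hstay : ∀ t', s' + 1 ≤ t' → t' ≤ t →
      (∀ σ, s' + 1 ≤ σ → σ < t' → ¬ (p σ l = q j ∧ p (σ + 1) l = q (j - 1))) →
      ∃ a b, j ≤ a ∧ a < b ∧ b ≤ M ∧ p t' l = q a ∧ p t' i = q b := by
    intro t' h1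
    induction t', h1 using Nat.le_induction with
    | base =>
      intro _ _
      obtain ⟨b, hb1, hb2, hib⟩ := h.mem (s' + 1) (by omega) (by omega)
      exact ⟨j, b, le_rfl, by omega, hb2, hf3, hib⟩
    | succ t' h1 ih =>
      intro h2 h3
      obtain ⟨a, b, h4, h5, h6, h7, h8⟩ := ih (by omega) fun σ h4 h5 => h3 σ h4 (by omega)
      have hst := hopt.step t' (by omega)
      obtain ⟨a', ha', hla⟩ := hq.step_inner hst (a := a) (by omega) (by omega) h7
      obtain ⟨b', hb1, hb2, hib⟩ := h.mem (t' + 1) (by omega) (by omega)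
      have haj : ¬ (a = j ∧ a' = j - 1) := by
        rintro ⟨rfl, rfl⟩
        exact h3 t' h1 (by omega) ⟨h7, hla⟩
      refine ⟨a', b', by omega, ?_, hb2, hla, hib⟩
      exact hq.order hst (by omega) h6 h5 (by omega) (by omega) (by omega) hb2 h7 h8 hla hib
  have hturn : ∃ σ, s' + 1 ≤ σ ∧ σ ≤ t ∧ (p σ l = q j ∧ p (σ + 1) l = q (j - 1)) := by
    by_contra hcon
    push Not at hcon
    obtain ⟨a, b, h1, h2, h3, h4, h5⟩ := hstay t (by omega) le_rfl
      fun σ h1 h2 h3 => hcon σ h1 h2.le h3.1 h3.2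
    rw [h.ht] at h5
    have := hq.inj _ _ (by omega) (by omega) (by omega) h3 h5
    have e : a = j := by omega
    subst e
    have hst := hopt.step t (by omega)
    obtain ⟨a', ha', hla⟩ := hq.step_inner hst (a := a) (by omega) (by omega) h4
    have h6 : a' = a ∨ a' = a - 1 ∨ a' = a + 1 := by omega
    rcases h6 with rfl | rfl | rfl
    · exact hli (hst.inj' (hla.trans h.ht1.symm))
    · exact hcon t (by omega) le_rfl h4 hla
    · exact hst.noswap l i hli ⟨by rw [hla, h.ht], by rw [h.ht1, h4]⟩
  obtain ⟨hg1, hg2, hg3, hg4⟩ := Nat.find_spec hturn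
  have hgmin : ∀ σ, s' + 1 ≤ σ → σ < Nat.find hturn →
      ¬ (p σ l = q j ∧ p (σ + 1) l = q (j - 1)) := by
    intro σ h1 h2 h3
    exact Nat.find_min hturn h2 ⟨h1, by omega, h3⟩
  generalize Nat.find hturn = t' at hg1 hg2 hg3 hg4 hgmin
  refine ⟨l, s', t', by omega, hg2, ⟨hg1, hs'l, ?_, ?_, hg4, ?_⟩, hf3⟩
  · rw [hf3, Nat.sub_add_cancel (by omega)]
  · rw [hg3, Nat.sub_add_cancel (by omega)]
  · intro σ h1 h2
    obtain ⟨a, b, h3, h4, h5, h6, -⟩ := hstay σ h1 (by omega)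
      fun σ' h3 h4 => hgmin σ' h3 (by omega)
    exact ⟨a, by omega, by omega, h6⟩

theorem Corridor.no_return (hq : Corridor G q M) (hopt : Opt G p T) {i : ι} {j s t : ℕ}
    (hj : Fintype.card ι < j) (hjM : j + 1 ≤ M) (htT : t + 1 ≤ T) : ¬ Return q M p i j s t := by
  have key : ∀ (n : ℕ) (R : Finset ι) (i : ι) (j s t : ℕ), Return q M p i j s t → i ∉ R →
      (∀ r ∈ R, ∀ τ, s + 1 ≤ τ → τ ≤ t → ∃ a, j + 1 ≤ a ∧ a ≤ M ∧ p τ r = q a) →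
      Fintype.card ι ≤ R.card + n → n < j → j + 1 ≤ M → t + 1 ≤ T → False := by
    intro n
    induction n with
    | zero =>
      intro R i j s t _ hiR _ hcard _ _ _
      have : R = Finset.univ := (Finset.card_eq_iff_eq_univ R).1
        (le_antisymm (Finset.card_le_univ R) hcard)
      rw [this] at hiR
      exact hiR (Finset.mem_univ _)
    | succ n ih =>
      intro R i j s t h hiR hR hcard hn hjM htT
      obtain ⟨l, s', t', hs', ht', h', hlj⟩ := hq.nested hopt (by omega) hjM htT h
      have hle := h'.le
      have hnot : ∀ r, (∃ a, j + 1 ≤ a ∧ a ≤ M ∧ p (s' + 1) r = q a) → r ≠ l := by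
        rintro r ⟨a, h1, h2, h3⟩ rfl
        rw [hlj] at h3
        have := hq.inj _ _ (by omega) (by omega) (by omega) h2 h3
        omega
      have hall : ∀ r ∈ insert i R, ∀ τ, s + 1 ≤ τ → τ ≤ t →
          ∃ a, j + 1 ≤ a ∧ a ≤ M ∧ p τ r = q a := by
        intro r hr
        rw [Finset.mem_insert] at hr
        rcases hr with rfl | hr
        · exact h.mem
        · exact hR r hr
      refine ih (insert i R) l (j - 1) s' t' h' ?_ ?_ ?_ (by omega) (by omega) (by omega)
      · intro hl
        exact hnot l (hall l hl (s' + 1) (by omega) (by omega)) rfl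
      · intro r hr τ h1 h2
        obtain ⟨a, h3, h4, h5⟩ := hall r hr τ (by omega) (by omega)
        exact ⟨a, by omega, h4, h5⟩
      · rw [Finset.card_insert_of_notMem hiR]; omega
  intro h
  exact key (Fintype.card ι) ∅ i j s t h (by simp) (by simp) (by simp) hj hjM htT

/-- After traversing a deep edge forwards, a robot traverses it again only after having left the
corridor at the far end. -/
theorem Corridor.exists_leave (hq : Corridor G q M) (hopt : Opt G p T) {i : ι} {j s t : ℕ}
    (hj : Fintype.card ι < j) (hjM : j + 1 ≤ M) (hst : s < t) (htT : t < T) (hs : p s i = q j)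
    (hs1 : p (s + 1) i = q (j + 1))
    (ht : (p t i = q (j + 1) ∧ p (t + 1) i = q j) ∨ (p t i = q j ∧ p (t + 1) i = q (j + 1))) :
    ∃ σ, s < σ ∧ σ < t ∧ p σ i = q M ∧ ∀ a, 1 ≤ a → a ≤ M → p (σ + 1) i ≠ q a := by
  by_contra hcon
  push Not at hcon
  have hret : ∀ σ, s + 1 ≤ σ → σ ≤ t → p σ i = q (j + 1) → p (σ + 1) i = q j →
      ¬ ∀ τ, s + 1 ≤ τ → τ ≤ σ → ∃ a, j + 1 ≤ a ∧ a ≤ M ∧ p τ i = q a := fun σ h1 h2 h3 h4 h5 =>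
    hq.no_return hopt hj hjM (by omega) ⟨h1, hs, hs1, h3, h4, h5⟩
  have hmem : ∀ σ, s + 1 ≤ σ → σ ≤ t → ∀ τ, s + 1 ≤ τ → τ ≤ σ →
      ∃ a, j + 1 ≤ a ∧ a ≤ M ∧ p τ i = q a := by
    intro σ h1
    induction σ, h1 using Nat.le_induction with
    | base =>
      intro _ τ h2 h3
      have : τ = s + 1 := by omega
      subst this
      exact ⟨j + 1, le_rfl, hjM, hs1⟩
    | succ σ h1 ih =>
      intro h2 τ h3 h4
      have hih := ih (by omega)
      rcases Nat.lt_or_ge σ τ with h5 | h5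
      swap
      · exact hih τ h3 h5
      have e : τ = σ + 1 := by omega
      subst e
      obtain ⟨a, ha1, ha2, ha⟩ := hih σ h1 le_rfl
      have hst' := hopt.step σ (by omega)
      obtain ⟨b, hb, hpb, hbM⟩ : ∃ b, (b = a ∨ b + 1 = a ∨ a + 1 = b) ∧ p (σ + 1) i = q b ∧
          b ≤ M := by
        rcases Nat.lt_or_ge a M with h6 | h6
        · obtain ⟨b, hb, hpb⟩ := hq.step_inner hst' (a := a) (by omega) h6 ha
          exact ⟨b, hb, hpb, by omega⟩
        · have e : a = M := by omega
          subst e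
          obtain ⟨b, hb1, hb2, hpb⟩ := hcon σ (by omega) (by omega) ha
          have := hq.step_index hst' (by omega) ha2 hb1 hb2 ha hpb
          exact ⟨b, by omega, hpb, hb2⟩
      have hbj : b ≠ j := by
        rintro rfl
        have e : a = b + 1 := by omega
        subst e
        exact hret σ h1 (by omega) ha hpb hih
      exact ⟨b, by omega, hbM, hpb⟩
  have hmt := hmem t hst le_rfl
  rcases ht with ⟨h1, h2⟩ | ⟨h1, -⟩
  · exact hret t hst le_rfl h1 h2 hmt
  · obtain ⟨a, ha1, ha2, ha⟩ := hmt t hst le_rfl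
    rw [h1] at ha
    have := hq.inj _ _ (by omega) (by omega) (by omega) ha2 ha
    omega

theorem Corridor.exists_leave_back (hq : Corridor G q M) (hopt : Opt G p T) {i : ι} {j s t : ℕ}
    (hj : j + Fintype.card ι < M) (hj1 : 1 ≤ j) (hst : s < t) (htT : t < T)
    (hs : p s i = q (j + 1)) (hs1 : p (s + 1) i = q j)
    (ht : (p t i = q (j + 1) ∧ p (t + 1) i = q j) ∨ (p t i = q j ∧ p (t + 1) i = q (j + 1))) :
    ∃ σ, s < σ ∧ σ < t ∧ p σ i = q 1 ∧ ∀ a, 1 ≤ a → a ≤ M → p (σ + 1) i ≠ q a := by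
  have e1 : M + 1 - (M - j) = j + 1 := by omega
  have e2 : M + 1 - (M - j + 1) = j := by omega
  obtain ⟨σ, h1, h2, h3, h4⟩ := hq.reverse.exists_leave hopt (i := i) (j := M - j) (s := s) (t := t)
    (by omega) (by omega) hst htT (by rw [e1, hs]) (by rw [e2, hs1]) (by rw [e1, e2]; exact ht.symm)
  refine ⟨σ, h1, h2, by rw [h3]; congr 1; omega, fun a ha1 ha2 => ?_⟩
  have := h4 (M + 1 - a) (by omega) (by omega)
  rwa [show M + 1 - (M + 1 - a) = a by omega] at this

/-- The robot `i` traverses the `j`-th edge of the corridor at time `t`. -/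
def Crosses (q : ℕ → V) (p : ℕ → ι → V) (i : ι) (j t : ℕ) : Prop :=
  (p t i = q j ∧ p (t + 1) i = q (j + 1)) ∨ (p t i = q (j + 1) ∧ p (t + 1) i = q j)

theorem ncard_le_two {S : Set ℕ} (hS : S.Finite)
    (h : ∀ a ∈ S, ∀ b ∈ S, ∀ c ∈ S, a < b → b < c → False) : S.ncard ≤ 2 := by
  by_contra hcon
  push Not at hcon
  rw [Set.ncard_eq_toFinset_card S hS, Finset.two_lt_card] at hcon
  obtain ⟨a, ha, b, hb, c, hc, hab, hac, hbc⟩ := hcon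
  rw [Set.Finite.mem_toFinset] at ha hb hc
  rcases lt_or_gt_of_ne hab with h1 | h1 <;> rcases lt_or_gt_of_ne hac with h2 | h2 <;>
    rcases lt_or_gt_of_ne hbc with h3 | h3
  · exact h a ha b hb c hc h1 h3
  · exact h a ha c hc b hb h2 h3
  · omega
  · exact h c hc a ha b hb h2 h1
  · exact h b hb a ha c hc h1 h2
  · omega
  · exact h b hb c hc a ha h3 h2
  · exact h c hc b hb a ha h3 h1

/-- While a robot does not visit the far end of a corridor, it traverses a deep edge at most
twice. -/
theorem Corridor.crosses_le_two (hq : Corridor G q M) (hopt : Opt G p T) {i : ι} {j α β : ℕ}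
    (hj : Fintype.card ι < j) (hjM : j + 1 < M) (hβ : β ≤ T)
    (havoid : ∀ τ, α ≤ τ → τ < β → p τ i ≠ q M) :
    {t | α ≤ t ∧ t < β ∧ Crosses q p i j t}.ncard ≤ 2 := by
  have hfin : {t | α ≤ t ∧ t < β ∧ Crosses q p i j t}.Finite :=
    (Set.finite_lt_nat β).subset fun t ht => ht.2.1
  have hfwd : ∀ s t, α ≤ s → s < t → t < β → p s i = q j → p (s + 1) i = q (j + 1) →
      ¬ Crosses q p i j t := by
    intro s t h1 h2 h3 h4 h5 h6
    obtain ⟨σ, h7, h8, h9, -⟩ := hq.exists_leave hopt hj hjM.le h2 (by omega) h4 h5 h6.symm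
    exact havoid σ (by omega) (by omega) h9
  refine ncard_le_two hfin ?_
  rintro a ⟨ha1, ha2, ha⟩ b ⟨hb1, hb2, hb⟩ c ⟨hc1, hc2, hc⟩ hab hbc
  rcases ha with ⟨h1, h2⟩ | ⟨h1, h2⟩
  · exact hfwd a b ha1 hab hb2 h1 h2 hb
  · rcases hb with ⟨h3, h4⟩ | ⟨h3, h4⟩
    · exact hfwd b c hb1 hbc hc2 h3 h4 hc
    · have key : ∀ σ, a + 1 ≤ σ → σ ≤ b → ¬ ∃ l, j + 1 ≤ l ∧ l < M ∧ p σ i = q l := by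
        intro σ h5
        induction σ, h5 using Nat.le_induction with
        | base =>
          rintro - ⟨l, h6, h7, h8⟩
          rw [h2] at h8
          have := hq.inj _ _ (by omega) (by omega) (by omega) h7.le h8
          omega
        | succ σ h5 ih =>
          rintro h6 ⟨l, h7, h8, h9⟩
          obtain ⟨m, hm, hpm⟩ := hq.step_inner (hopt.step σ (by omega)).symm (a := l) (by omega) h8 h9
          by_cases hmj : m = j
          · subst hmj
            have e : l = m + 1 := by omega
            subst e
            exact hfwd σ b (by omega) (by omega) hb2 hpm h9 (Or.inr ⟨h3, h4⟩)
          · by_cases hmM : m = M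
            · subst hmM
              exact havoid σ (by omega) (by omega) hpm
            · exact ih (by omega) ⟨m, by omega, by omega, hpm⟩
      exact key b hab le_rfl ⟨j + 1, le_rfl, hjM, h3⟩

end GCMP

namespace GCMP
set_option linter.unusedSectionVars false
variable {V ι : Type*} [Fintype ι] [DecidableEq V] [DecidableEq ι] {G : SimpleGraph V}

/-- The set `S` is connected in `G`. -/
def Conn (G : SimpleGraph V) (S : Set V) : Prop :=
  ∀ a ∈ S, ∀ b ∈ S, Joined G S a b

theorem conn_of_joined {S : Set V} {w : V} (h : ∀ a ∈ S, Joined G S a w) : Conn G S :=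
  fun a ha b hb => (h a ha).trans (h b hb).symm

theorem conn_univ (hG : G.Connected) : Conn G Set.univ := by
  intro a _ b _
  obtain ⟨w⟩ := hG.preconnected a b
  exact ⟨w, fun _ _ => Set.mem_univ _⟩

theorem joined_seq {q : ℕ → V} {S : Set V} {a b : ℕ} (hab : a ≤ b)
    (hadj : ∀ i, a ≤ i → i < b → G.Adj (q i) (q (i + 1))) (hS : ∀ i, a ≤ i → i ≤ b → q i ∈ S) :
    Joined G S (q a) (q b) := by
  induction b, hab using Nat.le_induction with
  | base => exact Joined.refl (hS a le_rfl le_rfl)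
  | succ b hab ih =>
    exact (ih (fun i h1 h2 => hadj i h1 (by omega)) fun i h1 h2 => hS i h1 (by omega)).trans
      (Joined.of_adj (hS b hab (by omega)) (hS _ (by omega) le_rfl) (hadj b hab (by omega)))

theorem conn_seq {q : ℕ → V} {a b : ℕ} (hadj : ∀ i, a ≤ i → i < b → G.Adj (q i) (q (i + 1))) :
    Conn G {u | ∃ i, a ≤ i ∧ i ≤ b ∧ q i = u} := by
  apply conn_of_joined (w := q a)
  rintro _ ⟨i, h1, h2, rfl⟩
  exact (joined_seq h1 (fun j h3 h4 => hadj j h3 (by omega))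
    fun j h3 h4 => (⟨j, h3, by omega, rfl⟩ : ∃ i, a ≤ i ∧ i ≤ b ∧ q i = q j)).symm

theorem Conn.union {S T : Set V} (hS : Conn G S) (hT : Conn G T) {a b : V} (ha : a ∈ S) (hb : b ∈ T)
    (hab : G.Adj a b) : Conn G (S ∪ T) := by
  apply conn_of_joined (w := b)
  rintro u (hu | hu)
  · exact ((hS u hu a ha).mono Set.subset_union_left).trans
      (Joined.of_adj (Or.inl ha) (Or.inr hb) hab)
  · exact (hT u hu b hb).mono Set.subset_union_right

theorem Conn.insert {S : Set V} (hS : Conn G S) {a b : V} (ha : a ∈ S) (hab : G.Adj a b) :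
    Conn G (insert b S) := by
  have := hS.union (T := {b}) (by rintro _ rfl _ rfl; exact Joined.refl rfl) ha rfl hab
  rwa [Set.union_comm, Set.singleton_union] at this

theorem Conn.union_of_mem {S T : Set V} (hS : Conn G S) (hT : Conn G T) {a : V} (ha : a ∈ S)
    (hb : a ∈ T) : Conn G (S ∪ T) := by
  apply conn_of_joined (w := a)
  rintro u (hu | hu)
  · exact (hS u hu a ha).mono Set.subset_union_left
  · exact (hT u hu a hb).mono Set.subset_union_right

theorem Joined.exit_set {A Z : Set V} {u v : V} (h : Joined G A u v) (hu : u ∉ Z) (hv : v ∈ Z) :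
    ∃ p z, Joined G (A \ Z) u p ∧ G.Adj p z ∧ z ∈ Z ∧ z ∈ A := by
  obtain ⟨w, hw⟩ := h
  induction w with
  | nil => exact absurd hv hu
  | @cons u u1 v h w ih =>
    have hu' : u ∈ A \ Z := ⟨hw u (by simp), hu⟩
    by_cases h1 : u1 ∈ Z
    · exact ⟨u, u1, Joined.refl hu', h, h1, hw u1 (by simp)⟩
    · obtain ⟨p, z, hp, hpz, hz, hzA⟩ := ih h1 hv fun a ha => hw a (by simp [ha])
      exact ⟨p, z, (Joined.of_adj hu' hp.left_mem h).trans hp, hpz, hz, hzA⟩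

theorem Joined.dist_lt {S : Finset V} {a b : V} (h : Joined G (S : Set V) a b) :
    G.dist a b < S.card := by
  obtain ⟨w, hw, hS⟩ := h.exists_path
  have h1 : w.support.toFinset ⊆ S := fun u hu => by simpa using hS u (by simpa using hu)
  have h2 := Finset.card_le_card h1
  rw [List.toFinset_card_of_nodup hw.support_nodup, Walk.length_support] at h2
  have := dist_le w
  omega

/-- The connected component of `v` inside `S`. -/
def comp (G : SimpleGraph V) (S : Set V) (v : V) : Set V := {u | Joined G S v u}

theorem comp_subset {S : Set V} {v : V} : comp G S v ⊆ S := fun _ h => Joined.right_mem h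

theorem comp_closed {S : Set V} {v u z : V} (hu : u ∈ comp G S v) (hz : z ∈ S) (h : G.Adj u z) :
    z ∈ comp G S v :=
  Joined.trans hu (Joined.of_adj (comp_subset hu) hz h)

theorem conn_comp {S : Set V} {v : V} : Conn G (comp G S v) := by
  apply conn_of_joined (w := v)
  intro u hu
  obtain ⟨w, hw⟩ := Joined.symm hu
  refine ⟨w, fun a ha => ?_⟩
  obtain ⟨w1, w2, rfl⟩ := Walk.mem_support_iff_exists_append.1 ha
  exact Joined.symm ⟨w2, fun c hc => hw c ((Walk.mem_support_append_iff _ _).2 (Or.inr hc))⟩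

/-- Two disjoint connected arms with `m` vertices each that meet at `w`. -/
structure Arms (G : SimpleGraph V) (m : ℕ) (w : V) (A B : Finset V) : Prop where
  notMem_A : w ∉ A
  notMem_B : w ∉ B
  disj : Disjoint A B
  joined_A : ∀ a ∈ A, Joined G (insert w (A : Set V)) a w
  joined_B : ∀ b ∈ B, Joined G (insert w (B : Set V)) b w
  card_A : m ≤ A.card
  card_B : m ≤ B.card

theorem Arms.symm {m : ℕ} {w : V} {A B : Finset V} (h : Arms G m w A B) : Arms G m w B A :=
  ⟨h.notMem_B, h.notMem_A, h.disj.symm, h.joined_B, h.joined_A, h.card_B, h.card_A⟩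

/-- A vertex at which two large arms meet, and that has two neighbours in one of them. -/
def Nice (G : SimpleGraph V) (m : ℕ) (w : V) : Prop :=
  ∃ A B : Finset V, Arms G m w A B ∧ ∃ y2 y3, y2 ≠ y3 ∧ y2 ∈ B ∧ y3 ∈ B ∧ G.Adj w y2 ∧ G.Adj w y3

theorem Arms.exists_adj {m : ℕ} {w : V} {A B : Finset V} (h : Arms G m w A B) (hm : 0 < m) :
    ∃ a ∈ A, G.Adj w a := by
  obtain ⟨a, ha⟩ : A.Nonempty := Finset.card_pos.1 (by have := h.card_A; omega)
  obtain ⟨p, hp, hpw⟩ := (h.joined_A a ha).exit (by rintro rfl; exact h.notMem_A ha)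
  refine ⟨p, ?_, hpw.symm⟩
  rcases hp.right_mem with ⟨h1 | h1, h2⟩
  · exact absurd h1 h2
  · exact h1

theorem Arms.degree {m : ℕ} {w : V} {A B : Finset V} (h : Arms G m w A B) (hm : 0 < m)
    (hn : ¬ Nice G m w) :
    ∃ a ∈ A, ∃ b ∈ B, G.Adj w a ∧ G.Adj w b ∧ ∀ u, G.Adj w u → u = a ∨ u = b := by
  obtain ⟨a, ha, hwa⟩ := h.exists_adj hm
  obtain ⟨b, hb, hwb⟩ := h.symm.exists_adj hm
  refine ⟨a, ha, b, hb, hwa, hwb, fun u hu => ?_⟩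
  by_contra hcon
  push Not at hcon
  apply hn
  by_cases hA : u ∈ A
  · exact ⟨B, A, h.symm, u, a, hcon.1, hA, ha, hu, hwa⟩
  · refine ⟨A, insert u B, ⟨h.notMem_A, ?_, ?_, h.joined_A, ?_, h.card_A, ?_⟩, u, b, hcon.2,
      by simp, by simp [hb], hu, hwb⟩
    · simp only [Finset.mem_insert, not_or]
      exact ⟨hu.ne, h.notMem_B⟩
    · rw [Finset.disjoint_insert_right]; exact ⟨hA, h.disj⟩
    · intro c hc
      rw [Finset.mem_insert] at hc
      rcases hc with rfl | hc
      · exact Joined.of_adj (by simp) (by simp) hu.symm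
      · refine (h.joined_B c hc).mono ?_
        intro z; simp only [Set.mem_insert_iff, Finset.mem_coe, Finset.coe_insert]; tauto
    · exact h.card_B.trans (Finset.card_le_card (Finset.subset_insert _ _))

theorem exists_trim {A S : Finset V} {w : V} {m : ℕ} (hwA : w ∉ A)
    (hA : ∀ a ∈ A, Joined G (insert w (A : Set V)) a w) (hSA : S ⊆ A) (hS : ∀ a ∈ S, Joined G (insert w (S : Set V)) a w) (hSm : S.card ≤ m)
    (hm : m ≤ A.card) :
    ∃ A', S ⊆ A' ∧ A' ⊆ A ∧ A'.card = m ∧ ∀ a ∈ A', Joined G (insert w (A' : Set V)) a w := by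
  induction hd : m - S.card generalizing S with
  | zero => exact ⟨S, subset_rfl, hSA, by omega, hS⟩
  | succ d ih =>
    obtain ⟨a, haA, haS⟩ : ∃ a ∈ A, a ∉ S := by
      by_contra hcon
      push Not at hcon
      have := Finset.card_le_card (show A ⊆ S from hcon)
      omega
    have haw : a ≠ w := by rintro rfl; exact hwA haA
    obtain ⟨p, z, hp, hpz, hz, -⟩ := (hA a haA).exit_set (Z := insert w (S : Set V))
      (by simp [haw, haS]) (Or.inl rfl)
    have hpA : p ∈ A := by
      rcases hp.right_mem with ⟨h | h, h'⟩
      · subst h; exact absurd (Or.inl rfl) h'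
      · exact h
    have hpS : p ∉ S := fun h => hp.right_mem.2 (Or.inr h)
    have hJ : Joined G (insert w (S : Set V)) z w := by
      rcases hz with rfl | hz
      · exact Joined.refl (Or.inl rfl)
      · exact hS z hz
    obtain ⟨A', h1, h2, h3, h4⟩ := ih (S := insert p S) (Finset.insert_subset hpA hSA) (by
      intro c hc
      rw [Finset.mem_insert] at hc
      have hmono : insert w (S : Set V) ⊆ insert w ((insert p S : Finset V) : Set V) := by
        intro u; simp only [Set.mem_insert_iff, Finset.mem_coe, Finset.coe_insert]; tauto
      rcases hc with rfl | hc
      · exact (Joined.of_adj (by simp) (hmono hz) hpz).trans (hJ.mono hmono)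
      · exact (hS c hc).mono hmono) (by rw [Finset.card_insert_of_notMem hpS]; omega)
      (by rw [Finset.card_insert_of_notMem hpS]; omega)
    exact ⟨A', (Finset.subset_insert _ _).trans h1, h2, h3, h4⟩

/-- Both arms of a nice vertex may be taken to have exactly `m` vertices. -/
theorem Nice.exists_junction {m : ℕ} {w : V} (h : Nice G m w) (hm : 2 ≤ m) :
    ∃ A B, Junction G m w A B ∧ A.card = m ∧ B.card = m := by
  obtain ⟨A, B, h, y2, y3, h23, h2, h3, a2, a3⟩ := h
  obtain ⟨A', -, hA1, hA2, hA3⟩ := exists_trim (m := m) h.notMem_A h.joined_A (Finset.empty_subset A)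
    (by simp) (by simp) h.card_A
  obtain ⟨B', hB0, hB1, hB2, hB3⟩ := exists_trim (m := m) (S := {y2, y3}) h.notMem_B h.joined_B
    (by intro u; simp only [Finset.mem_insert, Finset.mem_singleton]; rintro (rfl | rfl) <;> assumption)
    (by
      intro u
      simp only [Finset.mem_insert, Finset.mem_singleton]
      rintro (rfl | rfl)
      · exact Joined.of_adj (by simp) (by simp) a2.symm
      · exact Joined.of_adj (by simp) (by simp) a3.symm)
    (by rw [Finset.card_pair h23]; exact hm) h.card_B
  refine ⟨A', B', ⟨fun e => h.notMem_A (hA1 e), fun e => h.notMem_B (hB1 e),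
    Finset.disjoint_of_subset_left hA1 (Finset.disjoint_of_subset_right hB1 h.disj), hA3, hB3, hA2.ge,
    Or.inl ⟨y2, y3, h23, hB0 (by simp), hB0 (by simp), a2, a3, hB2.ge⟩⟩, hA2, hB2⟩

section Peel

variable [Fintype V] {m : ℕ}

/-- A connected set `E` next to a large connected set `K` starts with a path of vertices of
degree two as long as no vertex is nice. -/
theorem exists_peel (hG : G.Connected) (hm : 0 < m) (s : ℕ) {K E : Finset V} {a f1 : V}
    (hK : Conn G (K : Set V)) (hE : Conn G (E : Set V)) (hdis : Disjoint K E)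
    (hcl : ∀ u ∈ E, ∀ z, G.Adj u z → z ∈ E ∨ z ∈ K) (ha : a ∈ K) (hf1 : f1 ∈ E) (hadj : G.Adj a f1)
    (hKm : m ≤ K.card) (hs : s + m ≤ E.card) (hn : ∀ u, G.dist a u ≤ s → ¬ Nice G m u) :
    ∃ f : ℕ → V, f 0 = a ∧ f 1 = f1 ∧ (∀ i, 1 ≤ i → i ≤ s + 1 → f i ∈ E) ∧
      (∀ i j, 1 ≤ i → i ≤ s + 1 → 1 ≤ j → j ≤ s + 1 → f i = f j → i = j) ∧
      (∀ i, i ≤ s → G.Adj (f i) (f (i + 1))) ∧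
      (∀ i, 1 ≤ i → i ≤ s → ∀ u, G.Adj (f i) u → u = f (i - 1) ∨ u = f (i + 1)) ∧
      Conn G {u | u ∈ E ∧ ∀ i, 1 ≤ i → i ≤ s → f i ≠ u} := by
  induction s generalizing K E a f1 with
  | zero =>
    refine ⟨fun i => if i = 0 then a else f1, rfl, rfl, ?_, ?_, ?_, ?_, ?_⟩
    · intro i h1 _; simpa [show i ≠ 0 by omega] using hf1
    · intros; omega
    · intro i hi
      obtain rfl : i = 0 := by omega
      simpa using hadj
    · intros; omega
    · convert hE using 1
      ext u
      simp only [Set.mem_ofPred_eq, Finset.mem_coe, and_iff_left_iff_imp]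
      intros; omega
  | succ s ih =>
    have harms : Arms G m f1 K (E.erase f1) := by
      refine ⟨fun h => Finset.disjoint_left.1 hdis h hf1, by simp, ?_, ?_, ?_, hKm, ?_⟩
      · exact Finset.disjoint_of_subset_right (Finset.erase_subset _ _) hdis
      · intro c hc
        exact ((hK c hc a ha).mono (Set.subset_insert _ _)).trans
          (Joined.of_adj (Or.inr ha) (Or.inl rfl) hadj)
      · intro c hc
        refine (hE c (Finset.mem_of_mem_erase hc) f1 hf1).mono ?_
        intro u hu
        by_cases h : u = f1
        · exact Or.inl h
        · exact Or.inr (by simpa [h] using hu)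
      · rw [Finset.card_erase_of_mem hf1]; omega
    obtain ⟨a', ha', b, hb, h1, h2, h3⟩ := harms.degree hm (hn f1 (by rw [dist_eq_one_iff_adj.2 hadj]; omega))
    have haa' : a' = a := by
      rcases h3 a hadj.symm with h | h
      · exact h.symm
      · subst h
        exact absurd (Finset.mem_of_mem_erase hb) (Finset.disjoint_left.1 hdis ha)
    subst haa'
    have hfK : f1 ∉ K := fun h => Finset.disjoint_left.1 hdis h hf1
    have hE' : Conn G ((E.erase f1 : Finset V) : Set V) := by
      apply conn_of_joined (w := b)
      intro u hu
      have huE : u ∈ E := Finset.mem_of_mem_erase hu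
      have huf : u ≠ f1 := Finset.ne_of_mem_erase hu
      obtain ⟨p, hp, hpf⟩ := (hE u huE f1 hf1).exit huf
      have hpE := hp.right_mem.1
      rcases h3 p hpf.symm with h | h
      · subst h; exact absurd hpE (Finset.disjoint_left.1 hdis ha)
      · subst h
        refine hp.mono ?_
        intro z hz
        simpa using hz
    obtain ⟨f, hf0, hf1', hfE, hfinj, hfadj, hfdeg, hfconn⟩ := ih (K := insert f1 K) (E := E.erase f1)
      (a := f1) (f1 := b) (by rw [Finset.coe_insert]; exact hK.insert ha hadj) hE'
      (by
        rw [Finset.disjoint_insert_left]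
        exact ⟨by simp, Finset.disjoint_of_subset_right (Finset.erase_subset _ _) hdis⟩)
      (by
        intro u hu z hz
        by_cases hzf : z = f1
        · right; simp [hzf]
        · rcases hcl u (Finset.mem_of_mem_erase hu) z hz with h | h
          · left; simp [hzf, h]
          · right; simp [h])
      (by simp) hb h2 (by rw [Finset.card_insert_of_notMem hfK]; omega)
      (by rw [Finset.card_erase_of_mem hf1]; omega)
      (fun u hu => hn u (by
        have := hG.dist_triangle (u := a') (v := f1) (w := u)
        rw [dist_eq_one_iff_adj.2 hadj] at this
        omega))
    refine ⟨fun i => if i = 0 then a' else f (i - 1), rfl, by simp [hf0], ?_, ?_, ?_, ?_, ?_⟩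
    · intro i h4 h5
      beta_reduce
      rw [if_neg (by omega)]
      by_cases hi : i = 1
      · subst hi; simpa [hf0] using hf1
      · exact Finset.mem_of_mem_erase (hfE (i - 1) (by omega) (by omega))
    · intro i j h4 h5 h6 h7 e
      beta_reduce at e
      rw [if_neg (by omega), if_neg (by omega)] at e
      by_cases hi : i = 1 <;> by_cases hj : j = 1
      · omega
      · subst hi
        rw [Nat.sub_self, hf0] at e
        have := hfE (j - 1) (by omega) (by omega)
        rw [← e] at this
        simp at this
      · subst hj
        rw [Nat.sub_self, hf0] at e
        have := hfE (i - 1) (by omega) (by omega)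
        rw [e] at this
        simp at this
      · have := hfinj (i - 1) (j - 1) (by omega) (by omega) (by omega) (by omega) e
        omega
    · intro i hi
      by_cases h4 : i = 0
      · subst h4; simpa [hf0] using hadj
      · simp only [h4, if_false, Nat.succ_ne_zero, Nat.add_sub_cancel]
        have := hfadj (i - 1) (by omega)
        rwa [show i - 1 + 1 = i by omega] at this
    · intro i h4 h5 u hu
      simp only [show i ≠ 0 by omega, if_false, Nat.succ_ne_zero, Nat.add_sub_cancel] at hu ⊢
      by_cases hi : i = 1
      · subst hi
        simp only [Nat.sub_self, hf0, if_true, hf1'] at hu ⊢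
        exact h3 u hu
      · rw [if_neg (by omega)]
        have := hfdeg (i - 1) (by omega) (by omega) u hu
        rwa [show i - 1 + 1 = i by omega] at this
    · convert hfconn using 1
      ext u
      simp only [Set.mem_ofPred_eq, Finset.mem_erase]
      constructor
      · rintro ⟨h4, h5⟩
        refine ⟨⟨fun e => h5 1 le_rfl (by omega) (by simp [hf0, e]), h4⟩, fun i h6 h7 e => ?_⟩
        exact h5 (i + 1) (by omega) (by omega) (by simpa using e)
      · rintro ⟨⟨h4, h5⟩, h6⟩
        refine ⟨h5, fun i h7 h8 e => ?_⟩
        rw [if_neg (by omega)] at e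
        by_cases hi : i = 1
        · subst hi; rw [Nat.sub_self, hf0] at e; exact h4 e.symm
        · exact h6 (i - 1) (by omega) (by omega) e

/-- A long cycle without nice vertices is the whole graph. -/
theorem not_notCycle_of_cycle (hG : G.Connected) (hm : 0 < m) {q : ℕ → V} {N : ℕ} (hN : 2 * m + 1 ≤ N)
    (hinj : ∀ i j, i < N → j < N → q i = q j → i = j) (hadj : ∀ i, i + 1 < N → G.Adj (q i) (q (i + 1)))
    (hlast : G.Adj (q (N - 1)) (q 0)) (hn : ∀ u, ¬ Nice G m u) : ¬ NotCycle G := by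
  have key : ∀ c, c < N → ∃ a b, a ≠ b ∧ a < N ∧ b < N ∧ G.Adj (q c) (q a) ∧ G.Adj (q c) (q b) ∧
      ∀ u, G.Adj (q c) u → u = q a ∨ u = q b := by
    intro c hc
    set r : ℕ → V := fun i => q ((c + i) % N) with hr
    have hmod : ∀ i, (c + i) % N < N := fun i => Nat.mod_lt _ (by omega)
    have hradj : ∀ i, G.Adj (r i) (r (i + 1)) := by
      intro i
      simp only [hr]
      have h1 : (c + (i + 1)) % N = ((c + i) % N + 1) % N := by
        rw [← add_assoc, Nat.mod_add_mod]
      rw [h1]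
      by_cases h2 : (c + i) % N + 1 < N
      · rw [Nat.mod_eq_of_lt h2]; exact hadj _ h2
      · have h3 : (c + i) % N = N - 1 := by have := hmod i; omega
        rw [h3, Nat.sub_add_cancel (by omega), Nat.mod_self]
        exact hlast
    have hrinj : ∀ i j, i < N → j < N → r i = r j → i = j := by
      intro i j hi hj e
      have h1 := hinj _ _ (hmod i) (hmod j) e
      have h2 : i ≡ j [MOD N] := Nat.ModEq.add_left_cancel' c h1
      rwa [Nat.ModEq, Nat.mod_eq_of_lt hi, Nat.mod_eq_of_lt hj] at h2
    have hr0 : r 0 = q c := by simp [hr, Nat.mod_eq_of_lt hc]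
    have hrN : r N = q c := by simp [hr, Nat.mod_eq_of_lt hc]
    have hIm : ∀ x y, x ≤ y + 1 → 1 ≤ x → y < N →
        ((Finset.Icc x y).image r).card = y + 1 - x := by
      intro x y h1 h2 h3
      rw [Finset.card_image_of_injOn, Nat.card_Icc]
      intro i hi j hj e
      simp only [Finset.coe_Icc, Set.mem_Icc] at hi hj
      exact hrinj i j (by omega) (by omega) e
    have hnot : ∀ x y, 1 ≤ x → y < N → r 0 ∉ (Finset.Icc x y).image r := by
      intro x y h1 h2 h3
      rw [Finset.mem_image] at h3
      obtain ⟨i, hi, e⟩ := h3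
      rw [Finset.mem_Icc] at hi
      have := hrinj i 0 (by omega) (by omega) e
      omega
    have harms : Arms G m (r 0) ((Finset.Icc 1 m).image r) ((Finset.Icc (m + 1) (N - 1)).image r) := by
      refine ⟨hnot _ _ le_rfl (by omega), hnot _ _ (by omega) (by omega), ?_, ?_, ?_, ?_, ?_⟩
      · rw [Finset.disjoint_left]
        intro u h1 h2
        rw [Finset.mem_image] at h1 h2
        obtain ⟨i, hi, rfl⟩ := h1
        obtain ⟨j, hj, e⟩ := h2
        rw [Finset.mem_Icc] at hi hj
        have := hrinj j i (by omega) (by omega) e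
        omega
      · intro u hu
        rw [Finset.mem_image] at hu
        obtain ⟨i, hi, rfl⟩ := hu
        rw [Finset.mem_Icc] at hi
        refine (joined_seq (Nat.zero_le i) (fun j _ _ => hradj j) fun j h1 h2 => ?_).symm
        by_cases hj : j = 0
        · left; rw [hj]
        · right; simp only [Finset.coe_image, Set.mem_image, Finset.coe_Icc, Set.mem_Icc]
          exact ⟨j, ⟨by omega, by omega⟩, rfl⟩
      · intro u hu
        rw [Finset.mem_image] at hu
        obtain ⟨i, hi, rfl⟩ := hu
        rw [Finset.mem_Icc] at hi
        rw [hr0, ← hrN]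
        refine joined_seq (by omega) (fun j _ _ => hradj j) fun j h1 h2 => ?_
        by_cases hj : j = N
        · left; rw [hj]
        · right; simp only [Finset.coe_image, Set.mem_image, Finset.coe_Icc, Set.mem_Icc]
          exact ⟨j, ⟨by omega, by omega⟩, rfl⟩
      · rw [hIm _ _ (by omega) le_rfl (by omega)]; omega
      · rw [hIm _ _ (by omega) (by omega) (by omega)]; omega
    obtain ⟨a, ha, b, hb, h1, h2, h3⟩ := harms.degree hm (hn _)
    have hdis := harms.disj
    rw [Finset.mem_image] at ha hb
    obtain ⟨i, hi, rfl⟩ := ha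
    obtain ⟨j, hj, rfl⟩ := hb
    rw [hr0] at h1 h2 h3
    refine ⟨(c + i) % N, (c + j) % N, fun e => ?_, hmod _, hmod _, h1, h2, h3⟩
    rw [Finset.mem_Icc] at hi hj
    have := hrinj i j (by omega) (by omega) (by simp only [hr]; rw [e])
    omega
  have hall : ∀ u, ∃ c < N, q c = u := by
    intro u
    by_contra hcon
    have hJ : Joined G Set.univ u (q 0) := conn_univ hG _ (Set.mem_univ _) _ (Set.mem_univ _)
    obtain ⟨p, z, hp, hpz, ⟨c, hc, rfl⟩, -⟩ := hJ.exit_set (Z := {u | ∃ c < N, q c = u}) hcon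
      ⟨0, by omega, rfl⟩
    apply hp.right_mem.2
    obtain ⟨a, b, -, ha, hb, -, -, h⟩ := key c hc
    rcases h p hpz.symm with rfl | rfl
    · exact ⟨a, ha, rfl⟩
    · exact ⟨b, hb, rfl⟩
  rintro ⟨v, hv⟩
  obtain ⟨c, hc, rfl⟩ := hall v
  obtain ⟨a, b, hab, ha, hb, h1, h2, h3⟩ := key c hc
  apply hv
  have : G.neighborSet (q c) = {q a, q b} := by
    ext u
    simp only [mem_neighborSet, Set.mem_insert_iff, Set.mem_singleton_iff]
    exact ⟨h3 u, by rintro (rfl | rfl) <;> assumption⟩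
  rw [this, Set.ncard_pair fun e => hab (hinj _ _ ha hb e)]

end Peel

end GCMP

namespace GCMP
set_option linter.unusedSectionVars false
variable {V ι : Type*} [Fintype ι] [DecidableEq V] [DecidableEq ι] {G : SimpleGraph V}

section Windows

variable {p : ℕ → ι → V} {T : ℕ} {H D : Set V} {P : ℕ}

/-- The set of pairs of a robot and a time at which it enters `v`. -/
def entries (p : ℕ → ι → V) (T : ℕ) (v : V) : Set (ι × ℕ) :=
  {q | q.2 < T ∧ p q.2 q.1 ≠ v ∧ p (q.2 + 1) q.1 = v}

/-- The time `t` lies between two visits of `H` by robot `i`. -/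
def window (p : ℕ → ι → V) (T : ℕ) (H : Set V) (t : ℕ) (i : ι) : Prop :=
  (∃ s ≤ t, p s i ∈ H) ∧ ∃ s, t ≤ s ∧ s ≤ T ∧ p s i ∈ H

theorem finite_of_lt {S : Set (ι × ℕ)} (h : ∀ q ∈ S, q.2 < T) : S.Finite :=
  (Set.finite_univ.prod (Set.finite_lt_nat T)).subset fun q hq => ⟨Set.mem_univ _, h q hq⟩

theorem ncard_le_sum_fiber {S : Set (ι × ℕ)} (h : ∀ q ∈ S, q.2 < T) (N : ι → ℕ)
    (hN : ∀ i, {t | (i, t) ∈ S}.ncard ≤ N i) : S.ncard ≤ ∑ i, N i := by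
  classical
  have hfin : ∀ i, {t | (i, t) ∈ S}.Finite := fun i =>
    (Set.finite_lt_nat T).subset fun t ht => h _ ht
  have hS : S ⊆ ↑(Finset.univ.biUnion fun i => (hfin i).toFinset.image (Prod.mk i)) := by
    rintro ⟨i, t⟩ hq
    simp only [Finset.coe_biUnion, Set.mem_iUnion, Finset.mem_coe, Finset.mem_univ, Finset.mem_image]
    exact ⟨i, trivial, t, by simpa using hq, rfl⟩
  refine (Set.ncard_le_ncard hS (Finset.finite_toSet _)).trans ?_
  rw [Set.ncard_coe_finset]
  refine Finset.card_biUnion_le.trans (Finset.sum_le_sum fun i _ => ?_)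
  refine Finset.card_image_le.trans ?_
  rw [← Set.ncard_eq_toFinset_card _ (hfin i)]
  exact hN i

theorem exists_times {S : ι → Set ℕ} (h : ∀ i, ∀ t ∈ S i, t < T) (N : ι → ℕ)
    (hN : ∀ i, (S i).ncard ≤ N i) :
    ∃ X : Finset ℕ, X.card ≤ ∑ i, N i ∧ ∀ i, ∀ t ∈ S i, t ∈ X := by
  classical
  have hfin : ∀ i, (S i).Finite := fun i => (Set.finite_lt_nat T).subset fun t ht => h i t ht
  refine ⟨Finset.univ.biUnion fun i => (hfin i).toFinset, ?_, fun i t ht => ?_⟩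
  · refine Finset.card_biUnion_le.trans (Finset.sum_le_sum fun i _ => ?_)
    rw [← Set.ncard_eq_toFinset_card _ (hfin i)]
    exact hN i
  · rw [Finset.mem_biUnion]
    exact ⟨i, Finset.mem_univ _, by simpa using ht⟩

theorem exists_window_times (p : ℕ → ι → V) (T : ℕ) (H : Set V) :
    ∃ X : Finset ℕ, X.card ≤ 2 * Fintype.card ι ∧
      ∀ t < T, t ∉ X → ∀ i, (window p T H t i ↔ window p T H (t + 1) i) := by
  have h : ∀ i, {t | t < T ∧ ¬ (window p T H t i ↔ window p T H (t + 1) i)}.ncard ≤ 2 := by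
    intro i
    set S1 := {t | t < T ∧ p t i ∈ H ∧ ∀ s, t < s → s ≤ T → p s i ∉ H} with hS1
    set S2 := {t | t < T ∧ p (t + 1) i ∈ H ∧ ∀ s ≤ t, p s i ∉ H} with hS2
    have f1 : S1.Finite := (Set.finite_lt_nat T).subset fun t ht => ht.1
    have f2 : S2.Finite := (Set.finite_lt_nat T).subset fun t ht => ht.1
    have c1 : S1.ncard ≤ 1 := by
      rw [Set.ncard_le_one f1]
      rintro a ⟨ha, ha1, ha2⟩ b ⟨hb, hb1, hb2⟩
      rcases lt_trichotomy a b with h | h | h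
      · exact absurd hb1 (ha2 b h hb.le)
      · exact h
      · exact absurd ha1 (hb2 a h ha.le)
    have c2 : S2.ncard ≤ 1 := by
      rw [Set.ncard_le_one f2]
      rintro a ⟨ha, ha1, ha2⟩ b ⟨hb, hb1, hb2⟩
      rcases lt_trichotomy a b with h | h | h
      · exact absurd ha1 (hb2 _ h)
      · exact h
      · exact absurd hb1 (ha2 _ h)
    refine (Set.ncard_le_ncard (t := S1 ∪ S2) ?_ (f1.union f2)).trans
      ((Set.ncard_union_le _ _).trans (by omega))
    rintro t ⟨ht, hne⟩
    by_cases h1 : window p T H t i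
    · have h2 : ¬ window p T H (t + 1) i := fun h2 => hne ⟨fun _ => h2, fun _ => h1⟩
      obtain ⟨⟨s, hs, hsH⟩, s', hs', hs'T, hs'H⟩ := h1
      have h3 : ∀ r, t < r → r ≤ T → p r i ∉ H := fun r h3 h4 h5 =>
        h2 ⟨⟨s, by omega, hsH⟩, r, h3, h4, h5⟩
      left
      refine ⟨ht, ?_, h3⟩
      by_cases e : s' = t
      · exact e ▸ hs'H
      · exact absurd hs'H (h3 s' (by omega) hs'T)
    · have h2 : window p T H (t + 1) i := by
        by_contra h2; exact hne ⟨fun h => absurd h h1, fun h => absurd h h2⟩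
      obtain ⟨⟨s, hs, hsH⟩, s', hs', hs'T, hs'H⟩ := h2
      have h3 : ∀ r ≤ t, p r i ∉ H := fun r h3 h5 =>
        h1 ⟨⟨r, h3, h5⟩, s', by omega, hs'T, hs'H⟩
      right
      refine ⟨ht, ?_, h3⟩
      by_cases e : s = t + 1
      · exact e ▸ hsH
      · exact absurd hsH (h3 s (by omega))
  obtain ⟨X, hX, hmem⟩ := exists_times (T := T) (fun i t ht => ht.1) _ h
  refine ⟨X, hX.trans (by simp [mul_comm]), fun t ht htX i => ?_⟩
  by_contra hcon
  exact htX (hmem i t ⟨ht, hcon⟩)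

theorem cheap_empty : Cheap G ι ∅ P := by
  intro x y c h
  have : y = x := funext fun i => h.inside_eq (by simp)
  rw [this]
  exact Reach.refl _ h.inj _

theorem univ_empty {N : ℕ} : Univ G ι ∅ N P := by
  intro x y hx _ _ hoff _
  have : y = x := funext fun i => hoff i (by simp)
  rw [this]
  exact Reach.refl _ hx _

/-- The number of entries of a vertex, up to those outside the windows and outside `D`. -/
theorem Opt.entries_le (hopt : Opt G p T) (hHD : Disjoint H D)
    (hH : Univ G ι H (Fintype.card ι) P) (hD : Cheap G ι D P)
    (hcard : 3 * Fintype.card ι ≤ H.ncard ∨ H = ∅) (X : Finset ℕ)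
    (hX : ∀ t < T, t ∉ X → ∀ i, ¬ window p T H t i → ¬ window p T H (t + 1) i →
      (p t i ∈ D ↔ p (t + 1) i ∈ D)) (v : V) :
    (entries p T v).ncard ≤ (2 * Fintype.card ι + X.card) * (Fintype.card ι + 2 * P + 1) + 2 * P +
      {q | q ∈ entries p T v ∧ ¬ window p T H q.2 q.1 ∧ ¬ window p T H (q.2 + 1) q.1 ∧
        p q.2 q.1 ∉ D ∧ q.2 ∉ X}.ncard := by
  classical
  obtain ⟨Y, hYc, hY⟩ := exists_window_times p T H
  have hmain := hopt.reroute (w := window p T H) hHD hH hD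
    (hcard.imp_right fun e t i ⟨⟨s, _, hs⟩, _⟩ => by simp [e] at hs)
    (fun t ht i hw hH => hw ⟨⟨t, le_rfl, hH⟩, t, le_rfl, ht, hH⟩)
    (by
      rintro t ht i hw ⟨⟨s, hs, hsH⟩, s', hs', hs'T, hs'H⟩
      by_cases e : s = t + 1
      · exact e ▸ hsH
      · exact absurd ⟨⟨s, by omega, hsH⟩, s', by omega, hs'T, hs'H⟩ hw)
    (by
      rintro t ht i ⟨⟨s, hs, hsH⟩, s', hs', hs'T, hs'H⟩ hw
      by_cases e : s' = t
      · exact e ▸ hs'H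
      · exact absurd ⟨⟨s, by omega, hsH⟩, s', by omega, hs'T, hs'H⟩ hw)
    (by
      rintro i ⟨⟨s, hs, hsH⟩, -⟩
      obtain rfl : s = 0 := by omega
      exact hsH)
    (by
      rintro i ⟨-, s, hs, hs', hsH⟩
      obtain rfl : s = T := by omega
      exact hsH) (X ∪ Y)
    (by
      intro t ht htE i
      rw [Finset.mem_union, not_or] at htE
      have h1 := hY t ht htE.2 i
      refine ⟨h1, ?_⟩
      by_cases h2 : window p T H t i
      · simp [h2, h1.1 h2]
      · have h3 : ¬ window p T H (t + 1) i := fun h => h2 (h1.2 h)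
        simp [h2, h3, hX t ht htE.1 i h2 h3])
  set S1 := {q : ι × ℕ | q.2 < T ∧ q.2 ∉ X ∪ Y ∧ (window p T H q.2 q.1 ∨ p q.2 q.1 ∈ D) ∧
      p q.2 q.1 ≠ p (q.2 + 1) q.1} with hS1
  set S2 := {q : ι × ℕ | q ∈ entries p T v ∧ q.2 ∈ X ∪ Y} with hS2
  set S3 := {q | q ∈ entries p T v ∧ ¬ window p T H q.2 q.1 ∧ ¬ window p T H (q.2 + 1) q.1 ∧
        p q.2 q.1 ∉ D ∧ q.2 ∉ X} with hS3
  have f1 : S1.Finite := finite_of_lt (T := T) fun q hq => hq.1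
  have f2 : S2.Finite := finite_of_lt (T := T) fun q hq => hq.1.1
  have f3 : S3.Finite := finite_of_lt (T := T) fun q hq => hq.1.1
  have hsub : entries p T v ⊆ (S1 ∪ S2) ∪ S3 := by
    intro q hq
    by_cases h1 : q.2 ∈ X ∪ Y
    · exact Or.inl (Or.inr ⟨hq, h1⟩)
    · have h1' := h1
      rw [Finset.mem_union, not_or] at h1'
      by_cases h2 : window p T H q.2 q.1 ∨ p q.2 q.1 ∈ D
      · exact Or.inl (Or.inl ⟨hq.1, h1, h2, by rw [hq.2.2]; exact hq.2.1⟩)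
      · rw [not_or] at h2
        exact Or.inr ⟨hq, h2.1, fun h => h2.1 ((hY q.2 hq.1 h1'.2 q.1).2 h), h2.2, h1'.1⟩
  have hc := Set.ncard_le_ncard hsub ((f1.union f2).union f3)
  have hc2 := Set.ncard_union_le (S1 ∪ S2) S3
  have hc3 := Set.ncard_union_le S1 S2
  have hc4 : S2.ncard ≤ (X ∪ Y).card := by
    rw [← Set.ncard_coe_finset]
    refine Set.ncard_le_ncard_of_injOn Prod.snd (fun q hq => hq.2) ?_ (Finset.finite_toSet _)
    rintro ⟨i, t⟩ hq ⟨j, t'⟩ hq' e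
    change t = t' at e
    subst e
    have := hopt.inj (t + 1) hq.1.1 (hq.1.2.2.trans hq'.1.2.2.symm)
    rw [Prod.mk.injEq]; exact ⟨this, rfl⟩
  have hc5 := Finset.card_union_le X Y
  have hc6 : (X ∪ Y).card * (Fintype.card ι + 2 * P + 1) ≤
      (2 * Fintype.card ι + X.card) * (Fintype.card ι + 2 * P + 1) :=
    Nat.mul_le_mul_right _ (by omega)
  have hc7 : (X ∪ Y).card * (Fintype.card ι + 2 * P + 1) =
      (X ∪ Y).card * (Fintype.card ι + 2 * P) + (X ∪ Y).card := by ring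
  omega

/-- Outside the windows of a set that contains the far end of a corridor, a robot traverses a deep
edge at most four times. -/
theorem Corridor.crosses_le_four {q : ℕ → V} {M : ℕ} (hq : Corridor G q M) (hopt : Opt G p T) {j : ℕ}
    (hj : Fintype.card ι < j) (hjM : j + 1 < M) (hM : q M ∈ H) (i : ι) :
    {t | t < T ∧ ¬ window p T H t i ∧ Crosses q p i j t}.ncard ≤ 4 := by
  classical
  obtain ⟨β, hβ, hβ1, hβ2⟩ : ∃ β ≤ T, (∀ τ < β, p τ i ∉ H) ∧ (β < T → p β i ∈ H) := by
    by_cases h : ∃ τ, τ < T ∧ p τ i ∈ H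
    · refine ⟨Nat.find h, (Nat.find_spec h).1.le, fun τ hτ hH => ?_, fun _ => (Nat.find_spec h).2⟩
      exact Nat.find_min h hτ ⟨hτ.trans (Nat.find_spec h).1, hH⟩
    · push Not at h
      exact ⟨T, le_rfl, h, fun h => absurd h (lt_irrefl _)⟩
  obtain ⟨α, hα1, hα2⟩ : ∃ α, (∀ τ, α ≤ τ → τ < T → p τ i ∉ H) ∧
      (0 < α → ∃ τ, α ≤ τ + 1 ∧ τ ≤ T ∧ p τ i ∈ H) := by
    have hex : ∃ α, ∀ τ, α ≤ τ → τ ≤ T → p τ i ∉ H := ⟨T + 1, fun τ h1 h2 => by omega⟩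
    refine ⟨Nat.find hex, fun τ h1 h2 => Nat.find_spec hex τ h1 h2.le, fun hpos => ?_⟩
    have := Nat.find_min hex (Nat.sub_lt hpos one_pos)
    push Not at this
    obtain ⟨τ, h1, h2, h3⟩ := this
    exact ⟨τ, by omega, h2, h3⟩
  have h1 := hq.crosses_le_two hopt (i := i) (α := 0) hj hjM hβ fun τ _ h2 e => hβ1 τ h2 (e ▸ hM)
  have h2 := hq.crosses_le_two hopt (i := i) (α := α) hj hjM le_rfl
    fun τ h1 h2 e => hα1 τ h1 h2 (e ▸ hM)
  have f1 : {t | 0 ≤ t ∧ t < β ∧ Crosses q p i j t}.Finite :=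
    (Set.finite_lt_nat β).subset fun t ht => ht.2.1
  have f2 : {t | α ≤ t ∧ t < T ∧ Crosses q p i j t}.Finite :=
    (Set.finite_lt_nat T).subset fun t ht => ht.2.1
  refine (Set.ncard_le_ncard ?_ (f1.union f2)).trans ((Set.ncard_union_le _ _).trans (by omega))
  rintro t ⟨ht, hw, hc⟩
  by_cases h3 : t < β
  · exact Or.inl ⟨Nat.zero_le _, h3, hc⟩
  · right
    refine ⟨?_, ht, hc⟩
    by_contra h4
    obtain ⟨τ, h5, h6, h7⟩ := hα2 (by omega)
    exact hw ⟨⟨β, by omega, hβ2 (by omega)⟩, τ, by omega, h6, h7⟩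

/-- The number of entries of an inner vertex of a corridor in terms of traversals of its edges. -/
theorem Corridor.entry_crosses {q : ℕ → V} {M : ℕ} (hq : Corridor G q M) (hopt : Opt G p T) {j : ℕ}
    (hj : 1 < j) (hjM : j < M) {i : ι} {t : ℕ} (ht : t < T) (h1 : p t i ≠ q j)
    (h2 : p (t + 1) i = q j) : Crosses q p i (j - 1) t ∨ Crosses q p i j t := by
  rcases (hopt.step t ht).adj i with e | e
  · exact absurd (e ▸ h2) h1
  · rw [h2] at e
    rcases hq.inner j hj hjM _ e.symm with h | h
    · left; left; exact ⟨h, by rw [h2, Nat.sub_add_cancel (by omega)]⟩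
    · right; right; exact ⟨h, h2⟩

end Windows

theorem exists_geodesic (hG : G.Connected) (v w : V) :
    ∃ u : ℕ → V, u 0 = v ∧ u (G.dist v w) = w ∧ (∀ i, i < G.dist v w → G.Adj (u i) (u (i + 1))) ∧
      ∀ i ≤ G.dist v w, G.dist v (u i) = i := by
  obtain ⟨P, hP⟩ := hG.exists_walk_length_eq_dist v w
  refine ⟨P.getVert, P.getVert_zero, ?_, ?_, ?_⟩
  · rw [← hP]; exact P.getVert_length
  · intro i hi; exact P.adj_getVert_succ (by omega)
  · intro i hi
    have h1 : G.dist v (P.getVert i) ≤ i :=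
      (dist_le (P.take i)).trans (by rw [Walk.take_length]; omega)
    have h2 : G.dist (P.getVert i) w ≤ G.dist v w - i :=
      (dist_le (P.drop i)).trans (by rw [Walk.drop_length]; omega)
    have h3 := hG.dist_triangle (u := v) (v := P.getVert i) (w := w)
    omega

theorem Univ.mono {H : Set V} {N P P' : ℕ} (h : Univ G ι H N P) (hP : P ≤ P') : Univ G ι H N P' :=
  fun x y h1 h2 h3 h4 h5 => (h x y h1 h2 h3 h4 h5).mono hP

theorem Cheap.mono {D : Set V} {P P' : ℕ} (h : Cheap G ι D P) (hP : P ≤ P') : Cheap G ι D P' :=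
  fun x y c h1 => (h x y c h1).mono hP

end GCMP

namespace GCMP
set_option linter.unusedSectionVars false
variable {V ι : Type*} [Fintype ι] [DecidableEq V] [DecidableEq ι] {G : SimpleGraph V}

theorem visits_arith {k P c a b X : ℕ} (hk : 1 ≤ k) (hP : P ≤ c * k ^ 4) (hX : X ≤ a * k) :
    (2 * k + X) * (k + 2 * P + 1) + 2 * P + b * k ≤ ((2 + a) * (2 + 2 * c) + 2 * c + b) * k ^ 5 := by
  have h1 : k ≤ k ^ 4 := Nat.le_self_pow (by norm_num) k
  have h2 : k ^ 4 ≤ k ^ 5 := Nat.pow_le_pow_right hk (by norm_num)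
  have h3 : 1 ≤ k ^ 4 := Nat.one_le_pow _ _ hk
  have h4 : k + 2 * P + 1 ≤ (2 + 2 * c) * k ^ 4 := by
    have : (2 + 2 * c) * k ^ 4 = 2 * k ^ 4 + 2 * (c * k ^ 4) := by ring
    omega
  have h5 : 2 * k + X ≤ (2 + a) * k := by
    have : (2 + a) * k = 2 * k + a * k := by ring
    omega
  have h6 := Nat.mul_le_mul h5 h4
  have h7 : (2 + a) * k * ((2 + 2 * c) * k ^ 4) = (2 + a) * (2 + 2 * c) * k ^ 5 := by ring
  have h8 : 2 * P ≤ 2 * c * k ^ 5 := by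
    have := Nat.mul_le_mul_left c h2
    have : 2 * c * k ^ 5 = 2 * (c * k ^ 5) := by ring
    omega
  have h9 : b * k ≤ b * k ^ 5 := Nat.mul_le_mul_left b (h1.trans h2)
  have h10 : ((2 + a) * (2 + 2 * c) + 2 * c + b) * k ^ 5 =
    (2 + a) * (2 + 2 * c) * k ^ 5 + 2 * c * k ^ 5 + b * k ^ 5 := by ring
  omega

/-- The sequence `u 0, …, u r` is a shortest path. -/
structure Geodesic (G : SimpleGraph V) (u : ℕ → V) (r : ℕ) : Prop where
  adj : ∀ i, i < r → G.Adj (u i) (u (i + 1))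
  dist : ∀ i ≤ r, G.dist (u 0) (u i) = i

theorem Geodesic.inj {u : ℕ → V} {r i j : ℕ} (h : Geodesic G u r) (hi : i ≤ r) (hj : j ≤ r)
    (e : u i = u j) : i = j := by
  rw [← h.dist i hi, ← h.dist j hj, e]

theorem Geodesic.card_image {u : ℕ → V} {r a b : ℕ} (h : Geodesic G u r) (hb : b ≤ r) :
    ((Finset.Icc a b).image u).card = b + 1 - a := by
  rw [Finset.card_image_of_injOn, Nat.card_Icc]
  intro i hi j hj e
  simp only [Finset.coe_Icc, Set.mem_Icc] at hi hj
  exact h.inj (by omega) (by omega) e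

section Hub

variable [Fintype V] {m r : ℕ} {u : ℕ → V}

/-- A small universal set around a nice vertex and a piece of a geodesic that leads to it. -/
theorem Geodesic.exists_hub (hu : Geodesic G u r) (hG : G.Connected) (hm : 2 ≤ m)
    (hk : 3 * Fintype.card ι ≤ m) (hw : Nice G m (u r)) {j : ℕ} (hj : j ≤ r) (hrj : r ≤ j + 10 * m) :
    ∃ H : Set V, Univ G ι H (Fintype.card ι) (36 * (13 * m) ^ 4) ∧ 3 * Fintype.card ι ≤ H.ncard ∧
      (∀ i, j ≤ i → i ≤ r → u i ∈ H) ∧ ∀ h ∈ H, j ≤ G.dist (u 0) h ∨ r ≤ G.dist (u 0) h + m := by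
  obtain ⟨A, B, hJ, hA, hB⟩ := hw.exists_junction hm
  set w := u r with hwdef
  set L : Finset V := (Finset.Icc j r).image u with hL
  have hLmem : ∀ z, z ∈ L ↔ ∃ i, j ≤ i ∧ i ≤ r ∧ u i = z := by
    intro z; simp [hL, and_assoc]
  set H : Finset V := insert w A ∪ insert w B ∪ L with hH
  have cA : Conn G ((insert w A : Finset V) : Set V) := by
    apply conn_of_joined (w := w)
    rw [Finset.coe_insert]
    rintro a (rfl | ha)
    · exact Joined.refl (Or.inl rfl)
    · exact hJ.joined_A a ha
  have cB : Conn G ((insert w B : Finset V) : Set V) := by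
    apply conn_of_joined (w := w)
    rw [Finset.coe_insert]
    rintro a (rfl | ha)
    · exact Joined.refl (Or.inl rfl)
    · exact hJ.joined_B a ha
  have cL : Conn G (L : Set V) := by
    have : (L : Set V) = {z | ∃ i, j ≤ i ∧ i ≤ r ∧ u i = z} := by
      ext z; exact hLmem z
    rw [this]
    exact conn_seq fun i _ h2 => hu.adj i h2
  have cH : Conn G (H : Set V) := by
    rw [hH, Finset.coe_union, Finset.coe_union]
    refine (cA.union_of_mem cB (a := w) (by simp) (by simp)).union_of_mem cL (a := w) (by simp) ?_
    exact (hLmem w).2 ⟨r, hj, le_rfl, rfl⟩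
  have cardA : (insert w A).card = m + 1 := by rw [Finset.card_insert_of_notMem hJ.notMem_A, hA]
  have cardB : (insert w B).card = m + 1 := by rw [Finset.card_insert_of_notMem hJ.notMem_B, hB]
  have hcard : H.card ≤ 13 * m := by
    have h1 := Finset.card_union_le (insert w A ∪ insert w B) L
    have h2 : insert w A ∪ insert w B = insert w A ∪ B := by
      ext z; simp only [Finset.mem_union, Finset.mem_insert]; tauto
    have h3 := Finset.card_union_le (insert w A) B
    have h4 : L.card ≤ 10 * m + 1 := by
      rw [hL, hu.card_image le_rfl]; omega
    rw [h2] at h1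
    have e : H.card = (insert w A ∪ B ∪ L).card := by rw [hH, h2]
    omega
  refine ⟨H, ((hJ.mono (by omega)).univ (W := (H : Set V)) (by simp [hH]) ?_ ?_ cH).mono ?_, ?_, ?_, ?_⟩
  · intro z hz
    rw [Finset.mem_coe] at hz ⊢
    simp only [hH, Finset.mem_union, Finset.mem_insert]; tauto
  · intro z hz
    rw [Finset.mem_coe] at hz ⊢
    simp only [hH, Finset.mem_union, Finset.mem_insert]; tauto
  · rw [Set.ncard_coe_finset]
    exact Nat.mul_le_mul_left _ (Nat.pow_le_pow_left hcard 4)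
  · rw [Set.ncard_coe_finset]
    have : A ⊆ H := fun z hz => by simp only [hH, Finset.mem_union, Finset.mem_insert]; tauto
    have := Finset.card_le_card this
    omega
  · intro i h1 h2
    simp only [hH, Finset.coe_union]
    exact Or.inr ((hLmem _).2 ⟨i, h1, h2, rfl⟩)
  · intro h hh
    have key : ∀ S : Finset V, S.card = m + 1 → Conn G (S : Set V) → w ∈ S → h ∈ S →
        r ≤ G.dist (u 0) h + m := by
      intro S h1 h2 h3 h4
      have h5 := (h2 h h4 w h3).dist_lt
      have h6 := hG.dist_triangle (u := u 0) (v := h) (w := w)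
      rw [hwdef, hu.dist r le_rfl] at h6
      rw [hwdef] at h5
      omega
    rw [hH, Finset.coe_union, Finset.coe_union] at hh
    rcases hh with (hh | hh) | hh
    · exact Or.inr (key _ cardA cA (by simp) hh)
    · exact Or.inr (key _ cardB cB (by simp) hh)
    · obtain ⟨i, h1, h2, rfl⟩ := (hLmem _).1 hh
      left; rw [hu.dist i h2]; exact h1

theorem Geodesic.degree (hu : Geodesic G u r) (hm : 0 < m) {i : ℕ} (hi : m ≤ i) (hir : i + m ≤ r)
    (hn : ¬ Nice G m (u i)) {z : V} (hz : G.Adj (u i) z) : z = u (i - 1) ∨ z = u (i + 1) := by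
  have harms : Arms G m (u i) ((Finset.Icc 0 (i - 1)).image u) ((Finset.Icc (i + 1) r).image u) := by
    refine ⟨?_, ?_, ?_, ?_, ?_, ?_, ?_⟩
    · simp only [Finset.mem_image, Finset.mem_Icc, not_exists, not_and]
      intro j h1 e
      have := hu.inj (by omega) (by omega) e
      omega
    · simp only [Finset.mem_image, Finset.mem_Icc, not_exists, not_and]
      intro j h1 e
      have := hu.inj (by omega) (by omega) e
      omega
    · rw [Finset.disjoint_left]
      simp only [Finset.mem_image, Finset.mem_Icc]
      rintro _ ⟨a, ha, rfl⟩ ⟨b, hb, e⟩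
      have := hu.inj (by omega) (by omega) e
      omega
    · simp only [Finset.mem_image, Finset.mem_Icc]
      rintro _ ⟨a, ha, rfl⟩
      refine joined_seq (by omega) (fun j _ _ => hu.adj j (by omega)) fun j h1 h2 => ?_
      by_cases e : j = i
      · left; rw [e]
      · right; simp only [Finset.coe_image, Finset.coe_Icc, Set.mem_image, Set.mem_Icc]
        exact ⟨j, by omega, rfl⟩
    · simp only [Finset.mem_image, Finset.mem_Icc]
      rintro _ ⟨a, ha, rfl⟩
      refine (joined_seq (by omega) (fun j _ _ => hu.adj j (by omega)) fun j h1 h2 => ?_).symm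
      by_cases e : j = i
      · left; rw [e]
      · right; simp only [Finset.coe_image, Finset.coe_Icc, Set.mem_image, Set.mem_Icc]
        exact ⟨j, by omega, rfl⟩
    · rw [hu.card_image (by omega)]; omega
    · rw [hu.card_image (by omega)]; omega
  obtain ⟨a, ha, b, hb, -, -, h⟩ := harms.degree hm hn
  have h1 : G.Adj (u i) (u (i - 1)) := by
    have := hu.adj (i - 1) (by omega)
    rw [Nat.sub_add_cancel (by omega)] at this
    exact this.symm
  have h2 : G.Adj (u i) (u (i + 1)) := hu.adj i (by omega)
  have h3 : u (i - 1) ≠ u (i + 1) := fun e => by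
    have := hu.inj (by omega) (by omega) e
    omega
  have e1 := h _ h1
  have e2 := h _ h2
  rcases h z hz with rfl | rfl
  · rcases e1 with e1 | e1
    · exact Or.inl e1.symm
    · rcases e2 with e2 | e2
      · exact Or.inr e2.symm
      · exact absurd (e1.trans e2.symm) h3
  · rcases e1 with e1 | e1
    · rcases e2 with e2 | e2
      · exact absurd (e1.trans e2.symm) h3
      · exact Or.inr e2.symm
    · exact Or.inl e1.symm

variable {p : ℕ → ι → V} {T : ℕ}

/-- The start of the geodesic is close to a nice vertex. -/
theorem Geodesic.entries_near (hu : Geodesic G u r) (hG : G.Connected) (hopt : Opt G p T)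
    (hm : 2 ≤ m) (hk : 3 * Fintype.card ι ≤ m) (hw : Nice G m (u r)) (hr : r ≤ 10 * m) {P : ℕ}
    (hP : 36 * (13 * m) ^ 4 ≤ P) :
    (entries p T (u 0)).ncard ≤ 2 * Fintype.card ι * (Fintype.card ι + 2 * P + 1) + 2 * P := by
  obtain ⟨H, h1, h2, h3, -⟩ := hu.exists_hub (ι := ι) hG hm hk hw (Nat.zero_le r) (by omega)
  have hv : u 0 ∈ H := h3 0 le_rfl (Nat.zero_le _)
  have := hopt.entries_le (D := ∅) (by simp) (h1.mono hP) cheap_empty (Or.inl h2) ∅ (by simp) (u 0)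
  convert this using 1
  have e : {q : ι × ℕ | q ∈ entries p T (u 0) ∧ ¬ window p T H q.2 q.1 ∧
      ¬ window p T H (q.2 + 1) q.1 ∧ p q.2 q.1 ∉ (∅ : Set V) ∧ q.2 ∉ (∅ : Finset ℕ)} = ∅ := by
    ext ⟨i, t⟩
    simp only [Set.mem_ofPred_eq, Set.mem_empty_iff_false, iff_false]
    rintro ⟨⟨ht, -, hv'⟩, -, hw, -⟩
    exact hw ⟨⟨t + 1, le_rfl, by simpa [hv'] using hv⟩, t + 1, le_rfl, ht, by simpa [hv'] using hv⟩
  rw [e]; simp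

/-- The start of the geodesic lies in a small dead end. -/
theorem Geodesic.entries_dead (hu : Geodesic G u r) (hG : G.Connected) (hopt : Opt G p T)
    (hm : 2 ≤ m) (hk : 3 * Fintype.card ι ≤ m) (hw : Nice G m (u r)) (hr : 10 * m < r)
    (hn : ∀ z, G.dist (u 0) z < r → ¬ Nice G m z) {E : Finset V} (hEc : Conn G (E : Set V))
    (h0E : u 0 ∈ E) (hEK : ∀ i, m ≤ i → i ≤ 5 * m → u i ∉ E) (hE1 : u (m - 1) ∈ E)
    (hcl : ∀ a ∈ E, ∀ z, G.Adj a z → z ∈ E ∨ ∃ i, m ≤ i ∧ i ≤ 5 * m ∧ u i = z)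
    (hE : E.card ≤ 4 * m) {P : ℕ} (hP : 36 * (13 * m) ^ 4 ≤ P) :
    (entries p T (u 0)).ncard ≤
      (2 * Fintype.card ι + 4 * Fintype.card ι) * (Fintype.card ι + 2 * P + 1) + 2 * P := by
  obtain ⟨H, h1, h2, h3, h4⟩ := hu.exists_hub (ι := ι) (j := r - m) hG hm hk hw (by omega) (by omega)
  have hdeg : ∀ i, m ≤ i → i + m ≤ r → ∀ z, G.Adj (u i) z → z = u (i - 1) ∨ z = u (i + 1) :=
    fun i h5 h6 z hz => hu.degree (by omega) h5 h6
      (hn _ (by rw [hu.dist i (by omega)]; omega)) hz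
  have hdE : ∀ z ∈ E, G.dist (u 0) z < 4 * m := fun z hz =>
    ((hEc _ h0E z hz).dist_lt).trans_le hE
  have hq : Corridor G (fun a => u (m + a - 1)) (r - 2 * m + 1) := by
    refine ⟨by omega, ?_, ?_, ?_, ?_⟩
    · intro a b h5 h6 h7 h8 e
      have := hu.inj (by omega) (by omega) e
      omega
    · intro a h5 h6
      have := hu.adj (m + a - 1) (by omega)
      rwa [show m + a - 1 + 1 = m + (a + 1) - 1 by omega] at this
    · intro a h5 h6 z hz
      have := hdeg (m + a - 1) (by omega) (by omega) z hz
      rwa [show m + a - 1 + 1 = m + (a + 1) - 1 by omega,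
        show m + a - 1 - 1 = m + (a - 1) - 1 by omega] at this
    · intro hadj
      rcases hdeg (m + 1 - 1) (by omega) (by omega) _ hadj with e | e
      · have := hu.inj (by omega) (by omega) e; omega
      · have := hu.inj (by omega) (by omega) e; omega
  set L : Finset V := (Finset.Icc m (3 * m)).image u with hL
  have hLmem : ∀ z, z ∈ L ↔ ∃ i, m ≤ i ∧ i ≤ 3 * m ∧ u i = z := by
    intro z; simp [hL, and_assoc]
  set D : Finset V := E ∪ L with hD
  have hDmem : ∀ z, z ∈ (D : Set V) ↔ z ∈ E ∨ ∃ i, m ≤ i ∧ i ≤ 3 * m ∧ u i = z := by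
    intro z; rw [hD, Finset.mem_coe, Finset.mem_union, hLmem]
  have hDconn : Conn G (D : Set V) := by
    rw [hD, Finset.coe_union]
    have cL : Conn G (L : Set V) := by
      have : (L : Set V) = {z | ∃ i, m ≤ i ∧ i ≤ 3 * m ∧ u i = z} := by
        ext z; exact hLmem z
      rw [this]
      exact conn_seq fun i _ h2 => hu.adj i (by omega)
    refine hEc.union cL hE1 ((hLmem _).2 ⟨m, le_rfl, by omega, rfl⟩) ?_
    have := hu.adj (m - 1) (by omega)
    rwa [Nat.sub_add_cancel (by omega)] at this
  have hLcard : L.card = 2 * m + 1 := by rw [hL, hu.card_image (by omega)]; omega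
  have hD1 : D.card ≤ 13 * m := by
    have := Finset.card_union_le E L
    rw [← hD] at this
    omega
  have hD2 : Fintype.card ι < D.card := by
    have := Finset.card_le_card (Finset.subset_union_right (s₁ := E) (s₂ := L))
    rw [← hD] at this
    omega
  have hout : u (3 * m + 1) ∉ (D : Set V) := by
    rw [hDmem]
    rintro (h | ⟨i, h5, h6, e⟩)
    · exact hEK _ (by omega) (by omega) h
    · have := hu.inj (by omega) (by omega) e; omega
  have hnc : NotCycle (G.induce (D : Set V)) := by
    refine ⟨⟨u (3 * m), (hDmem _).2 (Or.inr ⟨_, by omega, le_rfl, rfl⟩)⟩, fun hcard => ?_⟩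
    have hle : ((G.induce (D : Set V)).neighborSet
        ⟨u (3 * m), (hDmem _).2 (Or.inr ⟨_, by omega, le_rfl, rfl⟩)⟩).ncard ≤ 1 := by
      rw [Set.ncard_le_one (Set.toFinite _)]
      have : ∀ z : (D : Set V), G.Adj (u (3 * m)) z → (z : V) = u (3 * m - 1) := by
        rintro ⟨z, hz⟩ hadj
        rcases hdeg (3 * m) (by omega) (by omega) z hadj with e | e
        · exact e
        · rw [e] at hz; exact absurd hz hout
      intro a ha b hb
      exact Subtype.ext ((this a ha).trans (this b hb).symm)
    omega
  have hcheap : Cheap G ι (D : Set V) P := by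
    refine (cheap_of_connected hDconn hnc ?_).mono (le_trans ?_ hP)
    · rw [Set.ncard_coe_finset]; exact hD2
    · rw [Set.ncard_coe_finset]
      exact Nat.mul_le_mul_left _ (Nat.pow_le_pow_left hD1 4)
  have hdisj : Disjoint H (D : Set V) := by
    rw [Set.disjoint_left]
    intro z hz hzD
    have h5 := h4 z hz
    rcases (hDmem z).1 hzD with h | ⟨i, h6, h7, rfl⟩
    · have := hdE z h; omega
    · rw [hu.dist i (by omega)] at h5; omega
  have hM : (fun a => u (m + a - 1)) (r - 2 * m + 1) ∈ H := by
    beta_reduce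
    exact h3 _ (by omega) (by omega)
  have hcross := hq.crosses_le_four hopt (j := 2 * m + 1) (H := H) (by omega) (by omega) hM
  obtain ⟨X, hX, hXm⟩ := exists_times (T := T) (fun i t ht => ht.1) _ hcross
  have hbd : ∀ a ∈ (D : Set V), ∀ b ∉ (D : Set V), G.Adj a b → a = u (3 * m) ∧ b = u (3 * m + 1) := by
    intro a ha b hb hab
    have hb' : ∀ i, m ≤ i → i ≤ 3 * m → b ≠ u i := fun i h5 h6 e =>
      hb ((hDmem b).2 (Or.inr ⟨i, h5, h6, e.symm⟩))
    have hbE : b ∉ E := fun h => hb ((hDmem b).2 (Or.inl h))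
    rcases (hDmem a).1 ha with h | ⟨i, h5, h6, rfl⟩
    · exfalso
      rcases hcl a h b hab with h5 | ⟨i, h5, h6, rfl⟩
      · exact hbE h5
      · by_cases h7 : i ≤ 3 * m
        · exact hb' i h5 h7 rfl
        · rcases hdeg i h5 (by omega) a hab.symm with e | e
          · subst e
            exact hEK _ (by omega) (by omega) h
          · subst e
            have h8 := hdE _ h
            rw [hu.dist _ (by omega)] at h8
            by_cases h9 : i + 1 ≤ 5 * m
            · exact hEK _ (by omega) h9 h
            · omega
    · rcases hdeg i h5 (by omega) b hab with e | e
      · exfalso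
        subst e
        by_cases h7 : i = m
        · subst h7; exact hbE hE1
        · exact hb' (i - 1) (by omega) (by omega) rfl
      · by_cases h7 : i = 3 * m
        · subst h7; exact ⟨rfl, e⟩
        · exact absurd e (hb' (i + 1) (by omega) (by omega))
  have hXprop : ∀ t < T, t ∉ X → ∀ i, ¬ window p T H t i → ¬ window p T H (t + 1) i →
      (p t i ∈ (D : Set V) ↔ p (t + 1) i ∈ (D : Set V)) := by
    intro t ht htX i hw _
    have hnc : ¬ Crosses (fun a => u (m + a - 1)) p i (2 * m + 1) t := fun hc => htX (hXm i t ⟨ht, hw, hc⟩)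
    have e1 : m + (2 * m + 1) - 1 = 3 * m := by omega
    have e2 : m + (2 * m + 1 + 1) - 1 = 3 * m + 1 := by omega
    simp only [Crosses, e1, e2, not_or] at hnc
    rcases (hopt.step t ht).adj i with e | e
    · rw [e]
    · constructor
      · intro h5
        by_contra h6
        exact hnc.1 (hbd _ h5 _ h6 e)
      · intro h5
        by_contra h6
        exact hnc.2 (hbd _ h5 _ h6 e.symm).symm
  have := hopt.entries_le hdisj (h1.mono hP) hcheap (Or.inl h2) X hXprop (u 0)
  have e : {q : ι × ℕ | q ∈ entries p T (u 0) ∧ ¬ window p T H q.2 q.1 ∧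
      ¬ window p T H (q.2 + 1) q.1 ∧ p q.2 q.1 ∉ (D : Set V) ∧ q.2 ∉ X} = ∅ := by
    ext ⟨i, t⟩
    simp only [Set.mem_ofPred_eq, Set.mem_empty_iff_false, iff_false]
    rintro ⟨⟨ht, -, hv'⟩, hw, hw', h5, h6⟩
    refine h5 ((hXprop t ht h6 i hw hw').2 ?_)
    rw [show p (t + 1) i = u 0 from hv']
    exact (hDmem _).2 (Or.inl h0E)
  rw [e, Set.ncard_empty, add_zero] at this
  refine this.trans ?_
  have hX' : X.card ≤ 4 * Fintype.card ι := by simpa [mul_comm] using hX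
  gcongr

/-- The start of the geodesic lies deep inside a corridor. -/
theorem Geodesic.entries_deep (hu : Geodesic G u r) (hG : G.Connected) (hopt : Opt G p T)
    (hm : 2 ≤ m) (hk : 3 * Fintype.card ι ≤ m) (hw : Nice G m (u r)) (hr : 10 * m < r)
    (hn : ∀ z, G.dist (u 0) z < r → ¬ Nice G m z) {E : Finset V} (hEc : Conn G (E : Set V))
    (hEK : ∀ i, m ≤ i → i ≤ 5 * m → u i ∉ E) (hE1 : u (m - 1) ∈ E)
    (hcl : ∀ a ∈ E, ∀ z, G.Adj a z → z ∈ E ∨ ∃ i, m ≤ i ∧ i ≤ 5 * m ∧ u i = z)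
    (hE : 4 * m < E.card) {P : ℕ} (hP : 36 * (13 * m) ^ 4 ≤ P) :
    (entries p T (u 0)).ncard ≤
      2 * Fintype.card ι * (Fintype.card ι + 2 * P + 1) + 2 * P + 8 * Fintype.card ι := by
  obtain ⟨H, h1, h2, h3, h4⟩ := hu.exists_hub (ι := ι) (j := r - m) hG hm hk hw (by omega) (by omega)
  have hdeg : ∀ i, m ≤ i → i + m ≤ r → ∀ z, G.Adj (u i) z → z = u (i - 1) ∨ z = u (i + 1) :=
    fun i h5 h6 z hz => hu.degree (by omega) h5 h6
      (hn _ (by rw [hu.dist i (by omega)]; omega)) hz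
  set K : Finset V := (Finset.Icc m (5 * m)).image u with hK
  have hKmem : ∀ z, z ∈ K ↔ ∃ i, m ≤ i ∧ i ≤ 5 * m ∧ u i = z := by
    intro z; simp [hK, and_assoc]
  have hKc : Conn G (K : Set V) := by
    have : (K : Set V) = {z | ∃ i, m ≤ i ∧ i ≤ 5 * m ∧ u i = z} := by
      ext z; exact hKmem z
    rw [this]
    exact conn_seq fun i _ h2 => hu.adj i (by omega)
  have hKE : Disjoint K E := by
    rw [Finset.disjoint_left]
    intro z hz hzE
    obtain ⟨i, h5, h6, rfl⟩ := (hKmem z).1 hz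
    exact hEK i h5 h6 hzE
  have hadj1 : G.Adj (u m) (u (m - 1)) := by
    have := hu.adj (m - 1) (by omega)
    rw [Nat.sub_add_cancel (by omega)] at this
    exact this.symm
  obtain ⟨f, hf0, hf1, hfE, hfinj, hfadj, hfdeg, -⟩ := exists_peel hG (by omega : 0 < m) (3 * m) hKc
    hEc hKE (fun a ha z hz => (hcl a ha z hz).imp_right (hKmem z).2)
    ((hKmem _).2 ⟨m, le_rfl, by omega, rfl⟩) hE1 hadj1 (by rw [hK, hu.card_image (by omega)]; omega)
    (by omega) (fun z hz => hn z (by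
      have := hG.dist_triangle (u := u 0) (v := u m) (w := z)
      rw [hu.dist m (by omega)] at this
      omega))
  have hfdist : ∀ i ≤ 3 * m + 1, G.dist (u 0) (f i) ≤ m + i := by
    intro i
    induction i with
    | zero => intro _; rw [hf0, hu.dist m (by omega)]; omega
    | succ i ih =>
      intro hi
      have h5 := ih (by omega)
      have h6 := hG.dist_triangle (u := u 0) (v := f i) (w := f (i + 1))
      rw [dist_eq_one_iff_adj.2 (hfadj i (by omega))] at h6
      omega
  have hfu : ∀ i ≤ m, f i = u (m - i) := by
    intro i
    induction i using Nat.strong_induction_on with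
    | _ i ih =>
      intro hi
      rcases Nat.lt_or_ge i 2 with h5 | h5
      · interval_cases i
        · exact hf0
        · exact hf1
      · have e1 := ih (i - 1) (by omega) (by omega)
        have e2 := ih (i - 2) (by omega) (by omega)
        have h6 := hu.adj (m - i) (by omega)
        rw [show m - i + 1 = m - (i - 1) by omega, ← e1] at h6
        rcases hfdeg (i - 1) (by omega) (by omega) _ h6.symm with e | e
        · rw [show i - 1 - 1 = i - 2 by omega, e2] at e
          have := hu.inj (by omega) (by omega) e
          omega
        · rw [Nat.sub_add_cancel (by omega)] at e
          exact e.symm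
  set q : ℕ → V := fun a => if a ≤ 2 * m then f (3 * m + 1 - a) else u (a - 2 * m - 1) with hqdef
  have hqf : ∀ a, a ≤ 3 * m + 1 → q a = f (3 * m + 1 - a) := by
    intro a ha
    simp only [hqdef]
    by_cases h5 : a ≤ 2 * m
    · rw [if_pos h5]
    · rw [if_neg h5, hfu _ (by omega)]
      congr 1; omega
  have hqu : ∀ a, 2 * m + 1 ≤ a → q a = u (a - 2 * m - 1) := by
    intro a ha
    simp only [hqdef]
    rw [if_neg (by omega)]
  have hfu' : ∀ a b, a ≤ 3 * m → 3 * m + 1 ≤ b → b ≤ r + m + 1 → 1 ≤ a → q a ≠ q b := by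
    intro a b h5 h6 h7 h8 e
    rw [hqf a (by omega), hqu b (by omega)] at e
    have h9 := hfE (3 * m + 1 - a) (by omega) (by omega)
    rw [e] at h9
    by_cases h10 : b - 2 * m - 1 ≤ 5 * m
    · exact hEK _ (by omega) h10 h9
    · have h11 := hfdist (3 * m + 1 - a) (by omega)
      rw [e, hu.dist _ (by omega)] at h11
      omega
  have hq : Corridor G q (r + m + 1) := by
    refine ⟨by omega, ?_, ?_, ?_, ?_⟩
    · intro a b h5 h6 h7 h8 e
      by_cases h9 : a ≤ 3 * m <;> by_cases h10 : b ≤ 3 * m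
      · rw [hqf a (by omega), hqf b (by omega)] at e
        have := hfinj _ _ (by omega) (by omega) (by omega) (by omega) e
        omega
      · exact absurd e (hfu' a b h9 (by omega) h8 h5)
      · exact absurd e.symm (hfu' b a h10 (by omega) h6 h7)
      · rw [hqu a (by omega), hqu b (by omega)] at e
        have := hu.inj (by omega) (by omega) e
        omega
    · intro a h5 h6
      by_cases h9 : a ≤ 3 * m
      · rw [hqf a (by omega), hqf (a + 1) (by omega)]
        have := hfadj (3 * m + 1 - (a + 1)) (by omega)
        rw [show 3 * m + 1 - (a + 1) + 1 = 3 * m + 1 - a by omega] at this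
        exact this.symm
      · rw [hqu a (by omega), hqu (a + 1) (by omega)]
        have := hu.adj (a - 2 * m - 1) (by omega)
        rwa [show a - 2 * m - 1 + 1 = a + 1 - 2 * m - 1 by omega] at this
    · intro a h5 h6 z hz
      by_cases h9 : a ≤ 3 * m
      · rw [hqf a (by omega)] at hz
        rw [hqf (a - 1) (by omega), hqf (a + 1) (by omega)]
        have := hfdeg (3 * m + 1 - a) (by omega) (by omega) z hz
        rw [show 3 * m + 1 - a - 1 = 3 * m + 1 - (a + 1) by omega,
          show 3 * m + 1 - a + 1 = 3 * m + 1 - (a - 1) by omega] at this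
        exact this.symm
      · rw [hqu a (by omega)] at hz
        rw [hqu (a - 1) (by omega), hqu (a + 1) (by omega)]
        have := hdeg (a - 2 * m - 1) (by omega) (by omega) z hz
        rwa [show a - 2 * m - 1 - 1 = a - 1 - 2 * m - 1 by omega,
          show a - 2 * m - 1 + 1 = a + 1 - 2 * m - 1 by omega] at this
    · intro hadj
      rw [hqf 1 (by omega), hqu _ (by omega)] at hadj
      rw [show 3 * m + 1 - 1 = 3 * m by omega, show r + m + 1 - 2 * m - 1 = r - m by omega] at hadj
      have h5 := hfdist (3 * m) (by omega)
      have h6 := hG.dist_triangle (u := u 0) (v := f (3 * m)) (w := u (r - m))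
      rw [dist_eq_one_iff_adj.2 hadj, hu.dist _ (by omega)] at h6
      omega
  have hM : q (r + m + 1) ∈ H := by
    rw [hqu _ (by omega)]; exact h3 _ (by omega) (by omega)
  have hv : q (2 * m + 1) = u 0 := by rw [hqu _ le_rfl]; congr 1; omega
  have := hopt.entries_le (D := ∅) (by simp) (h1.mono hP) cheap_empty (Or.inl h2) ∅ (by simp) (u 0)
  refine this.trans ?_
  rw [Finset.card_empty, add_zero]
  refine Nat.add_le_add_left ?_ _
  have c1 := hq.crosses_le_four hopt (j := 2 * m) (by omega) (by omega) hM
  have c2 := hq.crosses_le_four hopt (j := 2 * m + 1) (by omega) (by omega) hM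
  refine (ncard_le_sum_fiber (T := T) (fun q hq => hq.1.1) (fun _ => 8) fun i => ?_).trans
    (by simp [mul_comm])
  have f1 : {t | t < T ∧ ¬ window p T H t i ∧ Crosses q p i (2 * m) t}.Finite :=
    (Set.finite_lt_nat T).subset fun t ht => ht.1
  have f2 : {t | t < T ∧ ¬ window p T H t i ∧ Crosses q p i (2 * m + 1) t}.Finite :=
    (Set.finite_lt_nat T).subset fun t ht => ht.1
  refine (Set.ncard_le_ncard ?_ (f1.union f2)).trans ((Set.ncard_union_le _ _).trans
    (Nat.add_le_add (c1 i) (c2 i)))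
  rintro t ⟨⟨ht, hne, hent⟩, hw, -⟩
  rcases hq.entry_crosses hopt (j := 2 * m + 1) (by omega) (by omega) ht (by rw [hv]; exact hne)
    (by rw [hv]; exact hent) with h | h
  · exact Or.inl ⟨ht, hw, h⟩
  · exact Or.inr ⟨ht, hw, h⟩

/-- The bound on the number of entries of a vertex in a graph with a nice vertex. -/
theorem Opt.entries_of_nice (hG : G.Connected) (hopt : Opt G p T) (hk : 1 ≤ Fintype.card ι) {w : V}
    (hw : Nice G (3 * Fintype.card ι + 3) w) (v : V) :
    (entries p T v).ncard ≤ ((2 + 4) * (2 + 2 * (36 * 78 ^ 4)) + 2 * (36 * 78 ^ 4) + 8) *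
      Fintype.card ι ^ 5 := by
  classical
  set m := 3 * Fintype.card ι + 3 with hm
  obtain ⟨w, hw, hmin⟩ : ∃ w, Nice G m w ∧ ∀ z, G.dist v z < G.dist v w → ¬ Nice G m z := by
    obtain ⟨w, hw, hmin⟩ := Set.exists_min_image {w | Nice G m w} (G.dist v) (Set.toFinite _) ⟨w, hw⟩
    exact ⟨w, hw, fun z hz hz' => absurd (hmin z hz') (by omega)⟩
  obtain ⟨u, rfl, hu1, hu2, hu3⟩ := exists_geodesic hG v w
  set r := G.dist (u 0) w with hr
  have hu : Geodesic G u r := ⟨hu2, hu3⟩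
  have hw' : Nice G m (u r) := by rw [hu1]; exact hw
  have hP : 36 * (13 * m) ^ 4 ≤ 36 * 78 ^ 4 * Fintype.card ι ^ 4 := by
    have h1 : 13 * m ≤ 78 * Fintype.card ι := by omega
    have h2 := Nat.pow_le_pow_left h1 4
    rw [mul_pow 78] at h2
    rw [mul_assoc]
    exact Nat.mul_le_mul_left _ h2
  refine le_trans ?_ (visits_arith (P := 36 * 78 ^ 4 * Fintype.card ι ^ 4) (c := 36 * 78 ^ 4) (a := 4)
    (b := 8) (X := 4 * Fintype.card ι) hk le_rfl le_rfl)
  set P := 36 * 78 ^ 4 * Fintype.card ι ^ 4 with hPdef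
  have hmono : 2 * Fintype.card ι * (Fintype.card ι + 2 * P + 1) ≤
      (2 * Fintype.card ι + 4 * Fintype.card ι) * (Fintype.card ι + 2 * P + 1) :=
    Nat.mul_le_mul_right _ (by omega)
  rcases Nat.lt_or_ge (10 * m) r with h10 | h10
  · set K : Set V := {z | ∃ i, m ≤ i ∧ i ≤ 5 * m ∧ u i = z} with hK
    have h0 : u 0 ∈ Kᶜ := by
      rintro ⟨i, h1, h2, e⟩
      have := hu.inj (by omega) (by omega) e
      omega
    set E : Finset V := (Set.toFinite (comp G Kᶜ (u 0))).toFinset with hE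
    have hEmem : ∀ z, z ∈ E ↔ z ∈ comp G Kᶜ (u 0) := by intro z; simp [hE]
    have hEc : Conn G (E : Set V) := by
      rw [hE, Set.Finite.coe_toFinset]; exact conn_comp
    have h0E : u 0 ∈ E := (hEmem _).2 (Joined.refl h0)
    have hEK : ∀ i, m ≤ i → i ≤ 5 * m → u i ∉ E := fun i h1 h2 h3 =>
      comp_subset ((hEmem _).1 h3) ⟨i, h1, h2, rfl⟩
    have hE1 : u (m - 1) ∈ E := by
      refine (hEmem _).2 (joined_seq (Nat.zero_le _) (fun i _ h2 => hu.adj i (by omega)) ?_)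
      rintro i - h2 ⟨j, h3, h4, e⟩
      have := hu.inj (by omega) (by omega) e
      omega
    have hcl : ∀ a ∈ E, ∀ z, G.Adj a z → z ∈ E ∨ ∃ i, m ≤ i ∧ i ≤ 5 * m ∧ u i = z := by
      intro a ha z hz
      by_cases h : z ∈ K
      · exact Or.inr h
      · exact Or.inl ((hEmem _).2 (comp_closed ((hEmem _).1 ha) h hz))
    rcases Nat.lt_or_ge (4 * m) E.card with h4 | h4
    · have := hu.entries_deep hG hopt (by omega) (by omega) hw' h10 hmin hEc hEK hE1 hcl h4 hP
      omega
    · have := hu.entries_dead hG hopt (by omega) (by omega) hw' h10 hmin hEc h0E hEK hE1 hcl h4 hP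
      omega
  · have := hu.entries_near hG hopt (by omega) (by omega) hw' h10 hP
    omega

end Hub

end GCMP

namespace GCMP
set_option linter.unusedSectionVars false
variable {V ι : Type*} [Fintype ι] [DecidableEq V] [DecidableEq ι] {G : SimpleGraph V}

theorem Joined.of_closed {S A : Set V} {a b : V} (h : Joined G S a b) (ha : a ∈ A)
    (hcl : ∀ x ∈ A, ∀ z ∈ S, G.Adj x z → z ∈ A) : Joined G A a b := by
  obtain ⟨w, hw⟩ := h
  induction w with
  | nil => exact Joined.refl ha
  | @cons a a1 b hadj w ih =>
    have h1 := hcl a ha a1 (hw a1 (by simp)) hadj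
    exact (Joined.of_adj ha h1 hadj).trans (ih h1 fun c hc => hw c (by simp [hc]))

/-- In a graph without nice vertices there is a small connected set with connected complement. -/
theorem exists_small_side [Fintype V] (hG : G.Connected) {m : ℕ} (hm : 0 < m)
    (hn : ∀ u, ¬ Nice G m u) (hcard : 4 * m ≤ Fintype.card V) :
    ∃ O : Finset V, m ≤ O.card ∧ O.card < 4 * m ∧ Conn G (O : Set V) ∧ Conn G ((O : Set V)ᶜ) := by
  classical
  obtain ⟨O, ⟨hOm, hO, hO'⟩, hmin⟩ := Set.exists_min_image
    {O : Finset V | m ≤ O.card ∧ Conn G (O : Set V) ∧ Conn G ((O : Set V)ᶜ)} Finset.card (Set.toFinite _)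
    ⟨Finset.univ, by rw [Finset.card_univ]; omega, by rw [Finset.coe_univ]; exact conn_univ hG,
      by rw [Finset.coe_univ, Set.compl_univ]; exact fun a ha => absurd ha (by simp)⟩
  refine ⟨O, hOm, ?_, hO, hO'⟩
  by_contra hbig
  push Not at hbig
  obtain ⟨f, hf, hfc⟩ : ∃ f ∈ O, Conn G (insert f ((O : Set V)ᶜ)) := by
    obtain ⟨f0, hf0⟩ : O.Nonempty := Finset.card_pos.1 (by omega)
    by_cases hne : ∃ z, z ∉ O
    · obtain ⟨z, hz⟩ := hne
      have hJ : Joined G Set.univ z f0 := conn_univ hG _ (Set.mem_univ _) _ (Set.mem_univ _)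
      obtain ⟨x, f, hx, hxf, hfO, -⟩ := hJ.exit_set (Z := (O : Set V)) hz hf0
      exact ⟨f, hfO, hO'.insert hx.right_mem.2 hxf⟩
    · push Not at hne
      refine ⟨f0, hf0, conn_of_joined (w := f0) ?_⟩
      rintro a (rfl | ha)
      · exact Joined.refl (Or.inl rfl)
      · exact absurd (hne a) ha
  set S : Set V := (O : Set V) \ {f} with hS
  have hexit : ∀ z ∈ S, ∃ x, Joined G S z x ∧ G.Adj x f := fun z hz =>
    (hO z hz.1 f hf).exit hz.2
  have hsmall : ∀ y ∈ S, (comp G S y).ncard < m := by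
    intro y hy
    by_contra hcon
    push Not at hcon
    have hCf := Set.toFinite (comp G S y)
    have h1 := hmin hCf.toFinset ⟨by rwa [← Set.ncard_eq_toFinset_card _ hCf], by
      rw [Set.Finite.coe_toFinset]; exact conn_comp, by
      rw [Set.Finite.coe_toFinset]
      have hfC : f ∉ comp G S y := fun h => (comp_subset h).2 rfl
      have hsub : insert f ((O : Set V)ᶜ) ⊆ (comp G S y)ᶜ := by
        rintro z (rfl | hz) h
        · exact hfC h
        · exact hz (comp_subset h).1
      apply conn_of_joined (w := f)
      intro z hz
      by_cases hzS : z ∈ S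
      · obtain ⟨x, hx, hxf⟩ := hexit z hzS
        have h2 := hx.of_closed (A := S \ comp G S y) ⟨hzS, hz⟩ (by
          rintro b ⟨hb, hb'⟩ c hc hbc
          exact ⟨hc, fun h => hb' (comp_closed h hb hbc.symm)⟩)
        exact (h2.mono fun _ h => h.2).trans
          (Joined.of_adj h2.right_mem.2 hfC hxf)
      · refine (hfc z ?_ f (Or.inl rfl)).mono hsub
        by_cases e : z = f
        · exact Or.inl e
        · exact Or.inr fun h => hzS ⟨h, e⟩⟩
    have h2 : hCf.toFinset ⊂ O := by
      rw [Finset.ssubset_iff_of_subset fun z hz => (comp_subset ((Set.Finite.mem_toFinset _).1 hz)).1]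
      exact ⟨f, hf, fun h => (comp_subset ((Set.Finite.mem_toFinset _).1 h)).2 rfl⟩
    have := Finset.card_lt_card h2
    omega
  have hSO : ∀ z, z ∈ S ↔ z ∈ O.erase f := by intro z; simp [hS, and_comm]
  obtain ⟨B, ⟨hBm, hBS, hBcl⟩, hBmin⟩ := Set.exists_min_image
    {B : Finset V | m ≤ B.card ∧ (∀ b ∈ B, b ∈ S) ∧ ∀ b ∈ B, ∀ z ∈ S, G.Adj b z → z ∈ B}
    Finset.card (Set.toFinite _)
    ⟨O.erase f, by rw [Finset.card_erase_of_mem hf]; omega, fun b hb => (hSO b).2 hb,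
      fun b _ z hz _ => (hSO z).1 hz⟩
  have hB2 : B.card < 2 * m := by
    by_contra hcon
    push Not at hcon
    obtain ⟨b, hb⟩ : B.Nonempty := Finset.card_pos.1 (by omega)
    have hCf := Set.toFinite (comp G S b)
    have h1 := hsmall b (hBS b hb)
    rw [Set.ncard_eq_toFinset_card _ hCf] at h1
    have h2 := Finset.le_card_sdiff hCf.toFinset B
    have h3 := hBmin (B \ hCf.toFinset) ⟨by omega, fun c hc => hBS c (Finset.mem_sdiff.1 hc).1, by
      intro c hc z hz hcz
      rw [Finset.mem_sdiff, Set.Finite.mem_toFinset] at hc ⊢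
      exact ⟨hBcl c hc.1 z hz hcz, fun h => hc.2 (comp_closed h (hBS c hc.1) hcz.symm)⟩⟩
    have h4 : B \ hCf.toFinset ⊂ B := by
      rw [Finset.ssubset_iff_of_subset Finset.sdiff_subset]
      refine ⟨b, hb, fun h => (Finset.mem_sdiff.1 h).2 ?_⟩
      exact (Set.Finite.mem_toFinset _).2 (Joined.refl (hBS b hb))
    have := Finset.card_lt_card h4
    omega
  set A : Finset V := O.erase f \ B with hA
  have hAS : ∀ a ∈ A, a ∈ S := fun a ha => (hSO a).2 (Finset.mem_sdiff.1 ha).1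
  have hAcl : ∀ a ∈ A, ∀ z ∈ S, G.Adj a z → z ∈ A := by
    intro a ha z hz haz
    rw [hA, Finset.mem_sdiff] at ha ⊢
    exact ⟨(hSO z).1 hz, fun h => ha.2 (hBcl z h a ((hSO a).2 ha.1) haz.symm)⟩
  have hAm : 2 * m ≤ A.card := by
    have := Finset.le_card_sdiff B (O.erase f)
    rw [Finset.card_erase_of_mem hf, ← hA] at this
    omega
  have hjoin : ∀ C : Finset V, (∀ c ∈ C, c ∈ S) → (∀ c ∈ C, ∀ z ∈ S, G.Adj c z → z ∈ C) →
      ∀ c ∈ C, Joined G (insert f (C : Set V)) c f := by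
    intro C h1 h2 c hc
    obtain ⟨x, hx, hxf⟩ := hexit c (h1 c hc)
    have h3 := hx.of_closed (A := (C : Set V)) hc h2
    exact (h3.mono (Set.subset_insert _ _)).trans
      (Joined.of_adj (Or.inr h3.right_mem) (Or.inl rfl) hxf)
  have harms : Arms G m f A B := ⟨fun h => (hAS f h).2 rfl, fun h => (hBS f h).2 rfl,
    Finset.sdiff_disjoint, hjoin A hAS hAcl, hjoin B hBS hBcl, by omega, hBm⟩
  obtain ⟨a0, ha0, b0, hb0, -, -, hdeg⟩ := harms.degree hm (hn f)
  have hsub : (A : Set V) ⊆ comp G S a0 := by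
    intro a ha
    obtain ⟨x, hx, hxf⟩ := hexit a (hAS a ha)
    have hxA := (hx.of_closed (A := (A : Set V)) ha hAcl).right_mem
    rcases hdeg x hxf.symm with rfl | rfl
    · exact hx.symm
    · exact absurd hb0 (Finset.mem_sdiff.1 hxA).2
  have h1 := Set.ncard_le_ncard hsub (Set.toFinite _)
  rw [Set.ncard_coe_finset] at h1
  have := hsmall a0 (hAS a0 ha0)
  omega

/-- The vertex set is covered by a corridor and two connected end parts attached to its ends. -/
structure Dumbbell (G : SimpleGraph V) (q : ℕ → V) (M : ℕ) (B₁ B₂ : Finset V) : Prop where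
  corridor : Corridor G q M
  cover : ∀ z, z ∈ B₁ ∨ z ∈ B₂ ∨ ∃ a, 1 ≤ a ∧ a ≤ M ∧ q a = z
  disj : Disjoint B₁ B₂
  notMem₁ : ∀ a, 1 ≤ a → a ≤ M → q a ∉ B₁
  notMem₂ : ∀ a, 1 ≤ a → a ≤ M → q a ∉ B₂
  adj₁ : ∀ z ∈ B₁, ∀ y, G.Adj z y → y ∈ B₁ ∨ y = q 1
  adj₂ : ∀ z ∈ B₂, ∀ y, G.Adj z y → y ∈ B₂ ∨ y = q M
  joined₁ : ∀ z ∈ B₁, Joined G (insert (q 1) (B₁ : Set V)) z (q 1)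
  joined₂ : ∀ z ∈ B₂, Joined G (insert (q M) (B₂ : Set V)) z (q M)

section Dumbbell

variable {q : ℕ → V} {M : ℕ} {B₁ B₂ : Finset V}

theorem Dumbbell.reverse (h : Dumbbell G q M B₁ B₂) :
    Dumbbell G (fun a => q (M + 1 - a)) M B₂ B₁ := by
  have h3 := h.corridor.three
  have e : M + 1 - M = 1 := by omega
  refine ⟨h.corridor.reverse, fun z => ?_, h.disj.symm, ?_, ?_, ?_, ?_, ?_, ?_⟩
  · rcases h.cover z with h1 | h1 | ⟨a, h1, h2, h4⟩
    · exact Or.inr (Or.inl h1)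
    · exact Or.inl h1
    · exact Or.inr (Or.inr ⟨M + 1 - a, by omega, by omega,
        by rw [← h4]; congr 1; omega⟩)
  · exact fun a h1 h2 => h.notMem₂ _ (by omega) (by omega)
  · exact fun a h1 h2 => h.notMem₁ _ (by omega) (by omega)
  · simpa using h.adj₂
  · simpa [e] using h.adj₁
  · simpa using h.joined₂
  · simpa [e] using h.joined₁

theorem Dumbbell.adj_first (h : Dumbbell G q M B₁ B₂) {y : V} (hy : G.Adj (q 1) y) :
    y ∈ B₁ ∨ y = q 2 := by
  have h3 := h.corridor.three
  rcases h.cover y with h1 | h1 | ⟨a, h1, h2, rfl⟩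
  · exact Or.inl h1
  · rcases h.adj₂ y h1 _ hy.symm with h4 | h4
    · exact absurd h4 (h.notMem₂ 1 le_rfl (by omega))
    · have := h.corridor.inj 1 M (by omega) (by omega) (by omega) le_rfl h4
      omega
  · rcases h.corridor.adj_index le_rfl (by omega) h1 h2 hy with e | e
    · right; rw [← e]
    · omega

/-- The corridor may be extended until its end has two neighbours in the end part. -/
theorem Dumbbell.extend (h : Dumbbell G q M B₁ B₂) :
    ∃ q' M' B', Dumbbell G q' M' B' B₂ ∧ M ≤ M' ∧ B' ⊆ B₁ ∧ q' M' = q M ∧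
      (B' = ∅ ∨ ∃ y2 y3, y2 ≠ y3 ∧ y2 ∈ B' ∧ y3 ∈ B' ∧ G.Adj (q' 1) y2 ∧ G.Adj (q' 1) y3) := by
  induction hc : B₁.card generalizing q M B₁ with
  | zero => exact ⟨q, M, B₁, h, le_rfl, subset_rfl, rfl, Or.inl (Finset.card_eq_zero.1 hc)⟩
  | succ c ih =>
    by_cases hfork : ∃ y2 y3, y2 ≠ y3 ∧ y2 ∈ B₁ ∧ y3 ∈ B₁ ∧ G.Adj (q 1) y2 ∧ G.Adj (q 1) y3
    · exact ⟨q, M, B₁, h, le_rfl, subset_rfl, rfl, Or.inr hfork⟩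
    · have h3 := h.corridor.three
      have hq1 : q 1 ∉ B₁ := h.notMem₁ 1 le_rfl (by omega)
      have hexit : ∀ z ∈ B₁, ∃ x, Joined G (B₁ : Set V) z x ∧ G.Adj x (q 1) := by
        intro z hz
        obtain ⟨x, hx, hx1⟩ := (h.joined₁ z hz).exit (by rintro rfl; exact hq1 hz)
        exact ⟨x, hx.mono (by rintro y ⟨rfl | hy, hy'⟩; exacts [absurd rfl hy', hy]), hx1⟩
      obtain ⟨z0, hz0⟩ : B₁.Nonempty := Finset.card_pos.1 (by omega)
      obtain ⟨b, hb', hb1⟩ := hexit z0 hz0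
      have hb : b ∈ B₁ := hb'.right_mem
      have huniq : ∀ y ∈ B₁, G.Adj (q 1) y → y = b := by
        intro y hy hy1
        by_contra hne
        exact hfork ⟨y, b, hne, hy, hb, hy1, hb1.symm⟩
      set q' : ℕ → V := fun a => if a = 1 then b else q (a - 1) with hq'
      have hq'1 : q' 1 = b := by simp [hq']
      have hq's : ∀ a, 1 ≤ a → q' (a + 1) = q a := by
        intro a ha; simp [hq', show a ≠ 0 by omega]
      have hq'e : ∀ a, 1 < a → q' a = q (a - 1) := by
        intro a ha; simp [hq', show a ≠ 1 by omega]
      have hbq : ∀ a, 1 ≤ a → a ≤ M → q a ≠ b := fun a h1 h2 e => h.notMem₁ a h1 h2 (e ▸ hb)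
      have hdumb : Dumbbell G q' (M + 1) (B₁.erase b) B₂ := by
        refine ⟨⟨by omega, ?_, ?_, ?_, ?_⟩, ?_, ?_, ?_, ?_, ?_, ?_, ?_, ?_⟩
        · intro x y h4 h5 h6 h7 e
          by_cases hx : x = 1 <;> by_cases hy : y = 1
          · omega
          · subst hx
            rw [hq'1, hq'e y (by omega)] at e
            exact absurd e.symm (hbq _ (by omega) (by omega))
          · subst hy
            rw [hq'1, hq'e x (by omega)] at e
            exact absurd e (hbq _ (by omega) (by omega))
          · rw [hq'e x (by omega), hq'e y (by omega)] at e
            have := h.corridor.inj _ _ (by omega) (by omega) (by omega) (by omega) e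
            omega
        · intro x h4 h5
          by_cases hx : x = 1
          · subst hx; rw [hq'1, hq's 1 le_rfl]; exact hb1
          · rw [hq'e x (by omega), hq's x (by omega)]
            have := h.corridor.adj (x - 1) (by omega) (by omega)
            rwa [Nat.sub_add_cancel (by omega)] at this
        · intro x h4 h5 u hu
          rw [hq'e x h4] at hu
          rw [hq's x (by omega)]
          by_cases hx : x = 2
          · subst hx
            rcases h.adj_first hu with h6 | h6
            · left; rw [huniq u h6 hu]; exact hq'1.symm
            · exact Or.inr h6
          · rw [hq'e (x - 1) (by omega)]
            have := h.corridor.inner (x - 1) (by omega) (by omega) u hu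
            rwa [Nat.sub_add_cancel (by omega)] at this
        · rw [hq'1, hq's M (by omega)]
          intro hadj
          rcases h.adj₁ b hb _ hadj with h4 | h4
          · exact h.notMem₁ M (by omega) le_rfl h4
          · have := h.corridor.inj M 1 (by omega) le_rfl le_rfl (by omega) h4
            omega
        · intro z
          by_cases hzb : z = b
          · exact Or.inr (Or.inr ⟨1, le_rfl, by omega, by rw [hq'1, hzb]⟩)
          · rcases h.cover z with h4 | h4 | ⟨x, h4, h5, h6⟩
            · exact Or.inl (Finset.mem_erase.2 ⟨hzb, h4⟩)
            · exact Or.inr (Or.inl h4)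
            · exact Or.inr (Or.inr ⟨x + 1, by omega, by omega, by rw [hq's x h4, h6]⟩)
        · exact Finset.disjoint_of_subset_left (Finset.erase_subset _ _) h.disj
        · intro x h4 h5 h6
          by_cases hx : x = 1
          · subst hx; rw [hq'1] at h6; simp at h6
          · rw [hq'e x (by omega)] at h6
            exact h.notMem₁ _ (by omega) (by omega) (Finset.mem_of_mem_erase h6)
        · intro x h4 h5 h6
          by_cases hx : x = 1
          · subst hx; rw [hq'1] at h6
            exact Finset.disjoint_left.1 h.disj hb h6
          · rw [hq'e x (by omega)] at h6
            exact h.notMem₂ _ (by omega) (by omega) h6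
        · intro z hz y hy
          rw [hq'1]
          rcases h.adj₁ z (Finset.mem_of_mem_erase hz) y hy with h4 | h4
          · by_cases e : y = b
            · exact Or.inr e
            · exact Or.inl (Finset.mem_erase.2 ⟨e, h4⟩)
          · subst h4
            exact absurd (huniq z (Finset.mem_of_mem_erase hz) hy.symm) (Finset.ne_of_mem_erase hz)
        · rw [hq's M (by omega)]; exact h.adj₂
        · intro z hz
          rw [hq'1]
          obtain ⟨x, hx, hx1⟩ := hexit z (Finset.mem_of_mem_erase hz)
          rw [huniq x hx.right_mem hx1.symm] at hx
          refine hx.mono ?_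
          intro y hy
          by_cases e : y = b
          · exact Or.inl e
          · right; simpa [e] using hy
        · rw [hq's M (by omega)]; exact h.joined₂
      obtain ⟨q'', M'', B'', h4, h5, h6, h7, h8⟩ := ih hdumb (by
        rw [Finset.card_erase_of_mem hb]; omega)
      exact ⟨q'', M'', B'', h4, by omega, h6.trans (Finset.erase_subset _ _), by
        rw [h7, hq's M (by omega)], h8⟩

/-- A large graph without nice vertices other than a cycle consists of a long corridor and two small
end parts. -/
theorem exists_dumbbell [Fintype V] (hG : G.Connected) {m : ℕ} (hm : 0 < m)
    (hn : ∀ u, ¬ Nice G m u) (hnc : NotCycle G) (hcard : 8 * m ≤ Fintype.card V) :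
    ∃ q M B₁ B₂, Dumbbell G q M B₁ B₂ ∧ B₁.card ≤ 4 * m ∧ B₂.card ≤ 4 * m := by
  classical
  obtain ⟨O, hO1, hO2, hO, hO'⟩ := exists_small_side hG hm hn (by omega)
  rw [← Finset.coe_compl] at hO'
  have hEcard : Oᶜ.card = Fintype.card V - O.card := Finset.card_compl O
  obtain ⟨a, ha, f1, hf1, hadj⟩ : ∃ a ∈ O, ∃ f1 ∈ Oᶜ, G.Adj a f1 := by
    obtain ⟨a0, ha0⟩ : O.Nonempty := Finset.card_pos.1 (by omega)
    obtain ⟨z, hz⟩ : Oᶜ.Nonempty := Finset.card_pos.1 (by omega)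
    have hJ : Joined G Set.univ z a0 := conn_univ hG _ (Set.mem_univ _) _ (Set.mem_univ _)
    obtain ⟨x, f, hx, hxf, hfO, -⟩ := hJ.exit_set (Z := (O : Set V)) (by simpa using hz) ha0
    exact ⟨f, hfO, x, by simpa using hx.right_mem.2, hxf.symm⟩
  obtain ⟨s, hs⟩ : ∃ s, s + m = Oᶜ.card := ⟨Oᶜ.card - m, by omega⟩
  obtain ⟨f, hf0, hf1', hfE, hfinj, hfadj, hfdeg, hfconn⟩ := exists_peel hG hm s hO hO'
    (disjoint_compl_right) (fun u _ z _ => by simp only [Finset.mem_compl]; tauto) ha hf1 hadj hO1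
    (by omega) (fun u _ => hn u)
  have hfO : ∀ i, 1 ≤ i → i ≤ s + 1 → f i ∉ O := fun i h1 h2 => by simpa using hfE i h1 h2
  set B : Finset V := Oᶜ.filter fun u => ∀ i, 1 ≤ i → i ≤ s → f i ≠ u with hB
  have hBmem : ∀ u, u ∈ B ↔ u ∉ O ∧ ∀ i, 1 ≤ i → i ≤ s → f i ≠ u := by intro u; simp [hB]
  have hBconn : Conn G (B : Set V) := by
    convert hfconn using 1
    ext u; simp [hB]
  have hBs : f (s + 1) ∈ B := (hBmem _).2 ⟨hfO _ (by omega) le_rfl, fun i h1 h2 e => by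
    have := hfinj _ _ h1 (by omega) (by omega) le_rfl e
    omega⟩
  have hBcard : B.card ≤ 4 * m := by
    have h1 : B ⊆ Oᶜ \ (Finset.Icc 1 s).image f := by
      intro u hu
      rw [hBmem] at hu
      simp only [Finset.mem_sdiff, Finset.mem_compl, Finset.mem_image, Finset.mem_Icc, not_exists,
        not_and]
      exact ⟨hu.1, fun i hi => hu.2 i hi.1 hi.2⟩
    have h2 := Finset.card_le_card h1
    rw [Finset.card_sdiff_of_subset, Finset.card_image_of_injOn, Nat.card_Icc] at h2
    · omega
    · intro i hi j hj e
      simp only [Finset.coe_Icc, Set.mem_Icc] at hi hj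
      exact hfinj i j (by omega) (by omega) (by omega) (by omega) e
    · intro u hu
      rw [Finset.mem_image] at hu
      obtain ⟨i, hi, rfl⟩ := hu
      rw [Finset.mem_Icc] at hi
      exact hfE i hi.1 (by omega)
  have hOB : ∀ z ∈ O, ∀ y ∈ B, ¬ G.Adj z y := by
    intro z hz y hy hzy
    obtain ⟨P, hP, hPm⟩ := ((hBconn.union hO hy hz hzy.symm) (f (s + 1)) (Or.inl hBs) a
      (Or.inr ha)).exists_path
    have hPf : ∀ i, 1 ≤ i → i ≤ s → ∀ j, P.getVert j ≠ f i := by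
      intro i h1 h2 j e
      have := hPm _ (P.getVert_mem_support j)
      rw [e] at this
      rcases this with h | h
      · exact ((hBmem _).1 h).2 i h1 h2 rfl
      · exact hfO i h1 (by omega) h
    set r : ℕ → V := fun i => if i < s then f (i + 1) else P.getVert (i - s) with hr
    have hr1 : ∀ i, i < s → r i = f (i + 1) := fun i hi => by simp [hr, hi]
    have hr2 : ∀ i, s ≤ i → r i = P.getVert (i - s) := fun i hi => by simp [hr, show ¬ i < s by omega]
    refine not_notCycle_of_cycle hG hm (q := r) (N := s + P.length + 1) (by omega) ?_ ?_ ?_ hn hnc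
    · intro i j hi hj e
      by_cases h1 : i < s <;> by_cases h2 : j < s
      · rw [hr1 i h1, hr1 j h2] at e
        have := hfinj _ _ (by omega) (by omega) (by omega) (by omega) e
        omega
      · rw [hr1 i h1, hr2 j (by omega)] at e
        exact absurd e.symm (hPf _ (by omega) (by omega) _)
      · rw [hr1 j h2, hr2 i (by omega)] at e
        exact absurd e (hPf _ (by omega) (by omega) _)
      · rw [hr2 i (by omega), hr2 j (by omega)] at e
        have := hP.getVert_injOn (show i - s ≤ P.length by omega) (show j - s ≤ P.length by omega) e
        omega
    · intro i hi
      by_cases h1 : i + 1 < s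
      · rw [hr1 i (by omega), hr1 _ h1]
        exact hfadj _ (by omega)
      · by_cases h2 : i < s
        · rw [hr1 i h2, hr2 (i + 1) (by omega), show i + 1 - s = 0 by omega, P.getVert_zero,
            show i + 1 = s by omega]
          exact hfadj s le_rfl
        · rw [hr2 i (by omega), hr2 (i + 1) (by omega), show i + 1 - s = i - s + 1 by omega]
          exact P.adj_getVert_succ (by omega)
    · rw [hr1 0 (by omega), hr2 _ (by omega), show s + P.length + 1 - 1 - s = P.length by omega,
        P.getVert_length, hf1']
      exact hadj
  refine ⟨f, s, O, B, ⟨⟨by omega, ?_, ?_, ?_, ?_⟩, ?_, ?_, ?_, ?_, ?_, ?_, ?_, ?_⟩, by omega, hBcard⟩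
  · exact fun x y h1 h2 h3 h4 e => hfinj x y h1 (by omega) h3 (by omega) e
  · exact fun x h1 h2 => hfadj x (by omega)
  · exact fun x h1 h2 u hu => hfdeg x (by omega) (by omega) u hu
  · intro h
    rcases hfdeg s (by omega) le_rfl _ h.symm with e | e
    · have := hfinj _ _ (by omega) (by omega) (by omega) (by omega) e
      omega
    · have := hfinj _ _ (by omega) (by omega) (by omega) (by omega) e
      omega
  · intro z
    by_cases h1 : z ∈ O
    · exact Or.inl h1
    · by_cases h2 : ∃ i, 1 ≤ i ∧ i ≤ s ∧ f i = z
      · exact Or.inr (Or.inr h2)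
      · push Not at h2
        exact Or.inr (Or.inl ((hBmem z).2 ⟨h1, h2⟩))
  · rw [Finset.disjoint_left]
    exact fun z hz hz' => ((hBmem z).1 hz').1 hz
  · exact fun x h1 h2 => hfO x h1 (by omega)
  · exact fun x h1 h2 h3 => ((hBmem _).1 h3).2 x h1 h2 rfl
  · intro z hz y hzy
    by_cases h1 : y ∈ O
    · exact Or.inl h1
    · right
      by_cases h2 : ∃ i, 1 ≤ i ∧ i ≤ s ∧ f i = y
      · obtain ⟨i, h3, h4, rfl⟩ := h2
        by_cases hi : i = 1
        · rw [hi]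
        · exfalso
          rcases hfdeg i h3 h4 z hzy.symm with e | e
          · subst e; exact hfO _ (by omega) (by omega) hz
          · subst e; exact hfO _ (by omega) (by omega) hz
      · push Not at h2
        exact absurd hzy (hOB z hz y ((hBmem y).2 ⟨h1, h2⟩))
  · intro z hz y hzy
    by_cases h1 : y ∈ B
    · exact Or.inl h1
    · right
      have h0 : y ∉ O := fun h => hOB y h z hz hzy.symm
      obtain ⟨i, h3, h4, rfl⟩ : ∃ i, 1 ≤ i ∧ i ≤ s ∧ f i = y := by
        by_contra h2
        push Not at h2
        exact h1 ((hBmem y).2 ⟨h0, h2⟩)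
      by_cases hi : i = s
      · rw [hi]
      · exfalso
        rcases hfdeg i h3 h4 z hzy.symm with e | e
        · by_cases h5 : i = 1
          · subst h5
            rw [Nat.sub_self, hf0] at e
            subst e
            exact ((hBmem _).1 hz).1 ha
          · exact ((hBmem _).1 hz).2 (i - 1) (by omega) (by omega) e.symm
        · exact ((hBmem _).1 hz).2 (i + 1) (by omega) (by omega) e.symm
  · intro z hz
    rw [hf1']
    exact ((hO z hz a ha).mono (Set.subset_insert _ _)).trans
      (Joined.of_adj (Or.inr ha) (Or.inl rfl) hadj)
  · intro z hz
    exact ((hBconn z hz _ hBs).mono (Set.subset_insert _ _)).trans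
      (Joined.of_adj (Or.inr hBs) (Or.inl rfl) (hfadj s le_rfl).symm)

end Dumbbell

end GCMP

namespace GCMP
set_option linter.unusedSectionVars false
variable {V ι : Type*} [Fintype ι] [DecidableEq V] [DecidableEq ι] {G : SimpleGraph V}

section Count

variable {q : ℕ → V} {M : ℕ} {B₁ B₂ : Finset V} {p : ℕ → ι → V} {T : ℕ}

/-- The position along the corridor. -/
theorem Dumbbell.exists_height (h : Dumbbell G q M B₁ B₂) :
    ∃ φ : V → ℕ, (∀ z, φ z = 0 ↔ z ∈ B₁) ∧ (∀ z, φ z = M + 1 ↔ z ∈ B₂) ∧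
      (∀ z a, 1 ≤ a → a ≤ M → (φ z = a ↔ z = q a)) ∧ (∀ z, φ z ≤ M + 1) ∧
      ∀ x y, G.Adj x y → φ x ≤ φ y + 1 := by
  classical
  have hex : ∀ z, ∃ a, a ≤ M + 1 ∧ (a = 0 ↔ z ∈ B₁) ∧ (a = M + 1 ↔ z ∈ B₂) ∧
      ∀ b, 1 ≤ b → b ≤ M → (a = b ↔ z = q b) := by
    intro z
    rcases h.cover z with hz | hz | ⟨a, h1, h2, rfl⟩
    · refine ⟨0, by omega, by simp [hz], ⟨fun e => by omega, fun e =>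
        absurd e (Finset.disjoint_left.1 h.disj hz)⟩, fun b h1 h2 => ⟨fun e => by omega, fun e => ?_⟩⟩
      subst e; exact absurd hz (h.notMem₁ b h1 h2)
    · refine ⟨M + 1, le_rfl, ⟨fun e => by omega, fun e =>
        absurd hz (Finset.disjoint_left.1 h.disj e)⟩, by simp [hz], fun b h1 h2 =>
        ⟨fun e => by omega, fun e => ?_⟩⟩
      subst e; exact absurd hz (h.notMem₂ b h1 h2)
    · refine ⟨a, by omega, ⟨fun e => by omega, fun e => absurd e (h.notMem₁ a h1 h2)⟩,
        ⟨fun e => by omega, fun e => absurd e (h.notMem₂ a h1 h2)⟩, fun b h3 h4 => ⟨fun e => e ▸ rfl,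
        h.corridor.inj a b h1 h2 h3 h4⟩⟩
  choose φ h0 h1 h2 h3 using hex
  refine ⟨φ, h1, h2, fun z a ha hb => h3 z a ha hb, h0, fun x y hxy => ?_⟩
  have hM := h.corridor.three
  by_contra hcon
  push Not at hcon
  rcases h.cover y with hy | hy | ⟨b, hb1, hb2, rfl⟩
  · have hy0 := (h1 y).2 hy
    rcases h.adj₁ y hy x hxy.symm with hx | hx
    · have := (h1 x).2 hx; omega
    · have := (h3 x 1 le_rfl (by omega)).2 hx; omega
  · have := (h2 y).2 hy; have := h0 x; omega
  · have hb := (h3 (q b) b hb1 hb2).2 rfl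
    rcases h.cover x with hx | hx | ⟨a, ha1, ha2, rfl⟩
    · have := (h1 x).2 hx; omega
    · have := (h2 x).2 hx
      rcases h.adj₂ x hx _ hxy with e | e
      · exact h.notMem₂ b hb1 hb2 e
      · have := h.corridor.inj b M hb1 hb2 (by omega) le_rfl e; omega
    · have := (h3 (q a) a ha1 ha2).2 rfl
      have := h.corridor.adj_index ha1 ha2 hb1 hb2 hxy
      omega

/-- The times from `s` on at which robot `i` traverses the `j`-th edge. -/
def crossTimes (q : ℕ → V) (p : ℕ → ι → V) (T : ℕ) (i : ι) (j s : ℕ) : Set ℕ :=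
  {t | s ≤ t ∧ t < T ∧ Crosses q p i j t}

theorem finite_crossTimes (i : ι) (j s : ℕ) : (crossTimes q p T i j s).Finite :=
  (Set.finite_lt_nat T).subset fun _ ht => ht.2.1

/-- The number of moves of robot `i` from time `s` on. -/
noncomputable def movesFrom (p : ℕ → ι → V) (T : ℕ) (i : ι) (s : ℕ) : ℕ :=
  {t | s ≤ t ∧ t < T ∧ p t i ≠ p (t + 1) i}.ncard

theorem le_moves {φ : V → ℕ} (hφ : ∀ x y, G.Adj x y → φ x ≤ φ y + 1) (hopt : Opt G p T) (i : ι)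
    {s t : ℕ} (hst : s ≤ t) (ht : t ≤ T) :
    φ (p t i) + movesFrom p T i t ≤ φ (p s i) + movesFrom p T i s ∧
      φ (p s i) + movesFrom p T i t ≤ φ (p t i) + movesFrom p T i s := by
  induction t, hst using Nat.le_induction with
  | base => exact ⟨le_rfl, le_rfl⟩
  | succ t hst ih =>
    have h1 := ih (by omega)
    have hfin : ∀ s, {t | s ≤ t ∧ t < T ∧ p t i ≠ p (t + 1) i}.Finite := fun s =>
      (Set.finite_lt_nat T).subset fun _ ht => ht.2.1
    rcases (hopt.step t (by omega)).adj i with e | e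
    · have : movesFrom p T i (t + 1) ≤ movesFrom p T i t :=
        Set.ncard_le_ncard (fun x hx => ⟨by have := hx.1; omega, hx.2⟩) (hfin t)
      rw [e]; omega
    · have : movesFrom p T i (t + 1) + 1 ≤ movesFrom p T i t := by
        unfold movesFrom
        rw [← Set.ncard_insert_of_notMem (a := t) (fun h => by have := h.1; omega) (hfin _)]
        refine Set.ncard_le_ncard ?_ (hfin t)
        rintro x (rfl | hx)
        · exact ⟨le_rfl, by omega, e.ne⟩
        · exact ⟨by have := hx.1; omega, hx.2⟩
      have h2 := hφ _ _ e
      have h3 := hφ _ _ e.symm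
      omega

theorem exists_first {S : Set ℕ} (hS : 0 < S.ncard) : ∃ a ∈ S, ∀ b ∈ S, a ≤ b := by
  have hne : S.Nonempty := Set.nonempty_of_ncard_ne_zero (by omega)
  exact ⟨sInf S, Nat.sInf_mem hne, fun b hb => Nat.sInf_le hb⟩

/-- After a traversal that is followed by another one, the robot visits the end part that it was
moving to. -/
theorem Dumbbell.exists_visit (h : Dumbbell G q M B₁ B₂) (hopt : Opt G p T) {i : ι} {j s : ℕ}
    (hj : Fintype.card ι < j) (hjM : j + Fintype.card ι < M)
    (hN : 2 ≤ (crossTimes q p T i j s).ncard) :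
    ∃ t σ, s ≤ t ∧ t < σ ∧ σ ≤ T ∧ (∀ τ, s ≤ τ → τ < t → ¬ Crosses q p i j τ) ∧
      ((p t i = q j ∧ p σ i ∈ B₂) ∨ (p t i = q (j + 1) ∧ p σ i ∈ B₁)) ∧
      (crossTimes q p T i j s).ncard ≤ (crossTimes q p T i j σ).ncard + 1 := by
  obtain ⟨t, ht, htmin⟩ := exists_first (show 0 < (crossTimes q p T i j s).ncard by omega)
  have hfin := finite_crossTimes (q := q) (p := p) (T := T) i j
  have h1 := Set.ncard_sdiff_singleton_add_one ht (hfin s)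
  obtain ⟨t', ⟨ht', hne⟩, ht'min⟩ := exists_first
    (show 0 < (crossTimes q p T i j s \ {t}).ncard by omega)
  have htt' : t < t' := lt_of_le_of_ne (htmin t' ht') (Ne.symm hne)
  have hfirst : ∀ τ, s ≤ τ → τ < t → ¬ Crosses q p i j τ := fun τ h2 h3 h4 => by
    have := htmin τ ⟨h2, by have := ht.2.1; omega, h4⟩
    omega
  have hcount : ∀ σ, t < σ → σ < t' → (crossTimes q p T i j s).ncard ≤
      (crossTimes q p T i j (σ + 1)).ncard + 1 := by
    intro σ h2 h3
    rw [← h1]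
    refine Nat.add_le_add_right (Set.ncard_le_ncard ?_ (hfin _)) 1
    intro x hx
    have := ht'min x hx
    exact ⟨by omega, hx.1.2⟩
  have h3 := h.corridor.three
  rcases ht.2.2 with ⟨e1, e2⟩ | ⟨e1, e2⟩
  · obtain ⟨σ, h4, h5, h6, h7⟩ := h.corridor.exists_leave hopt hj (by omega) htt' ht'.2.1 e1 e2
      ht'.2.2.symm
    refine ⟨t, σ + 1, ht.1, by omega, by have := ht'.2.1; omega, hfirst, Or.inl ⟨e1, ?_⟩,
      hcount σ h4 h5⟩
    have hadj : G.Adj (q M) (p (σ + 1) i) := by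
      rcases (hopt.step σ (by have := ht'.2.1; omega)).adj i with e | e
      · exact absurd (e.trans h6) (h7 M (by omega) le_rfl)
      · rwa [h6] at e
    have := h.reverse.adj_first (y := p (σ + 1) i) (by simpa using hadj)
    rcases this with h8 | h8
    · exact h8
    · exact absurd h8 (h7 _ (by omega) (by omega))
  · obtain ⟨σ, h4, h5, h6, h7⟩ := h.corridor.exists_leave_back hopt hjM (by omega) htt' ht'.2.1 e1 e2
      ht'.2.2.symm
    refine ⟨t, σ + 1, ht.1, by omega, by have := ht'.2.1; omega, hfirst, Or.inr ⟨e1, ?_⟩,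
      hcount σ h4 h5⟩
    have hadj : G.Adj (q 1) (p (σ + 1) i) := by
      rcases (hopt.step σ (by have := ht'.2.1; omega)).adj i with e | e
      · exact absurd (e.trans h6) (h7 1 le_rfl (by omega))
      · rwa [h6] at e
    rcases h.adj_first hadj with h8 | h8
    · exact h8
    · exact absurd h8 (h7 _ (by omega) (by omega))

/-- From one end part, a robot with two more traversals comes to the other end part. -/
theorem Dumbbell.exists_opposite (h : Dumbbell G q M B₁ B₂) (hopt : Opt G p T) {i : ι} {j s : ℕ}
    (hj : Fintype.card ι < j) (hjM : j + Fintype.card ι < M)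
    (hN : 2 ≤ (crossTimes q p T i j s).ncard) (hs : p s i ∈ B₁ ∨ p s i ∈ B₂) :
    ∃ σ, s < σ ∧ σ ≤ T ∧ ((p s i ∈ B₁ ∧ p σ i ∈ B₂) ∨ (p s i ∈ B₂ ∧ p σ i ∈ B₁)) ∧
      (crossTimes q p T i j s).ncard ≤ (crossTimes q p T i j σ).ncard + 1 := by
  obtain ⟨t, σ, h1, h2, h3, h4, h5, h6⟩ := h.exists_visit hopt hj hjM hN
  obtain ⟨φ, f0, f1, f2, -, f4⟩ := h.exists_height
  have hleft : φ (p s i) ≤ j → ∀ τ, s ≤ τ → τ ≤ t → φ (p τ i) ≤ j := by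
    intro h7 τ hτ
    induction τ, hτ using Nat.le_induction with
    | base => exact fun _ => h7
    | succ τ hτ ih =>
      intro h8
      have h9 := ih (by omega)
      by_contra hcon
      rcases (hopt.step τ (by omega)).adj i with e | e
      · rw [e] at hcon; exact hcon h9
      · have := f4 _ _ e.symm
        exact h4 τ hτ (by omega) (Or.inl ⟨(f2 _ j (by omega) (by omega)).1 (by omega),
          (f2 _ (j + 1) (by omega) (by omega)).1 (by omega)⟩)
  have hright : j < φ (p s i) → ∀ τ, s ≤ τ → τ ≤ t → j < φ (p τ i) := by
    intro h7 τ hτ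
    induction τ, hτ using Nat.le_induction with
    | base => exact fun _ => h7
    | succ τ hτ ih =>
      intro h8
      have h9 := ih (by omega)
      by_contra hcon
      rcases (hopt.step τ (by omega)).adj i with e | e
      · rw [e] at hcon; exact hcon h9
      · have := f4 _ _ e
        exact h4 τ hτ (by omega) (Or.inr ⟨(f2 _ (j + 1) (by omega) (by omega)).1 (by omega),
          (f2 _ j (by omega) (by omega)).1 (by omega)⟩)
  refine ⟨σ, by omega, h3, ?_, h6⟩
  rcases hs with hs | hs
  · have h7 := hleft (by rw [(f0 _).2 hs]; omega) t h1 le_rfl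
    rcases h5 with h5 | h5
    · exact Or.inl ⟨hs, h5.2⟩
    · rw [(f2 _ (j + 1) (by omega) (by omega)).2 h5.1] at h7; omega
  · have h7 := hright (by rw [(f1 _).2 hs]; omega) t h1 le_rfl
    rcases h5 with h5 | h5
    · rw [(f2 _ j (by omega) (by omega)).2 h5.1] at h7; omega
    · exact Or.inr ⟨hs, h5.2⟩

/-- All but two traversals of a deep edge belong to passages of the whole corridor. -/
theorem Dumbbell.crosses_mul_le (h : Dumbbell G q M B₁ B₂) (hopt : Opt G p T) (i : ι) {j : ℕ}
    (hj : Fintype.card ι < j) (hjM : j + Fintype.card ι < M) :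
    (crossTimes q p T i j 0).ncard * M ≤ movesFrom p T i 0 + 2 * M := by
  obtain ⟨φ, f0, f1, -, -, f4⟩ := h.exists_height
  have key : ∀ N s, s ≤ T → (p s i ∈ B₁ ∨ p s i ∈ B₂) → N ≤ (crossTimes q p T i j s).ncard →
      N * M ≤ movesFrom p T i s + M := by
    intro N
    induction N with
    | zero => intro s _ _ _; simp
    | succ N ih =>
      intro s hs hsB hN
      by_cases hN2 : N = 0
      · subst hN2; simp
      · obtain ⟨σ, h1, h2, h3, h4⟩ := h.exists_opposite hopt hj hjM (by omega) hsB
        have h5 := ih σ h2 (by tauto) (by omega)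
        have h6 := le_moves f4 hopt i h1.le h2
        rw [Nat.succ_mul]
        rcases h3 with ⟨h3, h3'⟩ | ⟨h3, h3'⟩
        · rw [(f0 _).2 h3, (f1 _).2 h3'] at h6; omega
        · rw [(f1 _).2 h3, (f0 _).2 h3'] at h6; omega
  rcases Nat.lt_or_ge (crossTimes q p T i j 0).ncard 2 with hN | hN
  · exact (Nat.mul_le_mul_right M (show _ ≤ 2 by omega)).trans (by omega)
  · obtain ⟨t, σ, h1, h2, h3, -, h5, h6⟩ := h.exists_visit hopt hj hjM hN
    have h7 := key ((crossTimes q p T i j 0).ncard - 1) σ h3 (by tauto) (by omega)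
    have h8 : movesFrom p T i σ ≤ movesFrom p T i 0 :=
      Set.ncard_le_ncard (fun x hx => ⟨Nat.zero_le _, hx.2⟩)
        ((Set.finite_lt_nat T).subset fun _ ht => ht.2.1)
    rw [Nat.sub_mul] at h7
    omega

theorem Dumbbell.exists_passage (h : Dumbbell G q M B₁ B₂) (hopt : Opt G p T) {i : ι} {j : ℕ}
    (hj : Fintype.card ι < j) (hjM : j + Fintype.card ι < M)
    (hN : 3 ≤ (crossTimes q p T i j 0).ncard) :
    ∃ s t, s < t ∧ t ≤ T ∧ ((p s i ∈ B₁ ∧ p t i ∈ B₂) ∨ (p s i ∈ B₂ ∧ p t i ∈ B₁)) := by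
  obtain ⟨t, σ, h1, h2, h3, -, h5, h6⟩ := h.exists_visit hopt hj hjM (i := i) (s := 0) (by omega)
  obtain ⟨σ', h7, h8, h9, -⟩ := h.exists_opposite hopt hj hjM (i := i) (s := σ) (by omega) (by tauto)
  exact ⟨σ, σ', h7, h8, h9⟩

/-- The vertex `w` together with `B` allows to exchange `N` robots. -/
def Fork (G : SimpleGraph V) (N : ℕ) (w : V) (B : Finset V) : Prop :=
  (∃ y2 y3, y2 ≠ y3 ∧ y2 ∈ B ∧ y3 ∈ B ∧ G.Adj w y2 ∧ G.Adj w y3 ∧ N ≤ B.card) ∨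
    (∃ ρ, Rot G ρ ∧ (∀ u, ρ u ≠ u → u ∈ insert w B) ∧ ρ w ≠ w ∧ N ≤ B.card + 1)

theorem fork_of_step {x y : ι → V} {w : V} {B : Finset V} (hst : Step G x y) (hw : w ∉ B) {i : ι}
    (hi : x i = w) (hi' : y i ∈ B) {R : Finset ι} (hR : ∀ l ∈ R, x l ∈ B)
    (hcl : ∀ z ∈ B, ∀ y, G.Adj z y → y ∈ B ∨ y = w)
    (htwo : ∃ y2 y3, y2 ≠ y3 ∧ y2 ∈ B ∧ y3 ∈ B ∧ G.Adj w y2 ∧ G.Adj w y3) :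
    Fork G (R.card + 1) w B := by
  have hcard : (R.image x).card = R.card := Finset.card_image_of_injective _ hst.inj
  have hsub : R.image x ⊆ B := by
    intro z hz
    obtain ⟨l, hl, rfl⟩ := Finset.mem_image.1 hz
    exact hR l hl
  rcases Nat.lt_or_ge R.card B.card with hlt | hge
  · obtain ⟨y2, y3, h1, h2, h3, h4, h5⟩ := htwo
    exact Or.inl ⟨y2, y3, h1, h2, h3, h4, h5, hlt⟩
  · have himg : R.image x = B := Finset.eq_of_subset_of_card_le hsub (by omega)
    have hRB : R.card = B.card := by rw [← hcard, himg]
    set W : Set V := insert w (B : Set V) with hW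
    let e : {l // l ∈ insert i R} → ι := Subtype.val
    have hxW : ∀ l, x (e l) ∈ W := by
      rintro ⟨l, hl⟩
      rcases Finset.mem_insert.1 hl with rfl | hl
      · exact Or.inl hi
      · exact Or.inr (hR l hl)
    have hyW : ∀ l, y (e l) ∈ W := by
      rintro ⟨l, hl⟩
      rcases Finset.mem_insert.1 hl with rfl | hl
      · exact Or.inr hi'
      · change y l ∈ W
        rcases hst.adj l with h1 | h1
        · rw [h1]; exact Or.inr (hR l hl)
        · exact (hcl _ (hR l hl) _ h1).symm
    have hst' : Step (inside G W) (x ∘ e) (y ∘ e) := by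
      have h1 := hst.relabel (τ := e) Subtype.val_injective
      exact ⟨h1.inj, h1.inj', fun l => (h1.adj l).imp_right fun h => ⟨h, hxW l, hyW l⟩, h1.noswap⟩
    obtain ⟨π, hπ⟩ := exists_perm_of_range_subset hst'.inj' (x := x ∘ e) (by
      rintro _ ⟨l, rfl⟩
      rcases hyW l with h1 | h1
      · exact ⟨⟨i, by simp⟩, hi.trans h1.symm⟩
      · have h2 : y (e l) ∈ R.image x := himg ▸ h1
        obtain ⟨l', hl', h3⟩ := Finset.mem_image.1 h2
        exact ⟨⟨l', by simp [hl']⟩, h3⟩)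
    have hyi : y i = x (e (π ⟨i, by simp⟩)) := congrFun hπ ⟨i, by simp⟩
    have hne : π ⟨i, by simp⟩ ≠ ⟨i, by simp⟩ := by
      intro h1
      rw [h1] at hyi
      change y i = x i at hyi
      rw [hi] at hyi
      exact hw (hyi ▸ hi')
    rw [hπ] at hst'
    obtain ⟨ρ, hρ, hρi⟩ := hst'.exists_rot hne
    have hρw : ρ w = y i := by rw [← hi, hyi]; exact hρi
    refine Or.inr ⟨ρ, ⟨hρ.isCycle, fun u hu => (hρ.adj u hu).1, hρ.two⟩, fun u hu => ?_, ?_, by omega⟩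
    · have := (hρ.adj u hu).2.1
      simpa [hW] using this
    · rw [hρw]
      exact fun h1 => hw (h1 ▸ hi')

theorem height_lt {φ : V → ℕ} (f2 : ∀ z a, 1 ≤ a → a ≤ M → (φ z = a ↔ z = q a))
    (f4 : ∀ x y, G.Adj x y → φ x ≤ φ y + 1) {x y : ι → V} (hst : Step G x y) {i l : ι} (hil : i ≠ l)
    (h1 : 1 ≤ φ (x i)) (h2 : φ (x i) ≤ M) (h3 : 1 ≤ φ (y i)) (h4 : φ (y i) ≤ M)
    (hlt : φ (x i) < φ (x l)) : φ (y i) < φ (y l) := by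
  by_contra hcon
  push Not at hcon
  have hstep : ∀ l, φ (x l) ≤ φ (y l) + 1 ∧ φ (y l) ≤ φ (x l) + 1 := by
    intro l
    rcases hst.adj l with e | e
    · rw [e]; omega
    · exact ⟨f4 _ _ e, f4 _ _ e.symm⟩
  have hi := hstep i
  have hl := hstep l
  have e1 := (f2 _ _ h3 h4).1 rfl
  rcases eq_or_lt_of_le hcon with e | e
  · exact hil (hst.inj' (e1.trans ((f2 _ _ h3 h4).1 e).symm))
  · refine hst.noswap i l hil ⟨?_, ?_⟩
    · exact e1.trans ((f2 _ _ h3 h4).1 (by omega)).symm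
    · exact ((f2 _ _ h1 h2).1 (by omega)).trans ((f2 _ _ h1 h2).1 rfl).symm

/-- A passage through the corridor bounds the number of robots by the capacities of the ends. -/
theorem Dumbbell.forks_of_passage (h : Dumbbell G q M B₁ B₂) (hopt : Opt G p T) {i : ι} {s t : ℕ}
    (hst : s < t) (htT : t ≤ T) (hs : p s i ∈ B₁) (ht : p t i ∈ B₂)
    (h₁ : B₁ = ∅ ∨ ∃ y2 y3, y2 ≠ y3 ∧ y2 ∈ B₁ ∧ y3 ∈ B₁ ∧ G.Adj (q 1) y2 ∧ G.Adj (q 1) y3)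
    (h₂ : B₂ = ∅ ∨ ∃ y2 y3, y2 ≠ y3 ∧ y2 ∈ B₂ ∧ y3 ∈ B₂ ∧ G.Adj (q M) y2 ∧ G.Adj (q M) y3) :
    ∃ n₁ n₂, 1 ≤ n₁ ∧ 1 ≤ n₂ ∧ n₁ + n₂ = Fintype.card ι + 1 ∧ Fork G n₁ (q 1) B₁ ∧
      Fork G n₂ (q M) B₂ := by
  classical
  replace h₁ := h₁.resolve_left (Finset.ne_empty_of_mem hs)
  replace h₂ := h₂.resolve_left (Finset.ne_empty_of_mem ht)
  have hM := h.corridor.three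
  obtain ⟨φ, f0, f1, f2, f3, f4⟩ := h.exists_height
  obtain ⟨s0, hs0, hs0B, hs0max⟩ : ∃ s0 ≤ t, p s0 i ∈ B₁ ∧ ∀ τ, s0 < τ → τ ≤ t → p τ i ∉ B₁ :=
    ⟨Nat.findGreatest (fun τ => p τ i ∈ B₁) t, Nat.findGreatest_le t,
      Nat.findGreatest_spec (P := fun τ => p τ i ∈ B₁) hst.le hs,
      fun τ h5 h6 => Nat.findGreatest_is_greatest h5 h6⟩
  have hex : ∃ τ, s0 ≤ τ ∧ p τ i ∈ B₂ := ⟨t, hs0, ht⟩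
  obtain ⟨t0, ⟨hst0, ht0B⟩, ht0min⟩ : ∃ t0, (s0 ≤ t0 ∧ p t0 i ∈ B₂) ∧
      ∀ τ < t0, ¬ (s0 ≤ τ ∧ p τ i ∈ B₂) :=
    ⟨Nat.find hex, Nat.find_spec hex, fun τ => Nat.find_min hex⟩
  have ht0 : t0 ≤ t := by
    by_contra hcon
    exact ht0min t (by omega) ⟨hs0, ht⟩
  have hdis : ∀ z, z ∈ B₁ → z ∈ B₂ → False := fun z h5 h6 =>
    Finset.disjoint_left.1 h.disj h5 h6
  have hlt0 : s0 < t0 := lt_of_le_of_ne hst0 (by rintro rfl; exact hdis _ hs0B ht0B)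
  have e1 : p (s0 + 1) i = q 1 := by
    have hnot := hs0max (s0 + 1) (by omega) (by omega)
    rcases (hopt.step s0 (by omega)).adj i with e | e
    · rw [e] at hnot; exact absurd hs0B hnot
    · exact (h.adj₁ _ hs0B _ e).resolve_left hnot
  have hlt1 : s0 + 1 < t0 := lt_of_le_of_ne hlt0 (by
    rintro rfl; rw [e1] at ht0B; exact h.notMem₂ 1 le_rfl (by omega) ht0B)
  obtain ⟨t1, rfl⟩ : ∃ t1, t0 = t1 + 1 := ⟨t0 - 1, by omega⟩
  have e2 : p t1 i = q M := by
    have hnot := ht0min t1 (by omega)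
    rcases (hopt.step t1 (by omega)).adj i with e | e
    · rw [e] at ht0B; exact absurd ⟨by omega, ht0B⟩ hnot
    · exact (h.adj₂ _ ht0B _ e.symm).resolve_left fun h' => hnot ⟨by omega, h'⟩
  have hin : ∀ τ, s0 < τ → τ ≤ t1 → 1 ≤ φ (p τ i) ∧ φ (p τ i) ≤ M := by
    intro τ h5 h6
    have h7 : φ (p τ i) ≠ 0 := fun e => hs0max τ h5 (by omega) ((f0 _).1 e)
    have h8 : φ (p τ i) ≠ M + 1 := fun e => ht0min τ (by omega) ⟨by omega, (f1 _).1 e⟩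
    have := f3 (p τ i)
    omega
  have φ1 : φ (p (s0 + 1) i) = 1 := (f2 _ 1 le_rfl (by omega)).2 e1
  have φM : φ (p t1 i) = M := (f2 _ M (by omega) le_rfl).2 e2
  set R : Finset ι := Finset.univ.filter fun l => 1 < φ (p (s0 + 1) l) with hR
  set L : Finset ι := Finset.univ.filter fun l => φ (p (s0 + 1) l) = 0 with hL
  have hRpos : ∀ l ∈ R, p t1 l ∈ B₂ := by
    intro l hl
    have hl' : 1 < φ (p (s0 + 1) l) := by simpa [hR] using hl
    have hil : i ≠ l := by rintro rfl; omega
    have hord : ∀ τ, s0 + 1 ≤ τ → τ ≤ t1 → φ (p τ i) < φ (p τ l) := by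
      intro τ hτ
      induction τ, hτ using Nat.le_induction with
      | base => intro _; omega
      | succ τ hτ ih =>
        intro h5
        have h6 := hin τ (by omega) (by omega)
        have h7 := hin (τ + 1) (by omega) h5
        exact height_lt f2 f4 (hopt.step τ (by omega)) hil h6.1 h6.2 h7.1 h7.2 (ih (by omega))
    have h5 := hord t1 (by omega) le_rfl
    have h6 := f3 (p t1 l)
    exact (f1 _).1 (by omega)
  have hLpos : ∀ l ∈ L, p (s0 + 1) l ∈ B₁ := by
    intro l hl
    exact (f0 _).1 (by simpa [hL] using hl)
  have hcount : L.card + R.card + 1 = Fintype.card ι := by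
    have h5 : Disjoint L R := by
      rw [Finset.disjoint_left]
      intro l h5 h6
      simp only [hL, hR, Finset.mem_filter, Finset.mem_univ, true_and] at h5 h6
      omega
    have h6 : L ∪ R = Finset.univ.erase i := by
      ext l
      simp only [hL, hR, Finset.mem_union, Finset.mem_filter, Finset.mem_univ, true_and,
        Finset.mem_erase, and_true]
      constructor
      · rintro h6 rfl; omega
      · intro h6
        have : φ (p (s0 + 1) l) ≠ 1 := fun e =>
          h6 (hopt.inj (s0 + 1) (by omega) (((f2 _ 1 le_rfl (by omega)).1 e).trans e1.symm))
        omega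
    rw [← Finset.card_union_of_disjoint h5, h6, Finset.card_erase_of_mem (Finset.mem_univ _),
      Finset.card_univ]
    have : 0 < Fintype.card ι := Fintype.card_pos_iff.2 ⟨i⟩
    omega
  exact ⟨L.card + 1, R.card + 1, by omega, by omega, by omega,
    fork_of_step (hopt.step s0 (by omega)).symm (h.notMem₁ 1 le_rfl (by omega)) e1 hs0B hLpos h.adj₁ h₁,
    fork_of_step (hopt.step t1 (by omega)) (h.notMem₂ M (by omega) le_rfl) e2 ht0B hRpos h.adj₂ h₂⟩

end Count

end GCMP

namespace GCMP
set_option linter.unusedSectionVars false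
variable {V ι : Type*} [Fintype ι] [DecidableEq V] [DecidableEq ι] {G : SimpleGraph V}

theorem reach_perm {z : ι → V} {Q : ℕ} (hz : Function.Injective z) (h : ∀ i j, i ≠ j → Sw G Q z i j)
    (σ : Equiv.Perm ι) : Reach G z (z ∘ σ) (Fintype.card ι * Q) := by
  have key : ∀ (m : ℕ) (σ : Equiv.Perm ι), σ.support.card ≤ m → Reach G z (z ∘ σ) (m * Q) := by
    intro m
    induction m with
    | zero =>
      intro σ hm
      have : σ = 1 := by
        rw [← Equiv.Perm.support_eq_empty_iff]
        exact Finset.card_eq_zero.1 (by omega)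
      subst this
      exact Reach.refl _ hz _
    | succ m ih =>
      intro σ hm
      by_cases h1 : ∃ i, σ i ≠ i
      · obtain ⟨i, hi⟩ := h1
        have hlt := Equiv.Perm.card_support_swap_mul hi
        have h2 := Reach.comp_perm (h i (σ i) hi.symm) (ih (Equiv.swap i (σ i) * σ) (by omega))
        rw [← mul_assoc, Equiv.swap_mul_self, one_mul] at h2
        exact h2.mono (by ring_nf; omega)
      · push Not at h1
        rw [show σ = 1 from Equiv.ext h1]
        exact Reach.refl _ hz _
  exact key _ σ (Finset.card_le_univ _)

theorem Univ.sw {H : Set V} {N P : ℕ} (hU : Univ G ι H N P) {z : ι → V} (hz : Function.Injective z)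
    {i j : ι} (hi : z i ∈ H) (hj : z j ∈ H) (hN : {l | z l ∈ H}.ncard ≤ N) : Sw G P z i j := by
  have key : ∀ l, l = i ∨ l = j ∨ (z ∘ Equiv.swap i j) l = z l := by
    intro l
    by_cases h1 : l = i
    · exact Or.inl h1
    · by_cases h2 : l = j
      · exact Or.inr (Or.inl h2)
      · right; right; simp [Equiv.swap_apply_of_ne_of_ne h1 h2]
  refine (hU z _ hz (hz.comp (Equiv.injective _)) (fun l => ?_) (fun l hl => ?_) hN).mono_graph
    (inside_le _ _)
  · rcases key l with rfl | rfl | h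
    · simp [hi, hj]
    · simp [hi, hj]
    · rw [h]
  · rcases key l with rfl | rfl | h
    · exact absurd hi hl
    · exact absurd hj hl
    · exact h

section Ends

variable {q : ℕ → V} {M : ℕ} {B₁ B₂ : Finset V}

/-- An end part together with an initial piece of the corridor. -/
def leftPart (q : ℕ → V) (B : Finset V) (j : ℕ) : Finset V := B ∪ (Finset.Icc 1 j).image q

theorem mem_leftPart {B : Finset V} {j : ℕ} {z : V} :
    z ∈ leftPart q B j ↔ z ∈ B ∨ ∃ a, 1 ≤ a ∧ a ≤ j ∧ q a = z := by
  simp [leftPart, and_assoc]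

theorem Dumbbell.mem_leftPart_iff (h : Dumbbell G q M B₁ B₂) {j b : ℕ} (hj : j ≤ M) (hb : 1 ≤ b)
    (hbM : b ≤ M) : q b ∈ leftPart q B₁ j ↔ b ≤ j := by
  rw [mem_leftPart]
  constructor
  · rintro (h1 | ⟨a, h1, h2, e⟩)
    · exact absurd h1 (h.notMem₁ b hb hbM)
    · have := h.corridor.inj a b h1 (by omega) hb hbM e
      omega
  · exact fun h1 => Or.inr ⟨b, hb, h1, rfl⟩

theorem card_leftPart (B : Finset V) (j : ℕ) : (leftPart q B j).card ≤ B.card + j := by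
  refine (Finset.card_union_le _ _).trans (Nat.add_le_add_left (Finset.card_image_le.trans ?_) _)
  simp

theorem Dumbbell.conn_leftPart (h : Dumbbell G q M B₁ B₂) {j : ℕ} (hj : 1 ≤ j) (hjM : j ≤ M) :
    Conn G (leftPart q B₁ j : Set V) := by
  apply conn_of_joined (w := q 1)
  intro z hz
  rcases mem_leftPart.1 hz with h1 | ⟨a, h1, h2, rfl⟩
  · refine (h.joined₁ z h1).mono ?_
    rintro y (rfl | hy)
    · exact mem_leftPart.2 (Or.inr ⟨1, le_rfl, hj, rfl⟩)
    · exact mem_leftPart.2 (Or.inl hy)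
  · exact (joined_seq h1 (fun i h3 h4 => h.corridor.adj i h3 (by omega))
      fun i h3 h4 => mem_leftPart.2 (Or.inr ⟨i, h3, by omega, rfl⟩)).symm

theorem Dumbbell.univ_left [Fintype V] (h : Dumbbell G q M B₁ B₂) {N : ℕ} (hN : N ≤ Fintype.card ι)
    (hM : Fintype.card ι + 2 ≤ M) (hf : Fork G N (q 1) B₁) {P : ℕ}
    (hP : 36 * (B₁.card + (Fintype.card ι + 2)) ^ 4 ≤ P) :
    Univ G ι (leftPart q B₁ (Fintype.card ι + 2) : Set V) N P := by
  set k := Fintype.card ι with hk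
  have hJ : Junction G N (q 1) ((Finset.Icc 2 (k + 1)).image q) B₁ := by
    refine ⟨?_, h.notMem₁ 1 le_rfl (by omega), ?_, ?_, h.joined₁, ?_, hf⟩
    · simp only [Finset.mem_image, Finset.mem_Icc, not_exists, not_and]
      intro a h1 e
      have := h.corridor.inj a 1 (by omega) (by omega) le_rfl (by omega) e
      omega
    · rw [Finset.disjoint_left]
      simp only [Finset.mem_image, Finset.mem_Icc]
      rintro _ ⟨a, h1, rfl⟩ h2
      exact h.notMem₁ a (by omega) (by omega) h2
    · simp only [Finset.mem_image, Finset.mem_Icc]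
      rintro _ ⟨a, h1, rfl⟩
      refine (joined_seq (by omega : 1 ≤ a) (fun i h3 h4 => h.corridor.adj i h3 (by omega))
        fun i h3 h4 => ?_).symm
      by_cases hi : i = 1
      · left; rw [hi]
      · right
        simp only [Finset.coe_image, Finset.coe_Icc, Set.mem_image, Set.mem_Icc]
        exact ⟨i, by omega, rfl⟩
    · rw [Finset.card_image_of_injOn, Nat.card_Icc]
      · omega
      · intro a ha b hb e
        simp only [Finset.coe_Icc, Set.mem_Icc] at ha hb
        exact h.corridor.inj a b (by omega) (by omega) (by omega) (by omega) e
  refine (hJ.univ (W := (leftPart q B₁ (k + 2) : Set V)) ?_ ?_ ?_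
    (h.conn_leftPart (by omega) hM)).mono (le_trans ?_ hP)
  · exact mem_leftPart.2 (Or.inr ⟨1, le_rfl, by omega, rfl⟩)
  · intro z hz
    simp only [Finset.coe_image, Finset.coe_Icc, Set.mem_image, Set.mem_Icc] at hz
    obtain ⟨a, h1, rfl⟩ := hz
    exact mem_leftPart.2 (Or.inr ⟨a, by omega, by omega, rfl⟩)
  · exact fun z hz => mem_leftPart.2 (Or.inl hz)
  · rw [Set.ncard_coe_finset]
    exact Nat.mul_le_mul_left _ (Nat.pow_le_pow_left (card_leftPart _ _) 4)

/-- If the ends have enough capacity, all configurations can be reached from each other. -/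
theorem Dumbbell.reach [Fintype V] (hG : G.Connected) (h : Dumbbell G q M B₁ B₂) {n₁ n₂ P : ℕ}
    (hn₁ : 1 ≤ n₁) (hn₂ : 1 ≤ n₂) (hn : n₁ + n₂ = Fintype.card ι + 1)
    (hM : 2 * Fintype.card ι + 8 ≤ M)
    (hU₁ : Univ G ι (leftPart q B₁ (Fintype.card ι + 2) : Set V) n₁ P)
    (hU₂ : Univ G ι (leftPart (fun a => q (M + 1 - a)) B₂ (Fintype.card ι + 2) : Set V) n₂ P)
    {x y : ι → V} (hx : Function.Injective x) (hy : Function.Injective y) :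
    Reach G x y (4 * (Fintype.card ι * Fintype.card V) + 3 * (Fintype.card ι * P)) := by
  classical
  set k := Fintype.card ι with hk
  set n := Fintype.card V with hndef
  have hinj := h.corridor.inj
  have hD1 : ∀ b, 1 ≤ b → b ≤ M → (q b ∈ (leftPart q B₁ (k + 2) : Set V) ↔ b ≤ k + 2) :=
    fun b h1 h2 => h.mem_leftPart_iff (by omega) h1 h2
  have hD2 : ∀ b, 1 ≤ b → b ≤ M →
      (q b ∈ (leftPart (fun a => q (M + 1 - a)) B₂ (k + 2) : Set V) ↔ M + 1 ≤ b + (k + 2)) := by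
    intro b h1 h2
    have := h.reverse.mem_leftPart_iff (j := k + 2) (b := M + 1 - b) (by omega) (by omega) (by omega)
    rw [show M + 1 - (M + 1 - b) = b by omega] at this
    rw [Finset.mem_coe, this]; omega
  have hcardq : ∀ a b, 1 ≤ a → b ≤ M → ((Finset.Icc a b).image q).card = b + 1 - a := by
    intro a b h1 h2
    rw [Finset.card_image_of_injOn, Nat.card_Icc]
    intro c hc d hd e
    simp only [Finset.coe_Icc, Set.mem_Icc] at hc hd
    exact hinj c d (by omega) (by omega) (by omega) (by omega) e
  set S : Finset V := (Finset.Icc 1 n₁).image q ∪ (Finset.Icc (M + 2 - n₂) M).image q with hS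
  have hSmem : ∀ z, z ∈ S ↔ ∃ a, 1 ≤ a ∧ a ≤ M ∧ (a ≤ n₁ ∨ M + 2 ≤ a + n₂) ∧ q a = z := by
    intro z
    simp only [hS, Finset.mem_union, Finset.mem_image, Finset.mem_Icc]
    constructor
    · rintro (⟨a, h1, h2⟩ | ⟨a, h1, h2⟩)
      · exact ⟨a, by omega, by omega, by omega, h2⟩
      · exact ⟨a, by omega, by omega, by omega, h2⟩
    · rintro ⟨a, h1, h2, h3 | h3, h4⟩
      · exact Or.inl ⟨a, by omega, h4⟩
      · exact Or.inr ⟨a, by omega, h4⟩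
  have hScard : S.card = k := by
    rw [hS, Finset.card_union_of_disjoint, hcardq _ _ le_rfl (by omega), hcardq _ _ (by omega) le_rfl]
    · omega
    · rw [Finset.disjoint_left]
      simp only [Finset.mem_image, Finset.mem_Icc]
      rintro _ ⟨a, h1, rfl⟩ ⟨b, h2, e⟩
      have := hinj b a (by omega) (by omega) (by omega) (by omega) e
      omega
  have hgather : ∀ x : ι → V, Function.Injective x → ∃ z, Reach G x z (k * n) ∧ ∀ i, z i ∈ S := by
    intro x hx
    obtain ⟨z, h1, h2⟩ := exists_gather (W := Set.univ) (conn_univ hG) hx S (Set.subset_univ _)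
      (by simp [hScard, hk])
    exact ⟨z, (h1.mono_graph (inside_le _ _)).mono (Nat.mul_le_mul_right _ (Finset.card_le_univ _)),
      fun i => h2 i (Set.mem_univ _)⟩
  have hrange : ∀ z : ι → V, Function.Injective z → (∀ i, z i ∈ S) → Finset.univ.image z = S := by
    intro z hz hzS
    apply Finset.eq_of_subset_of_card_le
    · intro u hu
      obtain ⟨i, -, rfl⟩ := Finset.mem_image.1 hu
      exact hzS i
    · rw [Finset.card_image_of_injective _ hz, Finset.card_univ]; omega
  have hsub : ∀ z : ι → V, Function.Injective z → ∀ (I : Set ι) (a b : ℕ), 1 ≤ a → b ≤ M →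
      (∀ i ∈ I, ∃ c, a ≤ c ∧ c ≤ b ∧ q c = z i) → I.ncard ≤ b + 1 - a := by
    intro z hz I a b h1 h2 h3
    rw [← hcardq a b h1 h2, ← Set.ncard_coe_finset]
    refine Set.ncard_le_ncard_of_injOn z (fun i hi => ?_) hz.injOn (Finset.finite_toSet _)
    obtain ⟨c, h4, h5, h6⟩ := h3 i hi
    rw [Finset.mem_coe, Finset.mem_image]
    exact ⟨c, Finset.mem_Icc.2 ⟨h4, h5⟩, h6⟩
  have hsw : ∀ z : ι → V, Function.Injective z → (∀ i, z i ∈ S) → ∀ i j,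
      Sw G (2 * (P + n) + P) z i j := by
    intro z hz hzS
    choose a ha1 haM haS haq using fun i => (hSmem _).1 (hzS i)
    have hN1 : ∀ z : ι → V, Function.Injective z → (∀ i, z i ∈ S) →
        {l | z l ∈ (leftPart q B₁ (k + 2) : Set V)}.ncard ≤ n₁ := by
      intro z hz hzS
      refine (hsub z hz _ 1 n₁ le_rfl (by omega) fun l hl => ?_).trans (by omega)
      obtain ⟨b, h1, h2, h3, h4⟩ := (hSmem _).1 (hzS l)
      have hl : z l ∈ (leftPart q B₁ (k + 2) : Set V) := hl
      rw [← h4, hD1 b h1 h2] at hl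
      exact ⟨b, h1, by omega, h4⟩
    have hleft : ∀ i j, a i ≤ n₁ → a j ≤ n₁ → Sw G P z i j := fun i j hi hj =>
      hU₁.sw hz (by rw [← haq, hD1 _ (ha1 i) (haM i)]; omega)
        (by rw [← haq, hD1 _ (ha1 j) (haM j)]; omega) (hN1 z hz hzS)
    have hcross : ∀ i j, a i ≤ n₁ → ¬ a j ≤ n₁ → Sw G (2 * (P + n) + P) z i j := by
      intro i j hi hj
      have haj : M + 2 ≤ a j + n₂ := (haS j).resolve_left hj
      obtain ⟨f, hf⟩ : ∃ f, z f = q n₁ := by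
        have : q n₁ ∈ Finset.univ.image z := by
          rw [hrange z hz hzS]
          exact (hSmem _).2 ⟨n₁, hn₁, by omega, Or.inl le_rfl, rfl⟩
        obtain ⟨f, -, hf⟩ := Finset.mem_image.1 this
        exact ⟨f, hf⟩
      have haf : a f = n₁ := hinj _ _ (ha1 f) (haM f) hn₁ (by omega) ((haq f).trans hf)
      have hij : j ≠ i := by rintro rfl; exact hj hi
      have hjf : j ≠ f := by rintro rfl; omega
      have h1 : Reach G z (z ∘ Equiv.swap i f) P := hleft i f hi (by omega)
      set z1 := z ∘ Equiv.swap i f with hz1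
      have hz1i : z1 i = q n₁ := by simp [hz1, hf]
      have hz1S : ∀ l, z1 l ∈ S := fun l => hzS _
      have hz1j : z1 j = z j := by simp [hz1, Equiv.swap_apply_of_ne_of_ne hij hjf]
      have h2 := reach_joined (A := {u | ∃ b, n₁ ≤ b ∧ b ≤ M + 1 - n₂ ∧ q b = u}) h1.inj' (r := i)
        (v := q (M + 1 - n₂)) (by
          rw [hz1i]
          exact joined_seq (by omega) (fun b h3 h4 => h.corridor.adj b (by omega) (by omega))
            fun b h3 h4 => ⟨b, h3, h4, rfl⟩) (by
          rintro _ ⟨b, h3, h4, rfl⟩ l hl e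
          obtain ⟨c, h5, h6, h7, h8⟩ := (hSmem _).1 (hz1S l)
          have h9 := hinj c b h5 h6 (by omega) (by omega) (h8.trans e)
          have h10 : c = n₁ := by omega
          rw [h10, ← hz1i] at h8
          exact hl (h1.inj' h8.symm))
      set z2 := Function.update z1 i (q (M + 1 - n₂)) with hz2
      have hR := h1.trans h2
      refine hR.conj (hU₂.sw hR.inj' (i := i) (j := j) ?_ ?_ ?_)
      · rw [hz2, Function.update_self, hD2 _ (by omega) (by omega)]; omega
      · rw [hz2, Function.update_of_ne hij, hz1j, ← haq, hD2 _ (ha1 j) (haM j)]; omega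
      · refine (hsub z2 hR.inj' _ (M + 1 - n₂) M (by omega) le_rfl fun l hl => ?_).trans (by omega)
        by_cases hli : l = i
        · subst hli
          exact ⟨M + 1 - n₂, le_rfl, by omega, by rw [hz2, Function.update_self]⟩
        · obtain ⟨b, h3, h4, h5, h6⟩ := (hSmem _).1 (hz1S l)
          have e : z2 l = z1 l := by rw [hz2, Function.update_of_ne hli]
          have hl : z2 l ∈ (leftPart (fun a => q (M + 1 - a)) B₂ (k + 2) : Set V) := hl
          rw [e, ← h6, hD2 b h3 h4] at hl
          exact ⟨b, by omega, h4, by rw [h6, e]⟩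
    intro i j
    by_cases hi : a i ≤ n₁ <;> by_cases hj : a j ≤ n₁
    · exact (hleft i j hi hj).mono (by omega)
    · exact hcross i j hi hj
    · exact (hcross j i hj hi).symm
    · refine (hU₂.sw hz ?_ ?_ ?_ : Sw G P z i j).mono (by omega)
      · rw [← haq, hD2 _ (ha1 i) (haM i)]
        have := (haS i).resolve_left hi
        omega
      · rw [← haq, hD2 _ (ha1 j) (haM j)]
        have := (haS j).resolve_left hj
        omega
      · refine (hsub z hz _ (M + 2 - n₂) M (by omega) le_rfl fun l hl => ?_).trans (by omega)
        have hl : z l ∈ (leftPart (fun a => q (M + 1 - a)) B₂ (k + 2) : Set V) := hl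
        rw [← haq, hD2 _ (ha1 l) (haM l)] at hl
        exact ⟨a l, by have := haS l; omega, haM l, haq l⟩
  obtain ⟨x', hxx', hx'⟩ := hgather x hx
  obtain ⟨y', hyy', hy'⟩ := hgather y hy
  obtain ⟨σ, hσ⟩ := exists_perm_of_range_subset (x := x') hyy'.inj' (by
    rintro _ ⟨i, rfl⟩
    have : y' i ∈ Finset.univ.image x' := by rw [hrange x' hxx'.inj' hx']; exact hy' i
    obtain ⟨l, -, hl⟩ := Finset.mem_image.1 this
    exact ⟨l, hl⟩)
  have hmid := reach_perm hxx'.inj' (fun i j _ => hsw x' hxx'.inj' hx' i j) σ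
  rw [← hσ] at hmid
  refine ((hxx'.trans hmid).trans hyy'.symm).mono ?_
  rw [show k * (2 * (P + n) + P) = 2 * (k * n) + 3 * (k * P) by ring]
  omega

end Ends

end GCMP

namespace GCMP
set_option linter.unusedSectionVars false
variable {V ι : Type*} [Fintype ι] [DecidableEq V] [DecidableEq ι] {G : SimpleGraph V}
variable {q : ℕ → V} {M : ℕ} {B₁ B₂ : Finset V} {p : ℕ → ι → V} {T : ℕ}

theorem sum_movesFrom (p : ℕ → ι → V) (T : ℕ) :
    ∑ i, movesFrom p T i 0 = ∑ t ∈ Finset.range T, stepCost (p t) (p (t + 1)) := by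
  have h1 : ∀ i, movesFrom p T i 0 = ∑ t ∈ Finset.range T, if p t i ≠ p (t + 1) i then 1 else 0 := by
    intro i
    rw [← Finset.card_filter, ← Set.ncard_coe_finset]
    unfold movesFrom
    congr 1
    ext t
    simp
  simp_rw [h1]
  rw [Finset.sum_comm]
  refine Finset.sum_congr rfl fun t _ => ?_
  rw [stepCost, Finset.card_filter]

theorem entries_le_cost (p : ℕ → ι → V) (T : ℕ) (v : V) :
    (entries p T v).ncard ≤ ∑ t ∈ Finset.range T, stepCost (p t) (p (t + 1)) := by
  rw [← sum_movesFrom]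
  refine ncard_le_sum_fiber (T := T) (fun q hq => hq.1) _ fun i => ?_
  refine Set.ncard_le_ncard ?_ ((Set.finite_lt_nat T).subset fun _ ht => ht.2.1)
  rintro t ⟨h1, h2, h3⟩
  exact ⟨Nat.zero_le _, h1, fun e => h2 (e.trans h3)⟩

theorem Dumbbell.entries_left [Fintype V] (h : Dumbbell G q M B₁ B₂) (hopt : Opt G p T)
    (hM : 2 * Fintype.card ι + 8 ≤ M) {X P : ℕ}
    (hX : ∑ i, (crossTimes q p T i (Fintype.card ι + 2) 0).ncard ≤ X)
    (hP : 36 * (B₁.card + (Fintype.card ι + 2)) ^ 4 ≤ P) {v : V}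
    (hv : v ∈ leftPart q B₁ (Fintype.card ι + 2)) :
    (entries p T v).ncard ≤
      (2 * Fintype.card ι + X) * (Fintype.card ι + 2 * P + 1) + 2 * P := by
  set k := Fintype.card ι with hk
  set D := leftPart q B₁ (k + 2) with hD
  have hinj := h.corridor.inj
  have hbd : ∀ a ∈ D, ∀ b ∉ D, G.Adj a b → a = q (k + 2) ∧ b = q (k + 2 + 1) := by
    intro a ha b hb hab
    rcases mem_leftPart.1 ha with h1 | ⟨c, h1, h2, rfl⟩
    · exfalso
      rcases h.adj₁ a h1 b hab with h2 | h2
      · exact hb (mem_leftPart.2 (Or.inl h2))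
      · exact hb (mem_leftPart.2 (Or.inr ⟨1, le_rfl, by omega, h2.symm⟩))
    · have h3 : b = q (c + 1) := by
        by_cases hc : c = 1
        · subst hc
          exact (h.adj_first hab).resolve_left fun h4 => hb (mem_leftPart.2 (Or.inl h4))
        · refine (h.corridor.inner c (by omega) (by omega) b hab).resolve_left fun e => ?_
          exact hb (mem_leftPart.2 (Or.inr ⟨c - 1, by omega, by omega, e.symm⟩))
      by_cases hc : c = k + 2
      · subst hc; exact ⟨rfl, h3⟩
      · exact absurd (mem_leftPart.2 (Or.inr ⟨c + 1, by omega, by omega, h3.symm⟩)) hb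
  have hqD : q (k + 2) ∈ D := mem_leftPart.2 (Or.inr ⟨k + 2, by omega, le_rfl, rfl⟩)
  have hnc : NotCycle (G.induce (D : Set V)) := by
    refine ⟨⟨q (k + 2), hqD⟩, fun hcard => ?_⟩
    have hle : ((G.induce (D : Set V)).neighborSet ⟨q (k + 2), hqD⟩).ncard ≤ 1 := by
      rw [Set.ncard_le_one (Set.toFinite _)]
      have : ∀ z : (D : Set V), G.Adj (q (k + 2)) z → (z : V) = q (k + 1) := by
        rintro ⟨z, hz⟩ hadj
        refine (h.corridor.inner (k + 2) (by omega) (by omega) z hadj).resolve_right fun e => ?_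
        change z = _ at e
        have := (h.mem_leftPart_iff (j := k + 2) (b := k + 2 + 1) (by omega) (by omega) (by omega)).1
          (e ▸ hz)
        omega
      intro a ha b hb
      exact Subtype.ext ((this a ha).trans (this b hb).symm)
    omega
  have hDcard : k < D.card := by
    have h1 : (Finset.Icc 1 (k + 2)).image q ⊆ D := Finset.subset_union_right
    have h2 := Finset.card_le_card h1
    rw [Finset.card_image_of_injOn, Nat.card_Icc] at h2
    · omega
    · intro a ha b hb e
      simp only [Finset.coe_Icc, Set.mem_Icc] at ha hb
      exact hinj a b (by omega) (by omega) (by omega) (by omega) e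
  have hcheap : Cheap G ι (D : Set V) P := by
    refine (cheap_of_connected (h.conn_leftPart (by omega) (by omega)) hnc ?_).mono (le_trans ?_ hP)
    · rw [Set.ncard_coe_finset]; exact hDcard
    · rw [Set.ncard_coe_finset]
      exact Nat.mul_le_mul_left _ (Nat.pow_le_pow_left (card_leftPart _ _) 4)
  obtain ⟨Y, hY, hYm⟩ := exists_times (T := T) (S := fun i => crossTimes q p T i (k + 2) 0)
    (fun i t ht => ht.2.1) _ fun i => le_rfl
  have hYprop : ∀ t < T, t ∉ Y → ∀ i, ¬ window p T (∅ : Set V) t i →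
      ¬ window p T (∅ : Set V) (t + 1) i → (p t i ∈ (D : Set V) ↔ p (t + 1) i ∈ (D : Set V)) := by
    intro t ht htY i _ _
    have hnc : ¬ Crosses q p i (k + 2) t := fun hc => htY (hYm i t ⟨Nat.zero_le _, ht, hc⟩)
    simp only [Crosses, not_or] at hnc
    rcases (hopt.step t ht).adj i with e | e
    · rw [e]
    · constructor
      · intro h5
        by_contra h6
        exact hnc.1 (hbd _ h5 _ h6 e)
      · intro h5
        by_contra h6
        exact hnc.2 (hbd _ h5 _ h6 e.symm).symm
  have := hopt.entries_le (H := ∅) (by simp) univ_empty hcheap (Or.inr rfl) Y hYprop v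
  have e : {q : ι × ℕ | q ∈ entries p T v ∧ ¬ window p T (∅ : Set V) q.2 q.1 ∧
      ¬ window p T (∅ : Set V) (q.2 + 1) q.1 ∧ p q.2 q.1 ∉ (D : Set V) ∧ q.2 ∉ Y} = ∅ := by
    ext ⟨i, t⟩
    simp only [Set.mem_ofPred_eq, Set.mem_empty_iff_false, iff_false]
    rintro ⟨⟨ht, -, hv'⟩, hw, hw', h5, h6⟩
    refine h5 ((hYprop t ht h6 i hw hw').2 ?_)
    rw [show p (t + 1) i = v from hv']
    exact hv
  rw [e, Set.ncard_empty, add_zero] at this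
  refine this.trans ?_
  have : Y.card ≤ X := hY.trans hX
  gcongr

theorem crossTimes_reverse (i : ι) {j : ℕ} (hj : j < M) (s : ℕ) :
    crossTimes (fun a => q (M + 1 - a)) p T i j s = crossTimes q p T i (M - j) s := by
  ext t
  have e1 : M + 1 - j = M - j + 1 := by omega
  have e2 : M + 1 - (j + 1) = M - j := by omega
  simp only [crossTimes, Crosses, e1, e2, Set.mem_ofPred_eq]
  tauto

/-- The bound on the number of entries of a vertex when deep edges are traversed rarely. -/
theorem Dumbbell.entries_le [Fintype V] (h : Dumbbell G q M B₁ B₂) (hopt : Opt G p T)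
    (hM : 2 * Fintype.card ι + 8 ≤ M) {X P : ℕ}
    (hX : ∀ j, Fintype.card ι < j → j + Fintype.card ι < M →
      ∑ i, (crossTimes q p T i j 0).ncard ≤ X)
    (hP₁ : 36 * (B₁.card + (Fintype.card ι + 2)) ^ 4 ≤ P)
    (hP₂ : 36 * (B₂.card + (Fintype.card ι + 2)) ^ 4 ≤ P) (v : V) :
    (entries p T v).ncard ≤
      (2 * Fintype.card ι + X) * (Fintype.card ι + 2 * P + 1) + 2 * P + 2 * X := by
  set k := Fintype.card ι with hk
  by_cases h1 : v ∈ leftPart q B₁ (k + 2)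
  · have := h.entries_left hopt hM (hX _ (by omega) (by omega)) hP₁ h1
    exact this.trans (Nat.le_add_right _ _)
  by_cases h2 : v ∈ leftPart (fun a => q (M + 1 - a)) B₂ (k + 2)
  · have := h.reverse.entries_left hopt hM (X := X) (by
      refine le_trans (le_of_eq ?_) (hX (M - (k + 2)) (by omega) (by omega))
      exact Finset.sum_congr rfl fun i _ => by rw [crossTimes_reverse i (by omega)]) hP₂ h2
    exact this.trans (Nat.le_add_right _ _)
  · obtain ⟨b, hb1, hbM, rfl⟩ : ∃ b, 1 ≤ b ∧ b ≤ M ∧ q b = v := by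
      rcases h.cover v with h3 | h3 | h3
      · exact absurd (mem_leftPart.2 (Or.inl h3)) h1
      · exact absurd (mem_leftPart.2 (Or.inl h3)) h2
      · exact h3
    rw [h.mem_leftPart_iff (by omega) hb1 hbM] at h1
    have h3 : b + (k + 2) < M + 1 := by
      by_contra hcon
      refine h2 (mem_leftPart.2 (Or.inr ⟨M + 1 - b, by omega, by omega, ?_⟩))
      congr 1; omega
    have h4 := ncard_le_sum_fiber (S := entries p T (q b)) (T := T) (fun q hq => hq.1)
      (fun i => (crossTimes q p T i (b - 1) 0).ncard + (crossTimes q p T i b 0).ncard) fun i => by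
        refine (Set.ncard_le_ncard ?_ ((finite_crossTimes _ _ _).union (finite_crossTimes _ _ _))).trans
          (Set.ncard_union_le _ _)
        rintro t ⟨ht, hne, hent⟩
        rcases h.corridor.entry_crosses hopt (j := b) (by omega) (by omega) ht hne hent with h5 | h5
        · exact Or.inl ⟨Nat.zero_le _, ht, h5⟩
        · exact Or.inr ⟨Nat.zero_le _, ht, h5⟩
    rw [Finset.sum_add_distrib] at h4
    have h5 := hX (b - 1) (by omega) (by omega)
    have h6 := hX b (by omega) (by omega)
    omega

/-- The bound on the number of entries of a vertex in a large graph without nice vertices. -/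
theorem Opt.entries_of_no_nice [Fintype V] (hG : G.Connected) (hopt : Opt G p T)
    (hk : 1 ≤ Fintype.card ι) (hn : ∀ u, ¬ Nice G (3 * Fintype.card ι + 3) u) (hnc : NotCycle G)
    (hcard : 16 * (3 * Fintype.card ι + 3) ≤ Fintype.card V) (v : V) :
    (entries p T v).ncard ≤ ((2 + (10 + 6 * (36 * 30 ^ 4))) * (2 + 2 * (36 * 30 ^ 4)) +
      2 * (36 * 30 ^ 4) + 2 * (10 + 6 * (36 * 30 ^ 4))) * Fintype.card ι ^ 5 := by
  classical
  set k := Fintype.card ι with hkdef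
  set m := 3 * k + 3 with hm
  set n := Fintype.card V with hndef
  set c := 36 * 30 ^ 4 with hc
  obtain ⟨q, M, B₁, B₂, hd, hB₁, hB₂, hF₁, hF₂⟩ : ∃ q M B₁ B₂, Dumbbell G q M B₁ B₂ ∧
      B₁.card ≤ 4 * m ∧ B₂.card ≤ 4 * m ∧
      (B₁ = ∅ ∨ ∃ y2 y3, y2 ≠ y3 ∧ y2 ∈ B₁ ∧ y3 ∈ B₁ ∧ G.Adj (q 1) y2 ∧ G.Adj (q 1) y3) ∧
      (B₂ = ∅ ∨ ∃ y2 y3, y2 ≠ y3 ∧ y2 ∈ B₂ ∧ y3 ∈ B₂ ∧ G.Adj (q M) y2 ∧ G.Adj (q M) y3) := by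
    obtain ⟨q, M, B₁, B₂, hd, h1, h2⟩ := exists_dumbbell hG (m := m) (by omega) hn hnc (by omega)
    obtain ⟨q', M', B₁', hd', -, hsub, -, hf⟩ := hd.extend
    obtain ⟨q'', M'', B₂', hd'', -, hsub', he, hf'⟩ := hd'.reverse.extend
    refine ⟨q'', M'', B₂', B₁', hd'', (Finset.card_le_card hsub').trans h2,
      (Finset.card_le_card hsub).trans h1, hf', ?_⟩
    rw [he]
    simpa [show M' + 1 - M' = 1 by omega] using hf
  have hMn : n ≤ B₁.card + B₂.card + M := by
    have h1 : (Finset.univ : Finset V) ⊆ B₁ ∪ B₂ ∪ (Finset.Icc 1 M).image q := by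
      intro z _
      simp only [Finset.mem_union, Finset.mem_image, Finset.mem_Icc]
      rcases hd.cover z with h | h | ⟨a, h2, h3, h4⟩
      · exact Or.inl (Or.inl h)
      · exact Or.inl (Or.inr h)
      · exact Or.inr ⟨a, ⟨h2, h3⟩, h4⟩
    have h2 := Finset.card_le_card h1
    rw [Finset.card_univ] at h2
    have h3 := Finset.card_union_le (B₁ ∪ B₂) ((Finset.Icc 1 M).image q)
    have h4 := Finset.card_union_le B₁ B₂
    have h5 : ((Finset.Icc 1 M).image q).card ≤ M := Finset.card_image_le.trans (by simp)
    omega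
  have hP : ∀ B : Finset V, B.card ≤ 4 * m → 36 * (B.card + (k + 2)) ^ 4 ≤ c * k ^ 4 := by
    intro B hB
    have h1 : B.card + (k + 2) ≤ 30 * k := by omega
    have h2 := Nat.pow_le_pow_left h1 4
    rw [mul_pow] at h2
    rw [hc, mul_assoc]
    exact Nat.mul_le_mul_left _ h2
  set P := c * k ^ 4 with hPdef
  have hM : 2 * k + 8 ≤ M := by omega
  have hfinish : (∀ j, k < j → j + k < M →
      ∑ i, (crossTimes q p T i j 0).ncard ≤ (10 + 6 * c) * k) →
      (entries p T v).ncard ≤ ((2 + (10 + 6 * c)) * (2 + 2 * c) + 2 * c + 2 * (10 + 6 * c)) * k ^ 5 := by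
    intro hX
    refine (hd.entries_le hopt hM hX (hP B₁ hB₁) (hP B₂ hB₂) v).trans ?_
    have := visits_arith (P := P) (c := c) (a := 10 + 6 * c) (b := 2 * (10 + 6 * c))
      (X := (10 + 6 * c) * k) hk le_rfl le_rfl
    rw [mul_assoc 2 (10 + 6 * c) k] at this
    exact this
  by_cases hpass : ∃ i s t, s < t ∧ t ≤ T ∧ ((p s i ∈ B₁ ∧ p t i ∈ B₂) ∨ (p s i ∈ B₂ ∧ p t i ∈ B₁))
  · obtain ⟨n₁, n₂, hn₁, hn₂, hnn, hf₁, hf₂⟩ : ∃ n₁ n₂, 1 ≤ n₁ ∧ 1 ≤ n₂ ∧ n₁ + n₂ = k + 1 ∧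
        Fork G n₁ (q 1) B₁ ∧ Fork G n₂ (q M) B₂ := by
      obtain ⟨i, s, t, hst, htT, ⟨h1, h2⟩ | ⟨h1, h2⟩⟩ := hpass
      · exact hd.forks_of_passage hopt hst htT h1 h2 hF₁ hF₂
      · obtain ⟨n₁, n₂, h3, h4, h5, h6, h7⟩ := hd.reverse.forks_of_passage hopt hst htT h1 h2
          (by simpa using hF₂) (by simpa [show M + 1 - M = 1 by omega] using hF₁)
        exact ⟨n₂, n₁, h4, h3, by omega, by simpa [show M + 1 - M = 1 by omega] using h7,
          by simpa using h6⟩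
    have hU₁ := hd.univ_left (ι := ι) (N := n₁) (by omega) (by omega) hf₁ (hP B₁ hB₁)
    have hU₂ := hd.reverse.univ_left (ι := ι) (N := n₂) (by omega) (by omega) (by simpa using hf₂)
      (hP B₂ hB₂)
    have hR := hd.reach hG hn₁ hn₂ hnn hM hU₁ hU₂ (hopt.inj 0 (Nat.zero_le _)) (hopt.inj T le_rfl)
    have htot := hopt.min _ hR
    rw [← hkdef, ← hndef] at htot
    have e5 : k * P = c * k ^ 5 := by rw [hPdef]; ring
    rcases Nat.lt_or_ge (k ^ 4) n with hlt | hge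
    · refine hfinish fun j hj hjM => ?_
      have h1 : ∑ i, (crossTimes q p T i j 0).ncard * M ≤
          ∑ i, (movesFrom p T i 0 + 2 * M) :=
        Finset.sum_le_sum fun i _ => hd.crosses_mul_le hopt i hj hjM
      rw [← Finset.sum_mul, Finset.sum_add_distrib, sum_movesFrom, Finset.sum_const, Finset.card_univ,
        smul_eq_mul, ← hkdef] at h1
      have h2 : n ≤ 2 * M := by omega
      have h3 : k * n ≤ 2 * (k * M) := by
        have := Nat.mul_le_mul_left k h2
        rwa [show k * (2 * M) = 2 * (k * M) by ring] at this
      have h4 : k * P ≤ 2 * (c * (k * M)) := by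
        have h5 : P ≤ c * n := Nat.mul_le_mul_left _ hlt.le
        have h6 := Nat.mul_le_mul_left k h5
        have h7 := Nat.mul_le_mul_left c h3
        rw [show c * (k * n) = k * (c * n) by ring, show c * (2 * (k * M)) = 2 * (c * (k * M)) by ring] at h7
        exact h6.trans h7
      refine Nat.le_of_mul_le_mul_right (c := M) (h1.trans ?_) (by omega)
      rw [show (10 + 6 * c) * k * M = 10 * (k * M) + 6 * (c * (k * M)) by ring,
        show k * (2 * M) = 2 * (k * M) by ring]
      omega
    · refine (entries_le_cost p T v).trans (htot.trans ?_)
      have h1 : k * n ≤ k ^ 5 := by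
        have := Nat.mul_le_mul_left k hge
        rwa [show k * k ^ 4 = k ^ 5 by ring] at this
      have h2 : 4 * (k * n) + 3 * (k * P) ≤ (4 + 3 * c) * k ^ 5 := by
        rw [show (4 + 3 * c) * k ^ 5 = 4 * k ^ 5 + 3 * (c * k ^ 5) by ring]
        omega
      refine h2.trans (Nat.mul_le_mul_right _ ?_)
      have : 0 ≤ (2 + (10 + 6 * c)) * (2 + 2 * c) := Nat.zero_le _
      omega
  · refine hfinish fun j hj hjM => ?_
    refine (Finset.sum_le_sum (g := fun _ => 2) fun i _ => ?_).trans ?_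
    · by_contra hcon
      push Not at hcon
      obtain ⟨s, t, h1⟩ := hd.exists_passage hopt hj hjM (i := i) (by omega)
      exact hpass ⟨i, s, t, h1⟩
    · rw [Finset.sum_const, Finset.card_univ, smul_eq_mul, ← hkdef, mul_comm]
      exact Nat.mul_le_mul_right _ (by omega)

end GCMP

namespace GCMP
set_option linter.unusedSectionVars false
variable {V ι : Type*} [Fintype ι] [DecidableEq V] [DecidableEq ι] {G : SimpleGraph V}

/-- The integer line `π` winds around the cycle `G` of length `n`. -/
structure Unroll (G : SimpleGraph V) (n : ℤ) (π : ℤ → V) : Prop where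
  three : 3 ≤ n
  eq_iff : ∀ a b, π a = π b ↔ n ∣ a - b
  adj : ∀ a, G.Adj (π a) (π (a + 1))
  nbr : ∀ a v, G.Adj (π a) v → v = π (a + 1) ∨ v = π (a - 1)
  surj : ∀ v, ∃ a, π a = v

theorem exists_unroll [Fintype V] (hG : G.Connected) (h2 : ∀ v, (G.neighborSet v).ncard = 2) :
    ∃ n π, Unroll G n π := by
  obtain ⟨v⟩ := hG.nonempty
  have hne : (G.neighborSet v).Nonempty := by
    rw [← Set.ncard_pos, h2]
    omega
  obtain ⟨c, hc, hcov⟩ := IsCycles.exists_cycle_toSubgraph_verts_eq_connectedComponentSupp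
    (c := G.connectedComponentMk v) (fun u _ => h2 u) rfl hne
  have h3 := hc.three_le_length
  have hn0 : (0 : ℤ) < c.length := by omega
  have hlt (a : ℤ) : (a % c.length).toNat < c.length := by
    have := Int.emod_lt_of_pos a hn0
    have := Int.emod_nonneg a hn0.ne'
    omega
  have heq (a b : ℤ) : c.getVert (a % c.length).toNat = c.getVert (b % c.length).toNat ↔
      (c.length : ℤ) ∣ a - b := by
    rw [← Int.emod_eq_emod_iff_emod_sub_eq_zero.trans (Int.dvd_iff_emod_eq_zero).symm]
    have ha := Int.emod_nonneg a hn0.ne'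
    have hb := Int.emod_nonneg b hn0.ne'
    refine ⟨fun h => ?_, fun h => by rw [h]⟩
    have h1 := hlt a
    have h2 := hlt b
    have := hc.getVert_injOn' (by rw [Set.mem_ofPred_eq]; omega) (by rw [Set.mem_ofPred_eq]; omega) h
    omega
  have hadj (a : ℤ) : G.Adj (c.getVert (a % c.length).toNat)
      (c.getVert ((a + 1) % c.length).toNat) := by
    have h1 := c.adj_getVert_succ (hlt a)
    have ha := Int.emod_nonneg a hn0.ne'
    have h4 : (a + 1) % c.length = (a % c.length + 1) % c.length := by
      rw [Int.emod_add_emod]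
    rcases Nat.lt_or_ge ((a % c.length).toNat + 1) c.length with h | h
    · rw [h4, Int.emod_eq_of_lt (a := a % c.length + 1) (by omega) (by omega)]
      rwa [show (a % c.length + 1).toNat = (a % c.length).toNat + 1 by omega]
    · have := hlt a
      have h5 : a % c.length + 1 = c.length := by omega
      rw [h4, h5, Int.emod_self, Int.toNat_zero, c.getVert_zero]
      rwa [show (a % c.length).toNat + 1 = c.length by omega, c.getVert_length] at h1
  refine ⟨c.length, fun a => c.getVert (a % c.length).toNat, by exact_mod_cast h3, heq, hadj, ?_, ?_⟩
  · intro a u hu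
    have hsub : {c.getVert ((a + 1) % c.length).toNat, c.getVert ((a - 1) % c.length).toNat} ⊆
        G.neighborSet (c.getVert (a % c.length).toNat) := by
      rintro w (rfl | rfl)
      · exact hadj a
      · have := (hadj (a - 1)).symm
        rwa [sub_add_cancel] at this
    have hE := Set.eq_of_subset_of_ncard_le hsub (by
      rw [h2, Set.ncard_pair]
      rw [Ne, heq]
      intro hd
      have := Int.le_of_dvd (by omega) hd
      omega)
    have : u ∈ G.neighborSet (c.getVert (a % c.length).toNat) := hu
    rwa [← hE] at this
  · intro u
    have hu : u ∈ c.toSubgraph.verts := by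
      rw [hcov]
      exact ConnectedComponent.sound (hG.preconnected u v)
    rw [Walk.mem_verts_toSubgraph, Walk.mem_support_iff_exists_getVert] at hu
    obtain ⟨m, hm, hle⟩ := hu
    rcases hle.lt_or_eq with h | h
    · exact ⟨m, by rw [Int.emod_eq_of_lt (by omega) (by omega)]; simpa using hm⟩
    · refine ⟨0, ?_⟩
      rw [Int.zero_emod, Int.toNat_zero, c.getVert_zero, ← hm, h, c.getVert_length]

/-- The lifts `A` and `B` have the same cyclic order. -/
def Compat (n : ℤ) (A B : ι → ℤ) : Prop := ∀ i j q, n ∣ q → A i < A j + q → B i < B j + q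

variable {n : ℤ} {π : ℤ → V} {A B C : ι → ℤ}

theorem Compat.symm (h : Compat n A B) (hA : ∀ i j, n ∣ A i - A j → i = j) : Compat n B A := by
  intro i j q hq hlt
  by_contra hcon
  rcases (not_lt.1 hcon).lt_or_eq with h1 | h1
  · have := h j i (-q) (dvd_neg.2 hq) (by omega)
    omega
  · obtain rfl := hA i j (by rw [← h1]; simpa using hq)
    omega

theorem Unroll.compat_inj (h : Unroll G n π) (hA : Function.Injective (π ∘ A)) (i j : ι)
    (hd : n ∣ A i - A j) : i = j :=
  hA ((h.eq_iff _ _).2 hd)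

theorem Compat.injective (h : Unroll G n π) (hAB : Compat n A B) (hA : Function.Injective (π ∘ A)) :
    Function.Injective (π ∘ B) := by
  intro i j hij
  have hd := (h.eq_iff _ _).1 hij
  by_contra hne
  rcases lt_trichotomy (A i) (A j + (B i - B j)) with h1 | h1 | h1
  · have := hAB i j _ hd h1
    omega
  · exact hne (h.compat_inj hA i j (by rw [h1]; simpa using hd))
  · have := hAB j i (-(B i - B j)) (dvd_neg.2 hd) (by omega)
    omega

theorem Compat.of_step (h : Unroll G n π) (hs : Step G (π ∘ A) (π ∘ B))
    (h1 : ∀ i, |B i - A i| ≤ 1) : Compat n A B := by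
  intro i j q hq hlt
  by_contra hcon
  have hi := abs_le.1 (h1 i)
  have hj := abs_le.1 (h1 j)
  rcases eq_or_ne i j with rfl | hij
  · omega
  rcases (not_lt.1 hcon).lt_or_eq with h2 | h2
  · refine hs.noswap i j hij ⟨(h.eq_iff _ _).2 ?_, (h.eq_iff _ _).2 ?_⟩
    · rwa [show B i - A j = q by omega]
    · rwa [show B j - A i = -q by omega, dvd_neg]
  · exact hij (h.compat_inj hs.inj' i j (by rw [← h2]; simpa using hq))

theorem Compat.step (h : Unroll G n π) (hAB : Compat n A B) (hA : Function.Injective (π ∘ A))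
    (h1 : ∀ i, B i = A i ∨ B i = A i + 1) : Step G (π ∘ A) (π ∘ B) where
  inj := hA
  inj' := hAB.injective h hA
  adj i := by
    rcases h1 i with h2 | h2
    · exact Or.inl (by simp [h2])
    · right
      simp only [Function.comp_apply, h2]
      exact h.adj _
  noswap i j hij := by
    rintro ⟨h3, h4⟩
    have hinj := h.compat_inj hA
    have h5 := (h.eq_iff _ _).1 h3
    have h6 := (h.eq_iff _ _).1 h4
    rcases h1 i with h2 | h2
    · exact hij (hinj i j (by rwa [h2] at h5))
    rcases h1 j with h7 | h7
    · exact hij (hinj j i (by rwa [h7] at h6)).symm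
    have h8 := dvd_add h5 h6
    have := h.three
    rw [show B i - A j + (B j - A i) = 2 by omega] at h8
    have := Int.le_of_dvd (by omega) h8
    omega

theorem Compat.reach_up (h : Unroll G n π) (N : ℕ) : ∀ A B : ι → ℤ, Compat n A B →
    Function.Injective (π ∘ A) → (∀ i, A i ≤ B i) → ∑ i, (B i - A i) = N →
    Reach G (π ∘ A) (π ∘ B) N := by
  induction N using Nat.strong_induction_on with
  | _ N ih =>
  intro A B hAB hA hle hN
  by_cases heq : A = B
  · subst heq
    exact .refl _ hA _
  obtain ⟨i₀, hi₀⟩ : ∃ i, A i < B i := by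
    by_contra hcon
    push Not at hcon
    exact heq (funext fun i => le_antisymm (hle i) (hcon i))
  set A' : ι → ℤ := fun i => if A i < B i then A i + 1 else A i with hA'
  have h1 : ∀ i, A' i = A i ∨ A' i = A i + 1 := fun i => by
    simp only [hA']; split_ifs <;> simp
  have hAA' : Compat n A A' := by
    intro i j q hq hlt
    have h2 := hAB i j q hq hlt
    have h3 := hle j
    simp only [hA']
    split_ifs <;> omega
  have hinj := h.compat_inj hA
  have hA'inj := hAA'.injective h hA
  have hA'B : Compat n A' B := fun i j q hq hlt => hAB i j q hq (hAA'.symm hinj i j q hq hlt)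
  have hst := hAA'.step h hA h1
  have hcost : ((stepCost (π ∘ A) (π ∘ A') : ℕ) : ℤ) ≤ ∑ i, (A' i - A i) := by
    rw [stepCost, Finset.card_filter]
    push_cast
    refine Finset.sum_le_sum fun i _ => ?_
    split_ifs with hne
    · rcases h1 i with h4 | h4
      · exact absurd (by simp [h4]) hne
      · omega
    · rcases h1 i with h4 | h4 <;> omega
  have hsum : ∑ i, (B i - A i) = ∑ i, (B i - A' i) + ∑ i, (A' i - A i) := by
    rw [← Finset.sum_add_distrib]
    exact Finset.sum_congr rfl fun i _ => by ring
  have hpos : 0 < ∑ i, (A' i - A i) := by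
    refine Finset.sum_pos' (fun i _ => by rcases h1 i with h4 | h4 <;> omega)
      ⟨i₀, Finset.mem_univ _, by simp [hA', hi₀]⟩
  have hle' : ∀ i, A' i ≤ B i := fun i => by
    have := hle i
    simp only [hA']; split_ifs <;> omega
  have hnn : 0 ≤ ∑ i, (B i - A' i) := Finset.sum_nonneg fun i _ => by
    have := hle' i
    omega
  have hr := ih (∑ i, (B i - A' i)).toNat (by omega) A' B hA'B hA'inj hle' (by omega)
  exact ((Reach.single hst).trans hr).mono (by omega)

theorem Compat.reach (h : Unroll G n π) (hAB : Compat n A B) (hA : Function.Injective (π ∘ A)) :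
    Reach G (π ∘ A) (π ∘ B) (∑ i, (B i - A i).natAbs) := by
  set Z : ι → ℤ := fun i => max (A i) (B i) with hZ
  have hAZ : Compat n A Z := fun i j q hq hlt => by
    have := hAB i j q hq hlt
    simp only [hZ]; omega
  have hBA := hAB.symm (h.compat_inj hA)
  have hBZ : Compat n B Z := fun i j q hq hlt => hAZ i j q hq (hBA i j q hq hlt)
  have h1 : ∀ i, A i ≤ Z i := fun i => le_max_left _ _
  have h2 : ∀ i, B i ≤ Z i := fun i => le_max_right _ _
  have n1 : 0 ≤ ∑ i, (Z i - A i) := Finset.sum_nonneg fun i _ => by have := h1 i; omega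
  have n2 : 0 ≤ ∑ i, (Z i - B i) := Finset.sum_nonneg fun i _ => by have := h2 i; omega
  have r1 := Compat.reach_up h (∑ i, (Z i - A i)).toNat A Z hAZ hA h1 (by omega)
  have r2 := Compat.reach_up h (∑ i, (Z i - B i)).toNat B Z hBZ (hAB.injective h hA) h2 (by omega)
  refine (r1.trans r2.symm).mono ?_
  have hs : ∑ i, (Z i - A i) + ∑ i, (Z i - B i) = ((∑ i, (B i - A i).natAbs : ℕ) : ℤ) := by
    rw [← Finset.sum_add_distrib]
    rw [Nat.cast_sum]
    refine Finset.sum_congr rfl fun i _ => ?_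
    simp only [hZ]; omega
  omega

variable {p : ℕ → ι → V} {T : ℕ}

theorem Unroll.exists_lift (h : Unroll G n π) (hp : ∀ t < T, Step G (p t) (p (t + 1))) (i : ι) :
    ∃ X : ℕ → ℤ, ∀ t ≤ T, π (X t) = p t i ∧
      (t < T → (X (t + 1) - X t).natAbs = if p t i ≠ p (t + 1) i then 1 else 0) := by
  have hex (a : ℤ) (t : ℕ) : ∃ b, t < T → π a = p t i → π b = p (t + 1) i ∧
      (b - a).natAbs = if p t i ≠ p (t + 1) i then 1 else 0 := by
    by_cases ht : t < T ∧ π a = p t i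
    · rcases (hp t ht.1).adj i with h1 | h1
      · exact ⟨a, fun _ _ => ⟨by rw [h1, ht.2], by simp [h1]⟩⟩
      · have hne := h1.ne
        rw [← ht.2] at h1
        rcases h.nbr _ _ h1 with h2 | h2
        · exact ⟨a + 1, fun _ _ => ⟨h2.symm, by rw [if_pos hne]; omega⟩⟩
        · exact ⟨a - 1, fun _ _ => ⟨h2.symm, by rw [if_pos hne]; omega⟩⟩
    · exact ⟨0, fun h1 h2 => absurd ⟨h1, h2⟩ ht⟩
  choose f hf using hex
  obtain ⟨a₀, ha₀⟩ := h.surj (p 0 i)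
  let X : ℕ → ℤ := fun t => Nat.rec a₀ (fun t a => f a t) t
  have hX : ∀ t ≤ T, π (X t) = p t i := by
    intro t
    induction t with
    | zero => exact fun _ => ha₀
    | succ t ih => exact fun ht => (hf (X t) t (by omega) (ih (by omega))).1
  exact ⟨X, fun t ht => ⟨hX t ht, fun ht' => (hf (X t) t ht' (hX t ht)).2⟩⟩

theorem natAbs_sub_le_sum (X : ℕ → ℤ) {s t : ℕ} (hst : s ≤ t) :
    (X t - X s).natAbs ≤ ∑ r ∈ Finset.Ico s t, (X (r + 1) - X r).natAbs := by
  induction t, hst using Nat.le_induction with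
  | base => simp
  | succ t hst ih =>
    rw [Finset.sum_Ico_succ_top hst]
    omega

/-- On a cycle, every robot of an optimal motion enters a vertex at most four times. -/
theorem Opt.entries_of_cycle [Fintype V] (hG : G.Connected) (hopt : Opt G p T)
    (hk : 1 ≤ Fintype.card ι) (hc : ¬ NotCycle G) (v : V) :
    (entries p T v).ncard ≤ 4 * Fintype.card ι := by
  obtain ⟨n, π, h⟩ := exists_unroll hG (by simpa [NotCycle] using hc)
  have hn := h.three
  choose X hX using h.exists_lift hopt.step
  have hπ : ∀ t ≤ T, π ∘ (fun i => X i t) = p t := fun t ht => funext fun i => (hX i t ht).1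
  have hinj0 : Function.Injective (π ∘ fun i => X i 0) := by
    rw [hπ 0 (Nat.zero_le _)]; exact hopt.inj 0 (Nat.zero_le _)
  have hcomp : ∀ t ≤ T, Compat n (fun i => X i 0) (fun i => X i t) := by
    intro t
    induction t with
    | zero => exact fun _ i j q _ hlt => hlt
    | succ t ih =>
      intro ht i j q hq hlt
      refine Compat.of_step h (A := fun i => X i t) (B := fun i => X i (t + 1)) ?_ (fun i => ?_)
        i j q hq (ih (by omega) i j q hq hlt)
      · rw [hπ t (by omega), hπ (t + 1) ht]
        exact hopt.step t (by omega)
      · have := (hX i t (by omega)).2 (by omega)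
        rw [Int.abs_eq_natAbs]
        split_ifs at this <;> omega
  set D : ι → ℤ := fun i => X i T - X i 0 with hD
  set mv : ι → ℕ := fun i => ∑ t ∈ Finset.range T, (X i (t + 1) - X i t).natAbs with hmv
  have htot : ∑ t ∈ Finset.range T, stepCost (p t) (p (t + 1)) = ∑ i, mv i := by
    rw [Finset.sum_comm]
    refine Finset.sum_congr rfl fun t ht => ?_
    rw [stepCost, Finset.card_filter]
    exact Finset.sum_congr rfl fun i _ =>
      ((hX i t (Finset.mem_range.1 ht).le).2 (Finset.mem_range.1 ht)).symm
  have hshift (q : ℤ) (hq : n ∣ q) : ∑ i, mv i ≤ ∑ i, (D i - q).natAbs := by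
    rw [← htot]
    refine hopt.min _ ?_
    have hr := Compat.reach h (A := fun i => X i 0) (B := fun i => X i T - q)
      (fun i j r hr hlt => by have := hcomp T le_rfl i j r hr hlt; beta_reduce at this ⊢; omega) hinj0
    have he : π ∘ (fun i => X i T - q) = p T := by
      rw [← hπ T le_rfl]
      exact funext fun i => (h.eq_iff _ _).2 (by simpa using hq)
    rw [hπ 0 (Nat.zero_le _), he] at hr
    refine hr.mono (Finset.sum_le_sum fun i _ => ?_)
    simp only [hD]; omega
  have hDmv (i : ι) : (D i).natAbs ≤ mv i := by
    simp only [hmv, Finset.range_eq_Ico]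
    exact natAbs_sub_le_sum (X i) (Nat.zero_le T)
  have hmvD (i : ι) : mv i = (D i).natAbs := by
    have h1 := hshift 0 (dvd_zero _)
    simp only [sub_zero] at h1
    exact ((Finset.sum_eq_sum_iff_of_le fun i _ => hDmv i).1
      (le_antisymm (Finset.sum_le_sum fun i _ => hDmv i) h1) i (Finset.mem_univ _)).symm
  have hdiff (i j : ι) : D i - D j < n := by
    have h1 := hcomp T le_rfl i j (n * ((X i 0 - X j 0) / n + 1)) (dvd_mul_right _ _) (by
      have := Int.lt_mul_ediv_self_add (x := X i 0 - X j 0) (k := n) (by omega)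
      rw [mul_add]
      beta_reduce
      omega)
    have h2 := Int.mul_ediv_self_le (x := X i 0 - X j 0) (k := n) (by omega)
    rw [mul_add] at h1
    beta_reduce at h1
    simp only [hD]
    omega
  obtain ⟨i₁⟩ : Nonempty ι := Fintype.card_pos_iff.1 hk
  have hlow : ∃ i, D i < n := by
    by_contra! hcon
    have h1 := hshift n dvd_rfl
    have h2 : ∑ i, (D i - n).natAbs < ∑ i, mv i :=
      Finset.sum_lt_sum_of_nonempty ⟨i₁, Finset.mem_univ _⟩ fun i _ => by
        have := hcon i
        rw [hmvD]; omega
    omega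
  have hhigh : ∃ i, -n < D i := by
    by_contra! hcon
    have h1 := hshift (-n) (dvd_neg.2 dvd_rfl)
    have h2 : ∑ i, (D i - -n).natAbs < ∑ i, mv i :=
      Finset.sum_lt_sum_of_nonempty ⟨i₁, Finset.mem_univ _⟩ fun i _ => by
        have := hcon i
        rw [hmvD]; omega
    omega
  obtain ⟨i₂, hi₂⟩ := hlow
  obtain ⟨i₃, hi₃⟩ := hhigh
  have hsmall (i : ι) : (mv i : ℤ) < 2 * n := by
    have h1 := hdiff i i₂
    have h2 := hdiff i₃ i
    rw [hmvD]; omega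
  refine (ncard_le_sum_fiber (S := entries p T v) (fun q hq => hq.1) (fun _ => 4) fun i => ?_).trans
    (by simp [mul_comm])
  have hsplit {s t : ℕ} (hst : s ≤ t) (ht : t ≤ T) : (X i s - X i 0).natAbs +
      ∑ r ∈ Finset.Ico s t, (X i (r + 1) - X i r).natAbs + (X i T - X i t).natAbs ≤ mv i := by
    have h1 := natAbs_sub_le_sum (X i) (Nat.zero_le s)
    have h2 := natAbs_sub_le_sum (X i) ht
    have h3 := Finset.sum_Ico_consecutive (fun r => (X i (r + 1) - X i r).natAbs) (Nat.zero_le s) hst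
    have h4 := Finset.sum_Ico_consecutive (fun r => (X i (r + 1) - X i r).natAbs)
      (Nat.zero_le t) ht
    simp only [hmv, Finset.range_eq_Ico]
    omega
  have hne {s t : ℕ} (hst : s < t) (ht : t < T) (hm : p t i ≠ p (t + 1) i) :
      X i (s + 1) ≠ X i (t + 1) := by
    intro he
    have h1 := hsplit (s := s + 1) (t := t + 1) (by omega) (by omega)
    rw [Finset.sum_Ico_succ_top (by omega), (hX i t (by omega)).2 ht, if_pos hm] at h1
    have := hmvD i
    simp only [hD] at this
    omega
  have hcard : ((Finset.Ico (0 : ℤ) 4 : Finset ℤ) : Set ℤ).ncard = 4 := by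
    rw [Set.ncard_coe_finset]; rfl
  rw [← hcard]
  refine Set.ncard_le_ncard_of_injOn (fun t => (X i (t + 1) - X i 0 + 2 * n) / n) ?_ ?_
    (Finset.finite_toSet _)
  · rintro t ⟨ht, -, -⟩
    have ht : t < T := ht
    have h1 := hsplit (s := t + 1) (t := t + 1) le_rfl (by omega)
    have h2 := hsmall i
    rw [Finset.coe_Ico]
    exact ⟨Int.ediv_nonneg (by omega) (by omega), Int.ediv_lt_of_lt_mul (by omega) (by omega)⟩
  · rintro s ⟨hs, hs1, hs2⟩ t ⟨ht, ht1, ht2⟩ hst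
    have hs : s < T := hs
    have ht : t < T := ht
    simp only at hs1 hs2 ht1 ht2
    have hd : n ∣ X i (s + 1) - X i (t + 1) := by
      rw [← h.eq_iff, (hX i _ (by omega)).1, (hX i _ (by omega)).1, hs2, ht2]
    have heq : X i (s + 1) = X i (t + 1) := by
      have h1 : (X i (s + 1) - X i 0 + 2 * n) % n = (X i (t + 1) - X i 0 + 2 * n) % n := by
        refine Int.emod_eq_emod_iff_emod_sub_eq_zero.2 (Int.emod_eq_zero_of_dvd ?_)
        rwa [show X i (s + 1) - X i 0 + 2 * n - (X i (t + 1) - X i 0 + 2 * n) =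
          X i (s + 1) - X i (t + 1) by ring]
      have h2 := Int.mul_ediv_add_emod (X i (s + 1) - X i 0 + 2 * n) n
      have h3 := Int.mul_ediv_add_emod (X i (t + 1) - X i 0 + 2 * n) n
      beta_reduce at hst
      rw [hst, h1] at h2
      omega
    rcases lt_trichotomy s t with h1 | h1 | h1
    · exact absurd heq (hne h1 ht (by rw [ht2]; exact ht1))
    · exact h1
    · exact absurd heq.symm (hne h1 hs (by rw [hs2]; exact hs1))

end GCMP

namespace GCMP
set_option linter.unusedSectionVars false
variable {V ι : Type*} [Fintype ι] [DecidableEq V] [DecidableEq ι] {G : SimpleGraph V}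

open Equiv (swap Perm)

/-- `σ` is a product of at most `c` rotations. -/
def Word (G : SimpleGraph V) (c : ℕ) (σ : Perm V) : Prop :=
  ∃ l : List (Perm V), (∀ r ∈ l, Rot G r) ∧ l.length ≤ c ∧ l.prod = σ

variable {c d : ℕ} {σ τ ρ : Perm V}

theorem Word.mono (h : Word G c σ) (hcd : c ≤ d) : Word G d σ := by
  obtain ⟨l, h1, h2, h3⟩ := h
  exact ⟨l, h1, h2.trans hcd, h3⟩

theorem Word.mul (h : Word G c σ) (h' : Word G d τ) : Word G (c + d) (σ * τ) := by
  obtain ⟨l, h1, h2, rfl⟩ := h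
  obtain ⟨l', h1', h2', rfl⟩ := h'
  refine ⟨l ++ l', fun r hr => ?_, by simp; omega, by simp⟩
  rcases List.mem_append.1 hr with h | h
  exacts [h1 r h, h1' r h]

theorem Word.inv (h : Word G c σ) : Word G c σ⁻¹ := by
  obtain ⟨l, h1, h2, rfl⟩ := h
  refine ⟨(l.map (·⁻¹)).reverse, fun r hr => ?_, by simpa using h2, by rw [List.prod_inv_reverse]⟩
  simp only [List.mem_reverse, List.mem_map] at hr
  obtain ⟨r', hr', rfl⟩ := hr
  exact (h1 r' hr').inv

theorem Rot.word_pow (h : Rot G ρ) (a : ℕ) : Word G a (ρ ^ a) :=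
  ⟨List.replicate a ρ, fun r hr => by rwa [List.eq_of_mem_replicate hr], by simp, by simp⟩

theorem Rot.word (h : Rot G ρ) : Word G 1 ρ := by
  simpa using h.word_pow 1

theorem Word.reach (h : Word G c σ) {x : ι → V} (hx : Function.Injective x) :
    Reach G x (σ ∘ x) (c * Fintype.card ι) := by
  obtain ⟨l, h1, h2, rfl⟩ := h
  refine Reach.mono ?_ (Nat.mul_le_mul_right _ h2)
  clear h2
  induction l with
  | nil => exact .refl _ hx _
  | cons r l ih =>
    have h3 := ih fun r hr => h1 r (List.mem_cons_of_mem _ hr)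
    have h4 := h3.trans ((h1 r (List.mem_cons_self)).reach h3.inj')
    rw [List.prod_cons, List.length_cons, add_mul, one_mul]
    exact h4

theorem word_of_mem_closure (h : σ ∈ Subgroup.closure {ρ | Rot G ρ}) : ∃ c, Word G c σ := by
  induction h using Subgroup.closure_induction with
  | mem r hr => exact ⟨1, hr.word⟩
  | one => exact ⟨0, [], by simp, by simp, rfl⟩
  | mul a b _ _ ha hb =>
    obtain ⟨c, hc⟩ := ha
    obtain ⟨d, hd⟩ := hb
    exact ⟨_, hc.mul hd⟩
  | inv a _ ha =>
    obtain ⟨c, hc⟩ := ha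
    exact ⟨c, hc.inv⟩

theorem Word.mem_closure (h : Word G c σ) : σ ∈ Subgroup.closure {ρ | Rot G ρ} := by
  obtain ⟨l, h1, -, rfl⟩ := h
  exact Subgroup.list_prod_mem _ fun r hr => Subgroup.subset_closure (h1 r hr)

/-- A point of a finite orbit is reached by a short word. -/
theorem Word.short {Ω : Type*} [Fintype Ω] [MulAction (Perm V) Ω] (h : Word G c σ) (ω : Ω) :
    ∃ τ, Word G (Fintype.card Ω) τ ∧ τ • ω = σ • ω := by
  classical
  obtain ⟨l₀, h1₀, -, h3₀⟩ := h
  have hex : ∃ m, ∃ l : List (Perm V), l.length = m ∧ (∀ r ∈ l, Rot G r) ∧ l.prod • ω = σ • ω :=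
    ⟨_, l₀, rfl, h1₀, by rw [h3₀]⟩
  obtain ⟨l, hl, h1, h2⟩ := Nat.find_spec hex
  refine ⟨l.prod, ⟨l, h1, ?_, rfl⟩, h2⟩
  by_contra! hlt
  obtain ⟨i, j, hij, he⟩ := Fintype.exists_ne_map_eq_of_card_lt
    (fun i : Fin (l.length + 1) => (l.drop i).prod • ω) (by simp; omega)
  wlog hlt' : i < j generalizing i j
  · exact this j i hij.symm he.symm (lt_of_le_of_ne (not_lt.1 hlt') hij.symm)
  have hlt'' : (i : ℕ) < j := hlt'
  refine Nat.find_min hex (m := (l.take i ++ l.drop j).length) ?_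
    ⟨l.take i ++ l.drop j, rfl, fun r hr => ?_, ?_⟩
  · rw [← hl]
    simp only [List.length_append, List.length_take, List.length_drop]
    omega
  · rcases List.mem_append.1 hr with h | h
    exacts [h1 r (List.mem_of_mem_take h), h1 r (List.mem_of_mem_drop h)]
  · rw [List.prod_append, mul_smul, ← he, ← mul_smul, ← List.prod_append, List.take_append_drop, h2]

theorem formPerm_append_cons (l : List V) (f : V) (B : List V) :
    (l ++ f :: B).formPerm = (l ++ [f]).formPerm * (f :: B).formPerm := by
  induction l with
  | nil => simp
  | cons a l ih =>
    cases l with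
    | nil => simp [List.formPerm_cons_cons]
    | cons b l =>
      simp only [List.cons_append, List.formPerm_cons_cons] at ih ⊢
      rw [ih, mul_assoc]

theorem rot_of_isChain {y : V} {m : List V} (hl : (y :: m).Nodup) (h3 : 2 ≤ m.length)
    (hc : List.IsChain G.Adj (y :: m ++ [y])) : Rot G (y :: m).formPerm := by
  rw [List.isChain_iff_getElem] at hc
  refine rot_formPerm hl (by simp; omega) (fun i hi => ?_) ?_
  · have := hc i (by simp at hi ⊢; omega)
    rwa [List.getElem_append_left (by omega), List.getElem_append_left hi] at this
  · have := hc ((y :: m).length - 1) (by simp)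
    rw [List.getElem_append_left (by simp), List.getElem_append_right (by simp)] at this
    simpa using this

/-- In a union of three paths `A`, `E`, `B` between `y` and `f`, the vertex `y` can be exchanged
with the first vertex of `E`. -/
theorem word_swap_of_theta {y f a : V} {A E B m : List V}
    (hnd : (y :: f :: (A ++ E ++ B)).Nodup) (hA : List.IsChain G.Adj (y :: A ++ [f]))
    (hE : List.IsChain G.Adj (y :: E ++ [f])) (hB : List.IsChain G.Adj (f :: B ++ [y]))
    (hAE : 0 < (A ++ E).length) (hAB : 0 < (A ++ B).length) (hEB : 0 < (E ++ B).length)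
    (ha : E ++ [f] = a :: m) : Word G 3 (swap y a) := by
  have hcount := List.nodup_iff_count_le_one.1 hnd
  simp only [List.count_cons, List.count_append] at hcount
  have mk (P Q : List V) (h1 : ∀ w, List.count w (y :: (P ++ f :: Q)) ≤ 1) (h2 : 0 < (P ++ Q).length)
      (h3 : List.IsChain G.Adj (y :: P ++ [f])) (h4 : List.IsChain G.Adj (f :: Q ++ [y])) :
      Rot G (y :: P ++ f :: Q).formPerm := by
    refine rot_of_isChain (m := P ++ f :: Q) (List.nodup_iff_count_le_one.2 h1)
      (by simp at *; omega) ?_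
    simpa using (List.isChain_split (l₁ := y :: P)).2 ⟨h3, h4⟩
  simp only [List.count_cons, List.count_append] at mk
  have r1 := mk A B (fun w => by have := hcount w; omega) hAB hA hB
  have r2 := mk E B (fun w => by have := hcount w; omega) hEB hE hB
  have hE' : List.IsChain G.Adj (f :: E.reverse ++ [y]) := by
    have : f :: E.reverse ++ [y] = (y :: E ++ [f]).reverse := by simp
    rw [this, List.isChain_reverse]
    exact hE.imp fun _ _ h => h.symm
  have r3 := mk A E.reverse (fun w => by
    have := hcount w
    rw [List.count_reverse]; omega) (by simpa using hAE) hA hE'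
  have key : swap y a = (y :: A ++ f :: E.reverse).formPerm⁻¹ *
      ((y :: A ++ f :: B).formPerm * (y :: E ++ f :: B).formPerm⁻¹) := by
    have h1 : (f :: E.reverse).formPerm = (a :: m).formPerm⁻¹ := by
      rw [← List.formPerm_reverse, ← ha]
      simp
    rw [formPerm_append_cons (y :: A), formPerm_append_cons (y :: A) f B,
      formPerm_append_cons (y :: E), h1, List.cons_append (as := E), ha, List.formPerm_cons_cons]
    simp only [mul_inv_rev, inv_inv, Equiv.swap_inv]
    group
  rw [key]
  exact r3.word.inv.mul (r1.word.mul r2.word.inv)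

/-- The commutator of permutations whose supports share one point is a three-cycle. -/
theorem commutator_eq {f g : Perm V} {y : V} (hfg : ∀ w, f w ≠ w → g w ≠ w → w = y)
    (hf : f y ≠ y) (hg : g y ≠ y) :
    f * g * f⁻¹ * g⁻¹ = swap y (g y) * swap y (f y) := by
  rw [mul_inv_eq_iff_eq_mul, mul_inv_eq_iff_eq_mul]
  have mf : ∀ w, f w ≠ w → f (f w) ≠ f w := fun w hw h => hw (f.injective h)
  have mg : ∀ w, g w ≠ w → g (g w) ≠ g w := fun w hw h => hw (g.injective h)
  have h1 : f y ≠ g y := fun h => hf (hfg _ (mf y hf) (by rw [h]; exact mg y hg))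
  have τo : ∀ w, w ≠ y → w ≠ f y → w ≠ g y → swap y (g y) (swap y (f y) w) = w := fun w a b c => by
    rw [Equiv.swap_apply_of_ne_of_ne a b, Equiv.swap_apply_of_ne_of_ne a c]
  have τy : swap y (g y) (swap y (f y) y) = f y := by
    rw [Equiv.swap_apply_left, Equiv.swap_apply_of_ne_of_ne hf h1]
  have τf : swap y (g y) (swap y (f y) (f y)) = g y := by
    rw [Equiv.swap_apply_right, Equiv.swap_apply_left]
  have τg : swap y (g y) (swap y (f y) (g y)) = y := by
    rw [Equiv.swap_apply_of_ne_of_ne hg h1.symm, Equiv.swap_apply_right]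
  ext w
  simp only [Equiv.Perm.mul_apply]
  have gf : g (f y) = f y := by
    by_contra h; exact hf (hfg _ (mf y hf) h)
  have fg : f (g y) = g y := by
    by_contra h; exact hg (hfg _ h (mg y hg))
  by_cases hwf : f w = w
  · rw [hwf]
    by_cases hwg : g w = w
    · rw [hwg, hwf, τo w] <;> rintro rfl
      exacts [hf hwf, mf y hf hwf, mg y hg hwg]
    · by_cases hy : g w = y
      · rw [hy, τy]
      · have h2 : f (g w) = g w := by
          by_contra h; exact hy (hfg _ h (mg w hwg))
        rw [h2, τo _ hy]
        · intro h; rw [h] at h2; exact mf y hf h2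
        · intro h; exact hf (by rw [← g.injective h]; exact hwf)
  · by_cases hwg : g w = w
    · rw [hwg]
      by_cases hy : f w = y
      · rw [hy, τg]
      · have h2 : g (f w) = f w := by
          by_contra h; exact hy (hfg _ (mf w hwf) h)
        rw [h2, τo _ hy]
        · intro h; exact hg (by rw [← f.injective h]; exact hwg)
        · intro h; rw [h] at h2; exact mg y hg h2
    · rw [hfg w hwf hwg, fg, gf, τf]

section

variable [Fintype V]

theorem Rot.exists_list (h : Rot G ρ) {y : V} (hy : ρ y ≠ y) : ∃ t, 0 < t.length ∧
    (y :: ρ y :: t).Nodup ∧ List.IsChain G.Adj (y :: ρ y :: t ++ [y]) ∧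
    (∀ u, u ∈ y :: ρ y :: t ↔ ρ u ≠ u) ∧ (y :: ρ y :: t).formPerm = ρ := by
  have hnd := Equiv.Perm.nodup_toList ρ y
  have hform : (ρ.toList y).formPerm = ρ := by
    rw [Equiv.Perm.formPerm_toList, h.isCycle.cycleOf_eq hy]
  have hlen : (ρ.toList y).length = orderOf ρ := by
    rw [Equiv.Perm.length_toList, h.isCycle.cycleOf_eq hy, h.isCycle.orderOf]
  have hget := Equiv.Perm.getElem_toList ρ y
  have hchain : List.IsChain G.Adj (ρ.toList y ++ [y]) := by
    rw [List.isChain_iff_getElem]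
    have h1 : ∀ i (hi : i < (ρ.toList y ++ [y]).length), (ρ.toList y ++ [y])[i] = (ρ ^ i) y := by
      intro i hi
      rcases Nat.lt_or_ge i (ρ.toList y).length with h2 | h2
      · rw [List.getElem_append_left h2, hget]
      · have h3 : i = orderOf ρ := by
          rw [List.length_append, List.length_singleton] at hi
          omega
        rw [List.getElem_append_right h2, List.getElem_singleton, h3, pow_orderOf_eq_one]
        rfl
    intro i hi
    rw [h1, h1, pow_succ', Equiv.Perm.mul_apply]
    refine h.adj _ fun h2 => hy ?_
    rw [← Equiv.Perm.mul_apply, ← pow_succ', pow_succ, Equiv.Perm.mul_apply] at h2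
    exact (ρ ^ i).injective h2
  have hmem : ∀ u, u ∈ ρ.toList y ↔ ρ u ≠ u := fun u => by
    rw [Equiv.Perm.mem_toList_iff, Equiv.Perm.mem_support]
    exact ⟨fun ⟨h1, _⟩ => (h1.apply_eq_self_iff.not).1 hy, fun h1 => ⟨h.isCycle.sameCycle hy h1, hy⟩⟩
  have h0 : ∀ hi, (ρ.toList y)[0]'hi = y := fun hi => by rw [hget]; rfl
  have h1 : ∀ hi, (ρ.toList y)[1]'hi = ρ y := fun hi => by rw [hget]; simp
  generalize ρ.toList y = l at hnd hform hchain hmem h0 h1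
  rcases l with _ | ⟨a, _ | ⟨b, t⟩⟩
  · exact absurd ((hmem y).2 hy) (by simp)
  · simp at hform
    exact absurd (by simp [← hform]) hy
  · obtain rfl : a = y := h0 (by simp)
    obtain rfl : b = ρ a := h1 (by simp)
    refine ⟨t, List.length_pos_iff.2 fun ht => h.two a hy ?_, hnd, hchain, hmem, hform⟩
    rw [ht, List.formPerm_pair] at hform
    have := Equiv.swap_apply_right a (ρ a)
    rwa [hform] at this

theorem exists_adj_boundary (hG : G.Connected) {S : Set V} {a b : V} (ha : a ∈ S) (hb : b ∉ S) :
    ∃ u ∈ S, ∃ v ∉ S, G.Adj u v := by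
  obtain ⟨w⟩ := hG.preconnected a b
  obtain ⟨d, -, h1, h2⟩ := w.exists_boundary_dart S ha hb
  exact ⟨_, h1, _, h2, d.adj⟩

theorem Rot.exists_local (h : Rot G ρ) (hG : G.Connected) (hnc : NotCycle G)
    (hrot : ∀ a b, G.Adj a b → ∃ ρ, Rot G ρ ∧ ρ a = b) :
    ∃ y e, ρ y ≠ y ∧ e ≠ ρ y ∧ Word G 4 (swap y e * swap y (ρ y)) := by
  suffices hs : ∃ y e, ρ y ≠ y ∧ (Word G 3 (swap y (ρ y)) ∨
      e ≠ ρ y ∧ Word G 4 (swap y e * swap y (ρ y))) by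
    obtain ⟨y, e, hy, h1 | ⟨h1, h2⟩⟩ := hs
    · exact ⟨y, y, hy, hy.symm, by rw [Equiv.swap_self]; exact h1.mono (by omega)⟩
    · exact ⟨y, e, hy, h1, h2⟩
  by_cases hall : ∀ u, ρ u ≠ u
  · obtain ⟨v, hv⟩ := hnc
    obtain ⟨t, ht, hnd, hc, hm, hf⟩ := h.exists_list (hall v)
    have hne : ρ v ≠ ρ⁻¹ v := fun e => h.two v (hall v) (by rw [e]; simp)
    have hsub : ({ρ v, ρ⁻¹ v} : Set V) ⊆ G.neighborSet v := by
      rintro w (rfl | rfl)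
      · exact h.adj v (hall v)
      · exact h.inv.adj v fun e => hall v (Equiv.Perm.inv_eq_iff_eq.1 e).symm
    obtain ⟨w, hw, hw'⟩ := Set.exists_of_ssubset
      (hsub.ssubset_of_ne fun e => hv (by rw [← e, Set.ncard_pair hne]))
    simp only [Set.mem_insert_iff, Set.mem_singleton_iff, not_or] at hw'
    have hwv : G.Adj v w := hw
    have hwt : w ∈ t := by
      have := (hm w).2 (hall w)
      simp only [List.mem_cons] at this
      rcases this with h1 | h1 | h1
      exacts [absurd h1 hwv.ne', absurd h1 hw'.1, h1]
    obtain ⟨A, B, rfl⟩ := List.append_of_mem hwt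
    have hB : 0 < B.length := by
      refine List.length_pos_iff.2 fun hB => hw'.2 ?_
      subst hB
      have := List.formPerm_apply_getLast v (ρ v :: (A ++ [w]))
      rw [hf] at this
      simp only [ne_eq, reduceCtorEq, not_false_eq_true, List.getLast_cons, List.append_eq_nil_iff,
        List.cons_ne_self, and_false, List.getLast_append_singleton] at this
      rw [← this]; simp
    have hc' : List.IsChain G.Adj (v :: ρ v :: A ++ w :: (B ++ [v])) := by simpa using hc
    obtain ⟨c1, c2⟩ := List.isChain_split.1 hc'
    refine ⟨v, v, hall v, Or.inl (word_swap_of_theta (A := []) (E := ρ v :: A) (B := B) (f := w)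
      ?_ (by simpa using hwv) c1 c2 (by simp) (by simpa using hB) (by simp) rfl)⟩
    rw [List.nodup_iff_count_le_one] at hnd ⊢
    intro u
    have := hnd u
    simp only [List.count_cons, List.count_append, List.cons_append, List.nil_append] at this ⊢
    omega
  · push Not at hall
    obtain ⟨b, hb⟩ := hall
    obtain ⟨a, ha, -⟩ := h.isCycle
    obtain ⟨y, hy, e, he, hye⟩ := exists_adj_boundary hG (S := {u | ρ u ≠ u}) ha (by simpa using hb)
    have hy : ρ y ≠ y := hy
    have he : ρ e = e := by simpa using he
    obtain ⟨ρ', h', rfl⟩ := hrot y e hye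
    obtain ⟨t', ht', hnd', hc', hm', hf'⟩ := h'.exists_list hye.ne'
    obtain ⟨t, ht, hnd, hc, hm, hf⟩ := h.exists_list hy
    obtain ⟨f, E, F, hE, hfZ, hEF, -⟩ := List.exists_of_eraseP (p := fun u => decide (ρ u ≠ u))
      (l := t' ++ [y]) (a := y) (by simp) (by simpa using hy)
    simp only [decide_eq_true_eq] at hE hfZ
    refine ⟨y, ρ' y, hy, ?_⟩
    by_cases hfy : f = y
    · subst hfy
      have hyt : f ∉ t' := by
        simp only [List.nodup_cons, List.mem_cons, not_or] at hnd'
        exact hnd'.1.2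
      have hF : F = [] := by
        by_contra hF
        obtain ⟨F', z, rfl⟩ := (List.eq_nil_or_concat F).resolve_left hF
        rw [List.concat_eq_append, ← List.cons_append, ← List.append_assoc] at hEF
        exact hyt (by rw [(List.append_inj' hEF rfl).1]; simp)
      subst hF
      obtain rfl := (List.append_inj' hEF rfl).1
      refine Or.inr ⟨fun e' => ?_, ?_⟩
      · rw [e'] at he
        exact hy (ρ.injective he)
      rw [← commutator_eq (f := ρ) (g := ρ') (fun w h1 h2 => ?_) hy hye.ne']
      · exact ((h.word.mul h'.word).mul h.word.inv).mul h'.word.inv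
      · have := (hm' w).2 h2
        simp only [List.mem_cons] at this
        rcases this with h3 | rfl | h3
        exacts [h3, absurd he h1, absurd h1 (hE w h3)]
    · left
      have hfm : f ∈ ρ y :: t := by
        have := (hm f).2 hfZ
        rw [List.mem_cons] at this
        exact this.resolve_left hfy
      obtain ⟨A, B, hAB⟩ := List.append_of_mem hfm
      have hlen := congrArg List.length hAB
      have c0 : List.IsChain G.Adj (y :: A ++ f :: (B ++ [y])) := by
        rw [hAB] at hc
        simpa using hc
      obtain ⟨c1, c2⟩ := List.isChain_split.1 c0
      have c3 : List.IsChain G.Adj (y :: ρ' y :: E ++ f :: F) := by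
        have : y :: ρ' y :: E ++ f :: F = y :: ρ' y :: t' ++ [y] := by
          rw [List.cons_append, List.cons_append, ← hEF]; rfl
        rwa [this]
      obtain ⟨m, hm2⟩ : ∃ m, A ++ [f] = ρ y :: m := by
        cases A with
        | nil =>
          simp only [List.nil_append, List.cons.injEq] at hAB
          exact ⟨[], by rw [hAB.1]; rfl⟩
        | cons a A =>
          simp only [List.cons_append, List.cons.injEq] at hAB
          exact ⟨A ++ [f], by rw [hAB.1]; rfl⟩
      refine word_swap_of_theta (A := ρ' y :: E) (E := A) (B := B) (f := f) ?_
        (List.isChain_split.1 c3).1 c1 c2 (by simp) (by simp) (by simp at hlen ⊢; omega) hm2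
      rw [hAB] at hnd
      have hcnt := List.nodup_iff_count_le_one.1 hnd
      have hcnt' := List.nodup_iff_count_le_one.1 hnd'
      rw [List.nodup_iff_count_le_one]
      intro u
      have h1 := hcnt u
      have h2 := hcnt' u
      have h3 := congrArg (List.count u) hEF
      simp only [List.count_cons, List.count_append, List.cons_append, List.count_nil] at h1 h2 h3 ⊢
      by_cases hu : u ∈ ρ' y :: E
      · have hu' : ρ u = u := by
          rcases List.mem_cons.1 hu with rfl | hu
          exacts [he, by simpa using hE u hu]
        have h4 : List.count u (y :: (A ++ f :: B)) = 0 := by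
          rw [← hAB]
          exact List.count_eq_zero.2 fun h5 => (hm u).1 h5 hu'
        simp only [List.count_cons, List.count_append] at h4
        omega
      · have h4 := List.count_eq_zero.2 hu
        simp only [List.count_cons] at h4
        omega

end

end GCMP

namespace GCMP
set_option linter.unusedSectionVars false
variable {V ι : Type*} [Fintype ι] [DecidableEq V] [DecidableEq ι] {G : SimpleGraph V}

open Equiv (swap Perm)

variable {c d : ℕ} {σ τ ρ : Perm V} [Fintype V]

theorem conj_swap_mul_swap (h : Perm V) (a b c : V) :
    h * (swap a b * swap a c) * h⁻¹ = swap (h a) (h b) * swap (h a) (h c) := by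
  rw [Equiv.swap_apply_apply, Equiv.swap_apply_apply]
  group

theorem exists_local_of_adj (hG : G.Connected) (hnc : NotCycle G)
    (hrot : ∀ a b, G.Adj a b → ∃ ρ, Rot G ρ ∧ ρ a = b) {u v : V} (huv : G.Adj u v) :
    ∃ e, e ≠ v ∧ Word G (2 * Fintype.card V + 4) (swap u e * swap u v) := by
  obtain ⟨ρ, h, rfl⟩ := hrot u v huv
  obtain ⟨y, e, hy, he, hw⟩ := h.exists_local hG hnc hrot
  obtain ⟨a, ha, hau⟩ := (h.isCycle.sameCycle hy huv.ne').exists_pow_eq'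
  have ha' : a ≤ Fintype.card V := 
    ha.le.trans (h.isCycle.orderOf.trans_le (Finset.card_le_univ _))
  have hau' : (ρ ^ a) (ρ y) = ρ u := by
    rw [← hau, ← Equiv.Perm.mul_apply, ← Equiv.Perm.mul_apply, ← pow_succ, ← pow_succ']
  refine ⟨(ρ ^ a) e, fun h1 => he ((ρ ^ a).injective (h1.trans hau'.symm)), ?_⟩
  rw [← hau', ← hau, ← conj_swap_mul_swap]
  exact (((h.word_pow a).mul hw).mul (h.word_pow a).inv).mono (by omega)

/-- The group generated by the rotations acts primitively. -/
theorem isPreprimitive_closure (hG : G.Connected) (hnc : NotCycle G)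
    (hrot : ∀ a b, G.Adj a b → ∃ ρ, Rot G ρ ∧ ρ a = b) :
    MulAction.IsPreprimitive (Subgroup.closure {ρ | Rot G ρ}) V := by
  have htr : MulAction.IsPretransitive (Subgroup.closure {ρ | Rot G ρ}) V := by
    refine ⟨fun x y => ?_⟩
    by_contra hcon
    obtain ⟨u, ⟨g, hg⟩, v, hv, huv⟩ := exists_adj_boundary hG
      (S := {z | ∃ g : Subgroup.closure {ρ | Rot G ρ}, g • x = z}) (a := x) (b := y) ⟨1, one_smul _ _⟩ hcon
    obtain ⟨ρ, h, rfl⟩ := hrot u v huv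
    exact hv ⟨⟨ρ, Subgroup.subset_closure h⟩ * g, by rw [mul_smul, hg]; rfl⟩
  refine ⟨fun {B} hB => ?_⟩
  by_contra hcon
  simp only [MulAction.IsTrivialBlock, not_or] at hcon
  obtain ⟨hsub, huniv⟩ := hcon
  rw [Set.not_subsingleton_iff] at hsub
  obtain ⟨b, hb⟩ := (Set.ne_univ_iff_exists_notMem B).1 huniv
  obtain ⟨a, ha⟩ := hsub.nonempty
  obtain ⟨u, hu, v, hv, huv⟩ := exists_adj_boundary hG ha hb
  obtain ⟨e, he, hw⟩ := exists_local_of_adj hG hnc hrot huv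
  set g : Subgroup.closure {ρ | Rot G ρ} := ⟨_, hw.mem_closure⟩ with hg
  have hgs : ∀ z, g • z = swap u e (swap u v z) := fun z => rfl
  have hgu : g • u = v := by
    rw [hgs, Equiv.swap_apply_left, Equiv.swap_apply_of_ne_of_ne huv.ne' he.symm]
  rcases hB.smul_eq_or_disjoint g with h1 | h1
  · refine hv ?_
    rw [← h1, ← hgu]
    exact Set.smul_mem_smul_set hu
  by_cases hue : e ∈ B ∧ e ≠ u
  · refine Set.disjoint_left.1 h1 ?_ hu
    have : g • e = u := by
      rw [hgs, Equiv.swap_apply_of_ne_of_ne hue.2 he, Equiv.swap_apply_right]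
    rw [← this]
    exact Set.smul_mem_smul_set hue.1
  · obtain ⟨w, hw1, hwu⟩ := hsub.exists_ne u
    refine Set.disjoint_left.1 h1 ?_ hw1
    have hwv : w ≠ v := by rintro rfl; exact hv hw1
    have hwe : w ≠ e := by rintro rfl; exact hue ⟨hw1, hwu⟩
    have : g • w = w := by
      rw [hgs, Equiv.swap_apply_of_ne_of_ne hwu hwv, Equiv.swap_apply_of_ne_of_ne hwu hwe]
    rw [← this]
    exact Set.smul_mem_smul_set hw1

theorem word_of_sign {K : ℕ}
    (hK : ∀ a b c : V, a ≠ b → a ≠ c → b ≠ c → Word G K (swap a b * swap a c)) (m : ℕ) :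
    ∀ g : Perm V, g.support.card ≤ m → Perm.sign g = 1 → Word G (m * K) g := by
  induction m with
  | zero =>
    intro g hg _
    rw [Nat.le_zero, Finset.card_eq_zero, Equiv.Perm.support_eq_empty_iff] at hg
    exact ⟨[], by simp, by simp, hg.symm⟩
  | succ m ih =>
    intro g hg hs
    by_cases h1 : g = 1
    · exact ⟨[], by simp, by simp, h1.symm⟩
    obtain ⟨a, ha⟩ : ∃ a, g a ≠ a := by
      by_contra! hcon
      exact h1 (Equiv.ext hcon)
    have h3 : 2 < g.support.card := by
      have h4 := Equiv.Perm.card_support_le_one.not.2 h1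
      have h5 : g.support.card ≠ 2 := fun h5 => by
        have := (Equiv.Perm.card_support_eq_two.1 h5).sign_eq
        rw [hs] at this
        exact absurd this (by decide)
      omega
    obtain ⟨e, he, he'⟩ := Finset.exists_mem_notMem_of_card_lt_card
      ((Finset.card_le_two (a := a) (b := g a)).trans_lt h3)
    simp only [Finset.mem_insert, Finset.mem_singleton, not_or] at he'
    obtain ⟨hea, heg⟩ : e ≠ a ∧ e ≠ g a := he'
    set t := swap (g a) e * swap (g a) a with ht
    have hta : t (g a) = a := by
      rw [ht, Equiv.Perm.mul_apply, Equiv.swap_apply_left,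
        Equiv.swap_apply_of_ne_of_ne ha.symm hea.symm]
    have hlt : (t * g).support.card < g.support.card := by
      refine Finset.card_lt_card ((Finset.ssubset_iff_of_subset fun w hw => ?_).2
        ⟨a, by simpa using ha, by simp [hta]⟩)
      by_contra hw'
      have hgw : g w = w := by simpa using hw'
      rw [Equiv.Perm.mem_support, Equiv.Perm.mul_apply, hgw, ht, Equiv.Perm.mul_apply] at hw
      have n1 : w ≠ a := by rintro rfl; exact ha hgw
      have n2 : w ≠ g a := by rintro rfl; exact ha (g.injective hgw)
      have n3 : w ≠ e := by rintro rfl; exact hw' he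
      rw [Equiv.swap_apply_of_ne_of_ne n2 n1, Equiv.swap_apply_of_ne_of_ne n2 n3] at hw
      exact hw rfl
    have htg := ih (t * g) (by omega) (by
      rw [map_mul, hs, ht, map_mul, Equiv.Perm.sign_swap heg.symm, Equiv.Perm.sign_swap ha]
      decide)
    have := (hK (g a) e a heg.symm ha hea).inv.mul htg
    rw [← ht, inv_mul_cancel_left] at this
    exact this.mono (by rw [add_mul]; omega)

theorem Word.bound (hG : G.Connected) (hnc : NotCycle G)
    (hrot : ∀ a b, G.Adj a b → ∃ ρ, Rot G ρ ∧ ρ a = b) {g : Perm V} (hg : Word G c g) :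
    Word G (24 * Fintype.card V ^ 4) g := by
  classical
  set n := Fintype.card V with hn
  have hn1 : 1 ≤ n := Fintype.card_pos_iff.2 hG.nonempty
  by_cases h5 : n < 5
  · obtain ⟨τ, h1, h2⟩ := hg.short (1 : Perm V)
    obtain rfl : τ = g := by simpa using h2
    refine h1.mono ?_
    rw [Fintype.card_perm, ← hn]
    have h6 : n.factorial ≤ 24 := Nat.factorial_le (show n ≤ 4 by omega)
    have := Nat.one_le_pow 4 n hn1
    omega
  have hprim := isPreprimitive_closure hG hnc hrot
  by_cases hR : ∃ ρ, Rot G ρ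
  swap
  · obtain ⟨l, h1, -, rfl⟩ := hg
    rw [List.eq_nil_iff_forall_not_mem.2 fun r hr => hR ⟨r, h1 r hr⟩]
    exact ⟨[], by simp, by simp, rfl⟩
  obtain ⟨ρ, h⟩ := hR
  obtain ⟨a₀, b₀, c₀, hab, hac, hbc, hw₀⟩ : ∃ a b c : V, a ≠ b ∧ a ≠ c ∧ b ≠ c ∧
      Word G (4 * n + 8) (swap a b * swap a c) := by
    obtain ⟨u, hu, -⟩ := h.isCycle
    have hu' : ρ (ρ u) ≠ ρ u := fun h1 => hu (ρ.injective h1)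
    obtain ⟨e, he, hw⟩ := exists_local_of_adj hG hnc hrot (h.adj u hu).symm
    obtain ⟨e', he', hw'⟩ := exists_local_of_adj hG hnc hrot (h.adj _ hu')
    by_cases h1 : e = ρ u
    · by_cases h2 : e' = ρ u
      · rw [h1, Equiv.swap_self] at hw
        rw [h2, Equiv.swap_self] at hw'
        exact ⟨ρ u, u, ρ (ρ u), hu, hu'.symm, (h.two u hu).symm, (hw.mul hw').mono (by omega)⟩
      · exact ⟨ρ u, e', ρ (ρ u), Ne.symm h2, hu'.symm, he', hw'.mono (by omega)⟩
    · exact ⟨ρ u, e, u, Ne.symm h1, hu, he, hw.mono (by omega)⟩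
  have h3 := Equiv.Perm.isThreeCycle_swap_mul_swap_same hab hac hbc
  have hAlt := Equiv.Perm.alternatingGroup_le_of_isPreprimitive_of_isThreeCycle_mem hprim h3
    hw₀.mem_closure
  have hK : ∀ a b c : V, a ≠ b → a ≠ c → b ≠ c →
      Word G (2 * n ^ 3 + 4 * n + 8) (swap a b * swap a c) := by
    intro a b c h1 h2 h4
    have h6 := Equiv.Perm.isThreeCycle_swap_mul_swap_same h1 h2 h4
    obtain ⟨x, hx⟩ := isConj_iff.1 (alternatingGroup.isThreeCycle_isConj
      (by rw [Nat.card_eq_fintype_card]; omega)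
      (σ := ⟨_, h3.mem_alternatingGroup⟩) (τ := ⟨_, h6.mem_alternatingGroup⟩) h3 h6)
    have hx' : (x : Perm V) * (swap a₀ b₀ * swap a₀ c₀) * (x : Perm V)⁻¹ = swap a b * swap a c :=
      congrArg Subtype.val hx
    obtain ⟨d, hd⟩ := word_of_mem_closure (hAlt x.2)
    obtain ⟨y, hy, hyx⟩ := hd.short (a₀, b₀, c₀)
    simp only [Prod.smul_mk, Equiv.Perm.smul_def, Prod.mk.injEq] at hyx
    rw [conj_swap_mul_swap, ← hyx.1, ← hyx.2.1, ← hyx.2.2, ← conj_swap_mul_swap] at hx'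
    rw [← hx']
    refine ((hy.mul hw₀).mul hy.inv).mono ?_
    rw [Fintype.card_prod, Fintype.card_prod, ← hn, show n ^ 3 = n * (n * n) by ring]
    omega
  have heven : ∀ g : Perm V, Perm.sign g = 1 → Word G (n * (2 * n ^ 3 + 4 * n + 8)) g :=
    fun g hg => word_of_sign hK n g (Finset.card_le_univ _) hg
  have hnum : n * (2 * n ^ 3 + 4 * n + 8) + 1 ≤ 24 * n ^ 4 := by
    have e0 := Nat.one_le_pow 4 n hn1
    have e1 : n ^ 1 ≤ n ^ 4 := Nat.pow_le_pow_right hn1 (by omega)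
    have e2 : n ^ 2 ≤ n ^ 4 := Nat.pow_le_pow_right hn1 (by omega)
    rw [show n * (2 * n ^ 3 + 4 * n + 8) + 1 = 2 * n ^ 4 + 4 * n ^ 2 + 8 * n ^ 1 + 1 by ring]
    omega
  rcases Int.units_eq_one_or (Perm.sign g) with hs | hs
  · exact (heven g hs).mono (by omega)
  obtain ⟨r, hr, hrs⟩ : ∃ r, Rot G r ∧ Perm.sign r = -1 := by
    by_contra! hcon
    obtain ⟨l, h1, -, rfl⟩ := hg
    rw [map_list_prod, List.prod_eq_one] at hs
    · exact absurd hs (by decide)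
    · intro s hs
      obtain ⟨r, hr, rfl⟩ := List.mem_map.1 hs
      exact (Int.units_eq_one_or _).resolve_right (hcon r (h1 r hr))
  have := hr.word.mul (heven (r⁻¹ * g) (by rw [map_mul, map_inv, hrs, hs]; decide))
  rw [mul_inv_cancel_left] at this
  exact this.mono (by omega)

theorem mem_closure_of_adj (σ : Perm V) : (∀ v, σ v ≠ v → G.Adj v (σ v)) →
    (∀ v, σ v ≠ v → σ (σ v) ≠ v) → σ ∈ Subgroup.closure {ρ | Rot G ρ} := by
  induction σ using Equiv.Perm.cycle_induction_on with
  | base_one => exact fun _ _ => one_mem _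
  | base_cycles σ h => exact fun h1 h2 => Subgroup.subset_closure ⟨h, h1, h2⟩
  | induction_disjoint σ τ hd hc ih1 ih2 =>
    intro h1 h2
    have hσ : ∀ v, σ v ≠ v → (σ * τ) v = σ v := fun v hv => by
      rw [Equiv.Perm.mul_apply, (hd v).resolve_left hv]
    have hτ : ∀ v, τ v ≠ v → (σ * τ) v = τ v := fun v hv => by
      rw [Equiv.Perm.mul_apply]
      exact (hd (τ v)).resolve_right fun h => hv (τ.injective h)
    have mσ : ∀ v, σ v ≠ v → σ (σ v) ≠ σ v := fun v hv h => hv (σ.injective h)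
    have mτ : ∀ v, τ v ≠ v → τ (τ v) ≠ τ v := fun v hv h => hv (τ.injective h)
    refine mul_mem (ih1 (fun v hv => ?_) fun v hv => ?_) (ih2 (fun v hv => ?_) fun v hv => ?_)
    · rw [← hσ v hv]; exact h1 v (by rwa [hσ v hv])
    · have := h2 v (by rwa [hσ v hv])
      rwa [hσ v hv, hσ _ (mσ v hv)] at this
    · rw [← hτ v hv]; exact h1 v (by rwa [hτ v hv])
    · have := h2 v (by rwa [hτ v hv])
      rwa [hτ v hv, hτ _ (mτ v hv)] at this

variable {p : ℕ → ι → V} {T : ℕ}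

/-- Every configuration of a full graph is reached by rotations, so the optimum is polynomial. -/
theorem Opt.entries_of_full (hG : G.Connected) (hopt : Opt G p T) (hnc : NotCycle G)
    (hcard : Fintype.card ι = Fintype.card V)
    (huse : ∀ a b, G.Adj a b → ∃ t < T, ∃ i, p t i = a ∧ p (t + 1) i = b ∨ p t i = b ∧ p (t + 1) i = a)
    (v : V) : (entries p T v).ncard ≤ 24 * Fintype.card ι ^ 5 := by
  have hbij : ∀ t ≤ T, Function.Bijective (p t) := fun t ht =>
    (Fintype.bijective_iff_injective_and_card _).2 ⟨hopt.inj t ht, hcard⟩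
  have hstep : ∀ t < T, ∃ σ : Perm V, p (t + 1) = σ ∘ p t ∧
      σ ∈ Subgroup.closure {ρ | Rot G ρ} := by
    intro t ht
    set f := Equiv.ofBijective _ (hbij t ht.le) with hf
    set f' := Equiv.ofBijective _ (hbij (t + 1) ht) with hf'
    have hs := hopt.step t ht
    have key : ∀ i, (f.symm.trans f') (p t i) = p (t + 1) i := fun i => by
      change f' (f.symm (f i)) = _
      rw [f.symm_apply_apply]; rfl
    refine ⟨f.symm.trans f', funext fun i => (key i).symm, mem_closure_of_adj _ ?_ ?_⟩
    · intro u hu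
      obtain ⟨i, rfl⟩ := (hbij t ht.le).2 u
      rw [key] at hu ⊢
      exact (hs.adj i).resolve_left hu
    · intro u hu
      obtain ⟨i, rfl⟩ := (hbij t ht.le).2 u
      rw [key] at hu ⊢
      obtain ⟨j, hj⟩ := (hbij t ht.le).2 (p (t + 1) i)
      rw [← hj, key]
      exact fun h2 => hs.noswap i j (by rintro rfl; exact hu hj.symm) ⟨hj.symm, h2⟩
  have hall : ∀ t ≤ T, ∃ σ : Perm V, p t = σ ∘ p 0 ∧ σ ∈ Subgroup.closure {ρ | Rot G ρ} := by
    intro t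
    induction t with
    | zero => exact fun _ => ⟨1, rfl, one_mem _⟩
    | succ t ih =>
      intro ht
      obtain ⟨σ, h1, h2⟩ := ih (by omega)
      obtain ⟨τ, h3, h4⟩ := hstep t (by omega)
      exact ⟨τ * σ, by rw [h3, h1]; rfl, mul_mem h4 h2⟩
  have hrot : ∀ a b, G.Adj a b → ∃ ρ, Rot G ρ ∧ ρ a = b := by
    have key : ∀ t < T, ∀ i, p t i ≠ p (t + 1) i → ∃ ρ, Rot G ρ ∧ ρ (p t i) = p (t + 1) i := by
      intro t ht i hi
      obtain ⟨π, hπ⟩ := exists_perm_of_range_subset (x := p t) (hopt.inj (t + 1) ht)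
        (by rw [(hbij t ht.le).2.range_eq]; exact Set.subset_univ _)
      have hs := hopt.step t ht
      rw [hπ] at hs hi ⊢
      exact hs.exists_rot fun h => hi (by simp [h])
    intro a b hab
    obtain ⟨t, ht, i, ⟨rfl, rfl⟩ | ⟨rfl, rfl⟩⟩ := huse a b hab
    · exact key t ht i hab.ne
    · obtain ⟨ρ, h1, h2⟩ := key t ht i hab.ne'
      exact ⟨ρ⁻¹, h1.inv, by rw [← h2]; simp⟩
  obtain ⟨σ, h1, h2⟩ := hall T le_rfl
  obtain ⟨c, hc⟩ := word_of_mem_closure h2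
  have hr := (hc.bound hG hnc hrot).reach (hopt.inj 0 (Nat.zero_le _))
  rw [← h1] at hr
  refine (entries_le_cost p T v).trans ((hopt.min _ hr).trans ?_)
  rw [hcard, mul_assoc, ← pow_succ]

end GCMP

namespace GCMP
set_option linter.unusedSectionVars false
variable {V ι : Type*} [Fintype ι] [DecidableEq V] [DecidableEq ι] {G : SimpleGraph V}

/-- The bound for motions on connected graphs all of whose edges are used. -/
theorem exists_entries_bound : ∃ C, 0 < C ∧ ∀ (V ι : Type) [Fintype V] [Fintype ι] [DecidableEq V]
    [DecidableEq ι] (G : SimpleGraph V) (p : ℕ → ι → V) (T : ℕ), G.Connected → Opt G p T →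
    (∀ a b, G.Adj a b → ∃ t < T, ∃ i, p t i = a ∧ p (t + 1) i = b ∨ p t i = b ∧ p (t + 1) i = a) →
    ∀ v, (entries p T v).ncard ≤ C * Fintype.card ι ^ 5 := by
  obtain ⟨c₁, h₁⟩ : ∃ c, c = (2 + 4) * (2 + 2 * (36 * 78 ^ 4)) + 2 * (36 * 78 ^ 4) + 8 := ⟨_, rfl⟩
  obtain ⟨c₂, h₂⟩ : ∃ c, c = (2 + (10 + 6 * (36 * 30 ^ 4))) * (2 + 2 * (36 * 30 ^ 4)) +
    2 * (36 * 30 ^ 4) + 2 * (10 + 6 * (36 * 30 ^ 4)) := ⟨_, rfl⟩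
  obtain ⟨c₃, h₃⟩ : ∃ c, c = 36 * 96 ^ 4 := ⟨_, rfl⟩
  refine ⟨c₁ + c₂ + c₃ + 28, by omega, ?_⟩
  intro V ι _ _ _ _ G p T hG hopt huse v
  have hle {c : ℕ} (hc : c ≤ c₁ + c₂ + c₃ + 28) (h : (entries p T v).ncard ≤ c * Fintype.card ι ^ 5) :
      (entries p T v).ncard ≤ (c₁ + c₂ + c₃ + 28) * Fintype.card ι ^ 5 :=
    h.trans (Nat.mul_le_mul_right _ hc)
  rcases Nat.eq_zero_or_pos (Fintype.card ι) with h0 | hk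
  · have := Fintype.card_eq_zero_iff.1 h0
    rw [Set.eq_empty_of_isEmpty (entries p T v)]
    simp
  have hself : Fintype.card ι ≤ Fintype.card ι ^ 5 := Nat.le_self_pow (by omega) _
  by_cases hnc : NotCycle G
  swap
  · exact hle (c := 4) (by omega)
      ((hopt.entries_of_cycle hG hk hnc v).trans (Nat.mul_le_mul_left _ hself))
  rcases (Fintype.card_le_of_injective _ (hopt.inj 0 (Nat.zero_le _))).eq_or_lt with hf | hlt
  · exact hle (c := 24) (by omega) (hopt.entries_of_full hG hnc hf huse v)
  rcases Nat.lt_or_ge (Fintype.card V) (16 * (3 * Fintype.card ι + 3)) with hn | hn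
  · refine hle (c := c₃) (by omega) ((entries_le_cost p T v).trans ((hopt.min _
      ((reach_of_steps (hopt.inj 0 (Nat.zero_le _)) hopt.step).bound hG hnc hlt)).trans ?_))
    have h1 : Fintype.card V ^ 4 ≤ (96 * Fintype.card ι) ^ 4 := Nat.pow_le_pow_left (by omega) _
    have h2 : Fintype.card ι ^ 4 ≤ Fintype.card ι ^ 5 := Nat.pow_le_pow_right hk (by omega)
    rw [h₃, mul_assoc]
    refine Nat.mul_le_mul_left _ (h1.trans ?_)
    rw [mul_pow]
    exact Nat.mul_le_mul_left _ h2
  by_cases hw : ∃ w, Nice G (3 * Fintype.card ι + 3) w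
  · obtain ⟨w, hw⟩ := hw
    refine hle (c := c₁) (by omega) ?_
    rw [h₁]
    exact hopt.entries_of_nice hG hk hw v
  · refine hle (c := c₂) (by omega) ?_
    rw [h₂]
    exact hopt.entries_of_no_nice hG hk (fun u hu => hw ⟨u, hu⟩) hnc hn v

/-- The graph of the edges used by the motion `p`. -/
def usedGraph (p : ℕ → ι → V) (T : ℕ) : SimpleGraph V where
  Adj a b := a ≠ b ∧ ∃ t < T, ∃ i, p t i = a ∧ p (t + 1) i = b ∨ p t i = b ∧ p (t + 1) i = a
  symm := ⟨fun _ _ ⟨h, t, ht, i, hi⟩ => ⟨h.symm, t, ht, i, hi.symm⟩⟩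
  loopless := ⟨fun _ h => h.1 rfl⟩

variable {p : ℕ → ι → V} {T : ℕ}

theorem Opt.usedGraph_le (hopt : Opt G p T) : usedGraph p T ≤ G := by
  rintro a b ⟨hne, t, ht, i, ⟨rfl, rfl⟩ | ⟨rfl, rfl⟩⟩
  · exact ((hopt.step t ht).adj i).resolve_left hne.symm
  · exact (((hopt.step t ht).adj i).resolve_left hne).symm

/-- The robots of a union `W` of components of the used graph move optimally inside `W`. -/
theorem Opt.restrict (hopt : Opt G p T) {W : Set V} {J : Set ι} [Fintype J]
    (hJ : ∀ t i, p t i ∈ W ↔ i ∈ J) :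
    Opt ((usedGraph p T).induce W) (fun t => confine (p t) fun i hi => (hJ t i).2 hi) T where
  inj t ht i j hij := Subtype.ext (hopt.inj t ht (congrArg Subtype.val hij))
  step t ht :=
    { inj := fun i j hij => Subtype.ext (hopt.inj t ht.le (congrArg Subtype.val hij))
      inj' := fun i j hij => Subtype.ext (hopt.inj (t + 1) ht (congrArg Subtype.val hij))
      adj := fun i => by
        by_cases h : p (t + 1) i = p t i
        · exact Or.inl (Subtype.ext h)
        · exact Or.inr ⟨Ne.symm h, t, ht, i, Or.inl ⟨rfl, rfl⟩⟩
      noswap := fun i j hij h => (hopt.step t ht).noswap i j (fun e => hij (Subtype.ext e))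
        ⟨congrArg Subtype.val h.1, congrArg Subtype.val h.2⟩ }
  min c hc := by
    classical
    set z : ℕ → ι → V := fun t i => if i ∈ J then p T i else p t i with hz
    have z1 : ∀ t, ∀ i ∈ J, z t i = p T i := fun t i hi => if_pos hi
    have z2 : ∀ t, ∀ i ∉ J, z t i = p t i := fun t i hi => if_neg hi
    have hzJ : ∀ t i, z t i ∈ W ↔ i ∈ J := fun t i => by
      by_cases hi : i ∈ J
      · rw [z1 t i hi, hJ]
      · rw [z2 t i hi, hJ]
    have hzi : ∀ t ≤ T, Function.Injective (z t) := by
      intro t ht i j hij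
      have hiff : i ∈ J ↔ j ∈ J := by rw [← hzJ t i, ← hzJ t j, hij]
      by_cases hi : i ∈ J
      · rw [z1 t i hi, z1 t j (hiff.1 hi)] at hij
        exact hopt.inj T le_rfl hij
      · rw [z2 t i hi, z2 t j (hiff.not.1 hi)] at hij
        exact hopt.inj t ht hij
    have hzs : ∀ t < T, Step G (z t) (z (t + 1)) := fun t ht =>
      { inj := hzi t ht.le
        inj' := hzi (t + 1) ht
        adj := fun i => by
          by_cases hi : i ∈ J
          · exact Or.inl (by rw [z1 _ i hi, z1 _ i hi])
          · rw [z2 _ i hi, z2 _ i hi]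
            exact (hopt.step t ht).adj i
        noswap := fun i j hij h => by
          have hiff : i ∈ J ↔ j ∈ J := by rw [← hzJ (t + 1) i, ← hzJ t j, h.1]
          by_cases hi : i ∈ J
          · rw [z1 _ i hi, z1 _ j (hiff.1 hi)] at h
            exact hij (hopt.inj T le_rfl h.1)
          · rw [z2 _ i hi, z2 _ j (hiff.not.1 hi), z2 _ i hi, z2 _ j (hiff.not.1 hi)] at h
            exact (hopt.step t ht).noswap i j hij h }
    have hr1 : Reach G (p 0) (z 0) c := by
      refine Reach.mono_graph ((inside_le _ W).trans hopt.usedGraph_le) (reach_inside_of_induce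
        (A := J) (hopt.inj 0 (Nat.zero_le _)) (hJ 0) (fun i hi => (hzJ 0 i).2 hi) (z2 0) ?_)
      convert hc using 1
      funext i
      exact Subtype.ext (z1 0 i i.2)
    have hzT : z T = p T := funext fun i => by
      by_cases hi : i ∈ J
      exacts [z1 T i hi, z2 T i hi]
    have hr2 := reach_of_steps (hzi 0 (Nat.zero_le _)) hzs
    rw [hzT] at hr2
    have hmin := hopt.min _ (hr1.trans hr2)
    have hsplit : ∀ t, stepCost (p t) (p (t + 1)) =
        stepCost (confine (p t) fun i hi => (hJ t i).2 hi)
          (confine (p (t + 1)) fun i (hi : i ∈ J) => (hJ (t + 1) i).2 hi) +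
        stepCost (z t) (z (t + 1)) := by
      intro t
      set y : ℕ → ι → V := fun s i => if i ∈ J then p s i else p 0 i with hy
      have hp : ∀ s, patch (p 0) (confine (p s) fun i (hi : i ∈ J) => (hJ s i).2 hi) = y s := by
        intro s
        funext i
        by_cases hi : i ∈ J
        · rw [patch_of_mem _ _ hi, hy]
          exact (if_pos hi).symm
        · rw [patch_of_notMem _ _ hi, hy]
          exact (if_neg hi).symm
      rw [← stepCost_patch (p 0), hp, hp]
      simp only [stepCost, Finset.card_filter, ← Finset.sum_add_distrib]
      refine Finset.sum_congr rfl fun i _ => ?_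
      by_cases hi : i ∈ J <;> simp [hy, hz, hi]
    simp only [hsplit, Finset.sum_add_distrib] at hmin
    omega

theorem exists_component (hT : ∀ t ≥ T, p t = p T) (v : V) :
    ∃ W : Set V, W.Finite ∧ v ∈ W ∧ ((usedGraph p T).induce W).Connected ∧
      ∀ t i, p t i ∈ W ↔ p 0 i ∈ W := by
  set C := (usedGraph p T).connectedComponentMk v with hC
  refine ⟨C.supp, ?_, rfl, C.connected_toSimpleGraph, ?_⟩
  · refine Set.Finite.subset (s := insert v (⋃ t ∈ Finset.range (T + 1), Set.range (p t))) ?_ ?_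
    · exact (Set.Finite.biUnion (Finset.finite_toSet _) fun t _ => Set.finite_range _).insert v
    · intro w hw
      obtain ⟨q⟩ := ConnectedComponent.exact hw
      cases q with
      | nil => exact Set.mem_insert _ _
      | cons h _ =>
        obtain ⟨-, t, ht, i, ⟨rfl, -⟩ | ⟨-, rfl⟩⟩ := h
        · exact Or.inr (Set.mem_biUnion (by simp; omega) ⟨i, rfl⟩)
        · exact Or.inr (Set.mem_biUnion (x := t + 1) (by simp; omega) ⟨i, rfl⟩)
  · intro t i
    induction t with
    | zero => rfl
    | succ t ih =>
      rw [← ih]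
      rcases Nat.lt_or_ge t T with ht | ht
      · by_cases h : p (t + 1) i = p t i
        · rw [h]
        · have hadj : (usedGraph p T).Adj (p t i) (p (t + 1) i) :=
            ⟨Ne.symm h, t, ht, i, Or.inl ⟨rfl, rfl⟩⟩
          rw [ConnectedComponent.mem_supp_iff, ConnectedComponent.mem_supp_iff,
            ConnectedComponent.sound hadj.reachable]
      · rw [hT t ht, hT (t + 1) (by omega)]

theorem Reach.exists_steps {x y : ι → V} {c : ℕ} (h : Reach G x y c) : ∃ (T : ℕ) (q : ℕ → ι → V),
    q 0 = x ∧ q T = y ∧ (∀ t < T, Step G (q t) (q (t + 1))) ∧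
    ∑ t ∈ Finset.range T, stepCost (q t) (q (t + 1)) ≤ c := by
  induction h with
  | refl hx c => exact ⟨0, fun _ => x, rfl, rfl, by simp, by simp⟩
  | tail y z c d _ hs hcd ih =>
    obtain ⟨T, q, h0, hT, h1, h2⟩ := ih
    have e : ∀ t ≤ T, (if t ≤ T then q t else z) = q t := fun t ht => if_pos ht
    have e' : (if T + 1 ≤ T then q (T + 1) else z) = z := if_neg (by omega)
    refine ⟨T + 1, fun t => if t ≤ T then q t else z, by simpa using h0, e', fun t ht => ?_, ?_⟩
    · beta_reduce
      rcases Nat.lt_succ_iff_lt_or_eq.1 ht with h | rfl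
      · rw [e t h.le, e (t + 1) h]; exact h1 t h
      · rw [e t le_rfl, e', hT]; exact hs
    · rw [Finset.sum_range_succ]
      beta_reduce
      rw [e T le_rfl, e', hT]
      refine le_trans (Nat.add_le_add_right (le_trans (le_of_eq ?_) h2) _) hcd
      refine Finset.sum_congr rfl fun t ht => ?_
      have ht := Finset.mem_range.1 ht
      rw [e t ht.le, e (t + 1) ht]

theorem totalLength_eq {V : Type} [DecidableEq V] {G : SimpleGraph V} {k : ℕ} {I : Inst V G k}
    (S : Sched I) :
    totalLength S = ∑ t ∈ Finset.range S.T, stepCost (S.pos t) (S.pos (t + 1)) := by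
  rw [← sum_movesFrom]
  simp [totalLength, routeLength, movesFrom]

theorem opt_of_optimal {V : Type} [DecidableEq V] {G : SimpleGraph V} {k : ℕ} {I : Inst V G k}
    {S : Sched I} (hS : Optimal S) : Opt G (fun t => S.pos (min t S.T)) S.T := by
  have e : ∀ t ≤ S.T, S.pos (min t S.T) = S.pos t := fun t ht => by rw [min_eq_left ht]
  refine ⟨fun t ht => ?_, fun t ht => ?_, fun c hc => ?_⟩
  · rw [e t ht]
    exact S.noVertexConflict t ht
  · rw [e t ht.le, e (t + 1) ht]
    exact ⟨S.noVertexConflict t ht.le, S.noVertexConflict _ ht, S.step t ht, S.noSwap t ht⟩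
  · beta_reduce at hc
    rw [e 0 (Nat.zero_le _), e S.T le_rfl] at hc
    obtain ⟨T, q, h0, hT, h1, h2⟩ := hc.exists_steps
    let S' : Sched I :=
      { T := T
        pos := q
        init := fun i => by rw [h0, S.init]
        final := fun i hi => by rw [hT, S.final i hi]
        step := fun t ht => (h1 t ht).adj
        noVertexConflict := fun t ht => by
          rcases ht.lt_or_eq with ht | rfl
          · exact (h1 t ht).inj
          · rw [hT]; exact hc.inj'
        noSwap := fun t ht => (h1 t ht).noswap }
    refine le_trans (le_of_eq ?_) ((hS S').trans ((totalLength_eq S').trans_le h2))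
    rw [totalLength_eq]
    refine Finset.sum_congr rfl fun t ht => ?_
    have ht := Finset.mem_range.1 ht
    rw [e t ht.le, e (t + 1) ht]

end GCMP

/-- There is a universal constant `c > 0` such that for every GCMP
instance with `k` robots and every optimal schedule `S`, every vertex of `G` is entered
at most `c * k ^ 5` times over the course of the schedule (an entry of robot `i` into
`v` at step `j+1` means `pos j i ≠ v` and `pos (j+1) i = v`). -/
theorem optimal_visits_bound :
    ∃ c : ℕ, 0 < c ∧
      ∀ (V : Type) (G : SimpleGraph V) (k : ℕ) (I : Inst V G k) (S : Sched I),
        Optimal S →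
        ∀ v : V,
          {q : Fin k × ℕ | q.2 < S.T ∧ S.pos q.2 q.1 ≠ v ∧ S.pos (q.2 + 1) q.1 = v}.ncard
            ≤ c * k ^ 5 := by
  obtain ⟨C, hC, hbound⟩ := GCMP.exists_entries_bound
  refine ⟨C, hC, fun V G k I S hS v => ?_⟩
  classical
  have hopt := GCMP.opt_of_optimal hS
  set p : ℕ → Fin k → V := fun t => S.pos (min t S.T) with hp
  have e : ∀ t ≤ S.T, p t = S.pos t := fun t ht => by simp only [hp, min_eq_left ht]
  obtain ⟨W, hfin, hvW, hconn, hW⟩ := GCMP.exists_component (p := p) (T := S.T)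
    (fun t ht => by simp only [hp, min_eq_right ht, min_self]) v
  have := hfin.fintype
  set J : Set (Fin k) := {i | p 0 i ∈ W} with hJ
  have hsub := hbound W J _ _ S.T hconn (hopt.restrict (J := J) hW) (by
    rintro a b ⟨-, t, ht, i, h⟩
    have hi : i ∈ J := (hW t i).1 (by rcases h with h | h <;> rw [h.1] <;> exact Subtype.mem _)
    refine ⟨t, ht, ⟨i, hi⟩, ?_⟩
    rcases h with h | h
    · exact Or.inl ⟨Subtype.ext h.1, Subtype.ext h.2⟩
    · exact Or.inr ⟨Subtype.ext h.1, Subtype.ext h.2⟩) ⟨v, hvW⟩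
  have hcard : Fintype.card J ≤ k := by
    simpa using Fintype.card_le_of_injective (Subtype.val : J → Fin k) Subtype.val_injective
  refine le_trans ?_ (hsub.trans (Nat.mul_le_mul_left _ (Nat.pow_le_pow_left hcard 5)))
  have hEfin : (GCMP.entries (fun t => GCMP.confine (p t) fun i (hi : i ∈ J) => (hW t i).2 hi) S.T
      ⟨v, hvW⟩).Finite :=
    (Set.finite_univ.prod (Set.finite_lt_nat S.T)).subset fun q hq => ⟨trivial, hq.1⟩
  refine le_trans (Set.ncard_le_ncard ?_ (hEfin.image fun q => (q.1.1, q.2))) (Set.ncard_image_le hEfin)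
  rintro ⟨i, t⟩ ⟨h1, h2, h3⟩
  simp only at h1 h2 h3
  have hi : i ∈ J := (hW (t + 1) i).1 (by rw [e _ h1, h3]; exact hvW)
  refine ⟨(⟨i, hi⟩, t), ⟨h1, fun h => h2 ?_, Subtype.ext ?_⟩, rfl⟩
  · rw [← e t h1.le]; exact congrArg Subtype.val h
  · change p (t + 1) i = v
    rw [e _ h1, h3]
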